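/- Let n ≥ 2 and fix a smooth function φ₀ on ℝ^n, compactly supported in the closed unit ball, with ∫φ₀ = 1. There is a constant C > 0, depending only on n and φ₀, such that for every locally integrable f : ℝ^n → ℝ with ‖f‖_{H^{log}} < ∞ there exist sequences of vector fields (F_k)_{k≥0} and (G_k)_{k≥0} in L¹_loc(ℝ^n, ℝ^n) such that: every component of every F_k has finite H¹ norm and every G_k has finite BMO⁺ norm; for each k, one of the two fields F_k, G_k is divergence-free in the sense of distributions and the other is curl-free in the sense of distributions; each pointwise scalar product F_k·G_k belongs to L¹(ℝ^n); f = Σ_k F_k·G_k in the sense of distributions (the partial sums Σ_{k≤N} ∫ (F_k·G_k) ψ converge to ∫ f ψ for every ψ ∈ C_c^∞(ℝ^n)); and Σ_k ‖F_k‖_{H¹} ‖G_k‖_{BMO⁺} ≤ C ‖f‖_{H^{log}}, where ‖F_k‖_{H¹} denotes the maximum of the H¹ norms of the components of F_k. -/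

import Mathlib

open MeasureTheory Metric Real Filter
open scoped ENNReal Topology BigOperators

noncomputable section

/-- `ℝⁿ` with the Euclidean structure. -/
abbrev Eucl (n : ℕ) := EuclideanSpace ℝ (Fin n)

/-- The dilated function `φ_t(x) = t^{-n} φ(x/t)`. -/
def dil (n : ℕ) (φ : Eucl n → ℝ) (t : ℝ) (x : Eucl n) : ℝ :=
  (t ^ n)⁻¹ * φ (t⁻¹ • x)

/-- The maximal function `f⁺(x) = sup_{t>0} |(f * φ_t)(x)|`, with values in `ℝ≥0∞`. -/
def maxFun (n : ℕ) (φ : Eucl n → ℝ) (f : Eucl n → ℝ) (x : Eucl n) : ℝ≥0∞ :=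
  ⨆ (t : ℝ) (_ : 0 < t), ENNReal.ofReal |∫ y, f y * dil n φ t (x - y)|

/-- `‖f‖_{H¹} = ∫ f⁺`. -/
def H1Norm (n : ℕ) (φ : Eucl n → ℝ) (f : Eucl n → ℝ) : ℝ≥0∞ :=
  ∫⁻ x, maxFun n φ f x

/-- The growth function `θ(x,t) = t / (log(e+|x|) + log(e+t))`, extended to `t ∈ ℝ≥0∞`. -/
def thetaE (n : ℕ) (x : Eucl n) (t : ℝ≥0∞) : ℝ≥0∞ :=
  t / ENNReal.ofReal (Real.log (Real.exp 1 + ‖x‖) + Real.log (Real.exp 1 + t.toReal))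

/-- The Luxemburg (quasi-)norm associated to `θ`. -/
def luxNorm (n : ℕ) (g : Eucl n → ℝ≥0∞) : ℝ≥0∞ :=
  sInf {lam : ℝ≥0∞ | lam ≠ 0 ∧ ∫⁻ x, thetaE n x (g x / lam) ≤ 1}

/-- `‖f‖_{H^{log}} = ‖f⁺‖_{L^θ}`. -/
def HlogNorm (n : ℕ) (φ : Eucl n → ℝ) (f : Eucl n → ℝ) : ℝ≥0∞ :=
  luxNorm n (maxFun n φ f)

/-- Mean of `g` over a set `B`. -/
def setAvg (n : ℕ) (g : Eucl n → ℝ) (B : Set (Eucl n)) : ℝ :=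
  (∫ x in B, g x) / (volume B).toReal

/-- The open unit cube `(0,1)ⁿ`. -/
def unitCube (n : ℕ) : Set (Eucl n) := {x | ∀ i, x i ∈ Set.Ioo (0 : ℝ) 1}

/-- `‖g‖_{BMO⁺} = ∫_{(0,1)ⁿ} |g| + sup_B |B|⁻¹ ∫_B |g - g_B|`. -/
def BMOplus (n : ℕ) (g : Eucl n → ℝ) : ℝ≥0∞ :=
  (∫⁻ x in unitCube n, ENNReal.ofReal |g x|) +
    ⨆ (x₀ : Eucl n) (r : ℝ) (_ : 0 < r),
      (∫⁻ x in ball x₀ r, ENNReal.ofReal |g x - setAvg n g (ball x₀ r)|) / volume (ball x₀ r)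

/-- The `i`-th partial derivative of `ψ`. -/
def pd (n : ℕ) (ψ : Eucl n → ℝ) (i : Fin n) (x : Eucl n) : ℝ :=
  fderiv ℝ ψ x (EuclideanSpace.single i 1)

/-- A vector field is divergence-free in the sense of distributions. -/
def DivFree (n : ℕ) (F : Eucl n → Eucl n) : Prop :=
  ∀ ψ : Eucl n → ℝ, ContDiff ℝ (⊤ : ℕ∞) ψ → HasCompactSupport ψ →
    ∫ x, ∑ i, F x i * pd n ψ i x = 0

/-- A vector field is curl-free in the sense of distributions. -/
def CurlFree (n : ℕ) (F : Eucl n → Eucl n) : Prop :=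
  ∀ ψ : Eucl n → ℝ, ContDiff ℝ (⊤ : ℕ∞) ψ → HasCompactSupport ψ →
    ∀ i j : Fin n, i < j →
      ∫ x, (F x i * pd n ψ j x - F x j * pd n ψ i x) = 0

namespace HlogFact

open scoped NNReal

/-- Data on the fixed kernel used throughout. -/
structure KernelBound (n : ℕ) (φ : Eucl n → ℝ) (A : ℝ) : Prop where
  pos : 1 ≤ A
  smooth : ContDiff ℝ (⊤ : ℕ∞) φ
  supp : ∀ x, φ x ≠ 0 → ‖x‖ ≤ 1
  bound : ∀ x, |φ x| ≤ A
  lip : ∀ x y, |φ x - φ y| ≤ A * ‖x - y‖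
  int_eq : ∫ x, φ x = 1

theorem exists_kernelBound (n : ℕ) (φ : Eucl n → ℝ) (hs : ContDiff ℝ (⊤ : ℕ∞) φ)
    (hsupp : Function.support φ ⊆ closedBall 0 1) (hInt : ∫ x, φ x = 1) :
    ∃ A, KernelBound n φ A := by
  have hc : HasCompactSupport φ := HasCompactSupport.of_support_subset_isCompact
    (isCompact_closedBall _ _) hsupp
  obtain ⟨C1, h1⟩ := hc.exists_bound_of_continuous hs.continuous
  obtain ⟨C2, h2⟩ := hs.lipschitzWith_of_hasCompactSupport hc (by simp)
  refine ⟨max 1 (max C1 C2), le_max_left _ _, hs, fun x hx => by simpa using hsupp hx, fun x =>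
    (h1 x).trans ((le_max_left _ _).trans (le_max_right _ _)), fun x y => ?_, hInt⟩
  have := h2.dist_le_mul x y
  rw [dist_eq_norm, Real.norm_eq_abs, dist_eq_norm] at this
  exact this.trans (mul_le_mul_of_nonneg_right
    ((le_max_right _ _).trans (le_max_right _ _)) (norm_nonneg _))

variable {n : ℕ}

theorem vitali_lintegral {ι : Type*} (t : Set ι) (x : ι → Eucl n) (r : ι → ℝ)
    (hr : ∀ a ∈ t, 0 < r a) (w u : Eucl n → ℝ≥0∞)
    (h : ∀ a ∈ t, ∫⁻ y in closedBall (x a) (5 * r a), w y ≤ ∫⁻ y in closedBall (x a) (r a), u y) :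
    ∫⁻ y in ⋃ a ∈ t, closedBall (x a) (r a), w y ≤ ∫⁻ y, u y := by
  have key : ∀ N : ℕ, ∫⁻ y in ⋃ a ∈ {a ∈ t | r a ≤ N}, closedBall (x a) (r a), w y
      ≤ ∫⁻ y, u y := by
    intro N
    obtain ⟨v, hv, hd, hc⟩ := Vitali.exists_disjoint_subfamily_covering_enlargement_closedBall
      {a ∈ t | r a ≤ N} x r N (fun a ha => ha.2) 5 (by norm_num)
    have hcount : v.Countable := hd.countable_of_nonempty_interior fun a ha =>
      ⟨x a, ball_subset_interior_closedBall (mem_ball_self (hr a (hv ha).1))⟩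
    have : Countable v := hcount.to_subtype
    calc _ ≤ ∫⁻ y in ⋃ b : v, closedBall (x b) (5 * r b), w y := by
          apply lintegral_mono_set
          refine Set.iUnion₂_subset fun a ha => ?_
          obtain ⟨b, hb, hab⟩ := hc a ha
          exact hab.trans (Set.subset_iUnion_of_subset ⟨b, hb⟩ subset_rfl)
      _ ≤ ∑' b : v, ∫⁻ y in closedBall (x b) (5 * r b), w y := lintegral_iUnion_le _ _
      _ ≤ ∑' b : v, ∫⁻ y in closedBall (x b) (r b), u y :=
          ENNReal.tsum_le_tsum fun b => h _ (hv b.2).1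
      _ = ∫⁻ y in ⋃ b ∈ v, closedBall (x b) (r b), u y :=
          (lintegral_biUnion hcount (fun _ _ => measurableSet_closedBall) hd _).symm
      _ ≤ _ := setLIntegral_le_lintegral _ _
  have hU : ⋃ a ∈ t, closedBall (x a) (r a)
      = ⋃ N : ℕ, ⋃ a ∈ {a ∈ t | r a ≤ N}, closedBall (x a) (r a) := by
    ext y
    simp only [Set.mem_iUnion, Set.mem_ofPred_eq, exists_prop]
    constructor
    · rintro ⟨a, ha, hy⟩
      obtain ⟨N, hN⟩ := exists_nat_ge (r a)
      exact ⟨N, a, ⟨ha, hN⟩, hy⟩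
    · rintro ⟨N, a, ⟨ha, hN⟩, hy⟩
      exact ⟨a, ha, hy⟩
  rw [hU, setLIntegral_iUnion_of_directed]
  · exact iSup_le key
  · refine Monotone.directed_le fun N M hNM => ?_
    refine Set.iUnion₂_subset fun a ha => ?_
    exact Set.subset_biUnion_of_mem (u := fun a => closedBall (x a) (r a))
      (show a ∈ {a ∈ t | r a ≤ M} from ⟨ha.1, ha.2.trans (by exact_mod_cast hNM)⟩)

/-! ### The maximal function -/

theorem dil_eq_zero {φ : Eucl n → ℝ} {A : ℝ} (hφ : KernelBound n φ A) {t : ℝ} (ht : 0 < t)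
    {x : Eucl n} (hx : t < ‖x‖) : dil n φ t x = 0 := by
  unfold dil
  by_contra h
  have := hφ.supp _ (right_ne_zero_of_mul h)
  rw [norm_smul, norm_inv, Real.norm_of_nonneg ht.le, inv_mul_le_iff₀ ht] at this
  linarith

theorem dil_hasCompactSupport {φ : Eucl n → ℝ} {A : ℝ} (hφ : KernelBound n φ A) {t : ℝ}
    (ht : 0 < t) : HasCompactSupport (dil n φ t) :=
  HasCompactSupport.of_support_subset_isCompact (isCompact_closedBall (0 : Eucl n) t)
    fun x hx => by
      rw [mem_closedBall_zero_iff]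
      by_contra h
      exact hx (dil_eq_zero hφ ht (not_le.1 h))

theorem dil_continuous {φ : Eucl n → ℝ} {A : ℝ} (hφ : KernelBound n φ A) (t : ℝ) :
    Continuous (dil n φ t) := by
  unfold dil
  exact continuous_const.mul (hφ.smooth.continuous.comp (continuous_const_smul _))

theorem abs_dil_le {φ : Eucl n → ℝ} {A : ℝ} (hφ : KernelBound n φ A) {t : ℝ} (ht : 0 < t)
    (x : Eucl n) : |dil n φ t x| ≤ A * (t ^ n)⁻¹ := by
  unfold dil
  rw [abs_mul, abs_of_pos (by positivity), mul_comm]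
  exact mul_le_mul_of_nonneg_right (hφ.bound _) (by positivity)

theorem abs_dil_sub_le {φ : Eucl n → ℝ} {A : ℝ} (hφ : KernelBound n φ A) {t : ℝ} (ht : 0 < t)
    (x y : Eucl n) : |dil n φ t x - dil n φ t y| ≤ A * (t ^ (n + 1))⁻¹ * ‖x - y‖ := by
  unfold dil
  rw [← mul_sub, abs_mul, abs_of_pos (a := (t ^ n)⁻¹) (by positivity)]
  refine (mul_le_mul_of_nonneg_left (hφ.lip _ _) (by positivity)).trans (le_of_eq ?_)
  rw [← smul_sub, norm_smul, norm_inv, Real.norm_of_nonneg ht.le]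
  field_simp
  ring

theorem conv_continuous {φ : Eucl n → ℝ} {A : ℝ} (hφ : KernelBound n φ A) {t : ℝ} (ht : 0 < t)
    {f : Eucl n → ℝ} (hf : LocallyIntegrable f volume) :
    Continuous fun x => ∫ y, f y * dil n φ t (x - y) :=
  HasCompactSupport.continuous_convolution_right (ContinuousLinearMap.mul ℝ ℝ)
    (dil_hasCompactSupport hφ ht) hf (dil_continuous hφ t)

theorem maxFun_measurable {φ : Eucl n → ℝ} {A : ℝ} (hφ : KernelBound n φ A)
    {f : Eucl n → ℝ} (hf : LocallyIntegrable f volume) : Measurable (maxFun n φ f) := by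
  apply LowerSemicontinuous.measurable
  unfold maxFun
  refine lowerSemicontinuous_iSup fun t => lowerSemicontinuous_iSup fun ht => ?_
  exact (ENNReal.continuous_ofReal.comp (conv_continuous hφ ht hf).abs).lowerSemicontinuous

theorem le_maxFun (φ f : Eucl n → ℝ) {t : ℝ} (ht : 0 < t) (x : Eucl n) :
    ENNReal.ofReal |∫ y, f y * dil n φ t (x - y)| ≤ maxFun n φ f x := by
  unfold maxFun
  exact le_iSup₂_of_le t ht le_rfl

theorem maxFun_le {φ f : Eucl n → ℝ} {x : Eucl n} {a : ℝ≥0∞}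
    (h : ∀ t : ℝ, 0 < t → ENNReal.ofReal |∫ y, f y * dil n φ t (x - y)| ≤ a) :
    maxFun n φ f x ≤ a :=
  iSup₂_le h

theorem maxFun_smul (φ f : Eucl n → ℝ) (a : ℝ) (x : Eucl n) :
    maxFun n φ (fun y => a * f y) x = ENNReal.ofReal |a| * maxFun n φ f x := by
  unfold maxFun
  simp only [ENNReal.mul_iSup, mul_assoc, integral_const_mul, abs_mul,
    ENNReal.ofReal_mul (abs_nonneg a)]

theorem dil_smul {φ : Eucl n → ℝ} {r t : ℝ} (hr : 0 < r) (u : Eucl n) :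
    dil n φ t (r • u) = (r ^ n)⁻¹ * dil n φ (t / r) u := by
  unfold dil
  rw [smul_smul, inv_div, div_pow]
  have : r ^ n ≠ 0 := by positivity
  rw [← mul_assoc, inv_div, div_eq_mul_inv, div_eq_mul_inv, mul_comm t⁻¹ r, ← mul_assoc,
    inv_mul_cancel₀ this, one_mul]

theorem integral_scale (c : Eucl n) {r : ℝ} (hr : 0 < r) (g : Eucl n → ℝ) :
    ∫ y, g (r⁻¹ • (y - c)) = r ^ n * ∫ y, g y := by
  rw [integral_sub_right_eq_self (fun y => g (r⁻¹ • y)) c, Measure.integral_comp_smul]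
  simp [abs_of_pos hr]

theorem lintegral_scale (c : Eucl n) {r : ℝ} (hr : 0 < r) (g : Eucl n → ℝ≥0∞) :
    ∫⁻ y, g (r⁻¹ • (y - c)) = ENNReal.ofReal (r ^ n) * ∫⁻ y, g y := by
  rw [lintegral_sub_right_eq_self (fun y => g (r⁻¹ • y)) c]
  have h := Measure.map_addHaar_smul (volume : Measure (Eucl n)) (inv_ne_zero hr.ne')
  have hm : MeasurableEmbedding (fun y : Eucl n => r⁻¹ • y) :=
    (Homeomorph.smulOfNeZero r⁻¹ (inv_ne_zero hr.ne')).measurableEmbedding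
  rw [← hm.lintegral_map g, h, lintegral_smul_measure]
  simp [abs_of_pos hr]

theorem maxFun_scale (φ f : Eucl n → ℝ) (c : Eucl n) {r : ℝ} (hr : 0 < r) (x : Eucl n) :
    maxFun n φ (fun y => f (r⁻¹ • (y - c))) x = maxFun n φ f (r⁻¹ • (x - c)) := by
  have key : ∀ t, ∫ y, f (r⁻¹ • (y - c)) * dil n φ t (x - y)
      = ∫ y, f y * dil n φ (t / r) (r⁻¹ • (x - c) - y) := by
    intro t
    have h1 : ∀ y, f (r⁻¹ • (y - c)) * dil n φ t (x - y) =
        (fun z => f z * dil n φ t (r • (r⁻¹ • (x - c) - z))) (r⁻¹ • (y - c)) := by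
      intro y
      simp only
      rw [← smul_sub, smul_inv_smul₀ hr.ne']
      congr 2; abel
    rw [integral_congr_ae (ae_of_all _ h1), integral_scale c hr
      (fun z => f z * dil n φ t (r • (r⁻¹ • (x - c) - z)))]
    simp_rw [dil_smul hr, ← integral_const_mul]
    congr 1; ext y
    have : r ^ n ≠ 0 := by positivity
    field_simp
  apply le_antisymm
  · refine maxFun_le fun t ht => ?_
    rw [key]
    exact le_maxFun φ f (div_pos ht hr) _
  · refine maxFun_le fun t ht => ?_
    have := key (t * r)
    rw [mul_div_cancel_right₀ _ hr.ne'] at this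
    rw [← this]
    exact le_maxFun φ _ (mul_pos ht hr) x

theorem H1Norm_scale (φ f : Eucl n → ℝ) (c : Eucl n) {r : ℝ} (hr : 0 < r) :
    H1Norm n φ (fun y => f (r⁻¹ • (y - c))) = ENNReal.ofReal (r ^ n) * H1Norm n φ f := by
  unfold H1Norm
  simp_rw [maxFun_scale φ f c hr]
  exact lintegral_scale c hr _

theorem H1Norm_smul (φ f : Eucl n → ℝ) (a : ℝ) :
    H1Norm n φ (fun y => a * f y) = ENNReal.ofReal |a| * H1Norm n φ f := by
  unfold H1Norm
  simp_rw [maxFun_smul]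
  exact lintegral_const_mul' _ _ ENNReal.ofReal_ne_top

/-- The volume of the unit ball. -/
def omegaVol (n : ℕ) : ℝ := (volume (closedBall (0 : Eucl n) 1)).toReal

theorem omegaVol_pos : 0 < omegaVol n :=
  ENNReal.toReal_pos (measure_closedBall_pos volume _ one_pos).ne'
    measure_closedBall_lt_top.ne

theorem volume_closedBall_eq (x : Eucl n) {r : ℝ} (hr : 0 ≤ r) :
    volume (closedBall x r) = ENNReal.ofReal (r ^ n * omegaVol n) := by
  rw [Measure.addHaar_closedBall' _ _ hr, finrank_euclideanSpace_fin,
    ENNReal.ofReal_mul (by positivity), omegaVol, ENNReal.ofReal_toReal measure_closedBall_lt_top.ne]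

theorem volume_real_closedBall (x : Eucl n) {r : ℝ} (hr : 0 ≤ r) :
    (volume (closedBall x r)).toReal = r ^ n * omegaVol n := by
  rw [volume_closedBall_eq x hr, ENNReal.toReal_ofReal]
  have := omegaVol_pos (n := n)
  positivity

theorem setIntegral_abs_le {F : Eucl n → ℝ} (hF : Continuous F) (hc : HasCompactSupport F)
    (x : Eucl n) {r l : ℝ} (hr : 0 ≤ r) (hl : 0 < l) :
    ∫ y in closedBall x r, |F y| ≤
      (l * (r ^ n * omegaVol n) + (∫ y in closedBall x r, F y ^ 2) / l) / 2 := by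
  have hi : Integrable F := hF.integrable_of_hasCompactSupport hc
  have hi2 : Integrable fun y => F y ^ 2 :=
    (hF.pow 2).integrable_of_hasCompactSupport (by simpa [pow_two] using hc.mul_left)
  have h1 : ∫ y in closedBall x r, |F y| ≤ ∫ y in closedBall x r, (l + F y ^ 2 / l) / 2 := by
    apply integral_mono hi.abs.integrableOn
    · exact (((integrableOn_const (C := l) measure_closedBall_lt_top.ne).add
        (hi2.integrableOn.div_const l)).div_const 2)
    · intro y
      simp only
      rw [le_div_iff₀ two_pos, ← sq_abs (F y), ← sub_nonneg]
      have : l + |F y| ^ 2 / l - |F y| * 2 = (l - |F y|) ^ 2 / l := by field_simp; ring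
      rw [this]; positivity
  refine h1.trans (le_of_eq ?_)
  have hcst : Integrable (fun _ : Eucl n => l) (volume.restrict (closedBall x r)) :=
    integrableOn_const measure_closedBall_lt_top.ne
  rw [integral_div, integral_add hcst (hi2.integrableOn.div_const l), integral_div,
    setIntegral_const, smul_eq_mul, mul_comm l]
  rw [measureReal_def, volume_real_closedBall x hr]

theorem abs_conv_le {φ : Eucl n → ℝ} {A : ℝ} (hφ : KernelBound n φ A) {F : Eucl n → ℝ}
    (hF : LocallyIntegrable F volume) {t : ℝ} (ht : 0 < t) (x : Eucl n) :
    |∫ y, F y * dil n φ t (x - y)| ≤ A * (t ^ n)⁻¹ * ∫ y in closedBall x t, |F y| := by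
  have h0 : ∫ y, F y * dil n φ t (x - y) = ∫ y in closedBall x t, F y * dil n φ t (x - y) := by
    refine (setIntegral_eq_integral_of_forall_compl_eq_zero fun y hy => ?_).symm
    rw [dil_eq_zero hφ ht, mul_zero]
    rw [mem_closedBall, not_le, dist_comm, dist_eq_norm] at hy
    exact hy
  rw [h0, ← integral_const_mul]
  have hi : IntegrableOn F (closedBall x t) := hF.integrableOn_isCompact (isCompact_closedBall _ _)
  refine (abs_integral_le_integral_abs).trans (integral_mono_of_nonneg (ae_of_all _ fun _ =>
    abs_nonneg _) (hi.abs.const_mul _) (ae_of_all _ fun y => ?_))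
  simp only [abs_mul]
  rw [mul_comm]
  exact mul_le_mul_of_nonneg_right (abs_dil_le hφ ht _) (abs_nonneg _)

theorem weak_type_L2 {φ : Eucl n → ℝ} {A : ℝ} (hφ : KernelBound n φ A) {F : Eucl n → ℝ}
    (hF : Continuous F) (hc : HasCompactSupport F) {s : ℝ} (hs : 0 < s) :
    volume {x | ENNReal.ofReal s < maxFun n φ F x} ≤
      ENNReal.ofReal (5 ^ n * A ^ 2 * omegaVol n ^ 2 / s ^ 2 * ∫ y, F y ^ 2) := by
  have hA := hφ.pos
  have hω := omegaVol_pos (n := n)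
  have hi2 : Integrable fun y => F y ^ 2 :=
    (hF.pow 2).integrable_of_hasCompactSupport (by simpa [pow_two] using hc.mul_left)
  set S := {x | ENNReal.ofReal s < maxFun n φ F x}
  have hex : ∀ x ∈ S, ∃ t : ℝ, 0 < t ∧ s < |∫ y, F y * dil n φ t (x - y)| := by
    intro x hx
    by_contra hcon
    push Not at hcon
    exact absurd (show ENNReal.ofReal s < _ from hx)
      (not_lt.2 (maxFun_le fun t ht => ENNReal.ofReal_le_ofReal (hcon t ht)))
  choose! t ht hst using hex
  set K := 5 ^ n * A ^ 2 * omegaVol n ^ 2 / s ^ 2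
  have hKpos : 0 ≤ K := by positivity
  have hV := vitali_lintegral S id t ht (fun _ => 1) (fun y => ENNReal.ofReal (K * F y ^ 2)) ?_
  · simp only [id, lintegral_const, one_mul, Measure.restrict_apply_univ] at hV
    calc volume S ≤ volume (⋃ a ∈ S, closedBall a (t a)) := by
          apply measure_mono
          intro x hx
          exact Set.mem_biUnion hx (mem_closedBall_self (ht x hx).le)
      _ ≤ _ := hV
      _ = _ := by
        rw [← ofReal_integral_eq_lintegral_ofReal (hi2.const_mul _) (ae_of_all _ fun y => by
          positivity), integral_const_mul]
  · intro x hx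
    have htx := ht x hx
    simp only [id, lintegral_const, one_mul, Measure.restrict_apply_univ]
    rw [← ofReal_integral_eq_lintegral_ofReal (hi2.const_mul _).integrableOn (ae_of_all _ fun y => by
          positivity), integral_const_mul, volume_closedBall_eq _ (by positivity)]
    apply ENNReal.ofReal_le_ofReal
    have h1 := (hst x hx).trans_le (abs_conv_le hφ hF.locallyIntegrable htx x)
    have h2 := setIntegral_abs_le hF hc x htx.le (l := s / (A * omegaVol n)) (by positivity)
    set I := ∫ y in closedBall x (t x), F y ^ 2
    set T := t x ^ n
    have hT : 0 < T := by positivity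
    have h3 : A * T⁻¹ * ∫ y in closedBall x (t x), |F y| ≤ A * T⁻¹ *
      ((s / (A * omegaVol n) * (T * omegaVol n) + I / (s / (A * omegaVol n))) / 2) :=
      mul_le_mul_of_nonneg_left h2 (by positivity)
    have h4 := h1.trans_le h3
    have h5 : A * T⁻¹ *
      ((s / (A * omegaVol n) * (T * omegaVol n) + I / (s / (A * omegaVol n))) / 2) =
      s / 2 + A ^ 2 * omegaVol n * I / (2 * s * T) := by field_simp
    rw [h5] at h4
    have h6 : s / 2 < A ^ 2 * omegaVol n * I / (2 * s * T) := by linarith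
    rw [lt_div_iff₀ (by positivity)] at h6
    have h7 : s ^ 2 * T ≤ A ^ 2 * omegaVol n * I := by nlinarith
    rw [mul_pow]
    show 5 ^ n * T * omegaVol n ≤ 5 ^ n * A ^ 2 * omegaVol n ^ 2 / s ^ 2 * I
    rw [div_mul_eq_mul_div, le_div_iff₀ (by positivity)]
    have : 0 ≤ (5 : ℝ) ^ n * omegaVol n := by positivity
    nlinarith [mul_le_mul_of_nonneg_left h7 this]

theorem le_dyadic_sum (m : ℝ≥0∞) {a : ℝ} (ha : 0 < a) :
    m ≤ ENNReal.ofReal a + ∑' j : ℕ, ENNReal.ofReal (2 ^ (j + 1) * a) *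
      (if ENNReal.ofReal (2 ^ j * a) < m then 1 else 0) := by
  by_cases h1 : m ≤ ENNReal.ofReal a
  · exact h1.trans le_self_add
  push Not at h1
  by_cases h2 : m = ⊤
  · subst h2
    have : ∑' j : ℕ, ENNReal.ofReal (2 ^ (j + 1) * a) *
      (if ENNReal.ofReal (2 ^ j * a) < (⊤ : ℝ≥0∞) then 1 else 0) = ⊤ := by
      rw [eq_top_iff]
      have : ∑' j : ℕ, ENNReal.ofReal a = ⊤ := ENNReal.tsum_const_eq_top_of_ne_zero (by simpa)
      refine this.symm.le.trans (ENNReal.tsum_le_tsum fun j => ?_)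
      simp only [ENNReal.ofReal_lt_top, if_true, mul_one]
      apply ENNReal.ofReal_le_ofReal
      exact le_mul_of_one_le_left ha.le (one_le_pow₀ one_le_two)
    rw [this]; simp
  · lift m to ℝ≥0 using h2
    have h3 : a < m := by
      have := (ENNReal.ofReal_lt_iff_lt_toReal ha.le ENNReal.coe_ne_top).1 h1
      simpa using this
    obtain ⟨j, hj1, hj2⟩ := exists_nat_pow_near (show 1 ≤ (m : ℝ) / a by
      rw [le_div_iff₀ ha]; linarith) one_lt_two
    rw [le_div_iff₀ ha] at hj1
    rw [div_lt_iff₀ ha] at hj2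
    rcases hj1.lt_or_eq with hj1 | hj1
    · refine le_add_left (le_trans ?_ (ENNReal.le_tsum j))
      rw [if_pos ((ENNReal.ofReal_lt_iff_lt_toReal (by positivity) ENNReal.coe_ne_top).2
        (by simpa using hj1)), mul_one, ← ENNReal.ofReal_coe_nnreal]
      exact ENNReal.ofReal_le_ofReal hj2.le
    · rcases j with _ | j
      · rw [pow_zero, one_mul] at hj1; linarith
      · refine le_add_left (le_trans ?_ (ENNReal.le_tsum j))
        rw [if_pos ((ENNReal.ofReal_lt_iff_lt_toReal (by positivity) ENNReal.coe_ne_top).2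
          (by simp only [ENNReal.coe_toReal]; rw [← hj1, pow_succ]
              nlinarith [pow_pos (two_pos (α := ℝ)) j, mul_pos (pow_pos (two_pos (α := ℝ)) j) ha])),
              mul_one, ← ENNReal.ofReal_coe_nnreal]
        exact ENNReal.ofReal_le_ofReal hj1.ge

theorem H1Norm_le_of_L2 {φ : Eucl n → ℝ} {A : ℝ} (hφ : KernelBound n φ A) {R : ℝ} (hR : 1 ≤ R) :
    ∃ C : ℝ, 0 < C ∧ ∀ F : Eucl n → ℝ, Continuous F → (∀ x, F x ≠ 0 → ‖x‖ ≤ R) → ∫ x, F x = 0 →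
      ∀ a : ℝ, 0 < a → ∫ x, F x ^ 2 ≤ a ^ 2 → H1Norm n φ F ≤ ENNReal.ofReal (C * a) := by
  have hA := hφ.pos
  have hω := omegaVol_pos (n := n)
  have hI : ∫⁻ x : Eucl n, ENNReal.ofReal ((1 + ‖x‖) ^ (-((n : ℝ) + 1))) < ⊤ :=
    finite_integral_one_add_norm (by simp)
  set I := (∫⁻ x : Eucl n, ENNReal.ofReal ((1 + ‖x‖) ^ (-((n : ℝ) + 1)))).toReal with hIdef
  set W := 5 ^ n * A ^ 2 * omegaVol n ^ 2 with hW
  set K := A * (omegaVol n * R ^ n + 1) * R * 4 ^ (n + 1) with hK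
  have hI0 : 0 ≤ I := ENNReal.toReal_nonneg
  refine ⟨((2 * R) ^ n * omegaVol n + 4 * W) + K * I, by positivity, fun F hF hsupp h0 a ha hFa => ?_⟩
  have hc : HasCompactSupport F := HasCompactSupport.of_support_subset_isCompact
    (isCompact_closedBall (0 : Eucl n) R) fun x hx => by simpa using hsupp x hx
  have hmeas := maxFun_measurable hφ hF.locallyIntegrable
  have hi : Integrable F := hF.integrable_of_hasCompactSupport hc
  have hi2 : Integrable fun y => F y ^ 2 :=
    (hF.pow 2).integrable_of_hasCompactSupport (by simpa [pow_two] using hc.mul_left)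
  have hnear : ∫⁻ x in closedBall 0 (2 * R), maxFun n φ F x
      ≤ ENNReal.ofReal (((2 * R) ^ n * omegaVol n + 4 * W) * a) := by
    calc _ ≤ ∫⁻ x in closedBall 0 (2 * R), (ENNReal.ofReal a + ∑' j : ℕ,
          ENNReal.ofReal (2 ^ (j + 1) * a) *
          (if ENNReal.ofReal (2 ^ j * a) < maxFun n φ F x then 1 else 0)) :=
          lintegral_mono fun x => le_dyadic_sum _ ha
      _ = ENNReal.ofReal a * volume (closedBall (0 : Eucl n) (2 * R)) + ∑' j : ℕ,
          ENNReal.ofReal (2 ^ (j + 1) * a) * ∫⁻ x in closedBall 0 (2 * R),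
          (if ENNReal.ofReal (2 ^ j * a) < maxFun n φ F x then 1 else 0) := by
          have hm : ∀ j : ℕ, Measurable fun x => (if ENNReal.ofReal (2 ^ j * a) < maxFun n φ F x
            then (1 : ℝ≥0∞) else 0) := fun j =>
            Measurable.ite (measurableSet_lt measurable_const hmeas) measurable_const
              measurable_const
          rw [lintegral_add_left measurable_const, lintegral_const, Measure.restrict_apply_univ,
            lintegral_tsum fun j => ((hm j).const_mul _).aemeasurable]
          congr 2; ext j
          rw [lintegral_const_mul _ (hm j)]
      _ ≤ ENNReal.ofReal a * ENNReal.ofReal ((2 * R) ^ n * omegaVol n) + ∑' j : ℕ,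
          ENNReal.ofReal ((1 / 2) ^ j * (2 * W * a)) := by
          refine add_le_add (by rw [volume_closedBall_eq _ (by positivity)])
            (ENNReal.tsum_le_tsum fun j => ?_)
          have hs : 0 < 2 ^ j * a := by positivity
          have : ∫⁻ x in closedBall 0 (2 * R),
              (if ENNReal.ofReal (2 ^ j * a) < maxFun n φ F x then (1 : ℝ≥0∞) else 0)
              ≤ ENNReal.ofReal (W / (2 ^ j * a) ^ 2 * ∫ y, F y ^ 2) := by
            refine (setLIntegral_le_lintegral _ _).trans (le_trans (le_of_eq ?_)
              (weak_type_L2 hφ hF hc hs))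
            rw [← lintegral_indicator_one (measurableSet_lt measurable_const hmeas)]
            congr 1; ext y
            simp [Set.indicator_apply]
          refine (mul_le_mul_right this _).trans ?_
          rw [← ENNReal.ofReal_mul (by positivity)]
          apply ENNReal.ofReal_le_ofReal
          calc 2 ^ (j + 1) * a * (W / (2 ^ j * a) ^ 2 * ∫ y, F y ^ 2)
              ≤ 2 ^ (j + 1) * a * (W / (2 ^ j * a) ^ 2 * a ^ 2) := by gcongr
            _ = (1 / 2) ^ j * (2 * W * a) := by
              rw [one_div, inv_pow]; field_simp; ring
      _ ≤ _ := by
          rw [← ENNReal.ofReal_tsum_of_nonneg (fun j => by positivity)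
            (summable_geometric_two.mul_right _), tsum_mul_right, tsum_geometric_two,
            ← ENNReal.ofReal_mul ha.le, ← ENNReal.ofReal_add (by positivity) (by positivity)]
          apply ENNReal.ofReal_le_ofReal
          apply le_of_eq; ring
  have hfar : ∫⁻ x in (closedBall 0 (2 * R))ᶜ, maxFun n φ F x ≤ ENNReal.ofReal (K * I * a) := by
    have hL1 : ∫ y, |F y| ≤ (omegaVol n * R ^ n + 1) * a := by
      have e : ∀ G : Eucl n → ℝ, (∀ x, G x ≠ 0 → F x ≠ 0) →
          ∫ y, G y = ∫ y in closedBall 0 R, G y := fun G hG =>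
        (setIntegral_eq_integral_of_forall_compl_eq_zero fun y hy => by
          by_contra hcon
          exact hy (by simpa using hsupp y (hG y hcon))).symm
      have := setIntegral_abs_le hF hc 0 (by positivity : 0 ≤ R) ha
      rw [← e _ (by simp), ← e _ (by simp)] at this
      refine this.trans ?_
      have h5 : (∫ y, F y ^ 2) / a ≤ a := by rw [div_le_iff₀ ha]; nlinarith
      have h6 : 0 ≤ a * (R ^ n * omegaVol n) := by positivity
      nlinarith
    calc _ ≤ ∫⁻ x in (closedBall (0 : Eucl n) (2 * R))ᶜ,
          ENNReal.ofReal (K * a) * ENNReal.ofReal ((1 + ‖x‖) ^ (-((n : ℝ) + 1))) := by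
          apply setLIntegral_mono' measurableSet_closedBall.compl
          intro x hx
          have hx : 2 * R < ‖x‖ := by simpa using hx
          refine maxFun_le fun t ht => ?_
          rw [← ENNReal.ofReal_mul (by positivity)]
          apply ENNReal.ofReal_le_ofReal
          by_cases htx : t < ‖x‖ / 2
          · have : ∫ y, F y * dil n φ t (x - y) = 0 := by
              rw [← integral_zero (Eucl n) ℝ]
              congr 1; ext y
              by_cases hy : F y = 0
              · simp [hy]
              · rw [dil_eq_zero hφ ht, mul_zero]
                have := hsupp y hy
                have := norm_sub_norm_le x y
                linarith
            rw [this, abs_zero]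
            positivity
          · push Not at htx
            have hxp : 0 < ‖x‖ := by linarith
            have e1 : ∫ y, F y * dil n φ t (x - y)
                = ∫ y, F y * (dil n φ t (x - y) - dil n φ t x) := by
              simp_rw [mul_sub]
              rw [integral_sub, integral_mul_const, h0, zero_mul, sub_zero]
              · exact (hF.mul ((dil_continuous hφ t).comp
                  (continuous_const.sub continuous_id))).integrable_of_hasCompactSupport
                  hc.mul_right
              · exact hi.mul_const _
            have e2 : |∫ y, F y * dil n φ t (x - y)| ≤ ∫ y, |F y| * (A * (t ^ (n + 1))⁻¹ * R) := by
              rw [e1]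
              refine abs_integral_le_integral_abs.trans (integral_mono_of_nonneg
                (ae_of_all _ fun _ => abs_nonneg _) (hi.abs.mul_const _) (ae_of_all _ fun y => ?_))
              simp only [abs_mul]
              by_cases hy : F y = 0
              · simp [hy]
              · refine mul_le_mul_of_nonneg_left ((abs_dil_sub_le hφ ht _ _).trans ?_)
                  (abs_nonneg _)
                refine mul_le_mul_of_nonneg_left ?_ (by positivity)
                simpa using hsupp y hy
            rw [integral_mul_const] at e2
            have e3 : (t ^ (n + 1))⁻¹ ≤ 4 ^ (n + 1) * (1 + ‖x‖) ^ (-((n : ℝ) + 1)) := by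
              have : (1 + ‖x‖) ^ (-((n : ℝ) + 1)) = ((1 + ‖x‖) ^ (n + 1))⁻¹ := by
                rw [rpow_neg (by positivity)]
                congr 1
                exact_mod_cast rpow_natCast (1 + ‖x‖) (n + 1)
              rw [this, ← div_eq_mul_inv, ← div_pow, ← inv_div, inv_pow]
              gcongr
              rw [div_le_iff₀ (by norm_num)]
              linarith
            calc _ ≤ (∫ y, |F y|) * (A * (t ^ (n + 1))⁻¹ * R) := e2
              _ ≤ ((omegaVol n * R ^ n + 1) * a) *
                  (A * (4 ^ (n + 1) * (1 + ‖x‖) ^ (-((n : ℝ) + 1))) * R) := by gcongr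
              _ = _ := by rw [hK]; ring
      _ ≤ ENNReal.ofReal (K * a) * ∫⁻ x : Eucl n,
            ENNReal.ofReal ((1 + ‖x‖) ^ (-((n : ℝ) + 1))) := by
          rw [lintegral_const_mul' _ _ ENNReal.ofReal_ne_top]
          exact mul_le_mul_right (setLIntegral_le_lintegral _ _) _
      _ = _ := by
          rw [← ENNReal.ofReal_toReal hI.ne, ← ENNReal.ofReal_mul (by positivity)]
          congr 1; rw [← hIdef]; ring
  unfold H1Norm
  rw [← lintegral_add_compl _ (measurableSet_closedBall (x := (0 : Eucl n)) (ε := 2 * R))]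
  refine (add_le_add hnear hfar).trans ?_
  rw [← ENNReal.ofReal_add (by positivity) (by positivity)]
  apply ENNReal.ofReal_le_ofReal
  apply le_of_eq; ring

/-! ### Partial derivatives, gradients and rotations -/

theorem pd_continuous {w : Eucl n → ℝ} (hw : ContDiff ℝ 1 w) (i : Fin n) :
    Continuous (pd n w i) :=
  (hw.continuous_fderiv (by simp)).clm_apply continuous_const

theorem pd_contDiff {w : Eucl n → ℝ} {m k : WithTop ℕ∞} (hw : ContDiff ℝ k w) (h : m + 1 ≤ k)
    (i : Fin n) : ContDiff ℝ m (pd n w i) :=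
  (hw.fderiv_right h).clm_apply contDiff_const

theorem pd_hasCompactSupport {w : Eucl n → ℝ} (hc : HasCompactSupport w) (i : Fin n) :
    HasCompactSupport (pd n w i) :=
  hc.fderiv_apply ℝ _

theorem pd_eq_zero {w : Eucl n → ℝ} {c : Eucl n} {r : ℝ}
    (hs : ∀ x, w x ≠ 0 → x ∈ closedBall c r) (i : Fin n) {x : Eucl n} (hx : pd n w i x ≠ 0) :
    x ∈ closedBall c r := by
  have h1 : tsupport w ⊆ closedBall c r := closure_minimal hs isClosed_closedBall
  apply h1
  apply support_fderiv_subset ℝ (f := w)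
  intro h
  apply hx
  simp [pd, h]

theorem pd_ibp {w V : Eucl n → ℝ} (hw : ContDiff ℝ 1 w) (hc : HasCompactSupport w)
    (hV : ContDiff ℝ 1 V) (i : Fin n) :
    ∫ x, w x * pd n V i x = - ∫ x, pd n w i x * V x := by
  refine integral_mul_fderiv_eq_neg_fderiv_mul_of_integrable ?_ ?_ ?_ ?_ ?_
  · exact ((pd_continuous hw i).mul hV.continuous).integrable_of_hasCompactSupport
      (pd_hasCompactSupport hc i).mul_right
  · exact (hw.continuous.mul (pd_continuous hV i)).integrable_of_hasCompactSupport hc.mul_right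
  · exact (hw.continuous.mul hV.continuous).integrable_of_hasCompactSupport hc.mul_right
  · exact fun x _ => hw.differentiable (by simp) x
  · exact fun x _ => hV.differentiable (by simp) x

theorem pd_comm {V : Eucl n → ℝ} (hV : ContDiff ℝ 2 V) (i j : Fin n) (x : Eucl n) :
    pd n (pd n V i) j x = pd n (pd n V j) i x := by
  have hs : IsSymmSndFDerivAt ℝ V x := hV.contDiffAt.isSymmSndFDerivAt (by simp)
  have hd : DifferentiableAt ℝ (fderiv ℝ V) x :=
    (hV.fderiv_right (m := 1) (by norm_num)).differentiable (by simp) x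
  have key : ∀ a b : Fin n, pd n (pd n V a) b x =
      fderiv ℝ (fderiv ℝ V) x (EuclideanSpace.single b 1) (EuclideanSpace.single a 1) := by
    intro a b
    show fderiv ℝ (fun y => fderiv ℝ V y (EuclideanSpace.single a 1)) x _ = _
    rw [fderiv_clm_apply hd (differentiableAt_const _)]
    simp
  rw [key, key]
  exact hs _ _

theorem integral_curl_eq_zero {w V : Eucl n → ℝ} (hw : ContDiff ℝ 1 w) (hc : HasCompactSupport w)
    (hV : ContDiff ℝ 2 V) (i j : Fin n) :
    ∫ x, (pd n w i x * pd n V j x - pd n w j x * pd n V i x) = 0 := by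
  have hi : ∀ a b, Integrable fun x => pd n w a x * pd n V b x := fun a b =>
    ((pd_continuous hw a).mul (pd_continuous (hV.of_le (by norm_num)) b)).integrable_of_hasCompactSupport
      (pd_hasCompactSupport hc a).mul_right
  rw [integral_sub (hi _ _) (hi _ _)]
  have h1 := pd_ibp hw hc (pd_contDiff hV (m := 1) (by norm_num) j) i
  have h2 := pd_ibp hw hc (pd_contDiff hV (m := 1) (by norm_num) i) j
  have h3 : ∫ x, w x * pd n (pd n V j) i x = ∫ x, w x * pd n (pd n V i) j x := by
    congr 1; ext x; rw [pd_comm hV]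
  linarith

/-- The gradient field of `w`. -/
def gradF (n : ℕ) (w : Eucl n → ℝ) (x : Eucl n) : Eucl n := WithLp.toLp 2 fun i => pd n w i x

/-- The rotated gradient of `V` in the plane of the coordinates `i`, `i'`. -/
def rotF (n : ℕ) (V : Eucl n → ℝ) (i i' : Fin n) (x : Eucl n) : Eucl n :=
  EuclideanSpace.single i (pd n V i' x) - EuclideanSpace.single i' (pd n V i x)

theorem gradF_apply (w : Eucl n → ℝ) (x : Eucl n) (a : Fin n) : gradF n w x a = pd n w a x := rfl

theorem rotF_apply (V : Eucl n → ℝ) (i i' a : Fin n) (x : Eucl n) :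
    rotF n V i i' x a = (if a = i then pd n V i' x else 0) - (if a = i' then pd n V i x else 0) := by
  simp [rotF]

theorem sum_mul_rotF (u : Fin n → ℝ) (V : Eucl n → ℝ) (i i' : Fin n) (x : Eucl n) :
    ∑ a, u a * rotF n V i i' x a = u i * pd n V i' x - u i' * pd n V i x := by
  simp [rotF_apply, mul_sub, Finset.sum_sub_distrib]

theorem curlFree_gradF {w : Eucl n → ℝ} (hw : ContDiff ℝ 1 w) (hc : HasCompactSupport w) :
    CurlFree n (gradF n w) := by
  intro ψ hψ _ i j _
  exact integral_curl_eq_zero hw hc (contDiff_infty.1 hψ 2) i j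

theorem divFree_rotF {V : Eucl n → ℝ} (hV : ContDiff ℝ 2 V) (i i' : Fin n) :
    DivFree n (rotF n V i i') := by
  intro ψ hψ hc
  have h := integral_curl_eq_zero (contDiff_infty.1 hψ 1) hc hV i i'
  rw [← h]
  congr 1; ext x
  rw [← sum_mul_rotF (fun a => pd n ψ a x)]
  exact Finset.sum_congr rfl fun a _ => mul_comm _ _

theorem pd_affine {v : Eucl n → ℝ} (hv : ContDiff ℝ 1 v) {s : ℝ} (hs : s ≠ 0)
    (c : Eucl n) (a : Fin n) (x : Eucl n) :
    pd n (fun y => s⁻¹ * v (s • (y - c))) a x = pd n v a (s • (x - c)) := by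
  unfold pd
  have h1 : fderiv ℝ (fun y => v (s • (y - c))) x = s • fderiv ℝ v (s • (x - c)) := by
    rw [fderiv_comp_sub (f := fun y => v (s • y)) c, fderiv_comp_smul]
  have hd : DifferentiableAt ℝ (fun y => v (s • (y - c))) x := by
    have := hv.differentiable (by simp)
    fun_prop
  rw [fderiv_const_mul hd, h1]
  simp [hs]

/-! ### Mean oscillation -/

/-- `g` deviates on every ball from a constant by at most `C` on average. -/
def OscLe (n : ℕ) (g : Eucl n → ℝ) (C : ℝ) : Prop :=
  ∀ (x₀ : Eucl n) (r : ℝ), 0 < r → ∃ c : ℝ,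
    ∫⁻ x in ball x₀ r, ENNReal.ofReal |g x - c| ≤ ENNReal.ofReal C * volume (ball x₀ r)

theorem OscLe.neg {g : Eucl n → ℝ} {C : ℝ} (h : OscLe n g C) : OscLe n (fun x => - g x) C := by
  intro x₀ r hr
  obtain ⟨c, hc⟩ := h x₀ r hr
  refine ⟨-c, le_of_eq_of_le ?_ hc⟩
  congr 1; ext x; congr 1
  rw [← abs_neg]; congr 1; ring

theorem OscLe.const_add {g : Eucl n → ℝ} {C : ℝ} (h : OscLe n g C) (b : ℝ) :
    OscLe n (fun x => b + g x) C := by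
  intro x₀ r hr
  obtain ⟨c, hc⟩ := h x₀ r hr
  refine ⟨b + c, le_of_eq_of_le ?_ hc⟩
  congr 1; ext x; congr 1
  congr 1; ring

theorem BMOplus_le {g : Eucl n → ℝ} (hg : Continuous g) {C D : ℝ} (hC : 0 ≤ C) (hD : 0 ≤ D)
    (h : OscLe n g C) (hu : ∫⁻ x in unitCube n, ENNReal.ofReal |g x| ≤ ENNReal.ofReal D) :
    BMOplus n g ≤ ENNReal.ofReal (D + 2 * C) := by
  unfold BMOplus
  rw [ENNReal.ofReal_add hD (by positivity)]
  refine add_le_add hu (iSup_le fun x₀ => iSup_le fun r => iSup_le fun hr => ?_)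
  obtain ⟨c, hc⟩ := h x₀ r hr
  set B := ball x₀ r
  have hB0 : volume B ≠ 0 := (measure_ball_pos volume x₀ hr).ne'
  have hBt : volume B ≠ ⊤ := measure_ball_lt_top.ne
  have hgi : IntegrableOn g B :=
    (hg.locallyIntegrable.integrableOn_isCompact (isCompact_closedBall x₀ r)).mono_set
      ball_subset_closedBall
  have hci : IntegrableOn (fun _ => c) B := integrableOn_const hBt
  have hB : 0 < (volume B).toReal := ENNReal.toReal_pos hB0 hBt
  have havg : |c - setAvg n g B| ≤ C := by
    unfold setAvg
    have e : c - (∫ x in B, g x) / (volume B).toReal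
        = -((∫ x in B, (g x - c)) / (volume B).toReal) := by
      rw [integral_sub hgi hci, setIntegral_const, smul_eq_mul, measureReal_def]
      field_simp; ring
    rw [e, abs_neg, abs_div, abs_of_pos hB, div_le_iff₀ hB]
    refine abs_integral_le_integral_abs.trans ?_
    have hgc : Integrable (fun x => |g x - c|) (volume.restrict B) := (hgi.sub hci).abs
    rw [← ENNReal.ofReal_le_ofReal_iff (by positivity),
      ofReal_integral_eq_lintegral_ofReal hgc (ae_of_all _ fun _ => abs_nonneg _),
      ENNReal.ofReal_mul hC, ENNReal.ofReal_toReal hBt]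
    exact hc
  rw [ENNReal.div_le_iff hB0 hBt]
  calc ∫⁻ x in B, ENNReal.ofReal |g x - setAvg n g B|
      ≤ ∫⁻ x in B, (ENNReal.ofReal |g x - c| + ENNReal.ofReal C) := by
        refine lintegral_mono fun x => ?_
        rw [← ENNReal.ofReal_add (abs_nonneg _) hC]
        apply ENNReal.ofReal_le_ofReal
        have : g x - setAvg n g B = (g x - c) + (c - setAvg n g B) := by ring
        rw [this]
        exact (abs_add_le _ _).trans (by linarith)
    _ = (∫⁻ x in B, ENNReal.ofReal |g x - c|) + ENNReal.ofReal C * volume B := by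
        rw [lintegral_add_right _ measurable_const, lintegral_const, Measure.restrict_apply_univ]
    _ ≤ ENNReal.ofReal (2 * C) * volume B := by
        rw [two_mul, ENNReal.ofReal_add hC hC, add_mul]
        gcongr

theorem sum_zpow_le (S : Finset ℤ) {a : ℝ} (ha : 0 ≤ a) (h : ∀ k ∈ S, (2 : ℝ) ^ k ≤ a) :
    ∑ k ∈ S, (2 : ℝ) ^ k ≤ 2 * a := by
  rcases S.eq_empty_or_nonempty with rfl | hne
  · simpa using ha
  set m := S.max' hne
  have hm := h m (S.max'_mem hne)
  have e : ∀ k ∈ S, (2 : ℝ) ^ k = 2 ^ m * (1 / 2) ^ (m - k).toNat := by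
    intro k hk
    have hk' : 0 ≤ m - k := sub_nonneg.2 (S.le_max' k hk)
    rw [one_div, inv_pow, ← zpow_natCast, Int.toNat_of_nonneg hk', ← zpow_neg, ← zpow_add₀ two_ne_zero]
    congr 1; ring
  rw [Finset.sum_congr rfl e, ← Finset.mul_sum]
  have hinj : ∀ k ∈ S, ∀ l ∈ S, (m - k).toNat = (m - l).toNat → k = l := by
    intro k hk l hl hkl
    have := S.le_max' k hk
    have := S.le_max' l hl
    omega
  rw [← Finset.sum_image (f := fun j : ℕ => ((1 : ℝ) / 2) ^ j) hinj]
  have := summable_geometric_two.sum_le_tsum (S.image fun k => (m - k).toNat)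
    (fun j _ => by positivity)
  rw [tsum_geometric_two] at this
  nlinarith [zpow_pos (two_pos (α := ℝ)) m]

theorem sum_zpow_neg_le (S : Finset ℤ) {a : ℝ} (ha : 0 ≤ a) (h : ∀ k ∈ S, (2 : ℝ) ^ (-k) ≤ a) :
    ∑ k ∈ S, (2 : ℝ) ^ (-k) ≤ 2 * a := by
  have := sum_zpow_le (S.image fun k => -k) ha (by
    intro k hk
    obtain ⟨l, hl, rfl⟩ := Finset.mem_image.1 hk
    exact h l hl)
  rwa [Finset.sum_image (by intro a _ b _ hab; simpa using hab)] at this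

theorem volume_ball_eq (x : Eucl n) {r : ℝ} (hr : 0 < r) :
    volume (ball x r) = ENNReal.ofReal (r ^ n * omegaVol n) := by
  rw [← volume_closedBall_eq x hr.le, Measure.addHaar_ball_of_pos _ _ hr,
    Measure.addHaar_closedBall' _ _ hr.le, Measure.addHaar_unitClosedBall_eq_addHaar_unitBall]

theorem lintegral_bump_le {γ : Eucl n → ℝ} {M : ℝ} (hM : 0 ≤ M)
    (hb : ∀ x, |γ x| ≤ M) (hs : ∀ x, γ x ≠ 0 → ‖x‖ ≤ 2) (p : Eucl n) (k : ℤ) :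
    ∫⁻ x, ENNReal.ofReal |γ ((2 : ℝ) ^ k • (x - p))|
      ≤ ENNReal.ofReal (M * ((2 * 2 ^ (-k)) ^ n * omegaVol n)) := by
  have h2 : (0 : ℝ) < 2 ^ (-k) := zpow_pos two_pos _
  calc _ ≤ ∫⁻ x, (closedBall p (2 * 2 ^ (-k))).indicator (fun _ => ENNReal.ofReal M) x := by
        refine lintegral_mono fun x => ?_
        simp only
        by_cases hx : x ∈ closedBall p (2 * 2 ^ (-k))
        · rw [Set.indicator_of_mem hx]
          exact ENNReal.ofReal_le_ofReal (hb _)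
        · rw [Set.indicator_of_notMem hx]
          have : γ ((2 : ℝ) ^ k • (x - p)) = 0 := by
            by_contra hcon
            apply hx
            have h3 := hs _ hcon
            have h4 : (0 : ℝ) < 2 ^ k := zpow_pos two_pos k
            rw [norm_smul, Real.norm_of_nonneg h4.le] at h3
            rw [mem_closedBall, dist_eq_norm, zpow_neg, ← div_eq_mul_inv, le_div_iff₀ h4]
            linarith
          simp [this]
    _ = _ := by
        rw [lintegral_indicator_const measurableSet_closedBall,
          volume_closedBall_eq _ (by positivity), ENNReal.ofReal_mul hM]

theorem oscLe_lacunary (hn : 1 ≤ n) {γ : Eucl n → ℝ} {M : ℝ} (hM : 0 ≤ M) (hγc : Continuous γ)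
    (hb : ∀ x, |γ x| ≤ M) (hl : ∀ x y, |γ x - γ y| ≤ M * ‖x - y‖) (hs : ∀ x, γ x ≠ 0 → ‖x‖ ≤ 2)
    (S : Finset ℤ) (p : Eucl n) :
    OscLe n (fun x => ∑ k ∈ S, γ ((2 : ℝ) ^ k • (x - p))) (2 * M + M * 2 ^ n * 2) := by
  intro x₀ r hr
  have hω := omegaVol_pos (n := n)
  set S₁ := S.filter fun k : ℤ => (2 : ℝ) ^ k ≤ r⁻¹ with hS₁
  set S₂ := S.filter fun k : ℤ => ¬ (2 : ℝ) ^ k ≤ r⁻¹ with hS₂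
  refine ⟨∑ k ∈ S₁, γ ((2 : ℝ) ^ k • (x₀ - p)), ?_⟩
  have hpt : ∀ x ∈ ball x₀ r, ENNReal.ofReal |∑ k ∈ S, γ ((2 : ℝ) ^ k • (x - p)) -
      ∑ k ∈ S₁, γ ((2 : ℝ) ^ k • (x₀ - p))| ≤ ENNReal.ofReal (2 * M) +
      ∑ k ∈ S₂, ENNReal.ofReal |γ ((2 : ℝ) ^ k • (x - p))| := by
    intro x hx
    rw [← ENNReal.ofReal_sum_of_nonneg fun _ _ => abs_nonneg _,
      ← ENNReal.ofReal_add (by positivity) (Finset.sum_nonneg fun _ _ => abs_nonneg _)]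
    apply ENNReal.ofReal_le_ofReal
    rw [← Finset.sum_filter_add_sum_filter_not S fun k : ℤ => (2 : ℝ) ^ k ≤ r⁻¹, ← hS₁, ← hS₂,
      add_sub_right_comm, ← Finset.sum_sub_distrib]
    refine (abs_add_le _ _).trans (add_le_add ?_ (Finset.abs_sum_le_sum_abs _ _))
    have hx' : ‖x - x₀‖ ≤ r := by rw [← dist_eq_norm]; exact (mem_ball.1 hx).le
    calc _ ≤ ∑ k ∈ S₁, M * r * 2 ^ k := by
          refine (Finset.abs_sum_le_sum_abs _ _).trans (Finset.sum_le_sum fun k _ => ?_)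
          refine (hl _ _).trans ?_
          have h2 : (0 : ℝ) < 2 ^ k := zpow_pos two_pos k
          rw [← smul_sub, sub_sub_sub_cancel_right, norm_smul, Real.norm_of_nonneg h2.le,
            mul_assoc M, mul_comm r]
          gcongr
      _ ≤ M * r * (2 * r⁻¹) := by
          rw [← Finset.mul_sum]
          have := sum_zpow_le S₁ (inv_nonneg.2 hr.le) fun k hk => (Finset.mem_filter.1 hk).2
          gcongr
      _ = 2 * M := by field_simp
  have hmeas : ∀ k : ℤ, Measurable fun x => ENNReal.ofReal |γ ((2 : ℝ) ^ k • (x - p))| := fun k => by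
    have : Continuous fun x => |γ ((2 : ℝ) ^ k • (x - p))| := by fun_prop
    exact this.measurable.ennreal_ofReal
  calc _ ≤ ∫⁻ x in ball x₀ r, (ENNReal.ofReal (2 * M) +
      ∑ k ∈ S₂, ENNReal.ofReal |γ ((2 : ℝ) ^ k • (x - p))|) :=
        setLIntegral_mono' measurableSet_ball hpt
    _ = ENNReal.ofReal (2 * M) * volume (ball x₀ r) +
      ∑ k ∈ S₂, ∫⁻ x in ball x₀ r, ENNReal.ofReal |γ ((2 : ℝ) ^ k • (x - p))| := by
        rw [lintegral_add_left measurable_const, lintegral_const, Measure.restrict_apply_univ,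
          lintegral_finsetSum _ fun k _ => hmeas k]
    _ ≤ ENNReal.ofReal (2 * M) * volume (ball x₀ r) +
      ∑ k ∈ S₂, ENNReal.ofReal (M * 2 ^ n * r ^ (n - 1) * omegaVol n * 2 ^ (-k)) := by
        gcongr with k hk
        have h2 : (0 : ℝ) < 2 ^ (-k) := zpow_pos two_pos _
        have hk2 : (2 : ℝ) ^ (-k) ≤ r := by
          have := (Finset.mem_filter.1 hk).2
          push Not at this
          rw [zpow_neg]
          exact inv_le_of_inv_le₀ hr this.le
        calc _ ≤ ENNReal.ofReal (M * ((2 * 2 ^ (-k)) ^ n * omegaVol n)) :=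
              (setLIntegral_le_lintegral _ _).trans (lintegral_bump_le hM hb hs p k)
          _ ≤ _ := by
              apply ENNReal.ofReal_le_ofReal
              have h5 : ((2 : ℝ) ^ (-k)) ^ n ≤ r ^ (n - 1) * 2 ^ (-k) := by
                obtain ⟨m, rfl⟩ := Nat.exists_eq_add_of_le' hn
                rw [pow_succ, Nat.add_sub_cancel]
                gcongr
              rw [mul_pow]
              calc _ = M * 2 ^ n * omegaVol n * ((2 : ℝ) ^ (-k)) ^ n := by ring
                _ ≤ M * 2 ^ n * omegaVol n * (r ^ (n - 1) * 2 ^ (-k)) := by gcongr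
                _ = _ := by ring
    _ ≤ ENNReal.ofReal (2 * M) * volume (ball x₀ r) +
          ENNReal.ofReal (M * 2 ^ n * 2) * volume (ball x₀ r) := by
        gcongr
        rw [volume_ball_eq _ hr, ← ENNReal.ofReal_sum_of_nonneg fun k _ => by positivity,
          ← ENNReal.ofReal_mul (by positivity)]
        apply ENNReal.ofReal_le_ofReal
        rw [← Finset.mul_sum]
        have h6 := sum_zpow_neg_le S₂ hr.le fun k hk => by
          have := (Finset.mem_filter.1 hk).2
          push Not at this
          rw [zpow_neg]
          exact inv_le_of_inv_le₀ hr this.le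
        have h7 : r ^ n = r ^ (n - 1) * r := by
          obtain ⟨m, rfl⟩ := Nat.exists_eq_add_of_le' hn
          rw [pow_succ, Nat.add_sub_cancel]
        calc _ ≤ M * 2 ^ n * r ^ (n - 1) * omegaVol n * (2 * r) := by gcongr
          _ = _ := by rw [h7]; ring
    _ = _ := by rw [← add_mul, ← ENNReal.ofReal_add (by positivity) (by positivity)]

theorem pd_sum {ι : Type*} (s : Finset ι) (f : ι → Eucl n → ℝ) (hf : ∀ k ∈ s, ContDiff ℝ 1 (f k))
    (a : Fin n) (x : Eucl n) : pd n (fun y => ∑ k ∈ s, f k y) a x = ∑ k ∈ s, pd n (f k) a x := by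
  unfold pd
  rw [fderiv_fun_sum fun k hk => (hf k hk).differentiable (by simp) x]
  simp

theorem pd_sub {f g : Eucl n → ℝ} (hf : ContDiff ℝ 1 f) (hg : ContDiff ℝ 1 g)
    (a : Fin n) (x : Eucl n) : pd n (fun y => f y - g y) a x = pd n f a x - pd n g a x := by
  unfold pd
  rw [fderiv_fun_sub (hf.differentiable (by simp) x) (hg.differentiable (by simp) x)]
  simp

theorem coord_contDiff (i : Fin n) {m : WithTop ℕ∞} : ContDiff ℝ m fun x : Eucl n => x i :=
  (EuclideanSpace.proj (𝕜 := ℝ) i).contDiff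

theorem pd_coord (i a : Fin n) (x : Eucl n) : pd n (fun y => y i) a x = if a = i then 1 else 0 := by
  unfold pd
  have : fderiv ℝ (fun y : Eucl n => y i) x = EuclideanSpace.proj i :=
    (EuclideanSpace.proj (𝕜 := ℝ) i).fderiv
  rw [this]
  simp [eq_comm]

theorem pd_mul {f g : Eucl n → ℝ} (hf : ContDiff ℝ 1 f) (hg : ContDiff ℝ 1 g)
    (a : Fin n) (x : Eucl n) :
    pd n (fun y => f y * g y) a x = f x * pd n g a x + pd n f a x * g x := by
  unfold pd
  rw [fderiv_fun_mul (hf.differentiable (by simp) x) (hg.differentiable (by simp) x)]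
  simp [mul_comm]

theorem pd_congr {f g : Eucl n → ℝ} {U : Set (Eucl n)} (hU : IsOpen U) (h : ∀ x ∈ U, f x = g x)
    (a : Fin n) {x : Eucl n} (hx : x ∈ U) : pd n f a x = pd n g a x := by
  unfold pd
  rw [Filter.EventuallyEq.fderiv_eq]
  filter_upwards [hU.mem_nhds hx] with y hy using h y hy

theorem exists_cutoff (n : ℕ) {r : ℝ} (hr : 0 < r) : ∃ χ : Eucl n → ℝ,
    ContDiff ℝ (⊤ : ℕ∞) χ ∧ (∀ x, ‖x‖ ≤ r → χ x = 1) ∧ (∀ x, χ x ≠ 0 → ‖x‖ ≤ 2 * r) ∧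
      ∀ x, 0 ≤ χ x ∧ χ x ≤ 1 := by
  let χ : ContDiffBump (0 : Eucl n) := ⟨r, 2 * r, hr, by linarith⟩
  refine ⟨χ, χ.contDiff, fun x hx => χ.one_of_mem_closedBall (by simpa using hx), fun x hx => ?_,
    fun x => ⟨χ.nonneg, χ.le_one⟩⟩
  have : x ∈ Function.support χ := hx
  rw [χ.support_eq] at this
  simpa using (mem_ball.1 this).le

theorem norm_le_of_mem_unitCube {x : Eucl n} (hx : x ∈ unitCube n) : ‖x‖ ≤ n := by
  rw [EuclideanSpace.norm_eq, Real.sqrt_le_left (by positivity)]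
  calc ∑ i, ‖x i‖ ^ 2 ≤ ∑ i : Fin n, (1 : ℝ) := Finset.sum_le_sum fun i _ => by
        have := hx i
        rw [Real.norm_of_nonneg this.1.le]
        nlinarith [this.1, this.2]
    _ = n := by simp
    _ ≤ _ := by
        rcases Nat.eq_zero_or_pos n with rfl | h
        · simp
        · have : (1 : ℝ) ≤ n := by exact_mod_cast h
          nlinarith

theorem volume_unitCube_le : volume (unitCube n) ≤ ENNReal.ofReal (n ^ n * omegaVol n) := by
  rw [← volume_closedBall_eq 0 (Nat.cast_nonneg n)]
  exact measure_mono fun x hx => by simpa using norm_le_of_mem_unitCube hx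

/-- A rotated gradient all of whose components have controlled mean oscillation. -/
structure RotField (n : ℕ) (i i' : Fin n) (V : Eucl n → ℝ) (C : ℝ) : Prop where
  contDiff : ContDiff ℝ 2 V
  bmo : ∀ a, BMOplus n (fun x => rotF n V i i' x a) ≤ ENNReal.ofReal C

theorem rotField_of_osc {i i' : Fin n} (hii : i' ≠ i) {V : Eucl n → ℝ} {C D : ℝ}
    (hV : ContDiff ℝ 2 V) (hC : 0 ≤ C) (hD : 0 ≤ D) (h1 : ∀ a, OscLe n (pd n V a) C)
    (h2 : ∀ a, ∫⁻ x in unitCube n, ENNReal.ofReal |pd n V a x| ≤ ENNReal.ofReal D) :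
    RotField n i i' V (D + 2 * C) := by
  refine ⟨hV, fun a => ?_⟩
  have hc : ∀ a, Continuous (pd n V a) := pd_continuous (hV.of_le (by norm_num))
  by_cases ha : a = i
  · have : (fun x => rotF n V i i' x a) = pd n V i' := by
      ext x; simp [rotF_apply, ha, hii.symm]
    rw [this]
    exact BMOplus_le (hc _) hC hD (h1 _) (h2 _)
  · by_cases ha' : a = i'
    · have : (fun x => rotF n V i i' x a) = fun x => - pd n V i x := by
        ext x; simp [rotF_apply, ha', hii]
      rw [this]
      refine BMOplus_le (hc _).neg hC hD (h1 _).neg ?_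
      simpa using h2 i
    · have : (fun x => rotF n V i i' x a) = fun _ => 0 := by
        ext x; simp [rotF_apply, ha, ha']
      rw [this]
      refine BMOplus_le continuous_const hC hD (fun x r _ => ⟨0, by simp⟩) (by simp)

theorem exists_rotFields (hn : 2 ≤ n) : ∃ C : ℝ, 1 ≤ C ∧ ∀ i : Fin n, ∃ i', i' ≠ i ∧
    (∃ V, RotField n i i' V C ∧ ∀ x, pd n V i' x = 1 ∧ pd n V i x = 0) ∧
    (∀ (c : Eucl n) (K : ℕ), ∃ V, RotField n i i' V C ∧
      ∀ x ∈ ball c ((2 : ℝ) ^ K)⁻¹, pd n V i' x = K + 1 ∧ pd n V i x = 0) ∧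
    (∀ K : ℕ, ∃ V, RotField n i i' V C ∧
      (∀ x, 2 ^ (K + 1) < ‖x‖ → pd n V i' x = K + 1 ∧ pd n V i x = 0) ∧
      ∃ U : ℕ → Eucl n → ℝ, (∀ k, ContDiff ℝ 2 (U k)) ∧
        (∀ k a x, |pd n (U k) a x| ≤ C ∧ (pd n (U k) a x ≠ 0 → ‖x‖ ≤ 2 ^ (k + 1))) ∧
        ∀ x, pd n V i' x = (K + 1) - ∑ k ∈ Finset.range (K + 1), pd n (U k) i' x ∧
          pd n V i x = - ∑ k ∈ Finset.range (K + 1), pd n (U k) i x) := by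
  obtain ⟨χ, hχ, hχ1, hχ2, -⟩ := exists_cutoff n one_pos
  have hω := omegaVol_pos (n := n)
  have hχc : HasCompactSupport χ := HasCompactSupport.of_support_subset_isCompact
    (isCompact_closedBall (0 : Eucl n) 2) fun x hx => by simpa using hχ2 x hx
  set v : Fin n → Eucl n → ℝ := fun j x => x j * χ x with hvdef
  have hv : ∀ j, ContDiff ℝ (⊤ : ℕ∞) (v j) := fun j => (coord_contDiff j).mul hχ
  have hvk : ∀ j (k : ℕ), ContDiff ℝ k (v j) := fun j k => contDiff_infty.1 (hv j) k
  have hvc : ∀ j, HasCompactSupport (v j) := fun j => hχc.mul_left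
  have hpd1 : ∀ j a x, x ∈ ball (0 : Eucl n) 1 → pd n (v j) a x = if a = j then 1 else 0 := by
    intro j a x hx
    rw [← pd_coord j a x]
    refine pd_congr isOpen_ball (fun y hy => ?_) a hx
    simp only [hvdef]
    rw [hχ1 y (by simpa using (mem_ball.1 hy).le), mul_one]
  have hpd2 : ∀ j a x, pd n (v j) a x ≠ 0 → ‖x‖ ≤ 2 := by
    intro j a x hx
    have := pd_eq_zero (w := v j) (c := 0) (r := 2) (fun y hy => by
      simpa using hχ2 y (right_ne_zero_of_mul hy)) a hx
    simpa using this
  have hcont : ∀ j a, Continuous (pd n (v j) a) := fun j a => pd_continuous (hvk j 1) a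
  have hB : ∃ M : ℝ, 1 ≤ M ∧ ∀ j a, (∀ x, |pd n (v j) a x| ≤ M) ∧
      ∀ x y, |pd n (v j) a x - pd n (v j) a y| ≤ M * ‖x - y‖ := by
    have : ∀ j a, ∃ M : ℝ, 0 ≤ M ∧ (∀ x, |pd n (v j) a x| ≤ M) ∧
      ∀ x y, |pd n (v j) a x - pd n (v j) a y| ≤ M * ‖x - y‖ := by
      intro j a
      obtain ⟨C1, h1⟩ := (pd_hasCompactSupport (hvc j) a).exists_bound_of_continuous (hcont j a)
      obtain ⟨C2, h2⟩ := (pd_contDiff (hvk j 2) (m := 1) (by norm_num) a).lipschitzWith_of_hasCompactSupport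
        (pd_hasCompactSupport (hvc j) a) (by simp)
      refine ⟨max C1 C2, le_max_of_le_right C2.2, fun x => (h1 x).trans (le_max_left _ _),
        fun x y => ?_⟩
      have := h2.dist_le_mul x y
      rw [dist_eq_norm, Real.norm_eq_abs, dist_eq_norm] at this
      exact this.trans (mul_le_mul_of_nonneg_right (le_max_right _ _) (norm_nonneg _))
    choose M hM0 hM1 hM2 using this
    have hle : ∀ j a, M j a ≤ 1 + ∑ j, ∑ a, M j a := fun j a => by
      have h3 := Finset.single_le_sum (f := fun a => M j a) (fun a _ => hM0 j a) (Finset.mem_univ a)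
      have h4 := Finset.single_le_sum (f := fun j => ∑ a, M j a)
        (fun j _ => Finset.sum_nonneg fun a _ => hM0 j a) (Finset.mem_univ j)
      linarith
    refine ⟨1 + ∑ j, ∑ a, M j a, ?_, fun j a => ⟨fun x => (hM1 j a x).trans (hle j a), fun x y =>
      (hM2 j a x y).trans (mul_le_mul_of_nonneg_right (hle j a) (norm_nonneg _))⟩⟩
    have := Finset.sum_nonneg fun j (_ : j ∈ Finset.univ) =>
      Finset.sum_nonneg fun a (_ : a ∈ Finset.univ) => hM0 j a
    linarith
  obtain ⟨M, hM1, hM⟩ := hB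
  have hM0 : 0 ≤ M := by linarith
  set C₀ := 2 * M + M * 2 ^ n * 2 with hC₀
  set D₀ := (n ^ n * omegaVol n) * (1 + 2 * M * n) + M * 2 ^ n * omegaVol n * 2 with hD₀
  have hC₀0 : 0 ≤ C₀ := by positivity
  have hD₀0 : 0 ≤ D₀ := by positivity
  have hCM : M ≤ D₀ + 2 * C₀ := by
    have : 0 ≤ M * 2 ^ n * 2 := by positivity
    linarith
  have hosc : ∀ j a (S : Finset ℤ) p, OscLe n (fun x => ∑ k ∈ S, pd n (v j) a ((2 : ℝ) ^ k • (x - p))) C₀ :=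
    fun j a S p => oscLe_lacunary (by omega) hM0 (hcont j a) (hM j a).1 (hM j a).2 (hpd2 j a) S p
  refine ⟨D₀ + 2 * C₀, by linarith, fun i => ?_⟩
  obtain ⟨i', hii⟩ : ∃ i' : Fin n, i' ≠ i := by
    have : Nontrivial (Fin n) := Fin.nontrivial_iff_two_le.2 hn
    exact exists_ne i
  have hvol1 : (n : ℝ) ^ n * omegaVol n ≤ D₀ := by
    have h1 : 0 ≤ (n : ℝ) ^ n * omegaVol n * (2 * M * n) := by positivity
    have h2 : 0 ≤ M * 2 ^ n * omegaVol n * 2 := by positivity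
    rw [hD₀, mul_add]; linarith
  refine ⟨i', hii, ⟨fun x => x i', rotField_of_osc hii (coord_contDiff i') hC₀0 hD₀0
    (fun a x₀ r hr => ⟨if a = i' then 1 else 0, by simp [pd_coord]⟩) fun a => ?_, fun x => ?_⟩,
    fun c K => ?_, fun K => ?_⟩
  · calc _ ≤ ∫⁻ x in unitCube n, 1 := by
          refine lintegral_mono fun x => ?_
          simp only [pd_coord]
          split_ifs <;> simp
      _ ≤ _ := by
          rw [lintegral_one, Measure.restrict_apply_univ]
          exact volume_unitCube_le.trans (ENNReal.ofReal_le_ofReal hvol1)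
  · simp [pd_coord, hii.symm]
  · have hpd : ∀ a x, pd n (fun y => ∑ k ∈ Finset.range (K + 1), ((2 : ℝ) ^ (k : ℤ))⁻¹ *
        v i' ((2 : ℝ) ^ (k : ℤ) • (y - c))) a x
        = ∑ k ∈ Finset.range (K + 1), pd n (v i') a ((2 : ℝ) ^ (k : ℤ) • (x - c)) := by
      intro a x
      rw [pd_sum]
      · exact Finset.sum_congr rfl fun k _ => pd_affine (hvk i' 1) (by positivity) c a x
      · intro k _
        have := hvk i' 1
        simp only [Nat.cast_one] at this
        fun_prop
    refine ⟨fun y => ∑ k ∈ Finset.range (K + 1), ((2 : ℝ) ^ (k : ℤ))⁻¹ *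
      v i' ((2 : ℝ) ^ (k : ℤ) • (y - c)), rotField_of_osc hii ?_ hC₀0 hD₀0 ?_ ?_, ?_⟩
    · have := hvk i' 2
      simp only [Nat.cast_ofNat] at this
      fun_prop
    · intro a
      have h := hosc i' a ((Finset.range (K + 1)).image fun k : ℕ => (k : ℤ)) c
      simp_rw [Finset.sum_image (s := Finset.range (K + 1)) (g := fun k : ℕ => (k : ℤ))
        (by intro a _ b _ hab; simpa using hab)] at h
      convert h using 1
      ext x; exact hpd a x
    · intro a
      calc _ ≤ ∫⁻ x, ∑ k ∈ Finset.range (K + 1),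
            ENNReal.ofReal |pd n (v i') a ((2 : ℝ) ^ (k : ℤ) • (x - c))| := by
            refine (setLIntegral_le_lintegral _ _).trans (lintegral_mono fun x => ?_)
            simp only
            rw [hpd, ← ENNReal.ofReal_sum_of_nonneg fun _ _ => abs_nonneg _]
            exact ENNReal.ofReal_le_ofReal (Finset.abs_sum_le_sum_abs _ _)
        _ = ∑ k ∈ Finset.range (K + 1), ∫⁻ x,
            ENNReal.ofReal |pd n (v i') a ((2 : ℝ) ^ (k : ℤ) • (x - c))| := by
            rw [lintegral_finsetSum]
            intro k _
            have : Continuous fun x => |pd n (v i') a ((2 : ℝ) ^ (k : ℤ) • (x - c))| := by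
              have := hcont i' a
              fun_prop
            exact this.measurable.ennreal_ofReal
        _ ≤ ∑ k ∈ Finset.range (K + 1), ENNReal.ofReal (M * 2 ^ n * omegaVol n * (1 / 2) ^ k) := by
            refine Finset.sum_le_sum fun k _ => (lintegral_bump_le hM0 (hM i' a).1 (hpd2 i' a) c k).trans ?_
            apply ENNReal.ofReal_le_ofReal
            have h3 : ((2 : ℝ) ^ (-(k : ℤ))) ^ n ≤ (1 / 2) ^ k := by
              rw [zpow_neg, zpow_natCast, ← inv_pow, ← one_div]
              exact pow_le_of_le_one (by positivity) (pow_le_one₀ (by norm_num) (by norm_num)) (by omega)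
            rw [mul_pow]
            calc _ = M * 2 ^ n * omegaVol n * ((2 : ℝ) ^ (-(k : ℤ))) ^ n := by ring
              _ ≤ _ := by gcongr
        _ ≤ _ := by
            rw [← ENNReal.ofReal_sum_of_nonneg fun _ _ => by positivity, ← Finset.mul_sum]
            apply ENNReal.ofReal_le_ofReal
            have := summable_geometric_two.sum_le_tsum (Finset.range (K + 1))
              (fun j _ => by positivity)
            rw [tsum_geometric_two] at this
            have h1 : 0 ≤ (n : ℝ) ^ n * omegaVol n * (1 + 2 * M * n) := by positivity
            calc _ ≤ M * 2 ^ n * omegaVol n * 2 := by gcongr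
              _ ≤ _ := by linarith
    · intro x hx
      have : ∀ a, ∀ k ∈ Finset.range (K + 1), pd n (v i') a ((2 : ℝ) ^ (k : ℤ) • (x - c))
          = if a = i' then 1 else 0 := by
        intro a k hk
        apply hpd1
        rw [mem_ball, dist_eq_norm] at hx
        rw [mem_ball_zero_iff, norm_smul, zpow_natCast, Real.norm_of_nonneg (by positivity)]
        have h1 : (2 : ℝ) ^ k ≤ 2 ^ K := pow_le_pow_right₀ one_le_two (by simp at hk; omega)
        calc _ ≤ 2 ^ K * ‖x - c‖ := by gcongr
          _ < 1 := by
            rw [← lt_div_iff₀' (by positivity), one_div]; exact hx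
      rw [hpd, hpd, Finset.sum_congr rfl (this i'), Finset.sum_congr rfl (this i)]
      simp [hii.symm]
  · have hpdU : ∀ (k : ℕ) a x, pd n (fun y => ((2 : ℝ) ^ (-(k : ℤ)))⁻¹ *
        v i' ((2 : ℝ) ^ (-(k : ℤ)) • (y - 0))) a x = pd n (v i') a ((2 : ℝ) ^ (-(k : ℤ)) • (x - 0)) :=
      fun k a x => pd_affine (hvk i' 1) (by positivity) 0 a x
    have hU2 : ∀ (k : ℕ), ContDiff ℝ 2 (fun y => ((2 : ℝ) ^ (-(k : ℤ)))⁻¹ *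
        v i' ((2 : ℝ) ^ (-(k : ℤ)) • (y - 0))) := fun k => by
      have := hvk i' 2
      simp only [Nat.cast_ofNat] at this
      fun_prop
    have hpd : ∀ a x, pd n (fun y => ∑ k ∈ Finset.range (K + 1), (y i' - ((2 : ℝ) ^ (-(k : ℤ)))⁻¹ *
        v i' ((2 : ℝ) ^ (-(k : ℤ)) • (y - 0)))) a x
        = ∑ k ∈ Finset.range (K + 1), ((if a = i' then 1 else 0) -
          pd n (v i') a ((2 : ℝ) ^ (-(k : ℤ)) • (x - 0))) := by
      intro a x
      rw [pd_sum _ _ fun k _ => (coord_contDiff i').sub ((hU2 k).of_le (by norm_num))]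
      refine Finset.sum_congr rfl fun k _ => ?_
      rw [pd_sub (coord_contDiff i') ((hU2 k).of_le (by norm_num)), pd_coord, hpdU]
    refine ⟨fun y => ∑ k ∈ Finset.range (K + 1), (y i' - ((2 : ℝ) ^ (-(k : ℤ)))⁻¹ *
        v i' ((2 : ℝ) ^ (-(k : ℤ)) • (y - 0))), rotField_of_osc hii ?_ hC₀0 hD₀0 ?_ ?_, ?_,
        fun k y => ((2 : ℝ) ^ (-(k : ℤ)))⁻¹ * v i' ((2 : ℝ) ^ (-(k : ℤ)) • (y - 0)), hU2, ?_, ?_⟩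
    · exact ContDiff.sum fun k _ => (coord_contDiff i').sub (hU2 k)
    · intro a
      have h := hosc i' a ((Finset.range (K + 1)).image fun k : ℕ => -(k : ℤ)) 0
      simp_rw [Finset.sum_image (s := Finset.range (K + 1)) (g := fun k : ℕ => -(k : ℤ))
        (by intro a _ b _ hab; simpa using hab)] at h
      convert h.neg.const_add ((K + 1) * (if a = i' then 1 else 0)) using 1
      ext x; rw [hpd, Finset.sum_sub_distrib]
      simp only [Finset.sum_const, Finset.card_range, nsmul_eq_mul]
      push_cast; ring
    · intro a
      calc _ ≤ ∫⁻ x in unitCube n, ENNReal.ofReal (2 * M * n) := by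
            refine setLIntegral_mono measurable_const fun x hx => ?_
            apply ENNReal.ofReal_le_ofReal
            rw [hpd]
            calc _ ≤ ∑ k ∈ Finset.range (K + 1), M * n * (1 / 2) ^ k := by
                  refine (Finset.abs_sum_le_sum_abs _ _).trans (Finset.sum_le_sum fun k _ => ?_)
                  rw [← hpd1 i' a 0 (by simp)]
                  refine ((hM i' a).2 _ _).trans ?_
                  rw [zero_sub, norm_neg, norm_smul, sub_zero, Real.norm_of_nonneg (by positivity),
                    mul_assoc, zpow_neg, zpow_natCast, ← inv_pow, ← one_div, mul_comm (n : ℝ)]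
                  have := norm_le_of_mem_unitCube hx
                  gcongr
              _ ≤ M * n * 2 := by
                  rw [← Finset.mul_sum]
                  have := summable_geometric_two.sum_le_tsum (Finset.range (K + 1))
                    (fun j _ => by positivity)
                  rw [tsum_geometric_two] at this
                  gcongr
              _ = _ := by ring
        _ ≤ ENNReal.ofReal (2 * M * n) * ENNReal.ofReal (n ^ n * omegaVol n) := by
            rw [lintegral_const, Measure.restrict_apply_univ]
            gcongr
            exact volume_unitCube_le
        _ ≤ _ := by
            rw [← ENNReal.ofReal_mul (by positivity)]
            apply ENNReal.ofReal_le_ofReal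
            have h1 : 0 ≤ (n : ℝ) ^ n * omegaVol n := by positivity
            have h2 : 0 ≤ M * 2 ^ n * omegaVol n * 2 := by positivity
            rw [hD₀, mul_add]; linarith
    · intro x hx
      have : ∀ a, ∀ k ∈ Finset.range (K + 1), ((if a = i' then (1 : ℝ) else 0) -
          pd n (v i') a ((2 : ℝ) ^ (-(k : ℤ)) • (x - 0))) = if a = i' then 1 else 0 := by
        intro a k hk
        rw [sub_eq_self]
        by_contra hcon
        have h1 := hpd2 _ _ _ hcon
        rw [norm_smul, sub_zero, Real.norm_of_nonneg (by positivity), zpow_neg, zpow_natCast,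
          inv_mul_le_iff₀ (by positivity)] at h1
        have h2 : (2 : ℝ) ^ k ≤ 2 ^ K := pow_le_pow_right₀ one_le_two (by simp at hk; omega)
        rw [pow_succ] at hx
        linarith
      rw [hpd, hpd, Finset.sum_congr rfl (this i'), Finset.sum_congr rfl (this i)]
      simp [hii.symm]
    · intro k a x
      rw [hpdU]
      refine ⟨((hM i' a).1 _).trans hCM, fun hcon => ?_⟩
      have h1 := hpd2 _ _ _ hcon
      rw [norm_smul, sub_zero, Real.norm_of_nonneg (by positivity), zpow_neg, zpow_natCast,
        inv_mul_le_iff₀ (by positivity)] at h1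
      rwa [pow_succ]
    · intro x
      simp_rw [hpdU]
      rw [hpd, hpd, Finset.sum_sub_distrib, Finset.sum_sub_distrib]
      simp [hii.symm]

theorem eLpNorm_two_sq {α : Type*} [MeasurableSpace α] (μ : Measure α) (f : α → ℝ) :
    eLpNorm f 2 μ ^ 2 = ∫⁻ x, ‖f x‖ₑ ^ 2 ∂μ := by
  rw [eLpNorm_eq_lintegral_rpow_enorm_toReal (by simp) (by simp)]
  simp only [ENNReal.toReal_ofNat, ← ENNReal.rpow_natCast, ← ENNReal.rpow_mul]
  norm_num

theorem lintegral_enorm_sq_le {f : ℝ → ℝ} (hf : Continuous f) {a b : ℝ} :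
    (∫⁻ s in Set.Ioc a b, ‖f s‖ₑ) ^ 2 ≤
      ENNReal.ofReal (b - a) * ∫⁻ s in Set.Ioc a b, ‖f s‖ₑ ^ 2 := by
  have h := eLpNorm_le_eLpNorm_mul_rpow_measure_univ (μ := volume.restrict (Set.Ioc a b))
    (p := 1) (q := 2) (by norm_num) hf.aestronglyMeasurable
  rw [eLpNorm_one_eq_lintegral_enorm] at h
  calc _ ≤ _ := pow_le_pow_left' h 2
    _ = _ := by
      rw [mul_pow, eLpNorm_two_sq, mul_comm]
      congr 1
      rw [← ENNReal.rpow_natCast, ← ENNReal.rpow_mul]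
      norm_num

/-- Integral of `g` over the segment `x + [a, b] e_i`. -/
def lineInt (i : Fin n) (a b : ℝ) (g : Eucl n → ℝ) (x : Eucl n) : ℝ :=
  ∫ s in Set.Ioc a b, g (x + s • EuclideanSpace.single i 1)

theorem lineInt_continuous (i : Fin n) (a b : ℝ) {g : Eucl n → ℝ} (hg : Continuous g)
    (hc : HasCompactSupport g) : Continuous (lineInt i a b g) := by
  obtain ⟨M, hM⟩ := hc.exists_bound_of_continuous hg
  refine continuous_of_dominated (bound := fun _ => M)
    (fun x => Continuous.aestronglyMeasurable (by fun_prop))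
    (fun x => ae_of_all _ fun s => hM _) (by simp) (ae_of_all _ fun s => by fun_prop)

theorem lineInt_hasFDerivAt (i : Fin n) (a b : ℝ) {g : Eucl n → ℝ} (hg : ContDiff ℝ 1 g)
    (hc : HasCompactSupport g) (x : Eucl n) : HasFDerivAt (lineInt i a b g)
      (∫ s in Set.Ioc a b, fderiv ℝ g (x + s • EuclideanSpace.single i 1)) x := by
  have hg' : Continuous (fderiv ℝ g) := hg.continuous_fderiv (by simp)
  have hg0 := hg.continuous
  obtain ⟨M, hM⟩ := (hc.fderiv ℝ).exists_bound_of_continuous hg'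
  refine hasFDerivAt_integral_of_dominated_of_fderiv_le (bound := fun _ => M) (s := Set.univ)
    (F' := fun x s => fderiv ℝ g (x + s • EuclideanSpace.single i 1))
    univ_mem (Eventually.of_forall fun y => Continuous.aestronglyMeasurable (by fun_prop)) ?_
    (Continuous.aestronglyMeasurable (by fun_prop)) (ae_of_all _ fun s y _ => hM _) (by simp)
    (ae_of_all _ fun s y _ => ?_)
  · exact (Continuous.integrableOn_Icc (by fun_prop)).mono_set Set.Ioc_subset_Icc_self
  · have := (hg.differentiable (by simp) (y + s • EuclideanSpace.single i 1)).hasFDerivAt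
    exact (hasFDerivAt_comp_add_right (s • EuclideanSpace.single i (1 : ℝ))).2 this

theorem pd_lineInt (i : Fin n) (a b : ℝ) {g : Eucl n → ℝ} (hg : ContDiff ℝ 1 g)
    (hc : HasCompactSupport g) (j : Fin n) (x : Eucl n) :
    pd n (lineInt i a b g) j x = lineInt i a b (pd n g j) x := by
  have hg' : Continuous (fderiv ℝ g) := hg.continuous_fderiv (by simp)
  unfold pd
  rw [(lineInt_hasFDerivAt i a b hg hc x).fderiv, ContinuousLinearMap.integral_apply]
  · rfl
  · exact (Continuous.integrableOn_Icc (by fun_prop)).mono_set Set.Ioc_subset_Icc_self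

theorem contDiff_one_of_pd {f : Eucl n → ℝ} (hd : Differentiable ℝ f)
    (h : ∀ j, Continuous (pd n f j)) : ContDiff ℝ 1 f := by
  rw [contDiff_one_iff_fderiv]
  refine ⟨hd, continuous_clm_apply.2 fun y => ?_⟩
  have : ∀ x, fderiv ℝ f x y = ∑ j, y j * pd n f j x := by
    intro x
    conv_lhs => rw [← (EuclideanSpace.basisFun (Fin n) ℝ).sum_repr y]
    simp [pd]
  simp_rw [this]
  fun_prop

theorem lineInt_contDiff (i : Fin n) (a b : ℝ) {g : Eucl n → ℝ} (hg : ContDiff ℝ 1 g)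
    (hc : HasCompactSupport g) : ContDiff ℝ 1 (lineInt i a b g) := by
  refine contDiff_one_of_pd (fun x => (lineInt_hasFDerivAt i a b hg hc x).differentiableAt)
    fun j => ?_
  simp_rw [funext (pd_lineInt i a b hg hc j)]
  exact lineInt_continuous i a b (pd_continuous hg j) (pd_hasCompactSupport hc j)

theorem lineInt_pd_self (i : Fin n) {a b : ℝ} (hab : a ≤ b) {g : Eucl n → ℝ}
    (hg : ContDiff ℝ 1 g) (x : Eucl n) : lineInt i a b (pd n g i) x =
      g (x + b • EuclideanSpace.single i 1) - g (x + a • EuclideanSpace.single i 1) := by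
  have hg' : Continuous (fderiv ℝ g) := hg.continuous_fderiv (by simp)
  unfold lineInt
  rw [← intervalIntegral.integral_of_le hab]
  refine intervalIntegral.integral_eq_sub_of_hasDerivAt
    (f := fun s => g (x + s • EuclideanSpace.single i 1)) (fun s _ => ?_)
    (Continuous.intervalIntegrable (by unfold pd; fun_prop) _ _)
  have h1 := (hg.differentiable (by simp) (x + s • EuclideanSpace.single i 1)).hasFDerivAt
  have h2 : HasDerivAt (fun s : ℝ => x + s • EuclideanSpace.single i (1 : ℝ))
      (EuclideanSpace.single i 1) s := by
    simpa using ((hasDerivAt_id s).smul_const (EuclideanSpace.single i (1 : ℝ))).const_add x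
  exact h1.comp_hasDerivAt s h2

theorem eLpNorm_lineInt_le (i : Fin n) (a b : ℝ) {g : Eucl n → ℝ}
    (hg : Continuous g) :
    eLpNorm (lineInt i a b g) 2 volume ≤ ENNReal.ofReal (b - a) * eLpNorm g 2 volume := by
  refine (ENNReal.pow_le_pow_left_iff (n := 2) (by norm_num)).1 ?_
  rw [mul_pow, eLpNorm_two_sq, eLpNorm_two_sq]
  calc ∫⁻ x, ‖lineInt i a b g x‖ₑ ^ 2
      ≤ ∫⁻ x, ENNReal.ofReal (b - a) *
          ∫⁻ s in Set.Ioc a b, ‖g (x + s • EuclideanSpace.single i 1)‖ₑ ^ 2 := by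
        refine lintegral_mono fun x => ?_
        exact (pow_le_pow_left' (enorm_integral_le_lintegral_enorm _) 2).trans
          (lintegral_enorm_sq_le (f := fun s => g (x + s • EuclideanSpace.single i 1)) (by fun_prop))
    _ = ENNReal.ofReal (b - a) * ∫⁻ s in Set.Ioc a b, ∫⁻ x,
          ‖g (x + s • EuclideanSpace.single i 1)‖ₑ ^ 2 := by
        rw [lintegral_const_mul' _ _ (by simp), lintegral_lintegral_swap]
        exact Measurable.aemeasurable (by
          have : Continuous fun p : Eucl n × ℝ => g (p.1 + p.2 • EuclideanSpace.single i 1) := by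
            fun_prop
          exact this.measurable.enorm.pow_const 2)
    _ = _ := by
        simp_rw [lintegral_add_right_eq_self (fun x => ‖g x‖ₑ ^ 2)]
        rw [lintegral_const, Measure.restrict_apply_univ, Real.volume_Ioc]
        ring

/-- `g` is a `C¹` function supported in a cube, with `W^{1,2}` norm controlled by `a`. -/
structure SobLe (n : ℕ) (ρ : ℝ) (g : Eucl n → ℝ) (a : ℝ≥0∞) : Prop where
  contDiff : ContDiff ℝ 1 g
  supp : ∀ x, g x ≠ 0 → ∀ j, |x j| ≤ ρ
  norm_le : eLpNorm g 2 volume ≤ a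
  norm_pd_le : ∀ j, eLpNorm (pd n g j) 2 volume ≤ a

theorem norm_le_of_coord_le {x : Eucl n} {ρ : ℝ} (h : ∀ j, |x j| ≤ ρ) : ‖x‖ ≤ n * |ρ| := by
  rw [EuclideanSpace.norm_eq, Real.sqrt_le_left (by positivity)]
  calc ∑ i, ‖x i‖ ^ 2 ≤ ∑ i : Fin n, |ρ| ^ 2 := Finset.sum_le_sum fun i _ => by
        rw [Real.norm_eq_abs]
        exact pow_le_pow_left₀ (abs_nonneg _) ((h i).trans (le_abs_self _)) 2
    _ = n * |ρ| ^ 2 := by simp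
    _ ≤ _ := by
        rw [mul_pow]
        gcongr
        rcases Nat.eq_zero_or_pos n with rfl | h
        · simp
        · have : (1 : ℝ) ≤ n := by exact_mod_cast h
          nlinarith

theorem hasCompactSupport_of_coord_le {g : Eucl n → ℝ} {ρ : ℝ}
    (h : ∀ x, g x ≠ 0 → ∀ j, |x j| ≤ ρ) : HasCompactSupport g :=
  HasCompactSupport.of_support_subset_isCompact (isCompact_closedBall (0 : Eucl n) (n * |ρ|))
    fun x hx => by simpa using norm_le_of_coord_le (h x hx)

theorem SobLe.hasCompactSupport {ρ : ℝ} {g : Eucl n → ℝ} {a : ℝ≥0∞} (h : SobLe n ρ g a) :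
    HasCompactSupport g := hasCompactSupport_of_coord_le h.supp

theorem SobLe.mono {ρ : ℝ} {g : Eucl n → ℝ} {a b : ℝ≥0∞} (h : SobLe n ρ g a) (hab : a ≤ b) :
    SobLe n ρ g b :=
  ⟨h.contDiff, h.supp, h.norm_le.trans hab, fun j => (h.norm_pd_le j).trans hab⟩

theorem integral_pd_eq_zero {v : Eucl n → ℝ} (hv : ContDiff ℝ 1 v) (hc : HasCompactSupport v)
    (i : Fin n) : ∫ x, pd n v i x = 0 := by
  have := pd_ibp hv hc (V := fun _ => 1) contDiff_const i
  simpa [pd] using this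

theorem lineInt_eq_integral {i : Fin n} {ρ : ℝ} (hρ : 0 < ρ) {g : Eucl n → ℝ}
    (hs : ∀ x, g x ≠ 0 → ∀ j, |x j| ≤ ρ) {x : Eucl n} (hx : |x i| ≤ ρ) :
    lineInt i (-(3 * ρ)) (3 * ρ) g x = ∫ s : ℝ, g (x + s • EuclideanSpace.single i 1) := by
  refine setIntegral_eq_integral_of_forall_compl_eq_zero fun s hs' => ?_
  by_contra hcon
  have h1 := hs _ hcon i
  simp only [PiLp.add_apply, PiLp.smul_apply, PiLp.single_apply, if_true, smul_eq_mul,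
    mul_one] at h1
  rw [abs_le] at h1 hx
  exact hs' ⟨by linarith, by linarith⟩

theorem pd_comp_coord {η : ℝ → ℝ} (hη : ContDiff ℝ 1 η) (i j : Fin n) (x : Eucl n) :
    pd n (fun y => η (y i)) j x = deriv η (x i) * if j = i then 1 else 0 := by
  have h1 := (hη.differentiable (by simp) (x i)).hasDerivAt
  have h2 : HasFDerivAt (fun y : Eucl n => y i) (EuclideanSpace.proj (𝕜 := ℝ) i) x :=
    (EuclideanSpace.proj (𝕜 := ℝ) i).hasFDerivAt
  have h3 := h1.comp_hasFDerivAt x h2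
  unfold pd
  rw [show (fun y : Eucl n => η (y i)) = η ∘ fun y => y i from rfl, h3.fderiv]
  simp [eq_comm]

/-- One coordinate step: `g` is a derivative in direction `i` plus a function which is a fixed
bump in the `i`-th coordinate. -/
theorem sobLe_step {ρ : ℝ} (hρ : 0 < ρ) {η : ℝ → ℝ} (hη : ContDiff ℝ 1 η)
    (hη1 : ∫ t, η t = 1) (hηs : ∀ t, η t ≠ 0 → |t| ≤ ρ) :
    ∃ C : ℝ≥0, 1 ≤ C ∧ ∀ (i : Fin n) (g : Eucl n → ℝ) (a : ℝ≥0∞), SobLe n ρ g a →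
      ∃ v g' : Eucl n → ℝ, SobLe n ρ v (C * a) ∧ SobLe n ρ g' (C * a) ∧
        (∀ x, g' x = η (x i) * ∫ s : ℝ, g (x + s • EuclideanSpace.single i 1)) ∧
        ∀ x, g x = pd n v i x + g' x := by
  have hηc : HasCompactSupport η := HasCompactSupport.of_support_subset_isCompact
    (isCompact_Icc (a := -ρ) (b := ρ)) fun t ht => abs_le.1 (hηs t ht)
  obtain ⟨M1, hM1⟩ := hηc.exists_bound_of_continuous hη.continuous
  obtain ⟨M2, hM2⟩ := hηc.deriv.exists_bound_of_continuous (hη.continuous_deriv (by simp))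
  have hM1' := fun t => (hM1 t).trans (le_max_left M1 M2)
  have hM2' := fun t => (hM2 t).trans (le_max_right M1 M2)
  set M := max M1 M2 with hM
  have hM0 : 0 ≤ M := (norm_nonneg _).trans (hM1' 0)
  let cut : ContDiffBump (0 : ℝ) := ⟨3 * ρ / 2, 2 * ρ, by linarith, by linarith⟩
  have hcut1 : ∀ t, |t| ≤ 3 * ρ / 2 → cut t = 1 := fun t ht =>
    cut.one_of_mem_closedBall (by simpa using ht)
  have hcut2 : ∀ t, 2 * ρ ≤ |t| → cut t = 0 := fun t ht =>
    cut.zero_of_le_dist (by simpa using ht)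
  set K : ℝ := 2 * M * (6 * ρ) with hK
  have hK0 : 0 ≤ K := by positivity
  have hK1 : 0 ≤ (1 + K) * (4 * ρ) := by positivity
  refine ⟨(1 + K + (1 + K) * (4 * ρ)).toNNReal, ?_, fun i g a hg => ?_⟩
  · rw [← NNReal.coe_le_coe, Real.coe_toNNReal _ (by linarith)]; simp; linarith
  set e : Eucl n := EuclideanSpace.single i 1 with he
  have hgc := hg.hasCompactSupport
  have hei : ∀ (x : Eucl n) (s : ℝ), (x + s • e) i = x i + s := fun x s => by simp [he]
  have hej : ∀ (x : Eucl n) (s : ℝ) j, j ≠ i → (x + s • e) j = x j := fun x s j hj => by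
    simp [he, hj]
  set A := lineInt i (-(3 * ρ)) (3 * ρ) g with hA
  have hAc : ContDiff ℝ 1 A := lineInt_contDiff i _ _ hg.contDiff hgc
  have hηi : ContDiff ℝ 1 fun y : Eucl n => η (y i) := hη.comp (coord_contDiff i)
  set g' : Eucl n → ℝ := fun x => η (x i) * A x with hg'
  have hg'c : ContDiff ℝ 1 g' := hηi.mul hAc
  have hAeq : ∀ x : Eucl n, |x i| ≤ ρ → A x = ∫ s : ℝ, g (x + s • e) := fun x hx =>
    lineInt_eq_integral hρ hg.supp hx
  have hg'eq : ∀ x, g' x = η (x i) * ∫ s : ℝ, g (x + s • e) := by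
    intro x
    by_cases h : η (x i) = 0
    · simp [hg', h]
    · simp only [hg']; rw [hAeq x (hηs _ h)]
  have hg's : ∀ x, g' x ≠ 0 → ∀ j, |x j| ≤ ρ := by
    intro x hx j
    by_cases hj : j = i
    · rw [hj]; exact hηs _ (left_ne_zero_of_mul hx)
    · have h1 : A x ≠ 0 := right_ne_zero_of_mul hx
      by_contra hcon
      apply h1
      simp only [hA, lineInt]
      refine setIntegral_eq_zero_of_forall_eq_zero fun s _ => ?_
      by_contra h2
      have := hg.supp _ h2 j
      rw [hej x s j hj] at this
      exact hcon this
  have e6 : ENNReal.ofReal (3 * ρ - -(3 * ρ)) = ENNReal.ofReal (6 * ρ) := by ring_nf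
  have hAn : eLpNorm A 2 volume ≤ ENNReal.ofReal (6 * ρ) * a := by
    refine (eLpNorm_lineInt_le i _ _ hg.contDiff.continuous).trans ?_
    rw [e6]
    gcongr
    exact hg.norm_le
  have hApd : ∀ j, eLpNorm (pd n A j) 2 volume ≤ ENNReal.ofReal (6 * ρ) * a := by
    intro j
    rw [funext (pd_lineInt i _ _ hg.contDiff hgc j)]
    refine (eLpNorm_lineInt_le i _ _ (pd_continuous hg.contDiff j)).trans ?_
    rw [e6]
    gcongr
    exact hg.norm_pd_le j
  have e7 : ENNReal.ofReal M * (ENNReal.ofReal (6 * ρ) * a) +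
      ENNReal.ofReal M * (ENNReal.ofReal (6 * ρ) * a) = ENNReal.ofReal K * a := by
    rw [← mul_assoc, ← ENNReal.ofReal_mul hM0, ← add_mul, ← ENNReal.ofReal_add (by positivity)
      (by positivity), hK]
    ring_nf
  have hg'S : SobLe n ρ g' (ENNReal.ofReal K * a) := by
    refine ⟨hg'c, hg's, ?_, fun j => ?_⟩
    · refine (eLpNorm_le_mul_eLpNorm_of_ae_le_mul (g := A) (c := M) (ae_of_all _ fun x => ?_)
        2).trans ((mul_le_mul_right hAn _).trans ?_)
      · simp only [hg', norm_mul]; gcongr; exact hM1' _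
      · rw [← e7]; exact le_self_add
    · have hpd : pd n g' j = (fun x => η (x i) * pd n A j x) +
          fun x => pd n (fun y => η (y i)) j x * A x := by
        ext x; exact pd_mul hηi hAc j x
      rw [hpd, ← e7]
      refine (eLpNorm_add_le ?_ ?_ (by norm_num)).trans (add_le_add ?_ ?_)
      · exact (hηi.continuous.mul (pd_continuous hAc j)).aestronglyMeasurable
      · exact ((pd_continuous hηi j).mul hAc.continuous).aestronglyMeasurable
      · refine (eLpNorm_le_mul_eLpNorm_of_ae_le_mul (g := pd n A j) (c := M)
          (ae_of_all _ fun x => ?_) 2).trans (mul_le_mul_right (hApd j) _)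
        rw [norm_mul]; gcongr; exact hM1' _
      · refine (eLpNorm_le_mul_eLpNorm_of_ae_le_mul (g := A) (c := M)
          (ae_of_all _ fun x => ?_) 2).trans (mul_le_mul_right hAn _)
        rw [norm_mul, pd_comp_coord hη, norm_mul]
        gcongr
        calc _ ≤ ‖deriv η (x i)‖ * 1 := by gcongr; split_ifs <;> simp
          _ ≤ M := by rw [mul_one]; exact hM2' _
  set k : Eucl n → ℝ := fun x => g x - g' x with hk
  have hkc : ContDiff ℝ 1 k := hg.contDiff.sub hg'c
  have hks : ∀ x, k x ≠ 0 → ∀ j, |x j| ≤ ρ := by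
    intro x hx
    by_cases h : g x = 0
    · exact hg's x fun h' => hx (by simp [hk, h, h'])
    · exact hg.supp x h
  have hkcs := hasCompactSupport_of_coord_le hks
  have e8 : a + ENNReal.ofReal K * a = ENNReal.ofReal (1 + K) * a := by
    rw [ENNReal.ofReal_add zero_le_one hK0, add_mul, ENNReal.ofReal_one, one_mul]
  have hkS : SobLe n ρ k (ENNReal.ofReal (1 + K) * a) := by
    refine ⟨hkc, hks, ?_, fun j => ?_⟩
    · rw [← e8]
      exact (eLpNorm_sub_le hg.contDiff.continuous.aestronglyMeasurable
        hg'c.continuous.aestronglyMeasurable (by norm_num)).trans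
        (add_le_add hg.norm_le hg'S.norm_le)
    · rw [← e8, show pd n k j = pd n g j - pd n g' j from funext (pd_sub hg.contDiff hg'c j)]
      exact (eLpNorm_sub_le (pd_continuous hg.contDiff j).aestronglyMeasurable
        (pd_continuous hg'c j).aestronglyMeasurable (by norm_num)).trans
        (add_le_add (hg.norm_pd_le j) (hg'S.norm_pd_le j))
  set L := lineInt i (-(4 * ρ)) 0 k with hL
  have hLc : ContDiff ℝ 1 L := lineInt_contDiff i _ _ hkc hkcs
  have hline : ∀ {u : Eucl n → ℝ}, Continuous u → (∀ x, u x ≠ 0 → ∀ j, |x j| ≤ ρ) → ∀ x,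
      Integrable fun s : ℝ => u (x + s • e) := by
    intro u hu hus x
    refine Continuous.integrable_of_hasCompactSupport (by fun_prop)
      (HasCompactSupport.of_support_subset_isCompact
        (isCompact_Icc (a := -ρ - x i) (b := ρ - x i)) fun s hs => ?_)
    have := hus _ hs i
    rw [hei, abs_le] at this
    exact ⟨by linarith, by linarith⟩
  have hL0 : ∀ x : Eucl n, ρ < |x i| → |x i| ≤ 2 * ρ → L x = 0 := by
    intro x hx1 hx2
    rw [abs_le] at hx2
    rcases lt_abs.1 hx1 with h | h
    · have h1 : L x = ∫ s : ℝ, k (x + s • e) := by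
        refine setIntegral_eq_integral_of_forall_compl_eq_zero fun s hs => ?_
        by_contra hcon
        have := hks _ hcon i
        rw [hei, abs_le] at this
        exact hs ⟨by linarith, by linarith⟩
      have h2 : ∫ s : ℝ, g' (x + s • e) = ∫ s : ℝ, g (x + s • e) := by
        have h3 : ∀ s : ℝ, g' (x + s • e) = η (x i + s) * ∫ s : ℝ, g (x + s • e) := by
          intro s
          rw [hg'eq, hei]
          congr 1
          rw [← integral_add_left_eq_self (fun t : ℝ => g (x + t • e)) s]
          refine integral_congr_ae (ae_of_all _ fun t => ?_)
          simp only [add_smul, add_assoc]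
        simp_rw [h3]
        rw [integral_mul_const, integral_add_left_eq_self η, hη1, one_mul]
      rw [h1]
      simp only [hk]
      rw [integral_sub (hline hg.contDiff.continuous hg.supp x) (hline hg'c.continuous hg's x), h2,
        sub_self]
    · simp only [hL, lineInt]
      refine setIntegral_eq_zero_of_forall_eq_zero fun s hs => ?_
      by_contra h2
      have := hks _ h2 i
      rw [hei, abs_le] at this
      linarith [this.1, hs.2]
  have hcuti : ContDiff ℝ 1 fun y : Eucl n => cut (y i) :=
    cut.contDiff.comp (coord_contDiff i)
  set v : Eucl n → ℝ := fun x => cut (x i) * L x with hv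
  have hvc : ContDiff ℝ 1 v := hcuti.mul hLc
  have hcutL : ∀ j x, pd n (fun y : Eucl n => cut (y i)) j x * L x = 0 := by
    intro j x
    have hci : Continuous fun y : Eucl n => |y i| := by fun_prop
    rcases lt_or_ge (|x i|) (3 * ρ / 2) with h | h
    · rw [pd_congr (g := fun _ => 1) (isOpen_lt hci continuous_const)
        (fun y hy => hcut1 _ (le_of_lt hy)) j (x := x) h]
      simp [pd]
    · rcases le_or_gt (|x i|) (2 * ρ) with h' | h'
      · rw [hL0 x (by linarith) h', mul_zero]
      · rw [pd_congr (g := fun _ => 0) (isOpen_lt continuous_const hci)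
          (fun y hy => hcut2 _ (le_of_lt hy)) j (x := x) h']
        simp [pd]
  have hpdv : ∀ j x, pd n v j x = cut (x i) * lineInt i (-(4 * ρ)) 0 (pd n k j) x := by
    intro j x
    rw [hv, pd_mul hcuti hLc, hcutL, add_zero, hL, pd_lineInt i _ _ hkc hkcs]
  have hcutn : ∀ t, ‖cut t‖ ≤ 1 := fun t => by
    rw [Real.norm_of_nonneg cut.nonneg]; exact cut.le_one
  have e9 : ENNReal.ofReal (0 - -(4 * ρ)) * (ENNReal.ofReal (1 + K) * a) ≤
      (1 + K + (1 + K) * (4 * ρ)).toNNReal * a := by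
    rw [← mul_assoc, ← ENNReal.ofReal_mul (by linarith)]
    gcongr
    exact ENNReal.ofReal_le_ofReal (by linarith)
  refine ⟨v, g', ⟨hvc, fun x hx j => ?_, ?_, fun j => ?_⟩, hg'S.mono ?_, hg'eq, fun x => ?_⟩
  · have h1 : |x i| ≤ 2 * ρ := by
      by_contra h
      exact left_ne_zero_of_mul hx (hcut2 _ (by linarith))
    have h2 : |x i| ≤ ρ := by
      by_contra h
      exact right_ne_zero_of_mul hx (hL0 x (by linarith) h1)
    by_cases hj : j = i
    · rw [hj]; exact h2
    · by_contra hcon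
      apply right_ne_zero_of_mul hx
      simp only [hL, lineInt]
      refine setIntegral_eq_zero_of_forall_eq_zero fun s _ => ?_
      by_contra h2
      have := hks _ h2 j
      rw [hej x s j hj] at this
      exact hcon this
  · calc _ ≤ eLpNorm L 2 volume := eLpNorm_mono fun x => by
          rw [hv, norm_mul]; exact mul_le_of_le_one_left (norm_nonneg _) (hcutn _)
      _ ≤ _ := (eLpNorm_lineInt_le i _ _ hkc.continuous).trans
          ((mul_le_mul_right hkS.norm_le _).trans e9)
  · calc _ ≤ eLpNorm (lineInt i (-(4 * ρ)) 0 (pd n k j)) 2 volume := eLpNorm_mono fun x => by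
          rw [hpdv, norm_mul]; exact mul_le_of_le_one_left (norm_nonneg _) (hcutn _)
      _ ≤ _ := (eLpNorm_lineInt_le i _ _ (pd_continuous hkc j)).trans
          ((mul_le_mul_right (hkS.norm_pd_le j) _).trans e9)
  · gcongr
    exact ENNReal.ofReal_le_ofReal (by linarith)
  · rw [hpdv, lineInt_pd_self i (by linarith) hkc]
    rw [← he, zero_smul, add_zero]
    rcases le_or_gt (|x i|) (3 * ρ / 2) with h | h
    · have h1 : k (x + (-(4 * ρ)) • e) = 0 := by
        by_contra h2
        have := hks _ h2 i
        rw [hei] at this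
        rw [abs_le] at this h
        linarith [this.1, h.2]
      rw [h1, hcut1 _ h, hk]
      ring
    · have h0 : ∀ u : Eucl n → ℝ, (∀ x, u x ≠ 0 → ∀ j, |x j| ≤ ρ) → u x = 0 := by
        intro u hu
        by_contra h2
        linarith [hu x h2 i]
      have h1 : cut (x i) * k (x + (-(4 * ρ)) • e) = 0 := by
        by_contra h2
        have h3 := hks _ (right_ne_zero_of_mul h2) i
        have h4 : |x i| < 2 * ρ := by
          by_contra h4
          exact left_ne_zero_of_mul h2 (hcut2 _ (by linarith))
        rw [hei] at h3
        rw [abs_le] at h3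
        rw [abs_lt] at h4
        linarith [h3.1, h4.2]
      rw [mul_sub, h1, h0 k hks, h0 g hg.supp, h0 g' hg's]
      simp

theorem sobLe_divergence {ρ : ℝ} (hρ : 0 < ρ) : ∃ C : ℝ≥0, ∀ (g : Eucl n → ℝ) (a : ℝ≥0∞),
    SobLe n ρ g a → ∫ x, g x = 0 →
      ∃ v : Fin n → Eucl n → ℝ, (∀ i, SobLe n ρ (v i) (C * a)) ∧
        ∀ x, g x = ∑ i, pd n (v i) i x := by
  let β : ContDiffBump (0 : ℝ) := ⟨ρ / 2, ρ, by linarith, by linarith⟩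
  set η : ℝ → ℝ := β.normed volume with hηdef
  have hη : ContDiff ℝ 1 η := β.contDiff_normed
  have hη1 : ∫ t, η t = 1 := β.integral_normed
  have hη0 : ∀ t, 0 ≤ η t := β.nonneg_normed
  have hηs : ∀ t, η t ≠ 0 → |t| ≤ ρ := fun t ht => by
    have h1 : t ∈ Function.support (β.normed volume) := ht
    rw [β.support_normed_eq] at h1
    simpa using (mem_ball.1 h1).le
  obtain ⟨C, hC1, hC⟩ := sobLe_step (n := n) hρ hη hη1 hηs
  have key : ∀ S : Finset (Fin n), ∃ D : ℝ≥0, ∀ (g : Eucl n → ℝ) (a : ℝ≥0∞), SobLe n ρ g a →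
      ∃ (v : Fin n → Eucl n → ℝ) (g' G : Eucl n → ℝ), (∀ i, SobLe n ρ (v i) (D * a)) ∧
        SobLe n ρ g' (D * a) ∧ (∀ x y, (∀ j ∉ S, x j = y j) → G x = G y) ∧
        (∀ x, g' x = (∏ j ∈ S, η (x j)) * G x) ∧ ∀ x, g x = ∑ i ∈ S, pd n (v i) i x + g' x := by
    intro S
    induction S using Finset.induction_on with
    | empty =>
      refine ⟨1, fun g a hg => ⟨fun _ _ => 0, g, g, fun i => ⟨contDiff_const, by simp, by simp,
        fun j => ?_⟩, by simpa using hg, fun x y h => ?_, by simp, by simp⟩⟩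
      · have : pd n (fun _ => (0 : ℝ)) j = 0 := by ext x; simp [pd]
        rw [this]; simp
      · congr 1; ext j; exact h j (by simp)
    | insert i S hi ih =>
      obtain ⟨D, hD⟩ := ih
      refine ⟨C * D, fun g a hg => ?_⟩
      obtain ⟨v, g', G, hv, hg', hG, hg'G, hgv⟩ := hD g a hg
      obtain ⟨w, g'', hw, hg'', hg''eq, hgw⟩ := hC i g' _ hg'
      have hCD : ((C * D : ℝ≥0) : ℝ≥0∞) * a = C * (D * a) := by push_cast; ring
      rw [hCD]
      have hle : (D : ℝ≥0∞) * a ≤ C * (D * a) :=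
        le_mul_of_one_le_left (by simp) (by exact_mod_cast hC1)
      refine ⟨Function.update v i w, g'', fun x => ∫ s : ℝ, G (x + s • EuclideanSpace.single i 1),
        fun j => ?_, hg'', fun x y h => ?_, fun x => ?_, fun x => ?_⟩
      · by_cases hj : j = i
        · rw [hj, Function.update_self]; exact hw
        · rw [Function.update_of_ne hj]; exact (hv j).mono hle
      · simp only
        rw [← integral_add_left_eq_self
          (fun t : ℝ => G (x + t • EuclideanSpace.single i 1)) (y i - x i)]
        refine integral_congr_ae (ae_of_all _ fun s => hG _ _ fun j hj => ?_)
        by_cases hji : j = i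
        · subst hji; simp; ring
        · have := h j (by simp [hji, hj])
          simp [hji, this]
      · have hfun : ∀ s : ℝ, g' (x + s • EuclideanSpace.single i 1) =
            (∏ j ∈ S, η (x j)) * G (x + s • EuclideanSpace.single i 1) := fun s => by
          rw [hg'G]
          congr 1
          refine Finset.prod_congr rfl fun j hj => ?_
          have : j ≠ i := fun h => hi (h ▸ hj)
          simp [this]
        simp_rw [hg''eq, hfun]
        rw [integral_const_mul, Finset.prod_insert hi, mul_assoc]
      · have hsum : ∑ j ∈ S, pd n (Function.update v i w j) j x = ∑ j ∈ S, pd n (v j) j x :=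
          Finset.sum_congr rfl fun j hj => by
            have hji : j ≠ i := fun h => hi (h ▸ hj)
            rw [Function.update_of_ne hji]
        rw [hgv, hgw x, Finset.sum_insert hi, Function.update_self, hsum]
        ring
  obtain ⟨D, hD⟩ := key Finset.univ
  refine ⟨D, fun g a hg hg0 => ?_⟩
  obtain ⟨v, g', G, hv, hg', hG, hg'G, hgv⟩ := hD g a hg
  refine ⟨v, hv, fun x => ?_⟩
  have hGc : ∀ x, G x = G 0 := fun x => hG x 0 (by simp)
  have hInt : ∫ x, g' x = 0 := by
    have h1 : ∀ x, g' x = g x - ∑ i, pd n (v i) i x := fun x => by rw [hgv x]; ring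
    have h2 : ∀ i, Integrable (pd n (v i) i) := fun i =>
      (pd_continuous (hv i).contDiff i).integrable_of_hasCompactSupport
        (pd_hasCompactSupport (hv i).hasCompactSupport i)
    simp_rw [h1]
    rw [integral_sub (hg.contDiff.continuous.integrable_of_hasCompactSupport hg.hasCompactSupport)
      (integrable_finsetSum _ fun i _ => h2 i), integral_finsetSum _ fun i _ => h2 i, hg0]
    simp [integral_pd_eq_zero (hv _).contDiff (hv _).hasCompactSupport]
  have hG0 : G 0 = 0 := by
    have h3 : ∫ x : Eucl n, (∏ j, η (x j)) * G 0 = 0 := by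
      rw [← hInt]; congr 1; ext x; rw [hg'G, hGc x]
    rw [integral_mul_const, mul_eq_zero] at h3
    refine h3.resolve_left (ne_of_gt ?_)
    have hc : Continuous fun x : Eucl n => ∏ j, η (x j) :=
      continuous_finsetProd _ fun j _ => hη.continuous.comp (coord_contDiff j (m := 1)).continuous
    refine hc.integral_pos_of_hasCompactSupport_nonneg_nonzero
      (hasCompactSupport_of_coord_le (ρ := ρ) fun x hx j => ?_)
      (fun x => Finset.prod_nonneg fun j _ => hη0 _) (x := 0) ?_
    · exact hηs _ (Finset.prod_ne_zero_iff.1 hx j (Finset.mem_univ j))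
    · refine Finset.prod_ne_zero_iff.2 fun j _ => ?_
      have : (0 : ℝ) ∈ Function.support (β.normed volume) := by
        rw [β.support_normed_eq]; exact mem_ball_self hρ
      simpa using this
  rw [hgv x, hg'G, hGc x, hG0]
  simp

section

open scoped FourierTransform LineDeriv SchwartzMap

theorem eLpNorm_fourier_schwartz (f : 𝓢(Eucl n, ℂ)) :
    eLpNorm (𝓕 f : 𝓢(Eucl n, ℂ)) 2 volume = eLpNorm f 2 volume := by
  have h := SchwartzMap.norm_fourier_toL2_eq f
  rw [SchwartzMap.norm_toLp, SchwartzMap.norm_toLp] at h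
  have h1 := ((𝓕 f : 𝓢(Eucl n, ℂ)).memLp 2 volume).2.ne
  have h2 := (f.memLp 2 volume).2.ne
  exact (ENNReal.toReal_eq_toReal_iff' h1 h2).1 h

theorem eLpNorm_fourierMultiplier_le {m : Eucl n → ℝ} (hm : m.HasTemperateGrowth)
    (h1 : ∀ ξ, |m ξ| ≤ 1) (f : 𝓢(Eucl n, ℂ)) :
    eLpNorm (SchwartzMap.fourierMultiplierCLM ℂ m f) 2 volume ≤ eLpNorm f 2 volume := by
  rw [← eLpNorm_fourier_schwartz, ← eLpNorm_fourier_schwartz f,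
    SchwartzMap.fourierMultiplierCLM_apply, FourierTransform.fourier_fourierInv_eq]
  refine eLpNorm_mono fun ξ => ?_
  rw [SchwartzMap.smulLeftCLM_apply_apply hm, norm_smul, Real.norm_eq_abs]
  exact mul_le_of_le_one_left (norm_nonneg _) (h1 ξ)

theorem pd_re (f : 𝓢(Eucl n, ℂ)) (i : Fin n) (x : Eucl n) :
    pd n (fun y => (f y).re) i x = ((∂_{(EuclideanSpace.single i 1 : Eucl n)} f) x).re := by
  rw [SchwartzMap.lineDerivOp_apply_eq_fderiv]
  unfold pd
  have h := (Complex.reCLM.hasFDerivAt (x := f x)).comp x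
    (f.differentiableAt (x := x)).hasFDerivAt
  rw [show (fun y => (f y).re) = Complex.reCLM ∘ f from rfl, h.fderiv]
  simp

/-- Solution of `N - (2π)⁻² ΔN = h` with `W^{2,2}` bounds. -/
theorem exists_resolvent {h : Eucl n → ℝ} (hh : ContDiff ℝ (⊤ : ℕ∞) h)
    (hc : HasCompactSupport h) : ∃ N : Eucl n → ℝ, ContDiff ℝ (⊤ : ℕ∞) N ∧
      eLpNorm N 2 volume ≤ eLpNorm h 2 volume ∧
      (∀ i, eLpNorm (pd n N i) 2 volume ≤ ENNReal.ofReal (2 * π) * eLpNorm h 2 volume) ∧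
      (∀ i j, eLpNorm (pd n (pd n N i) j) 2 volume ≤
        ENNReal.ofReal (2 * π) * (ENNReal.ofReal (2 * π) * eLpNorm h 2 volume)) ∧
      ∀ x, h x = N x - ((2 * π) ^ 2)⁻¹ * ∑ i, pd n (pd n N i) i x := by
  have hcC : HasCompactSupport fun x => (h x : ℂ) := hc.comp_left (g := fun t : ℝ => (t : ℂ)) rfl
  have hhC : ContDiff ℝ (⊤ : ℕ∞) fun x => (h x : ℂ) := Complex.ofRealCLM.contDiff.comp hh
  set f : 𝓢(Eucl n, ℂ) := hcC.toSchwartzMap hhC with hf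
  have hfx : ∀ x, f x = h x := fun x => rfl
  have hfn : eLpNorm f 2 volume = eLpNorm h 2 volume :=
    eLpNorm_congr_norm_ae (ae_of_all _ fun x => by rw [hfx]; simp)
  set m : Eucl n → ℝ := fun ξ => (1 + ‖ξ‖ ^ 2) ^ (-1 : ℝ) with hm
  have hmt : m.HasTemperateGrowth := by fun_prop
  have hmx : ∀ ξ, m ξ = (1 + ‖ξ‖ ^ 2)⁻¹ := fun ξ => Real.rpow_neg_one _
  set P : 𝓢(Eucl n, ℂ) := SchwartzMap.fourierMultiplierCLM ℂ m f with hP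
  have hder : ∀ (v : Eucl n) (q : Eucl n → ℝ) (hq : q.HasTemperateGrowth),
      ∂_{v} (SchwartzMap.fourierMultiplierCLM ℂ q f) =
        (2 * π * Complex.I) • SchwartzMap.fourierMultiplierCLM ℂ (fun ξ => inner ℝ ξ v * q ξ) f := by
    intro v q hq
    rw [SchwartzMap.lineDeriv_eq_fourierMultiplierCLM,
      SchwartzMap.fourierMultiplierCLM_fourierMultiplierCLM_apply (by fun_prop) hq]
    rfl
  have hcn : ∀ g : 𝓢(Eucl n, ℂ), eLpNorm ((2 * π * Complex.I) • g : 𝓢(Eucl n, ℂ)) 2 volume =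
      ENNReal.ofReal (2 * π) * eLpNorm g 2 volume := by
    intro g
    rw [show ⇑((2 * π * Complex.I) • g : 𝓢(Eucl n, ℂ)) = (2 * π * Complex.I) • ⇑g from rfl,
      eLpNorm_const_smul, ← ofReal_norm]
    simp [abs_of_pos Real.pi_pos]
  have hre : ∀ g : 𝓢(Eucl n, ℂ), eLpNorm (fun x => (g x).re) 2 volume ≤ eLpNorm g 2 volume :=
    fun g => eLpNorm_mono fun x => Complex.abs_re_le_norm _
  have hsq : ∀ ξ : Eucl n, ∀ i, |ξ i| ≤ ‖ξ‖ := fun ξ i => by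
    simpa using PiLp.norm_apply_le ξ i
  have hin : ∀ (ξ : Eucl n) i, inner ℝ ξ (EuclideanSpace.single i 1) = ξ i := fun ξ i => by
    simp [EuclideanSpace.inner_single_right]
  have hpd1 : ∀ i, pd n (fun y => (P y).re) i = fun x =>
      ((∂_{(EuclideanSpace.single i 1 : Eucl n)} P) x).re := fun i => funext (pd_re P i)
  have hpd2 : ∀ i j, pd n (pd n (fun y => (P y).re) i) j = fun x =>
      ((∂_{(EuclideanSpace.single j 1 : Eucl n)}
        (∂_{(EuclideanSpace.single i 1 : Eucl n)} P : 𝓢(Eucl n, ℂ))) x).re := fun i j => by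
    rw [hpd1]; exact funext (pd_re _ j)
  refine ⟨fun x => (P x).re, Complex.reCLM.contDiff.comp (P.smooth ⊤), ?_, fun i => ?_,
    fun i j => ?_, fun x => ?_⟩
  · refine (hre P).trans (hfn ▸ eLpNorm_fourierMultiplier_le hmt (fun ξ => ?_) f)
    rw [hmx, abs_of_nonneg (by positivity)]
    exact inv_le_one_of_one_le₀ (by nlinarith [sq_nonneg ‖ξ‖])
  · rw [hpd1]
    refine (hre _).trans ?_
    rw [hP, hder _ m hmt, hcn, ← hfn]
    gcongr
    refine eLpNorm_fourierMultiplier_le (by fun_prop) (fun ξ => ?_) f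
    rw [hin, hmx, abs_mul, abs_of_nonneg (a := (1 + ‖ξ‖ ^ 2)⁻¹) (by positivity),
      ← div_eq_mul_inv, div_le_one (by positivity)]
    nlinarith [hsq ξ i, sq_nonneg (‖ξ‖ - 1)]
  · rw [hpd2]
    refine (hre _).trans ?_
    rw [hP, hder _ m hmt, LineDeriv.lineDerivOp_smul, hder _ _ (by fun_prop), hcn, hcn, ← hfn]
    gcongr
    refine eLpNorm_fourierMultiplier_le (by fun_prop) (fun ξ => ?_) f
    rw [hin, hin, hmx, ← mul_assoc, abs_mul, abs_of_nonneg (a := (1 + ‖ξ‖ ^ 2)⁻¹) (by positivity),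
      ← div_eq_mul_inv, div_le_one (by positivity), abs_mul]
    have := mul_le_mul (hsq ξ i) (hsq ξ j) (abs_nonneg _) (norm_nonneg _)
    nlinarith
  · have e1 : ∀ i, ∂_{(EuclideanSpace.single i 1 : Eucl n)}
        (∂_{(EuclideanSpace.single i 1 : Eucl n)} P : 𝓢(Eucl n, ℂ)) =
        (-((2 * π) ^ 2 : ℝ)) • SchwartzMap.fourierMultiplierCLM ℂ
          (fun ξ => ξ i * (ξ i * m ξ)) f := by
      intro i
      rw [hP, hder _ m hmt, LineDeriv.lineDerivOp_smul, hder _ _ (by fun_prop), smul_smul]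
      simp_rw [hin]
      ext y
      simp only [smul_apply, smul_eq_mul, Complex.real_smul]
      push_cast
      ring_nf
      rw [Complex.I_sq]
      ring
    have e2 : f = P + ∑ i, SchwartzMap.fourierMultiplierCLM ℂ (fun ξ => ξ i * (ξ i * m ξ)) f := by
      have e3 := SchwartzMap.fourierMultiplierCLM_sum (𝕜 := ℝ) (E := Eucl n) ℂ
        (g := fun o : Option (Fin n) => o.elim m fun i => fun ξ => ξ i * (ξ i * m ξ))
        (s := Finset.univ) (fun o _ => by
          rcases o with _ | i
          · exact hmt
          · simp only [Option.elim]
            simp_rw [← hin _ i]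
            fun_prop)
      have e4 : (fun ξ : Eucl n => ∑ o : Option (Fin n),
          (o.elim m fun i => fun ξ => ξ i * (ξ i * m ξ) : Eucl n → ℝ) ξ) = fun _ => 1 := by
        ext ξ
        rw [Fintype.sum_option]
        simp only [Option.elim]
        simp_rw [← mul_assoc]
        rw [← Finset.sum_mul, hmx]
        have : ∑ i, ξ i * ξ i = ‖ξ‖ ^ 2 := by
          rw [EuclideanSpace.norm_sq_eq]
          simp [pow_two]
        rw [this]
        field_simp
      rw [e4, SchwartzMap.fourierMultiplierCLM_const, Fintype.sum_option] at e3
      have := congrArg (fun T => T f) e3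
      simpa [sum_apply] using this
    have e5 : (f x).re = h x := by rw [hfx]; simp
    have e6 := congrArg (fun F : 𝓢(Eucl n, ℂ) => (F x).re) e2
    simp only [add_apply, Complex.add_re, sum_apply, Complex.re_sum] at e6
    rw [← e5, e6]
    simp_rw [hpd2, e1]
    simp only [smul_apply, Complex.real_smul, Complex.re_ofReal_mul]
    rw [← Finset.mul_sum]
    have : (2 * π) ^ 2 ≠ 0 := by positivity
    field_simp
    ring

end

theorem sobLe_mul {ρ M : ℝ} (hM : 0 ≤ M) {ζ P : Eucl n → ℝ} {a : ℝ≥0∞} (hζ : ContDiff ℝ 1 ζ)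
    (hs : ∀ x, ζ x ≠ 0 → ∀ j, |x j| ≤ ρ) (h0 : ∀ x, |ζ x| ≤ M) (h1 : ∀ j x, |pd n ζ j x| ≤ M)
    (hP : ContDiff ℝ 1 P) (hP0 : eLpNorm P 2 volume ≤ a)
    (hP1 : ∀ j, eLpNorm (pd n P j) 2 volume ≤ a) :
    SobLe n ρ (fun x => ζ x * P x) (ENNReal.ofReal (2 * M) * a) := by
  have e : ENNReal.ofReal (2 * M) * a = ENNReal.ofReal M * a + ENNReal.ofReal M * a := by
    rw [← add_mul, ← ENNReal.ofReal_add hM hM]; ring_nf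
  rw [e]
  refine ⟨hζ.mul hP, fun x hx => hs x (left_ne_zero_of_mul hx), ?_, fun j => ?_⟩
  · refine ((eLpNorm_le_mul_eLpNorm_of_ae_le_mul (g := P) (c := M) (ae_of_all _ fun x => ?_)
        2).trans (mul_le_mul_right hP0 _)).trans le_self_add
    rw [norm_mul]; gcongr; exact h0 _
  · have hpd : pd n (fun x => ζ x * P x) j = (fun x => ζ x * pd n P j x) +
          fun x => pd n ζ j x * P x := by
      ext x; exact pd_mul hζ hP j x
    rw [hpd]
    refine (eLpNorm_add_le ?_ ?_ (by norm_num)).trans (add_le_add ?_ ?_)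
    · exact (hζ.continuous.mul (pd_continuous hP j)).aestronglyMeasurable
    · exact ((pd_continuous hζ j).mul hP.continuous).aestronglyMeasurable
    · refine (eLpNorm_le_mul_eLpNorm_of_ae_le_mul (g := pd n P j) (c := M)
        (ae_of_all _ fun x => ?_) 2).trans (mul_le_mul_right (hP1 j) _)
      rw [norm_mul]; gcongr; exact h0 _
    · refine (eLpNorm_le_mul_eLpNorm_of_ae_le_mul (g := P) (c := M)
        (ae_of_all _ fun x => ?_) 2).trans (mul_le_mul_right hP0 _)
      rw [norm_mul]; gcongr; exact h1 _ _

theorem SobLe.add {ρ : ℝ} {f g : Eucl n → ℝ} {a b : ℝ≥0∞} (hf : SobLe n ρ f a)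
    (hg : SobLe n ρ g b) : SobLe n ρ (fun x => f x + g x) (a + b) := by
  refine ⟨hf.contDiff.add hg.contDiff, fun x hx => ?_, ?_, fun j => ?_⟩
  · by_cases h : f x = 0
    · exact hg.supp x fun h' => hx (by simp [h, h'])
    · exact hf.supp x h
  · exact (eLpNorm_add_le hf.contDiff.continuous.aestronglyMeasurable
      hg.contDiff.continuous.aestronglyMeasurable (by norm_num)).trans
      (add_le_add hf.norm_le hg.norm_le)
  · have : pd n (fun x => f x + g x) j = pd n f j + pd n g j := by
      ext x
      unfold pd
      rw [fderiv_fun_add (hf.contDiff.differentiable (by simp) x)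
        (hg.contDiff.differentiable (by simp) x)]
      simp
    rw [this]
    exact (eLpNorm_add_le (pd_continuous hf.contDiff j).aestronglyMeasurable
      (pd_continuous hg.contDiff j).aestronglyMeasurable (by norm_num)).trans
      (add_le_add (hf.norm_pd_le j) (hg.norm_pd_le j))

theorem sobLe_zero (ρ : ℝ) (a : ℝ≥0∞) : SobLe n ρ (fun _ => 0) a := by
  refine ⟨contDiff_const, by simp, by simp, fun j => ?_⟩
  have : pd n (fun _ => (0 : ℝ)) j = 0 := by ext x; simp [pd]
  rw [this]; simp

theorem SobLe.sum {ι : Type*} (s : Finset ι) {ρ : ℝ} {f : ι → Eucl n → ℝ} {a : ι → ℝ≥0∞}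
    (hf : ∀ i ∈ s, SobLe n ρ (f i) (a i)) :
    SobLe n ρ (fun x => ∑ i ∈ s, f i x) (∑ i ∈ s, a i) := by
  classical
  induction s using Finset.induction_on with
  | empty => simpa using sobLe_zero ρ 0
  | insert i s hi ih =>
    simp_rw [Finset.sum_insert hi]
    exact (hf i (Finset.mem_insert_self i s)).add
      (ih fun j hj => hf j (Finset.mem_insert_of_mem hj))

/-- A mean zero test function supported in the ball of radius `2` is the divergence of a compactly
supported field, with a `W^{1,2}` bound. -/
theorem exists_divergence_eq (n : ℕ) : ∃ C : ℝ≥0, ∀ h : Eucl n → ℝ, ContDiff ℝ (⊤ : ℕ∞) h →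
    (∀ x, h x ≠ 0 → ‖x‖ ≤ 2) → ∫ x, h x = 0 → ∃ v : Fin n → Eucl n → ℝ,
      (∀ i, SobLe n 4 (v i) (C * eLpNorm h 2 volume)) ∧ ∀ x, h x = ∑ i, pd n (v i) i x := by
  obtain ⟨D, hD⟩ := sobLe_divergence (n := n) (ρ := 4) (by norm_num)
  obtain ⟨χ, hχ, hχ1, hχs, hχb⟩ := exists_cutoff n (r := 2) (by norm_num)
  norm_num at hχs
  have hχ2 : ContDiff ℝ 2 χ := contDiff_infty.1 hχ 2
  have hχ1' : ContDiff ℝ 1 χ := contDiff_infty.1 hχ 1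
  have hχp : ∀ i, ContDiff ℝ 1 (pd n χ i) := fun i => pd_contDiff hχ2 (by norm_num) i
  have hco : ∀ {x : Eucl n}, ‖x‖ ≤ 4 → ∀ j, |x j| ≤ 4 := fun {x} hx j =>
    (by simpa using PiLp.norm_apply_le x j : |x j| ≤ ‖x‖).trans hx
  have hχc : HasCompactSupport χ := hasCompactSupport_of_coord_le (ρ := 4) fun x hx =>
    hco (hχs x hx)
  have hpc : ∀ i, HasCompactSupport (pd n χ i) := pd_hasCompactSupport hχc
  have hb1 : ∀ i, ∃ M, ∀ x, |pd n χ i x| ≤ M := fun i =>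
    (hpc i).exists_bound_of_continuous (hχp i).continuous
  have hb2 : ∀ i j, ∃ M, ∀ x, |pd n (pd n χ i) j x| ≤ M := fun i j =>
    (pd_hasCompactSupport (hpc i) j).exists_bound_of_continuous (pd_continuous (hχp i) j)
  choose M1 hM1 using hb1
  choose M2 hM2 using hb2
  set M : ℝ := 1 + ∑ i, |M1 i| + ∑ i, ∑ j, |M2 i j| with hM
  have hs1 : 0 ≤ ∑ i, |M1 i| := Finset.sum_nonneg fun _ _ => abs_nonneg _
  have hs2 : 0 ≤ ∑ i, ∑ j, |M2 i j| := Finset.sum_nonneg fun _ _ =>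
    Finset.sum_nonneg fun _ _ => abs_nonneg _
  have hM0 : 0 ≤ M := by linarith
  have hbχ : ∀ x, |χ x| ≤ M := fun x => by
    rw [abs_of_nonneg (hχb x).1]; linarith [(hχb x).2]
  have hbp : ∀ i x, |pd n χ i x| ≤ M := fun i x => by
    have := Finset.single_le_sum (f := fun i => |M1 i|) (fun _ _ => abs_nonneg _)
      (Finset.mem_univ i)
    linarith [hM1 i x, le_abs_self (M1 i)]
  have hbpp : ∀ i j x, |pd n (pd n χ i) j x| ≤ M := fun i j x => by
    have h1 := Finset.single_le_sum (f := fun i => ∑ j, |M2 i j|)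
      (fun _ _ => Finset.sum_nonneg fun _ _ => abs_nonneg _) (Finset.mem_univ i)
    have h2 := Finset.single_le_sum (f := fun j => |M2 i j|) (fun _ _ => abs_nonneg _)
      (Finset.mem_univ j)
    linarith [hM2 i j x, le_abs_self (M2 i j)]
  have hps : ∀ i x, pd n χ i x ≠ 0 → ∀ j, |x j| ≤ 4 := fun i x hx => hco (by
    simpa using pd_eq_zero (c := 0) (r := 4) (fun y hy => by simpa using hχs y hy) i hx)
  set c : ℝ := ((2 * π) ^ 2)⁻¹ with hc
  have hc0 : 0 ≤ c := by positivity
  have hc1 : c ≤ 1 := inv_le_one_of_one_le₀ (by nlinarith [Real.pi_gt_three])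
  have hcm : ∀ t : ℝ, |t| ≤ M → |c * t| ≤ M := fun t ht => by
    rw [abs_mul, abs_of_nonneg hc0]
    exact (mul_le_of_le_one_left (abs_nonneg _) hc1).trans ht
  have hpdc : ∀ {u : Eucl n → ℝ}, ContDiff ℝ 1 u → ∀ j x,
      pd n (fun y => c * u y) j x = c * pd n u j x := fun {u} hu j x => by
    rw [pd_mul contDiff_const hu]; simp [pd]
  set B : ℝ≥0 := (2 * M).toNNReal * (1 + 2 * π + 2 * π * (2 * π)).toNNReal with hB
  refine ⟨D * (B + n * B) + B, fun h hh hhs hh0 => ?_⟩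
  have hhc : HasCompactSupport h := hasCompactSupport_of_coord_le (ρ := 4) fun x hx =>
    hco ((hhs x hx).trans (by norm_num))
  obtain ⟨N, hN, hN0, hN1, hN2, hNeq⟩ := exists_resolvent hh hhc
  set b := eLpNorm h 2 volume with hb
  have hNc1 : ContDiff ℝ 1 N := contDiff_infty.1 hN 1
  have hNp : ∀ i, ContDiff ℝ 1 (pd n N i) := fun i =>
    pd_contDiff (contDiff_infty.1 hN 2) (by norm_num) i
  set a : ℝ≥0∞ := ENNReal.ofReal (1 + 2 * π + 2 * π * (2 * π)) * b with ha
  have hae : a = b + ENNReal.ofReal (2 * π) * b +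
      ENNReal.ofReal (2 * π) * (ENNReal.ofReal (2 * π) * b) := by
    rw [ha, ENNReal.ofReal_add (by positivity) (by positivity),
      ENNReal.ofReal_add (by positivity) (by positivity),
      ENNReal.ofReal_mul (p := 2 * π) (q := 2 * π) (by positivity), ENNReal.ofReal_one]
    ring
  have hBa : (B : ℝ≥0∞) * b = ENNReal.ofReal (2 * M) * a := by
    rw [ha, hB, ENNReal.coe_mul, mul_assoc]; rfl
  have hNa : eLpNorm N 2 volume ≤ a := by
    rw [hae, add_assoc]; exact hN0.trans le_self_add
  have hN1a : ∀ i, eLpNorm (pd n N i) 2 volume ≤ a := fun i => by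
    rw [hae, add_right_comm]; exact (hN1 i).trans le_add_self
  have hN2a : ∀ i j, eLpNorm (pd n (pd n N i) j) 2 volume ≤ a := fun i j => by
    rw [hae]; exact (hN2 i j).trans le_add_self
  set u : Fin n → Eucl n → ℝ := fun i x => (-c * χ x) * pd n N i x with hu
  have huS : ∀ i, SobLe n 4 (u i) (B * b) := fun i => by
    rw [hBa]
    refine sobLe_mul hM0 (contDiff_const.mul hχ1') (fun x hx => hco (hχs x
      (right_ne_zero_of_mul hx))) (fun x => ?_) (fun j x => ?_) (hNp i) (hN1a i) (hN2a i)
    · rw [neg_mul, abs_neg]; exact hcm _ (hbχ x)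
    · have : pd n (fun y => -c * χ y) j x = -(c * pd n χ j x) := by
        rw [pd_mul contDiff_const hχ1']; simp [pd]
      rw [this, abs_neg]; exact hcm _ (hbp j x)
  set g : Eucl n → ℝ := fun x => χ x * N x + ∑ i, (c * pd n χ i x) * pd n N i x with hg
  have hgS : SobLe n 4 g ((B + n * B : ℝ≥0) * b) := by
    have h1 : SobLe n 4 (fun x => χ x * N x) (B * b) := by
      rw [hBa]
      exact sobLe_mul hM0 hχ1' (fun x hx => hco (hχs x hx)) hbχ hbp hNc1 hNa hN1a
    have h2 : ∀ i, SobLe n 4 (fun x => (c * pd n χ i x) * pd n N i x) (B * b) := fun i => by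
      rw [hBa]
      refine sobLe_mul hM0 (contDiff_const.mul (hχp i)) (fun x hx => hps i x
        (right_ne_zero_of_mul hx)) (fun x => hcm _ (hbp i x)) (fun j x => ?_) (hNp i) (hN1a i)
        (hN2a i)
      rw [hpdc (hχp i)]; exact hcm _ (hbpp i j x)
    have h3 := h1.add (SobLe.sum Finset.univ fun i _ => h2 i)
    refine h3.mono (le_of_eq ?_)
    push_cast
    simp
    ring
  have hdec : ∀ x, h x = ∑ i, pd n (u i) i x + g x := by
    intro x
    have h1 : h x = χ x * h x := by
      by_cases hx : h x = 0
      · simp [hx]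
      · rw [hχ1 x (hhs x hx), one_mul]
    have h2 : ∀ i, pd n (u i) i x = -(c * χ x * pd n (pd n N i) i x) -
        c * pd n χ i x * pd n N i x := by
      intro i
      have : pd n (fun y => -c * χ y) i x = -(c * pd n χ i x) := by
        rw [pd_mul contDiff_const hχ1']; simp [pd]
      simp only [hu]
      rw [pd_mul (contDiff_const.mul hχ1') (hNp i), this]
      ring
    rw [h1, hNeq x]
    simp_rw [h2]
    rw [Finset.sum_sub_distrib, Finset.sum_neg_distrib, hg, ← Finset.mul_sum]
    ring
  have hg0 : ∫ x, g x = 0 := by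
    have h1 : ∀ x, g x = h x - ∑ i, pd n (u i) i x := fun x => by rw [hdec x]; ring
    have h2 : ∀ i, Integrable (pd n (u i) i) := fun i =>
      (pd_continuous (huS i).contDiff i).integrable_of_hasCompactSupport
        (pd_hasCompactSupport (huS i).hasCompactSupport i)
    simp_rw [h1]
    rw [integral_sub (hh.continuous.integrable_of_hasCompactSupport hhc)
      (integrable_finsetSum _ fun i _ => h2 i), integral_finsetSum _ fun i _ => h2 i, hh0]
    simp [integral_pd_eq_zero (huS _).contDiff (huS _).hasCompactSupport]
  obtain ⟨v, hv, hgv⟩ := hD g _ hgS hg0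
  refine ⟨fun i x => v i x + u i x, fun i => ((hv i).add (huS i)).mono (le_of_eq ?_), fun x => ?_⟩
  · push_cast; ring
  · rw [hdec, hgv, ← Finset.sum_add_distrib]
    refine Finset.sum_congr rfl fun i _ => ?_
    unfold pd
    rw [fderiv_fun_add ((hv i).contDiff.differentiable (by simp) x)
      ((huS i).contDiff.differentiable (by simp) x)]
    simp [add_comm]

section

/-- Test functions. -/
def IsTest (n : ℕ) (ψ : Eucl n → ℝ) : Prop := ContDiff ℝ (⊤ : ℕ∞) ψ ∧ HasCompactSupport ψ

/-- A div-curl pair with finite `H¹` and `BMO⁺` norms. -/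
structure GoodPair (n : ℕ) (φ : Eucl n → ℝ) (F G : Eucl n → Eucl n) : Prop where
  locF : ∀ i, LocallyIntegrable (fun x => F x i) volume
  locG : ∀ i, LocallyIntegrable (fun x => G x i) volume
  h1 : ∀ i, H1Norm n φ (fun x => F x i) < ⊤
  bmo : (⨆ i, BMOplus n (fun x => G x i)) < ⊤
  divcurl : (DivFree n F ∧ CurlFree n G) ∨ (CurlFree n F ∧ DivFree n G)
  integrable : Integrable (fun x => ∑ i, F x i * G x i) volume

/-- The product of the norms of a pair of fields. -/
def pairCost (n : ℕ) (φ : Eucl n → ℝ) (F G : Eucl n → Eucl n) : ℝ≥0∞ :=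
  (⨆ i, H1Norm n φ (fun x => F x i)) * (⨆ i, BMOplus n (fun x => G x i))

/-- The distribution `F · G`. -/
def pairDist (n : ℕ) (F G : Eucl n → Eucl n) (ψ : Eucl n → ℝ) : ℝ :=
  ∫ x, (∑ i, F x i * G x i) * ψ x

/-- The functional `Λ` is a countable sum of products of good pairs, with total cost at most `c`
and absolute convergence controlled by `B`. -/
def Rep (n : ℕ) (φ : Eucl n → ℝ) (B : (Eucl n → ℝ) → ℝ≥0) (Λ : (Eucl n → ℝ) → ℝ) (c : ℝ≥0∞) :
    Prop :=
  ∃ (ι : Type) (_ : Countable ι) (F G : ι → Eucl n → Eucl n),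
    (∀ k, GoodPair n φ (F k) (G k)) ∧ ∑' k, pairCost n φ (F k) (G k) ≤ c ∧
      ∀ ψ, IsTest n ψ → ∑' k, ‖pairDist n (F k) (G k) ψ‖ₑ ≤ B ψ * c ∧
        HasSum (fun k => pairDist n (F k) (G k) ψ) (Λ ψ)

theorem H1Norm_zero (φ : Eucl n → ℝ) : H1Norm n φ (fun _ => 0) = 0 := by
  have := H1Norm_smul φ (fun _ => 0) 0
  simpa using this

theorem BMOplus_zero : BMOplus n (fun _ => 0) = 0 := by
  simp [BMOplus, setAvg]

theorem goodPair_zero (φ : Eucl n → ℝ) : GoodPair n φ (fun _ => 0) (fun _ => 0) := by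
  refine ⟨fun i => ?_, fun i => ?_, fun i => ?_, ?_, Or.inl ⟨fun ψ _ _ => ?_, fun ψ _ _ i j _ => ?_⟩,
    ?_⟩
  · simpa using locallyIntegrable_zero
  · simpa using locallyIntegrable_zero
  · simp [H1Norm_zero]
  · simp [BMOplus_zero]
  · simp
  · simp
  · simp

theorem pairCost_zero (φ : Eucl n → ℝ) : pairCost n φ (fun _ => 0) (fun _ => 0) = 0 := by
  simp [pairCost, H1Norm_zero]

theorem pairDist_zero (ψ : Eucl n → ℝ) : pairDist n (fun _ => 0) (fun _ => 0) ψ = 0 := by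
  simp [pairDist]

variable {φ : Eucl n → ℝ} {B : (Eucl n → ℝ) → ℝ≥0} {Λ : (Eucl n → ℝ) → ℝ} {c : ℝ≥0∞}

theorem rep_zero (φ : Eucl n → ℝ) (B : (Eucl n → ℝ) → ℝ≥0) (c : ℝ≥0∞) :
    Rep n φ B (fun _ => 0) c :=
  ⟨Empty, inferInstance, fun _ _ => 0, fun _ _ => 0, fun k => k.elim, by simp, fun ψ _ =>
    ⟨by simp, hasSum_empty⟩⟩

theorem Rep.congr (h : Rep n φ B Λ c) {Λ' : (Eucl n → ℝ) → ℝ} (e : ∀ ψ, IsTest n ψ → Λ' ψ = Λ ψ) :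
    Rep n φ B Λ' c := by
  obtain ⟨ι, hι, F, G, h1, h2, h3⟩ := h
  exact ⟨ι, hι, F, G, h1, h2, fun ψ hψ => by rw [e ψ hψ]; exact h3 ψ hψ⟩

theorem Rep.mono (h : Rep n φ B Λ c) {c' : ℝ≥0∞} (hc : c ≤ c') : Rep n φ B Λ c' := by
  obtain ⟨ι, hι, F, G, h1, h2, h3⟩ := h
  exact ⟨ι, hι, F, G, h1, h2.trans hc, fun ψ hψ => ⟨(h3 ψ hψ).1.trans (by gcongr), (h3 ψ hψ).2⟩⟩

theorem Rep.enorm_le (h : Rep n φ B Λ c) {ψ : Eucl n → ℝ} (hψ : IsTest n ψ) :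
    ‖Λ ψ‖ₑ ≤ B ψ * c := by
  obtain ⟨ι, hι, F, G, -, -, h3⟩ := h
  rw [← (h3 ψ hψ).2.tsum_eq]
  by_cases hs : Summable fun k => ‖pairDist n (F k) (G k) ψ‖
  · refine le_trans ?_ (h3 ψ hψ).1
    rw [← ofReal_norm, ← tsum_congr fun k => ofReal_norm (pairDist n (F k) (G k) ψ),
      ← ENNReal.ofReal_tsum_of_nonneg (fun _ => norm_nonneg _) hs]
    exact ENNReal.ofReal_le_ofReal (norm_tsum_le_tsum_norm hs)
  · exact absurd (h3 ψ hψ).2.summable.norm hs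

theorem summable_of_tsum_enorm {ι : Type*} {f : ι → ℝ} (h : ∑' i, ‖f i‖ₑ ≠ ⊤) : Summable f := by
  refine Summable.of_norm ?_
  have := ENNReal.summable_toReal h
  simpa using this

theorem rep_sum {ι : Type} [Countable ι] {Λ : ι → (Eucl n → ℝ) → ℝ} {c : ι → ℝ≥0∞}
    (h : ∀ i, Rep n φ B (Λ i) (c i)) (hc : ∑' i, c i ≠ ⊤) :
    Rep n φ B (fun ψ => ∑' i, Λ i ψ) (∑' i, c i) := by
  choose κ hκ F G h1 h2 h3 using h
  refine ⟨Σ i, κ i, inferInstance, fun p => F p.1 p.2, fun p => G p.1 p.2, fun p => h1 _ _, ?_,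
    fun ψ hψ => ?_⟩
  · refine (ENNReal.tsum_sigma' _).trans_le ?_
    exact ENNReal.tsum_le_tsum h2
  · have hle : ∑' p : Σ i, κ i, ‖pairDist n (F p.1 p.2) (G p.1 p.2) ψ‖ₑ ≤ B ψ * ∑' i, c i := by
      rw [← ENNReal.tsum_mul_left]
      refine (ENNReal.tsum_sigma' _).trans_le ?_
      exact ENNReal.tsum_le_tsum fun i => (h3 i ψ hψ).1
    refine ⟨hle, ?_⟩
    have hs := summable_of_tsum_enorm (ne_top_of_le_ne_top (ENNReal.mul_ne_top (by simp) hc) hle)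
    have := hs.hasSum
    have h4 := this.sigma fun i => (h3 i ψ hψ).2
    show HasSum _ (∑' i, Λ i ψ)
    rw [h4.tsum_eq]
    exact this

theorem summable_of_rep {ι : Type} {Λ : ι → (Eucl n → ℝ) → ℝ} {c : ι → ℝ≥0∞}
    (h : ∀ i, Rep n φ B (Λ i) (c i)) (hc : ∑' i, c i ≠ ⊤) {ψ : Eucl n → ℝ} (hψ : IsTest n ψ) :
    Summable fun i => Λ i ψ := by
  refine summable_of_tsum_enorm (ne_top_of_le_ne_top
    (ENNReal.mul_ne_top (ENNReal.coe_ne_top (r := B ψ)) hc) ?_)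
  rw [← ENNReal.tsum_mul_left]
  exact ENNReal.tsum_le_tsum fun i => (h i).enorm_le hψ

theorem rep_finset_sum {ι : Type} (s : Finset ι) {Λ : ι → (Eucl n → ℝ) → ℝ} {c : ι → ℝ≥0∞}
    (h : ∀ i ∈ s, Rep n φ B (Λ i) (c i)) (hc : ∑ i ∈ s, c i ≠ ⊤) :
    Rep n φ B (fun ψ => ∑ i ∈ s, Λ i ψ) (∑ i ∈ s, c i) := by
  have h1 := rep_sum (ι := s) (Λ := fun i => Λ i) (c := fun i => c i) (fun i => h i i.2)
    (by rwa [Finset.tsum_subtype s c])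
  rw [Finset.tsum_subtype s c] at h1
  exact h1.congr fun ψ _ => (Finset.tsum_subtype s fun i => Λ i ψ).symm

theorem Rep.add {Λ' : (Eucl n → ℝ) → ℝ} {c' : ℝ≥0∞} (h : Rep n φ B Λ c) (h' : Rep n φ B Λ' c')
    (hc : c ≠ ⊤) (hc' : c' ≠ ⊤) : Rep n φ B (fun ψ => Λ ψ + Λ' ψ) (c + c') := by
  have := rep_sum (ι := Bool) (Λ := fun b => bif b then Λ else Λ')
    (c := fun b => bif b then c else c') (φ := φ) (B := B) (by rintro (_ | _) <;> assumption)
    (by simp [hc, hc'])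
  simpa [tsum_bool, add_comm] using this

theorem divFree_smul {F : Eucl n → Eucl n} (h : DivFree n F) (a : ℝ) :
    DivFree n fun x => a • F x := by
  intro ψ hψ hc
  have := h ψ hψ hc
  simp only [PiLp.smul_apply, smul_eq_mul, mul_assoc]
  simp_rw [← Finset.mul_sum]
  rw [integral_const_mul, this, mul_zero]

theorem curlFree_smul {F : Eucl n → Eucl n} (h : CurlFree n F) (a : ℝ) :
    CurlFree n fun x => a • F x := by
  intro ψ hψ hc i j hij
  have := h ψ hψ hc i j hij
  simp only [PiLp.smul_apply, smul_eq_mul, mul_assoc]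
  simp_rw [← mul_sub]
  rw [integral_const_mul, this, mul_zero]

theorem Rep.const_mul (h : Rep n φ B Λ c) (a : ℝ) :
    Rep n φ B (fun ψ => a * Λ ψ) (ENNReal.ofReal |a| * c) := by
  obtain ⟨ι, hι, F, G, h1, h2, h3⟩ := h
  have hd : ∀ k ψ, pairDist n (fun x => a • F k x) (G k) ψ = a * pairDist n (F k) (G k) ψ := by
    intro k ψ
    unfold pairDist
    rw [← integral_const_mul]
    congr 1; ext x
    simp only [PiLp.smul_apply, smul_eq_mul, mul_assoc]
    rw [← Finset.mul_sum, mul_assoc]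
  refine ⟨ι, hι, fun k x => a • F k x, G, fun k => ⟨fun i => ?_, (h1 k).locG, fun i => ?_, (h1 k).bmo,
    ?_, ?_⟩, ?_, fun ψ hψ => ⟨?_, ?_⟩⟩
  · exact ((h1 k).locF i).smul a
  · simp only [PiLp.smul_apply, smul_eq_mul]
    rw [H1Norm_smul]
    exact ENNReal.mul_lt_top (by simp) ((h1 k).h1 i)
  · rcases (h1 k).divcurl with h | h
    · exact Or.inl ⟨divFree_smul h.1 a, h.2⟩
    · exact Or.inr ⟨curlFree_smul h.1 a, h.2⟩
  · have := (h1 k).integrable.const_mul a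
    simp only [PiLp.smul_apply, smul_eq_mul, mul_assoc]
    simp_rw [← Finset.mul_sum]
    exact this
  · have : ∀ k, pairCost n φ (fun x => a • F k x) (G k) =
        ENNReal.ofReal |a| * pairCost n φ (F k) (G k) := by
      intro k
      unfold pairCost
      simp only [PiLp.smul_apply, smul_eq_mul]
      simp_rw [H1Norm_smul]
      rw [← ENNReal.mul_iSup, mul_assoc]
    simp_rw [this]
    rw [ENNReal.tsum_mul_left]
    gcongr
  · simp_rw [hd, enorm_mul]
    rw [ENNReal.tsum_mul_left, mul_left_comm, Real.enorm_eq_ofReal_abs]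
    gcongr
    exact (h3 ψ hψ).1
  · simp_rw [hd]
    exact (h3 ψ hψ).2.mul_left a

theorem Rep.exists_seq (h : Rep n φ B Λ c) :
    ∃ F G : ℕ → Eucl n → Eucl n, (∀ k, GoodPair n φ (F k) (G k)) ∧
      ∑' k, pairCost n φ (F k) (G k) ≤ c ∧
      ∀ ψ, IsTest n ψ → HasSum (fun k => pairDist n (F k) (G k) ψ) (Λ ψ) := by
  obtain ⟨ι, hι, F, G, h1, h2, h3⟩ := h
  obtain ⟨e, he⟩ := exists_injective_nat ι
  set F' : ℕ → Eucl n → Eucl n := Function.extend e F fun _ _ => 0 with hF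
  set G' : ℕ → Eucl n → Eucl n := Function.extend e G fun _ _ => 0 with hG
  have hFe : ∀ i, F' (e i) = F i := fun i => he.extend_apply _ _ _
  have hGe : ∀ i, G' (e i) = G i := fun i => he.extend_apply _ _ _
  have hF0 : ∀ k ∉ Set.range e, F' k = fun _ => 0 := fun k hk =>
    Function.extend_apply' _ _ _ hk
  have hG0 : ∀ k ∉ Set.range e, G' k = fun _ => 0 := fun k hk =>
    Function.extend_apply' _ _ _ hk
  refine ⟨F', G', fun k => ?_, ?_, fun ψ hψ => ?_⟩
  · by_cases hk : k ∈ Set.range e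
    · obtain ⟨i, rfl⟩ := hk
      rw [hFe, hGe]; exact h1 i
    · rw [hF0 k hk, hG0 k hk]; exact goodPair_zero φ
  · refine le_trans (le_of_eq ?_) h2
    rw [← he.tsum_eq (f := fun k => pairCost n φ (F' k) (G' k))]
    · simp_rw [hFe, hGe]
    · intro k hk
      by_contra h
      simp [hF0 k h, hG0 k h, pairCost_zero] at hk
  · rw [← he.hasSum_iff]
    · simpa [Function.comp_def, hFe, hGe] using (h3 ψ hψ).2
    · intro k hk
      rw [hF0 k hk, hG0 k hk, pairDist_zero]

/-- A number controlling the size of a test function. -/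
theorem exists_testSize (n : ℕ) : ∃ S : (Eucl n → ℝ) → ℝ≥0, ∀ ψ, IsTest n ψ →
    (∀ x, |ψ x| ≤ S ψ) ∧ (∀ i x, |pd n ψ i x| ≤ S ψ) ∧ (∀ x, ψ x ≠ 0 → ‖x‖ ≤ S ψ) ∧
      eLpNorm ψ 2 volume ≤ S ψ := by
  have key : ∀ ψ : Eucl n → ℝ, ∃ s : ℝ≥0, IsTest n ψ →
      (∀ x, |ψ x| ≤ s) ∧ (∀ i x, |pd n ψ i x| ≤ s) ∧ (∀ x, ψ x ≠ 0 → ‖x‖ ≤ s) ∧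
        eLpNorm ψ 2 volume ≤ s := by
    intro ψ
    by_cases h : IsTest n ψ
    swap
    · exact ⟨0, fun h' => absurd h' h⟩
    obtain ⟨h1, h2⟩ := h
    obtain ⟨a, ha⟩ := h2.exists_bound_of_continuous h1.continuous
    have hb : ∀ i, ∃ b, ∀ x, |pd n ψ i x| ≤ b := fun i =>
      (pd_hasCompactSupport h2 i).exists_bound_of_continuous (pd_continuous (contDiff_infty.1 h1 1) i)
    choose b hb using hb
    obtain ⟨d, hd⟩ := h2.isCompact.isBounded.exists_norm_le
    have hm := (h1.continuous.memLp_of_hasCompactSupport (p := 2) (μ := volume) h2).2.ne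
    refine ⟨a.toNNReal + (∑ i, (b i).toNNReal) + d.toNNReal + (eLpNorm ψ 2 volume).toNNReal,
      fun _ => ⟨fun x => ?_, fun i x => ?_, fun x hx => ?_, ?_⟩⟩
    · refine (ha x).trans ((Real.le_coe_toNNReal a).trans ?_)
      exact_mod_cast (le_self_add.trans (le_self_add.trans le_self_add))
    · refine (hb i x).trans ((Real.le_coe_toNNReal (b i)).trans ?_)
      have : (b i).toNNReal ≤ ∑ i, (b i).toNNReal :=
        Finset.single_le_sum (f := fun i => (b i).toNNReal) (fun _ _ => zero_le) (Finset.mem_univ i)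
      exact_mod_cast (this.trans (le_add_self.trans (le_self_add.trans le_self_add)))
    · refine (hd x (subset_closure hx)).trans ((Real.le_coe_toNNReal d).trans ?_)
      exact_mod_cast le_add_self.trans le_self_add
    · conv_lhs => rw [← ENNReal.coe_toNNReal hm]
      exact_mod_cast le_add_self
  choose S hS using key
  exact ⟨S, hS⟩

end

section

theorem integral_sq_le_of_eLpNorm {g : Eucl n → ℝ} (hg : AEStronglyMeasurable g volume) {a : ℝ}
    (ha : 0 ≤ a) (h : eLpNorm g 2 volume ≤ ENNReal.ofReal a) : ∫ x, g x ^ 2 ≤ a ^ 2 := by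
  rw [integral_eq_lintegral_of_nonneg_ae (ae_of_all _ fun x => sq_nonneg _) (hg.pow 2)]
  refine ENNReal.toReal_le_of_le_ofReal (by positivity) ?_
  rw [ENNReal.ofReal_pow ha]
  refine le_trans (le_of_eq ?_) (pow_le_pow_left' h 2)
  rw [eLpNorm_two_sq]
  congr 1; ext x
  rw [Real.enorm_eq_ofReal_abs, ← ENNReal.ofReal_pow (abs_nonneg _), sq_abs]

theorem integral_abs_le_of_sq {g : Eucl n → ℝ} (hg : Continuous g) {R a : ℝ} (hR : 0 ≤ R)
    (ha : 0 < a) (hs : ∀ x, g x ≠ 0 → ‖x‖ ≤ R) (h : ∫ x, g x ^ 2 ≤ a ^ 2) :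
    ∫ x, |g x| ≤ (R ^ n * omegaVol n + 1) * a := by
  have hω := omegaVol_pos (n := n)
  have hc : HasCompactSupport g := HasCompactSupport.of_support_subset_isCompact
    (isCompact_closedBall (0 : Eucl n) R) fun x hx => by simpa using hs x hx
  have h1 := setIntegral_abs_le hg hc 0 hR ha
  have h2 : ∀ F : Eucl n → ℝ, (∀ x, g x = 0 → F x = 0) →
      ∫ x in closedBall (0 : Eucl n) R, F x = ∫ x, F x := fun F hF =>
    setIntegral_eq_integral_of_forall_compl_eq_zero fun x hx => hF x (by
      by_contra h'
      exact hx (by simpa using hs x h'))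
  rw [h2 (fun x => |g x|) (by simp), h2 (fun x => g x ^ 2) (by simp)] at h1
  have h3 : (∫ x, g x ^ 2) / a ≤ a := by
    rw [div_le_iff₀ ha]; nlinarith
  nlinarith [mul_pos ha hω, pow_nonneg hR n, mul_nonneg (mul_nonneg ha.le (pow_nonneg hR n)) hω.le]

/-- The function `v` transplanted to the ball of centre `c` and radius `r`. -/
def affW (c : Eucl n) (r : ℝ) (v : Eucl n → ℝ) (y : Eucl n) : ℝ := (r⁻¹)⁻¹ * v (r⁻¹ • (y - c))

section affW
variable {v : Eucl n → ℝ} {r : ℝ} {c : Eucl n} {ρ : ℝ≥0∞}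

theorem affW_contDiff (hv : ContDiff ℝ 1 v) (c : Eucl n) (r : ℝ) : ContDiff ℝ 1 (affW c r v) :=
  contDiff_const.mul (hv.comp ((contDiff_id.sub contDiff_const).const_smul _))

theorem mem_closedBall_of_norm_le (hr : 0 < r) {R : ℝ} {y : Eucl n}
    (h : ‖r⁻¹ • (y - c)‖ ≤ R) : y ∈ closedBall c (R * r) := by
  rw [norm_smul, norm_inv, Real.norm_of_nonneg hr.le, inv_mul_le_iff₀ hr] at h
  rw [mem_closedBall, dist_eq_norm]
  linarith

theorem SobLe.norm_le_of_ne (hv : SobLe n 4 v ρ) {x : Eucl n} (hx : v x ≠ 0) : ‖x‖ ≤ 4 * n := by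
  have := norm_le_of_coord_le (hv.supp x hx)
  simp at this; linarith

theorem SobLe.norm_le_of_pd_ne (hv : SobLe n 4 v ρ) {i : Fin n} {x : Eucl n}
    (hx : pd n v i x ≠ 0) : ‖x‖ ≤ 4 * n := by
  have := pd_eq_zero (w := v) (c := 0) (r := 4 * n)
    (fun y hy => by simpa using hv.norm_le_of_ne hy) i hx
  simpa using this

theorem affW_supp (hv : SobLe n 4 v ρ) (c : Eucl n) (hr : 0 < r) (x : Eucl n)
    (hx : affW c r v x ≠ 0) : x ∈ closedBall c (4 * n * r) :=
  mem_closedBall_of_norm_le hr (hv.norm_le_of_ne (right_ne_zero_of_mul hx))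

theorem affW_hasCompactSupport (hv : SobLe n 4 v ρ) (c : Eucl n) (hr : 0 < r) :
    HasCompactSupport (affW c r v) :=
  HasCompactSupport.of_support_subset_isCompact (isCompact_closedBall c (4 * n * r))
    (affW_supp hv c hr)

theorem pd_affW (hv : ContDiff ℝ 1 v) (hr : 0 < r) (c : Eucl n) (a : Fin n) (x : Eucl n) :
    pd n (affW c r v) a x = pd n v a (r⁻¹ • (x - c)) :=
  pd_affine hv (inv_ne_zero hr.ne') c a x

theorem pd_affW_supp (hv : SobLe n 4 v ρ) (c : Eucl n) (hr : 0 < r) (i : Fin n) (x : Eucl n)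
    (hx : pd n (affW c r v) i x ≠ 0) : x ∈ closedBall c (4 * n * r) :=
  pd_eq_zero (affW_supp hv c hr) i hx

end affW

/-- Cost of a gradient paired with a rotated gradient. -/
theorem exists_goodPair_cost {φ : Eucl n → ℝ} {A : ℝ} (hφ : KernelBound n φ A) :
    ∃ C : ℝ, 0 < C ∧ ∀ (i i' : Fin n) (V : Eucl n → ℝ) (D : ℝ), RotField n i i' V D → 0 ≤ D →
      ∀ (v : Eucl n → ℝ) (a : ℝ), 0 < a → SobLe n 4 v (ENNReal.ofReal a) →
      ∀ (c : Eucl n) (r : ℝ), 0 < r →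
        GoodPair n φ (gradF n (affW c r v)) (rotF n V i i') ∧
        pairCost n φ (gradF n (affW c r v)) (rotF n V i i') ≤ ENNReal.ofReal (C * D * r ^ n * a) := by
  obtain ⟨C, hC, h⟩ := H1Norm_le_of_L2 hφ (R := 4 * n + 1) (by simp)
  refine ⟨C, hC, fun i i' V D hV hD v a ha hv c r hr => ?_⟩
  have hb : ∀ j, H1Norm n φ (fun x => gradF n (affW c r v) x j) ≤
      ENNReal.ofReal (r ^ n * (C * a)) := by
    intro j
    simp only [gradF_apply]
    simp_rw [pd_affW hv.contDiff hr c]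
    rw [H1Norm_scale φ (pd n v j) c hr, ENNReal.ofReal_mul (by positivity)]
    gcongr
    refine h _ (pd_continuous hv.contDiff j) (fun x hx => (hv.norm_le_of_pd_ne hx).trans (by simp))
      (integral_pd_eq_zero hv.contDiff hv.hasCompactSupport j) a ha ?_
    exact integral_sq_le_of_eLpNorm (pd_continuous hv.contDiff j).aestronglyMeasurable ha.le
      (hv.norm_pd_le j)
  have hw := affW_contDiff hv.contDiff c r
  have hwc := affW_hasCompactSupport hv c hr
  have hV1 : ∀ j, Continuous (pd n V j) := fun j => pd_continuous (hV.contDiff.of_le (by norm_num)) j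
  have hVc : ∀ j, Continuous fun x => rotF n V i i' x j := by
    intro j
    simp only [rotF_apply]
    refine Continuous.sub ?_ ?_
    · split_ifs
      exacts [hV1 _, continuous_const]
    · split_ifs
      exacts [hV1 _, continuous_const]
  have hbm : (⨆ j, BMOplus n (fun x => rotF n V i i' x j)) ≤ ENNReal.ofReal D := iSup_le hV.bmo
  refine ⟨⟨fun j => ?_, fun j => (hVc j).locallyIntegrable, fun j => (hb j).trans_lt (by simp),
    hbm.trans_lt (by simp), Or.inr ⟨curlFree_gradF hw hwc, divFree_rotF hV.contDiff i i'⟩, ?_⟩, ?_⟩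
  · exact (pd_continuous hw j).locallyIntegrable
  · refine integrable_finsetSum _ fun j _ => ?_
    exact ((pd_continuous hw j).mul (hVc j)).integrable_of_hasCompactSupport
      (pd_hasCompactSupport hwc j).mul_right
  · refine le_trans (mul_le_mul' (iSup_le hb) hbm) ?_
    rw [← ENNReal.ofReal_mul (by positivity)]
    exact ENNReal.ofReal_le_ofReal (le_of_eq (by ring))

theorem rep_pair {φ : Eucl n → ℝ} {B : (Eucl n → ℝ) → ℝ≥0} {F G : Eucl n → Eucl n} {c : ℝ≥0∞}
    (h : GoodPair n φ F G) (hc : pairCost n φ F G ≤ c)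
    (hB : ∀ ψ, IsTest n ψ → ‖pairDist n F G ψ‖ₑ ≤ B ψ * c) : Rep n φ B (pairDist n F G) c := by
  refine ⟨Unit, inferInstance, fun _ => F, fun _ => G, fun _ => h, by simpa using hc,
    fun ψ hψ => ⟨by simpa using hB ψ hψ, ?_⟩⟩
  simp

theorem pairDist_gradF_rotF (w V : Eucl n → ℝ) (i i' : Fin n) (ψ : Eucl n → ℝ) :
    pairDist n (gradF n w) (rotF n V i i') ψ =
      ∫ x, (pd n w i x * pd n V i' x - pd n w i' x * pd n V i x) * ψ x := by
  unfold pairDist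
  congr 1; ext x
  rw [← sum_mul_rotF (fun a => pd n w a x) V i i' x]
  rfl

/-- `∫ |g|` at scale `r` for a function with square mean at most `a`. -/
theorem SobLe.integral_abs_pd_affW {v : Eucl n → ℝ} {a : ℝ} (ha : 0 < a)
    (hv : SobLe n 4 v (ENNReal.ofReal a)) (c : Eucl n) {r : ℝ} (hr : 0 < r) (i : Fin n) :
    ∫ x, |pd n (affW c r v) i x| ≤ r ^ n * (((4 * n) ^ n * omegaVol n + 1) * a) := by
  simp_rw [pd_affW hv.contDiff hr c]
  rw [integral_scale c hr (fun y => |pd n v i y|)]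
  gcongr
  exact integral_abs_le_of_sq (pd_continuous hv.contDiff i) (by positivity) ha
    (fun x hx => hv.norm_le_of_pd_ne hx)
    (integral_sq_le_of_eLpNorm (pd_continuous hv.contDiff i).aestronglyMeasurable ha.le
      (hv.norm_pd_le i))

theorem SobLe.integral_abs_affW {v : Eucl n → ℝ} {a : ℝ} (ha : 0 < a)
    (hv : SobLe n 4 v (ENNReal.ofReal a)) (c : Eucl n) {r : ℝ} (hr : 0 < r) :
    ∫ x, |affW c r v x| ≤ r * (r ^ n * (((4 * n) ^ n * omegaVol n + 1) * a)) := by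
  unfold affW
  simp_rw [inv_inv, abs_mul, abs_of_pos hr]
  rw [integral_const_mul, integral_scale c hr (fun y => |v y|)]
  gcongr
  exact integral_abs_le_of_sq hv.contDiff.continuous (by positivity) ha
    (fun x hx => hv.norm_le_of_ne hx)
    (integral_sq_le_of_eLpNorm hv.contDiff.continuous.aestronglyMeasurable ha.le hv.norm_le)

/-- The pairing of `∂ᵢ w` with a test function. -/
theorem SobLe.abs_integral_pd_affW_mul {v : Eucl n → ℝ} {a : ℝ} (ha : 0 < a)
    (hv : SobLe n 4 v (ENNReal.ofReal a)) (c : Eucl n) {r : ℝ} (hr : 0 < r) (i : Fin n)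
    {ψ : Eucl n → ℝ} (hψ : IsTest n ψ) {S : ℝ} (hS : ∀ x, |ψ x| ≤ S)
    (hS' : ∀ x, |pd n ψ i x| ≤ S) :
    |∫ x, pd n (affW c r v) i x * ψ x| ≤
      min 1 r * (S * (r ^ n * (((4 * n) ^ n * omegaVol n + 1) * a))) := by
  have hS0 : 0 ≤ S := (abs_nonneg _).trans (hS 0)
  have hw := affW_contDiff hv.contDiff c r
  have hwc := affW_hasCompactSupport hv c hr
  have hω := omegaVol_pos (n := n)
  have key : ∀ u g : Eucl n → ℝ, Continuous u → HasCompactSupport u → (∀ x, |g x| ≤ S) →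
      |∫ x, u x * g x| ≤ S * ∫ x, |u x| := by
    intro u g hu huc hg
    rw [← integral_const_mul]
    rw [← Real.norm_eq_abs]
    refine (norm_integral_le_integral_norm _).trans (integral_mono_of_nonneg
      (ae_of_all _ fun x => norm_nonneg (u x * g x)) ?_ (ae_of_all _ fun x => ?_))
    · exact (hu.abs.integrable_of_hasCompactSupport huc.abs).const_mul S
    · simp only [norm_mul, Real.norm_eq_abs]
      rw [mul_comm]
      gcongr
      exact hg x
  rw [min_mul_of_nonneg _ _ (by positivity)]
  refine le_min ?_ ?_
  · rw [one_mul]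
    refine (key _ _ (pd_continuous hw i) (pd_hasCompactSupport hwc i) hS).trans ?_
    gcongr
    exact hv.integral_abs_pd_affW ha c hr i
  · have h := pd_ibp hw hwc (contDiff_infty.1 hψ.1 1) i
    have h' := (key _ _ hw.continuous hwc hS').trans
      (mul_le_mul_of_nonneg_left (hv.integral_abs_affW ha c hr) hS0)
    rw [h, abs_neg] at h'
    calc _ ≤ _ := h'
      _ = _ := by ring

end

/-- The logarithmic gain attached to a ball. -/
def LL (c : Eucl n) (r : ℝ) : ℝ := log (exp 1 + ‖c‖) + log (exp 1 + r⁻¹)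

/-- Balls that are small or far from the origin. -/
def Adm (c : Eucl n) (r : ℝ) : Prop := 8 * n * r ≤ ‖c‖ ∨ r ≤ n

theorem one_le_log_exp_add {t : ℝ} (ht : 0 ≤ t) : 1 ≤ log (exp 1 + t) := by
  rw [Real.le_log_iff_exp_le (by positivity)]
  linarith

theorem log_exp_add_le {t : ℝ} (ht : 0 ≤ t) : log (exp 1 + t) ≤ 2 + t := by
  have h := Real.log_le_sub_one_of_pos (show 0 < exp 1 + t by positivity)
  have h2 := Real.exp_one_lt_d9
  linarith

theorem log_exp_add_le_log {t : ℝ} (ht : 1 ≤ t) : log (exp 1 + t) ≤ 3 + log t := by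
  have h2 := Real.exp_one_lt_d9
  have h : log (exp 1 + t) ≤ log (4 * t) := Real.log_le_log (by positivity) (by linarith)
  rw [Real.log_mul (by norm_num) (by positivity)] at h
  have := Real.log_le_sub_one_of_pos (show (0 : ℝ) < 4 by norm_num)
  linarith

theorem log_le_of_le_two_pow {t : ℝ} (ht : 0 < t) {K : ℕ} (h : t ≤ 2 ^ K) : log t ≤ K := by
  have h1 := Real.log_le_log ht h
  rw [Real.log_pow] at h1
  have := Real.log_le_sub_one_of_pos (show (0 : ℝ) < 2 by norm_num)
  nlinarith [(Nat.cast_nonneg K : (0 : ℝ) ≤ K)]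

theorem natCast_add_one_le_two_pow (K : ℕ) : (K : ℝ) + 1 ≤ 2 ^ K := by
  have := Nat.lt_two_pow_self (n := K)
  exact_mod_cast this

theorem exists_field (hn : 2 ≤ n) : ∃ C Q : ℝ, 1 ≤ C ∧ 0 < Q ∧ ∀ (c : Eucl n) (r : ℝ), 0 < r →
    Adm c r → ∃ l : ℝ, 0 < l ∧ LL c r ≤ Q * l ∧
      (∀ i, ∃ i' V, RotField n i i' V C ∧
        ∀ x ∈ closedBall c (4 * n * r), pd n V i' x = l ∧ pd n V i x = 0) ∧
      ∀ S : ℝ, 0 ≤ S → (∃ x ∈ closedBall c (4 * n * r), ‖x‖ ≤ S) → l * min 1 r ≤ 2 * S + 1 := by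
  obtain ⟨C, hC, hF⟩ := exists_rotFields hn
  have hn2 : (2 : ℝ) ≤ n := by exact_mod_cast hn
  set M : ℝ := 16 * n ^ 2 + 16 with hM
  have hM0 : 0 < M := by positivity
  refine ⟨C, 2 * (4 + 8 * n) + 3 + M + 16, hC, by positivity, fun c r hr hadm => ?_⟩
  have hb1 := one_le_log_exp_add (inv_nonneg.2 hr.le)
  unfold LL
  by_cases h1 : log (exp 1 + r⁻¹) ≤ log (exp 1 + ‖c‖) ∧ M ≤ ‖c‖
  · obtain ⟨h1, h2⟩ := h1
    have h3 : 8 * n * r ≤ ‖c‖ := by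
      rcases hadm with h | h
      · exact h
      · refine le_trans ?_ h2
        rw [hM]
        nlinarith
    obtain ⟨K, hK1, hK2⟩ := exists_nat_pow_near (x := ‖c‖ / 8) (y := (2 : ℝ))
      (by rw [le_div_iff₀ (by norm_num)]; nlinarith) (by norm_num)
    have hx : ∀ x ∈ closedBall c (4 * n * r), ‖c‖ / 2 ≤ ‖x‖ := by
      intro x hx
      rw [mem_closedBall, dist_eq_norm] at hx
      have := norm_sub_norm_le c x
      rw [norm_sub_rev] at this
      linarith
    have hc16 : 16 ≤ ‖c‖ := by nlinarith
    refine ⟨K + 1, by positivity, ?_, fun i => ?_, fun S hS => ?_⟩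
    · have e1 := log_le_of_le_two_pow (by positivity) hK2.le
      rw [Real.log_div (by positivity) (by norm_num)] at e1
      push_cast at e1
      have e2 := log_exp_add_le_log (t := ‖c‖) (by linarith)
      have e3 := Real.log_le_sub_one_of_pos (show (0 : ℝ) < 8 by norm_num)
      have hK0 : (0 : ℝ) ≤ K := K.cast_nonneg
      nlinarith [mul_nonneg hK0 (show (0 : ℝ) ≤ n by positivity), mul_nonneg hK0 hM0.le]
    · obtain ⟨i', -, -, -, h⟩ := hF i
      obtain ⟨V, hV, hV1, -⟩ := h K
      refine ⟨i', V, hV, fun x hx' => hV1 x ?_⟩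
      have := hx x hx'
      rw [pow_succ]
      linarith
    · rintro ⟨x, hx', hxS⟩
      have e1 := hx x hx'
      have e2 := natCast_add_one_le_two_pow K
      have e3 : ((K : ℝ) + 1) * min 1 r ≤ (K + 1) * 1 := by gcongr; exact min_le_left _ _
      linarith
  have h1' : log (exp 1 + ‖c‖) ≤ log (exp 1 + r⁻¹) + 2 + M := by
    by_contra h
    push Not at h
    refine h1 ⟨by linarith, ?_⟩
    have := log_exp_add_le (norm_nonneg c)
    linarith
  by_cases h2 : 8 * n * r ≤ 1
  · obtain ⟨K, hK1, hK2⟩ := exists_nat_pow_near (x := (8 * n * r)⁻¹) (y := (2 : ℝ))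
      ((one_le_inv₀ (by positivity)).2 h2) (by norm_num)
    refine ⟨K + 1, by positivity, ?_, fun i => ?_, fun S hS _ => ?_⟩
    · have e1 := log_le_of_le_two_pow (by positivity) hK2.le
      rw [Real.log_inv, Real.log_mul (by positivity) hr.ne'] at e1
      have hr1 : 1 ≤ r⁻¹ := (one_le_inv₀ hr).2 (by nlinarith)
      have e2 := log_exp_add_le_log hr1
      rw [Real.log_inv] at e2
      have e3 := Real.log_le_sub_one_of_pos (show (0 : ℝ) < 8 * n by positivity)
      push_cast at e1
      have hK0 : (0 : ℝ) ≤ K := K.cast_nonneg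
      nlinarith [mul_nonneg hK0 (show (0 : ℝ) ≤ n by positivity), mul_nonneg hK0 hM0.le]
    · obtain ⟨i', -, -, h, -⟩ := hF i
      obtain ⟨V, hV, hV1⟩ := h c K
      refine ⟨i', V, hV, fun x hx' => hV1 x ?_⟩
      rw [mem_closedBall] at hx'
      rw [mem_ball]
      refine hx'.trans_lt ?_
      rw [lt_inv_comm₀ (by positivity) (by positivity)]
      refine hK1.trans_lt ?_
      gcongr
      linarith
    · have e2 := natCast_add_one_le_two_pow K
      have e3 : ((K : ℝ) + 1) * min 1 r ≤ (8 * n * r)⁻¹ * r := by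
        gcongr
        · linarith
        · exact min_le_right _ _
      have e4 : (8 * n * r)⁻¹ * r ≤ 1 := by
        rw [inv_mul_le_iff₀ (by positivity)]; nlinarith
      linarith
  · push Not at h2
    refine ⟨1, one_pos, ?_, fun i => ?_, fun S hS _ => ?_⟩
    · have e1 : r⁻¹ ≤ 8 * n := by
        rw [inv_le_iff_one_le_mul₀ hr]; linarith
      have e2 := log_exp_add_le (inv_nonneg.2 hr.le)
      linarith
    · obtain ⟨i', -, ⟨V, hV, h⟩, -, -⟩ := hF i
      exact ⟨i', V, hV, fun x _ => h x⟩
    · have := min_le_left 1 r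
      linarith

/-- A number controlling the size of a test function. -/
def testSize (n : ℕ) : (Eucl n → ℝ) → ℝ≥0 := (exists_testSize n).choose

theorem testSize_spec {ψ : Eucl n → ℝ} (hψ : IsTest n ψ) :
    (∀ x, |ψ x| ≤ testSize n ψ) ∧ (∀ i x, |pd n ψ i x| ≤ testSize n ψ) ∧
      (∀ x, ψ x ≠ 0 → ‖x‖ ≤ testSize n ψ) ∧ eLpNorm ψ 2 volume ≤ testSize n ψ :=
  (exists_testSize n).choose_spec ψ hψ

/-- The weight of a test function used for absolute convergence. -/
def bsize (n : ℕ) (ψ : Eucl n → ℝ) : ℝ≥0 := (testSize n ψ + 1) * (2 * testSize n ψ + 2)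

/-- The functional of integration against the transplant of `h`. -/
def scaled (c : Eucl n) (r : ℝ) (h : Eucl n → ℝ) (ψ : Eucl n → ℝ) : ℝ :=
  ∫ y, h (r⁻¹ • (y - c)) * ψ y

theorem enorm_le_ofReal_mul {x : ℝ} {b : ℝ≥0} {c : ℝ} (h : |x| ≤ b * c) :
    ‖x‖ₑ ≤ b * ENNReal.ofReal c := by
  rw [Real.enorm_eq_ofReal_abs, ← ENNReal.ofReal_coe_nnreal, ← ENNReal.ofReal_mul b.coe_nonneg]
  exact ENNReal.ofReal_le_ofReal h

theorem rep_pd_of_field {φ : Eucl n → ℝ} {A : ℝ} (hφ : KernelBound n φ A) {D : ℝ} (hD : 1 ≤ D) :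
    ∃ C : ℝ, 0 < C ∧ ∀ (c : Eucl n) (r l : ℝ), 0 < r → 0 < l → ∀ (i i' : Fin n) (V : Eucl n → ℝ),
      RotField n i i' V D → (∀ x ∈ closedBall c (4 * n * r), pd n V i' x = l ∧ pd n V i x = 0) →
      (∀ S : ℝ, 0 ≤ S → (∃ x ∈ closedBall c (4 * n * r), ‖x‖ ≤ S) → l * min 1 r ≤ 2 * S + 1) →
      ∀ (v : Eucl n → ℝ) (a : ℝ), 0 < a → SobLe n 4 v (ENNReal.ofReal a) →
        Rep n φ (bsize n) (fun ψ => ∫ x, pd n (affW c r v) i x * ψ x)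
          (ENNReal.ofReal (C * (r ^ n * a / l))) := by
  obtain ⟨C, hC, hG⟩ := exists_goodPair_cost hφ
  have hω := omegaVol_pos (n := n)
  set C1 : ℝ := (4 * n) ^ n * omegaVol n + 1 with hC1
  have hC1' : 0 < C1 := by positivity
  refine ⟨C * D + C1, by positivity, fun c r l hr hl i i' V hV hVl hS v a ha hv => ?_⟩
  obtain ⟨hgp, hcost⟩ := hG i i' V D hV (by linarith) v a ha hv c r hr
  have hdist : ∀ ψ, pairDist n (gradF n (affW c r v)) (rotF n V i i') ψ =
      l * ∫ x, pd n (affW c r v) i x * ψ x := by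
    intro ψ
    rw [pairDist_gradF_rotF, ← integral_const_mul]
    congr 1; ext x
    by_cases hx : x ∈ closedBall c (4 * n * r)
    · rw [(hVl x hx).1, (hVl x hx).2]; ring
    · have h : ∀ j, pd n (affW c r v) j x = 0 := fun j => by
        by_contra h'
        exact hx (pd_affW_supp hv c hr j x h')
      simp [h]
  have hrep : Rep n φ (bsize n) (pairDist n (gradF n (affW c r v)) (rotF n V i i'))
      (ENNReal.ofReal ((C * D + C1) * (r ^ n * a))) := by
    refine rep_pair hgp (hcost.trans (ENNReal.ofReal_le_ofReal ?_)) fun ψ hψ =>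
      enorm_le_ofReal_mul ?_
    · have : 0 ≤ C1 * (r ^ n * a) := by positivity
      linarith
    · rw [hdist]
      obtain ⟨h1, h2, h3, -⟩ := testSize_spec hψ
      set S : ℝ := (testSize n ψ : ℝ) with hSdef
      have hS0 : 0 ≤ S := (testSize n ψ).2
      have hb : ((bsize n ψ : ℝ≥0) : ℝ) = (S + 1) * (2 * S + 2) := by simp [bsize, hSdef]
      rw [hb]
      by_cases hx : ∃ x ∈ closedBall c (4 * n * r), ‖x‖ ≤ S
      · have e1 := hv.abs_integral_pd_affW_mul ha c hr i hψ h1 (h2 i)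
        have e2 := hS S hS0 hx
        rw [abs_mul, abs_of_pos hl]
        have e3 : 0 ≤ C * D * (r ^ n * a) := by positivity
        calc _ ≤ l * (min 1 r * (S * (r ^ n * (C1 * a)))) := by gcongr
          _ = l * min 1 r * (S * (r ^ n * (C1 * a))) := by ring
          _ ≤ (2 * S + 1) * (S * (r ^ n * (C1 * a))) := by gcongr
          _ ≤ (2 * S + 2) * (S * (r ^ n * (C1 * a))) := by gcongr; norm_num
          _ = S * (2 * S + 2) * (C1 * (r ^ n * a)) := by ring
          _ ≤ _ := by gcongr <;> nlinarith
      · have : ∀ x, pd n (affW c r v) i x * ψ x = 0 := by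
          intro x
          by_contra h'
          exact hx ⟨x, pd_affW_supp hv c hr i x (left_ne_zero_of_mul h'),
            h3 x (right_ne_zero_of_mul h')⟩
        simp only [this, integral_zero, mul_zero, abs_zero]
        positivity
  refine ((hrep.const_mul l⁻¹).congr fun ψ _ => ?_).mono ?_
  · rw [hdist, ← mul_assoc, inv_mul_cancel₀ hl.ne', one_mul]
  · rw [← ENNReal.ofReal_mul (abs_nonneg _), abs_of_pos (by positivity)]
    exact ENNReal.ofReal_le_ofReal (le_of_eq (by field_simp))

/-- Smooth mean zero functions supported in `closedBall c (2 r)` are represented with cost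
proportional to `D`. -/
def SmoothRep (n : ℕ) (φ : Eucl n → ℝ) (c : Eucl n) (r D : ℝ) : Prop :=
  ∀ (h : Eucl n → ℝ) (a : ℝ), 0 < a → ContDiff ℝ (⊤ : ℕ∞) h → (∀ x, h x ≠ 0 → ‖x‖ ≤ 2) →
    ∫ x, h x = 0 → eLpNorm h 2 volume ≤ ENNReal.ofReal a →
    Rep n φ (bsize n) (scaled c r h) (ENNReal.ofReal (D * a))

theorem exists_smoothRep_of_pd (n : ℕ) : ∃ C : ℝ, 0 < C ∧ ∀ (φ : Eucl n → ℝ) (c : Eucl n) (r D : ℝ),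
    0 < r → (∀ (i : Fin n) (v : Eucl n → ℝ) (a : ℝ), 0 < a → SobLe n 4 v (ENNReal.ofReal a) →
      Rep n φ (bsize n) (fun ψ => ∫ x, pd n (affW c r v) i x * ψ x) (ENNReal.ofReal (D * a))) →
    SmoothRep n φ c r (C * D) := by
  obtain ⟨Cd, hCd⟩ := exists_divergence_eq n
  refine ⟨(n + 1) * (Cd + 1), by positivity, fun φ c r D hr H h a ha hh hs h0 hle => ?_⟩
  obtain ⟨v, hv, hdiv⟩ := hCd h hh hs h0
  have ha' : 0 < (Cd + 1) * a := by positivity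
  have hv' : ∀ i, SobLe n 4 (v i) (ENNReal.ofReal ((Cd + 1) * a)) := fun i => (hv i).mono (by
    rw [ENNReal.ofReal_mul (by positivity)]
    refine mul_le_mul' ?_ hle
    rw [← ENNReal.ofReal_coe_nnreal]
    exact ENNReal.ofReal_le_ofReal (by linarith))
  have hrep := rep_finset_sum Finset.univ (fun i _ => H i (v i) _ ha' (hv' i))
    (by simp [ENNReal.mul_eq_top])
  refine (hrep.congr fun ψ hψ => ?_).mono ?_
  · unfold scaled
    rw [← integral_finsetSum]
    · congr 1; ext y
      rw [hdiv, Finset.sum_mul]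
      exact Finset.sum_congr rfl fun i _ => by rw [pd_affW (hv i).contDiff hr]
    · intro i _
      exact ((pd_continuous (affW_contDiff (hv i).contDiff c r) i).mul
        hψ.1.continuous).integrable_of_hasCompactSupport hψ.2.mul_left
  · simp only [Finset.sum_const, Finset.card_univ, Fintype.card_fin, nsmul_eq_mul]
    rcases le_total 0 D with hD | hD
    · rw [← ENNReal.ofReal_natCast, ← ENNReal.ofReal_mul (by positivity)]
      refine ENNReal.ofReal_le_ofReal ?_
      have : 0 ≤ D * ((Cd + 1) * a) := by positivity
      nlinarith
    · rw [ENNReal.ofReal_of_nonpos (by nlinarith), mul_zero]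
      exact zero_le

/-- Smooth mean zero functions on small or far balls. -/
theorem exists_smoothRep_adm (hn : 2 ≤ n) {φ : Eucl n → ℝ} {A : ℝ} (hφ : KernelBound n φ A) :
    ∃ C : ℝ, 0 < C ∧ ∀ (c : Eucl n) (r : ℝ), 0 < r → Adm c r →
      SmoothRep n φ c r (C * (r ^ n / LL c r)) := by
  obtain ⟨D, Q, hD, hQ, hF⟩ := exists_field hn
  obtain ⟨C1, hC1, h1⟩ := rep_pd_of_field hφ hD
  obtain ⟨C2, hC2, h2⟩ := exists_smoothRep_of_pd n
  refine ⟨C2 * (C1 * Q), by positivity, fun c r hr hadm => ?_⟩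
  obtain ⟨l, hl, hle, hf, hS⟩ := hF c r hr hadm
  have hL : 0 < LL c r := by
    have e1 := one_le_log_exp_add (norm_nonneg c)
    have e2 := one_le_log_exp_add (inv_nonneg.2 hr.le)
    unfold LL; linarith
  have := h2 φ c r (C1 * Q * (r ^ n / LL c r)) hr fun i v a ha hv => by
    obtain ⟨i', V, hV, hVl⟩ := hf i
    refine (h1 c r l hr hl i i' V hV hVl hS v a ha hv).mono (ENNReal.ofReal_le_ofReal ?_)
    rw [mul_assoc, mul_assoc]
    gcongr
    have : 1 / l ≤ Q / LL c r := by rw [div_le_div_iff₀ hl hL]; linarith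
    calc r ^ n * a / l = r ^ n * a * (1 / l) := by ring
      _ ≤ r ^ n * a * (Q / LL c r) := by gcongr
      _ = _ := by ring
  rwa [← mul_assoc] at this

/-- Smooth mean zero functions without logarithmic gain. -/
theorem exists_smoothRep (hn : 2 ≤ n) {φ : Eucl n → ℝ} {A : ℝ} (hφ : KernelBound n φ A) :
    ∃ C : ℝ, 0 < C ∧ ∀ (c : Eucl n) (r : ℝ), 0 < r → SmoothRep n φ c r (C * r ^ n) := by
  obtain ⟨D, hD, hF⟩ := exists_rotFields hn
  obtain ⟨C1, hC1, h1⟩ := rep_pd_of_field hφ hD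
  obtain ⟨C2, hC2, h2⟩ := exists_smoothRep_of_pd n
  refine ⟨C2 * C1, by positivity, fun c r hr => ?_⟩
  rw [mul_assoc]
  refine h2 φ c r (C1 * r ^ n) hr fun i v a ha hv => ?_
  obtain ⟨i', -, ⟨V, hV, hVl⟩, -, -⟩ := hF i
  refine (h1 c r 1 hr one_pos i i' V hV (fun x _ => hVl x) (fun S hS _ => ?_) v a ha hv).mono
    (ENNReal.ofReal_le_ofReal (le_of_eq (by ring)))
  have := min_le_left 1 r
  linarith

theorem integral_abs_le_of_eLpNorm (n : ℕ) (R : ℝ) : ∃ C : ℝ, 0 < C ∧ ∀ (u : Eucl n → ℝ) (a : ℝ),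
    0 ≤ a → AEStronglyMeasurable u volume → (∀ x, u x ≠ 0 → ‖x‖ ≤ R) →
    eLpNorm u 2 volume ≤ ENNReal.ofReal a → Integrable u ∧ ∫ x, |u x| ≤ C * a := by
  set m : ℝ≥0∞ := volume (closedBall (0 : Eucl n) R) with hm
  have hmt : m < ⊤ := measure_closedBall_lt_top
  refine ⟨(m ^ (1 / (1 : ℝ≥0∞).toReal - 1 / (2 : ℝ≥0∞).toReal)).toReal + 1, by positivity,
    fun u a ha hu hs hle => ?_⟩
  set p : ℝ := 1 / (1 : ℝ≥0∞).toReal - 1 / (2 : ℝ≥0∞).toReal with hp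
  have hp0 : 0 ≤ p := by simp [hp]; norm_num
  have h := eLpNorm_le_eLpNorm_mul_rpow_measure_univ (μ := volume.restrict (closedBall (0 : Eucl n) R))
    (p := 1) (q := 2) (by norm_num) hu.restrict
  rw [eLpNorm_one_eq_lintegral_enorm, setLIntegral_eq_of_support_subset, Measure.restrict_apply_univ,
    ← hm, ← hp] at h
  swap
  · intro x hx
    have : u x ≠ 0 := by simpa using hx
    simpa using hs x this
  have h2 : ∫⁻ x, ‖u x‖ₑ ≤ ENNReal.ofReal ((m ^ p).toReal * a) := by
    rw [ENNReal.ofReal_mul ENNReal.toReal_nonneg, ENNReal.ofReal_toReal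
      (ENNReal.rpow_ne_top_of_nonneg hp0 hmt.ne), mul_comm]
    refine h.trans ?_
    gcongr
    exact (eLpNorm_restrict_le _ _ _ _).trans hle
  have hi : Integrable u := ⟨hu, h2.trans_lt ENNReal.ofReal_lt_top⟩
  refine ⟨hi, ?_⟩
  have h3 : ∫ x, |u x| ≤ (m ^ p).toReal * a := by
    rw [integral_eq_lintegral_of_nonneg_ae (ae_of_all _ fun x => abs_nonneg _) hu.norm]
    refine ENNReal.toReal_le_of_le_ofReal (by positivity) ?_
    simpa [Real.enorm_eq_ofReal_abs] using h2
  linarith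

theorem exists_smooth_approx (n : ℕ) {h : Eucl n → ℝ} (hm : MemLp h 2 volume)
    (hs : ∀ x, h x ≠ 0 → ‖x‖ ≤ 1) (h0 : ∫ x, h x = 0) {ε : ℝ} (hε : 0 < ε) :
    ∃ g : Eucl n → ℝ, ContDiff ℝ (⊤ : ℕ∞) g ∧ (∀ x, g x ≠ 0 → ‖x‖ ≤ 2) ∧ ∫ x, g x = 0 ∧
      eLpNorm (fun x => h x - g x) 2 volume ≤ ENNReal.ofReal ε := by
  obtain ⟨χ, hχ, hχ1, hχs, hχb⟩ := exists_cutoff n one_pos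
  norm_num at hχs
  obtain ⟨C, hC, hI⟩ := integral_abs_le_of_eLpNorm n 2
  have hχc : HasCompactSupport χ := HasCompactSupport.of_support_subset_isCompact
    (isCompact_closedBall (0 : Eucl n) 2) fun x hx => by simpa using hχs x hx
  have hχi : Integrable χ := hχ.continuous.integrable_of_hasCompactSupport hχc
  have hχm : MemLp χ 2 volume := hχ.continuous.memLp_of_hasCompactSupport hχc
  set N : ℝ := (eLpNorm χ 2 volume).toReal with hN
  have hNe : eLpNorm χ 2 volume = ENNReal.ofReal N := (ENNReal.ofReal_toReal hχm.2.ne).symm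
  have hN0 : 0 ≤ N := ENNReal.toReal_nonneg
  set J : ℝ := ∫ x, χ x with hJ
  have hJ0 : 0 < J := by
    refine (integral_pos_iff_support_of_nonneg (fun x => (hχb x).1) hχi).2 ?_
    refine (measure_ball_pos volume (0 : Eucl n) one_pos).trans_le (measure_mono fun x hx => ?_)
    rw [Function.mem_support, hχ1 x (by simpa using (mem_ball.1 hx).le)]
    exact one_ne_zero
  set δ : ℝ := ε / (1 + C * N / J) with hδ
  have hδ0 : 0 < δ := by positivity
  obtain ⟨g, hgc, hg, hgδ⟩ := hm.exist_eLpNorm_sub_le (by simp) (by norm_num) hδ0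
  have hgi : MemLp (fun x => χ x * g x) 2 volume :=
    (hχ.continuous.mul hg.continuous).memLp_of_hasCompactSupport hχc.mul_right
  have hd : eLpNorm (fun x => h x - χ x * g x) 2 volume ≤ ENNReal.ofReal δ := by
    refine le_trans (eLpNorm_mono fun x => ?_) hgδ
    simp only [Pi.sub_apply, Real.norm_eq_abs]
    by_cases hx : h x = 0
    · rw [hx, zero_sub, zero_sub, abs_neg, abs_neg, abs_mul, abs_of_nonneg (hχb x).1]
      exact mul_le_of_le_one_left (abs_nonneg _) (hχb x).2
    · rw [hχ1 x (hs x hx), one_mul]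
  obtain ⟨hi1, hi2⟩ := hI _ δ hδ0.le (hm.1.sub hgi.1) (fun x hx => by
    by_contra h'
    push Not at h'
    have e1 : h x = 0 := by by_contra h''; linarith [hs x h'']
    have e2 : χ x = 0 := by by_contra h''; linarith [hχs x h'']
    simp [e1, e2] at hx) hd
  set μ : ℝ := ∫ x, χ x * g x with hμ
  have hgi1 : Integrable fun x => χ x * g x :=
    (hχ.continuous.mul hg.continuous).integrable_of_hasCompactSupport hχc.mul_right
  have hhi : Integrable h := by
    have := hi1.add hgi1
    refine this.congr (ae_of_all _ fun x => by simp)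
  have hμle : |μ| ≤ C * δ := by
    refine le_trans ?_ hi2
    have : μ = -∫ x, (h x - χ x * g x) := by rw [integral_sub hhi hgi1, h0]; simp [hμ]
    rw [this, abs_neg]
    exact abs_integral_le_integral_abs
  refine ⟨fun x => χ x * g x - μ / J * χ x, (hχ.mul hg).sub (contDiff_const.mul hχ),
    fun x hx => hχs x fun h' => hx (by simp [h']), ?_, ?_⟩
  · rw [integral_sub hgi1 (hχi.const_mul _), integral_const_mul, ← hμ, ← hJ]
    field_simp; ring
  · have e : (fun x => h x - (χ x * g x - μ / J * χ x)) =
        (fun x => h x - χ x * g x) + (μ / J) • χ := by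
      ext x; simp; ring
    rw [e]
    refine (eLpNorm_add_le (hm.1.sub hgi.1) (hχm.1.const_smul _) (by norm_num)).trans ?_
    rw [eLpNorm_const_smul, hNe, Real.enorm_eq_ofReal_abs, ← ENNReal.ofReal_mul (abs_nonneg _)]
    refine (add_le_add_left hd _).trans ?_
    rw [← ENNReal.ofReal_add hδ0.le (by positivity)]
    refine ENNReal.ofReal_le_ofReal ?_
    rw [abs_div, abs_of_pos hJ0]
    calc δ + |μ| / J * N ≤ δ + C * δ / J * N := by gcongr
      _ = δ * (1 + C * N / J) := by ring
      _ = ε := by rw [hδ]; field_simp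

theorem abs_scaled_le (c : Eucl n) {r : ℝ} (hr : 0 < r) {u : Eucl n → ℝ} (hu : Integrable u)
    {ψ : Eucl n → ℝ} (hψ : IsTest n ψ) :
    |scaled c r u ψ| ≤ testSize n ψ * (r ^ n * ∫ x, |u x|) := by
  unfold scaled
  rw [← integral_scale c hr, ← integral_const_mul, ← Real.norm_eq_abs]
  refine (norm_integral_le_integral_norm _).trans (integral_mono_of_nonneg
    (ae_of_all _ fun x => norm_nonneg (u (r⁻¹ • (x - c)) * ψ x)) ?_ (ae_of_all _ fun x => ?_))
  · refine Integrable.const_mul ?_ _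
    exact ((hu.abs.comp_smul (inv_ne_zero hr.ne')).comp_sub_right c)
  · simp only [norm_mul, Real.norm_eq_abs]
    rw [mul_comm]
    gcongr
    exact (testSize_spec hψ).1 x

theorem integrable_scaled (c : Eucl n) {r : ℝ} (hr : 0 < r) {u : Eucl n → ℝ} (hu : Integrable u)
    {ψ : Eucl n → ℝ} (hψ : IsTest n ψ) : Integrable fun y => u (r⁻¹ • (y - c)) * ψ y :=
  ((hu.comp_smul (inv_ne_zero hr.ne')).comp_sub_right c).mul_bdd (c := testSize n ψ)
    hψ.1.continuous.aestronglyMeasurable (ae_of_all _ (testSize_spec hψ).1)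

/-- Representation of square integrable mean zero functions. -/
theorem SmoothRep.memLp {φ : Eucl n → ℝ} {c : Eucl n} {r D : ℝ} (hD : 0 ≤ D) (hr : 0 < r)
    (H : SmoothRep n φ c r D) {h : Eucl n → ℝ} (hm : AEStronglyMeasurable h volume)
    (hs : ∀ x, h x ≠ 0 → ‖x‖ ≤ 1) (h0 : ∫ x, h x = 0) {a : ℝ} (ha : 0 < a)
    (hle : eLpNorm h 2 volume ≤ ENNReal.ofReal a) :
    Rep n φ (bsize n) (scaled c r h) (ENNReal.ofReal (8 * D * a)) := by
  have hL : MemLp h 2 volume := ⟨hm, hle.trans_lt ENNReal.ofReal_lt_top⟩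
  have hε : ∀ m : ℕ, 0 < (1 / 2 : ℝ) ^ m * a := fun m => by positivity
  choose g hg hgs hg0 hgle using fun m => exists_smooth_approx n hL hs h0 (hε m)
  have hgc : ∀ m, HasCompactSupport (g m) := fun m => HasCompactSupport.of_support_subset_isCompact
    (isCompact_closedBall (0 : Eucl n) 2) fun x hx => by simpa using hgs m x hx
  have hgi : ∀ m, Integrable (g m) := fun m =>
    (hg m).continuous.integrable_of_hasCompactSupport (hgc m)
  have hgm : ∀ m, AEStronglyMeasurable (g m) volume := fun m =>
    (hg m).continuous.aestronglyMeasurable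
  set d : ℕ → Eucl n → ℝ := fun m => m.casesOn (g 0) fun m x => g (m + 1) x - g m x with hd
  have hrep : ∀ m, Rep n φ (bsize n) (scaled c r (d m))
      (ENNReal.ofReal (D * (4 * ((1 / 2 : ℝ) ^ m * a)))) := by
    rintro (_ | m)
    · refine H _ _ (by positivity) (hg 0) (hgs 0) (hg0 0) ?_
      have e : g 0 = h - fun x => h x - g 0 x := by ext x; simp
      have : eLpNorm (g 0) 2 volume ≤ ENNReal.ofReal a + ENNReal.ofReal ((1 / 2 : ℝ) ^ 0 * a) := by
        conv_lhs => rw [e]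
        exact (eLpNorm_sub_le hm (hm.sub (hgm 0)) (by norm_num)).trans (add_le_add hle (hgle 0))
      refine this.trans ?_
      rw [← ENNReal.ofReal_add ha.le (by positivity)]
      refine ENNReal.ofReal_le_ofReal ?_
      rw [pow_zero]; linarith
    · refine H _ _ (by positivity) ((hg (m + 1)).sub (hg m)) (fun x hx => ?_) ?_ ?_
      · by_cases h' : g m x = 0
        · exact hgs (m + 1) x fun h'' => hx (show g (m + 1) x - g m x = 0 by simp [h', h''])
        · exact hgs m x h'
      · rw [integral_sub (hgi _) (hgi _), hg0, hg0, sub_zero]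
      · have e : (fun x => g (m + 1) x - g m x) =
            (fun x => h x - g m x) - fun x => h x - g (m + 1) x := by ext x; simp
        have : eLpNorm (fun x => g (m + 1) x - g m x) 2 volume ≤
            ENNReal.ofReal ((1 / 2 : ℝ) ^ m * a) + ENNReal.ofReal ((1 / 2 : ℝ) ^ (m + 1) * a) := by
          rw [e]
          exact (eLpNorm_sub_le (hm.sub (hgm m)) (hm.sub (hgm (m + 1))) (by norm_num)).trans
            (add_le_add (hgle m) (hgle _))
        refine this.trans ?_
        rw [← ENNReal.ofReal_add (hε m).le (hε _).le]
        refine ENNReal.ofReal_le_ofReal ?_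
        have := hε m
        rw [pow_succ]; linarith
  have hsum : ∑' m : ℕ, ENNReal.ofReal (D * (4 * ((1 / 2 : ℝ) ^ m * a))) =
      ENNReal.ofReal (8 * D * a) := by
    have h1 : HasSum (fun m : ℕ => D * (4 * ((1 / 2 : ℝ) ^ m * a))) (8 * D * a) := by
      have := (hasSum_geometric_two.mul_left (D * 4 * a))
      have e : (fun m : ℕ => D * (4 * ((1 / 2 : ℝ) ^ m * a))) =
          fun m => D * 4 * a * (1 / 2 : ℝ) ^ m := by ext m; ring
      rw [e, show 8 * D * a = D * 4 * a * 2 by ring]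
      exact this
    rw [← ENNReal.ofReal_tsum_of_nonneg (fun m => by positivity) h1.summable, h1.tsum_eq]
  have hne : ∑' m : ℕ, ENNReal.ofReal (D * (4 * ((1 / 2 : ℝ) ^ m * a))) ≠ ⊤ := by
    rw [hsum]; exact ENNReal.ofReal_ne_top
  have hR := rep_sum hrep hne
  rw [hsum] at hR
  refine hR.congr fun ψ hψ => ?_
  obtain ⟨C, hC, hI⟩ := integral_abs_le_of_eLpNorm n 2
  have hdi : ∀ m, Integrable (fun x => h x - g m x) ∧
      ∫ x, |h x - g m x| ≤ C * ((1 / 2 : ℝ) ^ m * a) := fun m => by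
    refine hI _ _ (hε m).le (hm.sub (hgm m)) (fun x hx => ?_) (hgle m)
    by_cases h' : g m x = 0
    · exact (hs x fun h'' => hx (by simp [h', h''])).trans (by norm_num)
    · exact hgs m x h'
  have hhi : Integrable h := ((hdi 0).1.add (hgi 0)).congr (ae_of_all _ fun x => by simp)
  have hpart : ∀ N : ℕ, ∑ m ∈ Finset.range (N + 1), scaled c r (d m) ψ = scaled c r (g N) ψ := by
    intro N
    induction N with
    | zero => simp [hd]
    | succ N ih =>
      rw [Finset.sum_range_succ, ih]
      unfold scaled
      rw [← integral_add (integrable_scaled c hr (hgi N) hψ)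
        (integrable_scaled c hr (show Integrable (d (N + 1)) from (hgi (N + 1)).sub (hgi N)) hψ)]
      congr 1; ext y
      simp only [hd]; ring
  have hs1 := (summable_of_rep hrep hne hψ).hasSum.tendsto_sum_nat
  have hs2 : Tendsto (fun N => scaled c r (g N) ψ) atTop (𝓝 (scaled c r h ψ)) := by
    rw [tendsto_iff_norm_sub_tendsto_zero]
    refine squeeze_zero (fun _ => norm_nonneg _)
      (g := fun m => testSize n ψ * (r ^ n * (C * ((1 / 2 : ℝ) ^ m * a)))) (fun m => ?_) ?_
    · rw [norm_sub_rev, Real.norm_eq_abs]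
      have : scaled c r h ψ - scaled c r (g m) ψ = scaled c r (fun x => h x - g m x) ψ := by
        unfold scaled
        rw [← integral_sub (integrable_scaled c hr hhi hψ) (integrable_scaled c hr (hgi m) hψ)]
        congr 1; ext y; ring
      rw [this]
      refine (abs_scaled_le c hr (hdi m).1 hψ).trans ?_
      gcongr
      exact (hdi m).2
    · have := (tendsto_pow_atTop_nhds_zero_of_lt_one (r := (1 / 2 : ℝ)) (by norm_num)
        (by norm_num)).const_mul (testSize n ψ * (r ^ n * (C * a)))
      simp only [mul_zero] at this
      refine this.congr fun m => by ring
  refine tendsto_nhds_unique hs2 ?_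
  refine ((tendsto_add_atTop_iff_nat 1).2 hs1).congr hpart

theorem eLpNorm_le_of_integral_sq {h : Eucl n → ℝ} (hi : Integrable fun x => h x ^ 2) {b : ℝ}
    (hb : 0 ≤ b) (hle : ∫ x, h x ^ 2 ≤ b ^ 2) : eLpNorm h 2 volume ≤ ENNReal.ofReal b := by
  rw [← ENNReal.pow_le_pow_left_iff (n := 2) (by norm_num), eLpNorm_two_sq,
    ← ENNReal.ofReal_pow hb]
  refine le_trans (le_of_eq ?_) (ENNReal.ofReal_le_ofReal hle)
  rw [ofReal_integral_eq_lintegral_ofReal hi (ae_of_all _ fun x => sq_nonneg _)]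
  congr 1; ext x
  rw [Real.enorm_eq_ofReal_abs, ← ENNReal.ofReal_pow (abs_nonneg _), sq_abs]

/-- Representation of integration against a square integrable mean zero function supported in a
ball. -/
theorem SmoothRep.integral {φ : Eucl n → ℝ} {c : Eucl n} {r D : ℝ} (hD : 0 ≤ D) (hr : 0 < r)
    (H : SmoothRep n φ c r D) {h : Eucl n → ℝ} (hm : AEStronglyMeasurable h volume)
    (hi : Integrable fun x => h x ^ 2)
    (hs : ∀ x, h x ≠ 0 → x ∈ closedBall c r) (h0 : ∫ x, h x = 0) {b : ℝ} (hb : 0 < b)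
    (hle : ∫ x, h x ^ 2 ≤ r ^ n * b ^ 2) :
    Rep n φ (bsize n) (fun ψ => ∫ x, h x * ψ x) (ENNReal.ofReal (8 * D * b)) := by
  set e : Eucl n → ℝ := fun z => h (r • z + c) with he
  have hback : ∀ y, e (r⁻¹ • (y - c)) = h y := fun y => by
    simp only [he]
    rw [smul_smul, mul_inv_cancel₀ hr.ne', one_smul, sub_add_cancel]
  have hInt : ∀ F : Eucl n → ℝ, r ^ n * ∫ z, F (r • z + c) = ∫ y, F y := fun F => by
    rw [← integral_scale c hr fun z => F (r • z + c)]
    congr 1; ext y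
    rw [smul_smul, mul_inv_cancel₀ hr.ne', one_smul, sub_add_cancel]
  have hrn : 0 < r ^ n := by positivity
  have hmp : ∀ F : Eucl n → ℝ, Integrable F → Integrable fun z => F (r • z + c) := fun F hF =>
    (hF.comp_add_right c).comp_smul hr.ne'
  have hqmp : Measure.QuasiMeasurePreserving (fun z : Eucl n => r • z + c) volume volume := by
    refine (measurePreserving_add_right volume c).quasiMeasurePreserving.comp
      ⟨measurable_const_smul r, ?_⟩
    rw [Measure.map_addHaar_smul _ hr.ne']
    exact Measure.smul_absolutelyContinuous
  have hRep := H.memLp hD hr (h := e) (hm.comp_quasiMeasurePreserving hqmp) (fun z hz => ?_) ?_ hb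
    (eLpNorm_le_of_integral_sq (hmp _ hi) hb.le ?_)
  · refine hRep.congr fun ψ _ => ?_
    unfold scaled
    simp_rw [hback]
  · have := hs _ hz
    rw [mem_closedBall, dist_eq_norm, add_sub_cancel_right, norm_smul, Real.norm_of_nonneg hr.le] at this
    nlinarith
  · have := hInt h
    rw [h0] at this
    exact (mul_eq_zero.1 this).resolve_left hrn.ne'
  · have := hInt fun x => h x ^ 2
    rw [← this] at hle
    exact le_of_mul_le_mul_left hle hrn

/-- Representation of integration against bounded functions. -/
theorem SmoothRep.bounded {φ : Eucl n → ℝ} {c : Eucl n} {r D : ℝ} (hD : 0 ≤ D) (hr : 0 < r)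
    (H : SmoothRep n φ c r D) {h : Eucl n → ℝ} (hm : AEStronglyMeasurable h volume)
    (hs : ∀ x, h x ≠ 0 → x ∈ closedBall c r) (h0 : ∫ x, h x = 0) {b : ℝ} (hb : 0 ≤ b)
    (hle : ∀ᵐ x, |h x| ≤ b) :
    Rep n φ (bsize n) (fun ψ => ∫ x, h x * ψ x)
      (ENNReal.ofReal (8 * (omegaVol n + 1) * (D * b))) := by
  have hω := omegaVol_pos (n := n)
  rcases hb.eq_or_lt with rfl | hb
  · refine (rep_zero φ _ _).congr fun ψ _ => ?_
    refine integral_eq_zero_of_ae ?_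
    filter_upwards [hle] with x hx
    simp [abs_nonpos_iff.1 hx]
  have hind : ∀ᵐ x, h x ^ 2 ≤ (closedBall c r).indicator (fun _ => b ^ 2) x := by
    filter_upwards [hle] with x hx
    by_cases h' : x ∈ closedBall c r
    · rw [Set.indicator_of_mem h']
      exact sq_le_sq' (by linarith [neg_abs_le (h x)]) (by linarith [le_abs_self (h x)])
    · rw [Set.indicator_of_notMem h']
      have : h x = 0 := by by_contra h''; exact h' (hs x h'')
      simp [this]
  have hI : Integrable ((closedBall c r).indicator fun _ : Eucl n => b ^ 2) :=
    (integrable_indicator_iff measurableSet_closedBall).2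
      (integrableOn_const measure_closedBall_lt_top.ne)
  have hi : Integrable fun x => h x ^ 2 := by
    refine hI.mono' (hm.pow 2) ?_
    filter_upwards [hind] with x hx
    rwa [Real.norm_of_nonneg (sq_nonneg _)]
  have hle2 : ∫ x, h x ^ 2 ≤ r ^ n * ((omegaVol n + 1) * b) ^ 2 := by
    refine (integral_mono_ae hi hI hind).trans ?_
    rw [integral_indicator measurableSet_closedBall, setIntegral_const, Measure.real, volume_real_closedBall _ hr.le,
      smul_eq_mul]
    have : 0 ≤ r ^ n * b ^ 2 * (omegaVol n ^ 2 + omegaVol n + 1) := by positivity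
    nlinarith
  refine (H.integral hD hr hm hi hs h0 (b := (omegaVol n + 1) * b) (by positivity) hle2).mono
    (ENNReal.ofReal_le_ofReal (le_of_eq (by ring)))

theorem exists_rep_adm (hn : 2 ≤ n) {φ : Eucl n → ℝ} {A : ℝ} (hφ : KernelBound n φ A) :
    ∃ C : ℝ, 0 < C ∧ ∀ (c : Eucl n) (r : ℝ), 0 < r → Adm c r → ∀ (h : Eucl n → ℝ) (b : ℝ), 0 ≤ b →
      AEStronglyMeasurable h volume → (∀ x, h x ≠ 0 → x ∈ closedBall c r) → ∫ x, h x = 0 →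
      (∀ᵐ x, |h x| ≤ b) →
      Rep n φ (bsize n) (fun ψ => ∫ x, h x * ψ x) (ENNReal.ofReal (C * (r ^ n * b / LL c r))) := by
  obtain ⟨C, hC, H⟩ := exists_smoothRep_adm hn hφ
  have hω := omegaVol_pos (n := n)
  refine ⟨8 * (omegaVol n + 1) * C, by positivity, fun c r hr hadm h b hb hm hs h0 hle => ?_⟩
  have hL : 0 ≤ LL c r := by
    have e1 := one_le_log_exp_add (norm_nonneg c)
    have e2 := one_le_log_exp_add (inv_nonneg.2 hr.le)
    unfold LL; linarith
  refine ((H c r hr hadm).bounded (by positivity) hr hm hs h0 hb hle).mono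
    (ENNReal.ofReal_le_ofReal (le_of_eq (by ring)))

theorem SobLe.integral_sq_pd_affW {v : Eucl n → ℝ} {a : ℝ} (ha : 0 < a)
    (hv : SobLe n 4 v (ENNReal.ofReal a)) (c : Eucl n) {r : ℝ} (hr : 0 < r) (i : Fin n) :
    ∫ x, pd n (affW c r v) i x ^ 2 ≤ r ^ n * a ^ 2 := by
  simp_rw [pd_affW hv.contDiff hr c]
  rw [integral_scale c hr (fun y => pd n v i y ^ 2)]
  gcongr
  exact integral_sq_le_of_eLpNorm (pd_continuous hv.contDiff i).aestronglyMeasurable ha.le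
      (hv.norm_pd_le i)

theorem integral_sq_testSize {ψ : Eucl n → ℝ} (hψ : IsTest n ψ) :
    ∫ x, ψ x ^ 2 ≤ (testSize n ψ : ℝ) ^ 2 := by
  refine integral_sq_le_of_eLpNorm hψ.1.continuous.aestronglyMeasurable (testSize n ψ).coe_nonneg ?_
  rw [ENNReal.ofReal_coe_nnreal]
  exact (testSize_spec hψ).2.2.2

/-- The pair obtained from a logarithmically growing field on a large ball around the origin. -/
theorem rep_pair_large {φ : Eucl n → ℝ} {A : ℝ} (hn : 2 ≤ n) (hφ : KernelBound n φ A) {D : ℝ}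
    (hD : 1 ≤ D) :
    ∃ C : ℝ, 0 < C ∧ ∀ (r l : ℝ), 1 ≤ r → 1 ≤ l → l ≤ r → ∀ (i i' : Fin n) (V : Eucl n → ℝ),
      RotField n i i' V D → (∀ x, |pd n V i' x| ≤ l * (1 + D) ∧ |pd n V i x| ≤ l * (1 + D)) →
      ∀ (v : Eucl n → ℝ) (a : ℝ), 0 < a → SobLe n 4 v (ENNReal.ofReal a) →
        Rep n φ (bsize n) (fun ψ => ∫ x, (pd n (affW 0 r v) i x * pd n V i' x -
          pd n (affW 0 r v) i' x * pd n V i x) * ψ x) (ENNReal.ofReal (C * (r ^ n * a))) := by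
  obtain ⟨C, hC, hG⟩ := exists_goodPair_cost hφ
  refine ⟨C * D + (1 + D), by positivity, fun r l hr hl hlr i i' V hV hVb v a ha hv => ?_⟩
  have hr0 : 0 < r := by linarith
  have hl0 : 0 < l := by linarith
  obtain ⟨g1, g2⟩ := hG i i' V D hV (by linarith) v a ha hv 0 r hr0
  have := rep_pair (B := bsize n) (c := ENNReal.ofReal ((C * D + (1 + D)) * (r ^ n * a))) g1
    (g2.trans (ENNReal.ofReal_le_ofReal (by
      have : 0 ≤ (1 + D) * (r ^ n * a) := by positivity
      nlinarith))) fun ψ hψ => ?_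
  · exact this.congr fun ψ _ => (pairDist_gradF_rotF _ _ _ _ _).symm
  refine enorm_le_ofReal_mul ?_
  rw [pairDist_gradF_rotF]
  have hw := affW_contDiff hv.contDiff 0 r
  have hwc := affW_hasCompactSupport hv 0 hr0
  set S : ℝ := ((testSize n ψ : ℝ≥0) : ℝ) with hS
  have hS0 : 0 ≤ S := (testSize n ψ).coe_nonneg
  set s : ℝ := (l * a)⁻¹ with hs
  have hs0 : 0 < s := by positivity
  have hu2 : ∀ j, Integrable fun x => pd n (affW 0 r v) j x ^ 2 := fun j =>
    ((pd_continuous hw j).pow 2).integrable_of_hasCompactSupport (by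
      simp_rw [pow_two]; exact (pd_hasCompactSupport hwc j).mul_right)
  have hψ2 : Integrable fun x => ψ x ^ 2 :=
    (hψ.1.continuous.pow 2).integrable_of_hasCompactSupport (by
      simp_rw [pow_two]; exact hψ.2.mul_right)
  have hyoung : ∀ u p : ℝ, |u| * |p| ≤ (s * u ^ 2 + s⁻¹ * p ^ 2) / 2 := by
    intro u p
    have e : s * s⁻¹ = 1 := mul_inv_cancel₀ hs0.ne'
    have h1 : 0 ≤ s * (|u| - s⁻¹ * |p|) ^ 2 := by positivity
    have e2 : s * (|u| - s⁻¹ * |p|) ^ 2 =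
        s * |u| ^ 2 - 2 * (s * s⁻¹) * (|u| * |p|) + (s * s⁻¹) * s⁻¹ * |p| ^ 2 := by ring
    rw [e2, e, sq_abs, sq_abs] at h1
    linarith
  set M : ℝ := l * (1 + D) with hM
  have hM0 : 0 ≤ M := by positivity
  have hI : ∫ x, M * ((s * pd n (affW 0 r v) i x ^ 2 + s⁻¹ * ψ x ^ 2) / 2 +
      (s * pd n (affW 0 r v) i' x ^ 2 + s⁻¹ * ψ x ^ 2) / 2) ≤
      M * ((s * (r ^ n * a ^ 2) + s⁻¹ * S ^ 2) / 2 + (s * (r ^ n * a ^ 2) + s⁻¹ * S ^ 2) / 2) := by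
    rw [integral_const_mul, integral_add, integral_div, integral_div, integral_add, integral_add,
      integral_const_mul, integral_const_mul, integral_const_mul]
    · gcongr
      · exact hv.integral_sq_pd_affW ha 0 hr0 i
      · exact integral_sq_testSize hψ
      · exact hv.integral_sq_pd_affW ha 0 hr0 i'
      · exact integral_sq_testSize hψ
    · exact (hu2 _).const_mul _
    · exact hψ2.const_mul _
    · exact (hu2 _).const_mul _
    · exact hψ2.const_mul _
    · exact (((hu2 _).const_mul _).add (hψ2.const_mul _)).div_const _
    · exact (((hu2 _).const_mul _).add (hψ2.const_mul _)).div_const _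
  rw [← Real.norm_eq_abs]
  refine (norm_integral_le_of_norm_le ?_ (ae_of_all _ fun x => ?_)).trans (hI.trans ?_)
  · exact ((((hu2 _).const_mul _).add (hψ2.const_mul _)).div_const _).add
      ((((hu2 _).const_mul _).add (hψ2.const_mul _)).div_const _) |>.const_mul _
  · rw [norm_mul, Real.norm_eq_abs, Real.norm_eq_abs]
    have h1 : |pd n (affW 0 r v) i x * pd n V i' x - pd n (affW 0 r v) i' x * pd n V i x| ≤
        |pd n (affW 0 r v) i x| * M + |pd n (affW 0 r v) i' x| * M := by
      refine (abs_sub _ _).trans ?_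
      rw [abs_mul, abs_mul]
      gcongr
      exacts [(hVb x).1, (hVb x).2]
    calc _ ≤ (|pd n (affW 0 r v) i x| * M + |pd n (affW 0 r v) i' x| * M) * |ψ x| := by gcongr
      _ = M * (|pd n (affW 0 r v) i x| * |ψ x| + |pd n (affW 0 r v) i' x| * |ψ x|) := by ring
      _ ≤ _ := by gcongr <;> exact hyoung _ _
  · have hl2 : l ^ 2 ≤ r ^ n :=
      (pow_le_pow_left₀ hl0.le hlr 2).trans (pow_le_pow_right₀ hr hn)
    have e : M * ((s * (r ^ n * a ^ 2) + s⁻¹ * S ^ 2) / 2 + (s * (r ^ n * a ^ 2) + s⁻¹ * S ^ 2) / 2) =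
        (1 + D) * (r ^ n * a) + (1 + D) * (l ^ 2 * a) * S ^ 2 := by
      rw [hM, hs]; field_simp
      ring
    have e3 : (1 + D) * (l ^ 2 * a) * S ^ 2 ≤ (1 + D) * (r ^ n * a) * S ^ 2 := by gcongr
    have e4 : ((bsize n ψ : ℝ≥0) : ℝ) = (S + 1) * (2 * S + 2) := by
      simp [bsize, hS]
    rw [e, e4]
    have e5 : 0 ≤ (1 + D) * (r ^ n * a) := by positivity
    have e6 : 0 ≤ (S + 1) * (2 * S + 2) * (C * D * (r ^ n * a)) := by positivity
    nlinarith [mul_nonneg e5 hS0, mul_nonneg e5 (mul_nonneg hS0 hS0)]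

theorem sum_two_pow_le (K : ℕ) : ∑ k ∈ Finset.range (K + 1), (2 : ℝ) ^ (k + 1) ≤ 4 * 2 ^ K := by
  induction K with
  | zero => norm_num
  | succ K ih => rw [Finset.sum_range_succ, pow_succ 2 (K + 1), pow_succ 2 K]; linarith

theorem exists_smoothRep_large (hn : 2 ≤ n) {φ : Eucl n → ℝ} {A : ℝ} (hφ : KernelBound n φ A) :
    ∃ C : ℝ, 0 < C ∧ ∀ r : ℝ, 1 ≤ r → SmoothRep n φ 0 r (C * (r ^ n / (1 + log r))) := by
  obtain ⟨D, hD, hF⟩ := exists_rotFields hn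
  obtain ⟨C1, hC1, h1⟩ := rep_pair_large hn hφ hD
  obtain ⟨C2, hC2, h2⟩ := exists_smoothRep_of_pd n
  obtain ⟨C3, hC3, h3⟩ := exists_smoothRep hn hφ
  refine ⟨C2 * (2 * (C1 + 8 * C3 * (2 * D) * 2 ^ n * 2)), by positivity, fun r hr => ?_⟩
  have hr0 : 0 < r := by linarith
  rw [mul_assoc]
  refine h2 φ 0 r _ hr0 fun i v a ha hv => ?_
  obtain ⟨K, hK1, hK2⟩ := exists_nat_pow_near (x := r) (y := (2 : ℝ)) hr (by norm_num)
  obtain ⟨i', -, -, -, hT⟩ := hF i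
  obtain ⟨V, hV, -, U, hU, hUb, hVU⟩ := hT K
  set l : ℝ := K + 1 with hl
  have hl1 : 1 ≤ l := by simp [hl]
  have hlr : l ≤ r := (natCast_add_one_le_two_pow K).trans hK1
  have hlog : 1 + log r ≤ 2 * l := by
    have := log_le_of_le_two_pow hr0 hK2.le
    push_cast at this; linarith
  have hlog0 : 0 ≤ log r := Real.log_nonneg hr
  have hsum : ∀ b x, |∑ k ∈ Finset.range (K + 1), pd n (U k) b x| ≤ l * D := by
    intro b x
    refine (Finset.abs_sum_le_sum_abs _ _).trans
      ((Finset.sum_le_sum fun k _ => (hUb k b x).1).trans ?_)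
    simp [hl]
  have hVb : ∀ x, |pd n V i' x| ≤ l * (1 + D) ∧ |pd n V i x| ≤ l * (1 + D) := by
    intro x
    rw [(hVU x).1, (hVU x).2, abs_neg]
    have e1 := hsum i' x
    have e2 := hsum i x
    refine ⟨(abs_sub _ _).trans ?_, by linarith⟩
    rw [abs_of_pos (by linarith : (0 : ℝ) < K + 1)]
    linarith
  have hP := (h1 r l hr hl1 hlr i i' V hV hVb v a ha hv).const_mul l⁻¹
  have hw := affW_contDiff hv.contDiff 0 r
  have hwc := affW_hasCompactSupport hv 0 hr0
  set w := affW 0 r v with hwdef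
  set E : ℕ → Eucl n → ℝ := fun k x => pd n w i x * pd n (U k) i' x - pd n w i' x * pd n (U k) i x
    with hE
  have hUc : ∀ k b, Continuous (pd n (U k) b) := fun k b =>
    pd_continuous ((hU k).of_le (by norm_num)) b
  have hEc : ∀ k, Continuous (E k) := fun k =>
    ((pd_continuous hw i).mul (hUc k i')).sub ((pd_continuous hw i').mul (hUc k i))
  have hEs : ∀ k, HasCompactSupport (E k) := fun k =>
    (pd_hasCompactSupport hwc i).mul_right.sub (pd_hasCompactSupport hwc i').mul_right
  have hu2 : ∀ j, Integrable fun x => pd n w j x ^ 2 := fun j =>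
    ((pd_continuous hw j).pow 2).integrable_of_hasCompactSupport (by
      simp_rw [pow_two]; exact (pd_hasCompactSupport hwc j).mul_right)
  have hE2i : ∀ k, Integrable fun x => E k x ^ 2 := fun k =>
    ((hEc k).pow 2).integrable_of_hasCompactSupport (by
      simp_rw [pow_two]; exact (hEs k).mul_right)
  have hE2 : ∀ k, ∫ x, E k x ^ 2 ≤ (2 * D) ^ 2 * (r ^ n * a ^ 2) := by
    intro k
    have : ∀ x, E k x ^ 2 ≤ 2 * D ^ 2 * (pd n w i x ^ 2 + pd n w i' x ^ 2) := by
      intro x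
      have e1 := sq_le_sq' (by linarith [neg_abs_le (pd n (U k) i' x), (hUb k i' x).1])
        ((le_abs_self _).trans (hUb k i' x).1)
      have e2 := sq_le_sq' (by linarith [neg_abs_le (pd n (U k) i x), (hUb k i x).1])
        ((le_abs_self _).trans (hUb k i x).1)
      have e3 := mul_le_mul_of_nonneg_left e1 (sq_nonneg (pd n w i x))
      have e4 := mul_le_mul_of_nonneg_left e2 (sq_nonneg (pd n w i' x))
      simp only [hE]
      nlinarith [sq_nonneg (pd n w i x * pd n (U k) i' x + pd n w i' x * pd n (U k) i x)]
    refine (integral_mono (hE2i k) (((hu2 i).add (hu2 i')).const_mul _) this).trans ?_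
    rw [integral_const_mul]
    simp only [Pi.add_apply]
    rw [integral_add (hu2 i) (hu2 i')]
    have e1 := hv.integral_sq_pd_affW ha 0 hr0 i
    have e2 := hv.integral_sq_pd_affW ha 0 hr0 i'
    rw [← hwdef] at e1 e2
    have : 0 ≤ D ^ 2 := sq_nonneg D
    nlinarith
  have hEr : ∀ k ∈ Finset.range (K + 1), Rep n φ (bsize n) (fun ψ => ∫ x, E k x * ψ x)
      (ENNReal.ofReal (8 * C3 * (2 * D) * a * (2 * r) ^ n / (2 * r) * 2 ^ (k + 1))) := by
    intro k hk
    rw [Finset.mem_range, Nat.lt_succ_iff] at hk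
    set ρ : ℝ := 2 ^ (k + 1) with hρ
    have hρ0 : 0 < ρ := by positivity
    have hρr : ρ ≤ 2 * r := by
      rw [hρ, pow_succ]
      have : (2 : ℝ) ^ k ≤ 2 ^ K := pow_le_pow_right₀ (by norm_num) hk
      linarith
    have hy : 1 ≤ 2 * r / ρ := by rwa [le_div_iff₀ hρ0, one_mul]
    refine ((h3 0 ρ hρ0).integral (by positivity) hρ0 (hEc k).aestronglyMeasurable (hE2i k)
      (fun x hx => ?_) (integral_curl_eq_zero hw hwc (hU k) i i')
      (b := 2 * D * a * ((2 * r / ρ) ^ n / (2 * r / ρ))) (by positivity) ((hE2 k).trans ?_)).mono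
      (ENNReal.ofReal_le_ofReal (le_of_eq ?_))
    · rw [mem_closedBall, dist_zero_right]
      by_cases hx' : pd n (U k) i' x = 0
      · exact (hUb k i x).2 fun h' => hx (by simp [hE, hx', h'])
      · exact (hUb k i' x).2 hx'
    · obtain ⟨m, rfl⟩ := Nat.exists_eq_add_of_le hn
      have e : (2 * D) ^ 2 * (r ^ (2 + m) * a ^ 2) ≤
          (2 * D * a) ^ 2 * (2 * r) ^ (2 + m) * (2 * r / ρ) ^ m := by
        have a1 : r ^ (2 + m) ≤ (2 * r) ^ (2 + m) := pow_le_pow_left₀ hr0.le (by linarith) _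
        have a2 : 1 ≤ (2 * r / ρ) ^ m := one_le_pow₀ hy
        calc _ = (2 * D * a) ^ 2 * r ^ (2 + m) * 1 := by ring
          _ ≤ _ := by gcongr
      refine e.trans (le_of_eq ?_)
      obtain ⟨y, hy'⟩ : ∃ y, y = 2 * r / ρ := ⟨_, rfl⟩
      have hyr : 2 * r = y * ρ := by rw [hy']; field_simp
      have hy0 : y ≠ 0 := by rw [hy']; positivity
      rw [← hy', hyr]
      rw [show y ^ (2 + m) / y = y ^ (1 + m) by
        rw [show 2 + m = (1 + m) + 1 by ring, pow_succ _ (1 + m)]; field_simp]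
      ring
    · rw [div_pow]; field_simp
  have hS := (rep_finset_sum _ hEr
    (ENNReal.sum_lt_top.2 fun k _ => ENNReal.ofReal_lt_top).ne).const_mul l⁻¹
  have hPS := hP.add hS (ENNReal.mul_ne_top ENNReal.ofReal_ne_top ENNReal.ofReal_ne_top)
    (ENNReal.mul_ne_top ENNReal.ofReal_ne_top
      ((ENNReal.sum_lt_top.2 fun k _ => ENNReal.ofReal_lt_top).ne))
  refine (hPS.congr fun ψ hψ => ?_).mono ?_
  · have hVc : ∀ b, Continuous (pd n V b) := fun b =>
      pd_continuous (hV.contDiff.of_le (by norm_num)) b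
    have i1 : Integrable fun x => (pd n w i x * pd n V i' x - pd n w i' x * pd n V i x) * ψ x :=
      ((((pd_continuous hw i).mul (hVc i')).sub ((pd_continuous hw i').mul (hVc i))).mul
        hψ.1.continuous).integrable_of_hasCompactSupport hψ.2.mul_left
    have i2 : ∀ k ∈ Finset.range (K + 1), Integrable fun x => E k x * ψ x := fun k _ =>
      ((hEc k).mul hψ.1.continuous).integrable_of_hasCompactSupport hψ.2.mul_left
    rw [← integral_finsetSum _ i2, ← mul_add, ← integral_add i1 (integrable_finsetSum _ i2),
      ← integral_const_mul]
    congr 1; ext x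
    rw [(hVU x).1, (hVU x).2, ← Finset.sum_mul]
    simp only [hE, Finset.sum_sub_distrib, ← Finset.mul_sum]
    field_simp
    ring
  · have hnn : ∀ k : ℕ, 0 ≤ 8 * C3 * (2 * D) * a * (2 * r) ^ n / (2 * r) * 2 ^ (k + 1) :=
      fun k => by positivity
    rw [← ENNReal.ofReal_sum_of_nonneg fun k _ => hnn k, abs_of_pos (by positivity),
      ← ENNReal.ofReal_mul (by positivity), ← ENNReal.ofReal_mul (by positivity),
      ← ENNReal.ofReal_add (by positivity)
        (mul_nonneg (by positivity) (Finset.sum_nonneg fun k _ => hnn k))]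
    refine ENNReal.ofReal_le_ofReal ?_
    rw [← Finset.mul_sum, ← mul_add]
    have e1 : ∑ k ∈ Finset.range (K + 1), (2 : ℝ) ^ (k + 1) ≤ 2 * (2 * r) :=
      (sum_two_pow_le K).trans (by linarith)
    have e2 : l⁻¹ ≤ 2 / (1 + log r) := by
      rw [inv_eq_one_div, div_le_div_iff₀ (by linarith) (by linarith)]; linarith
    have e3 : 0 ≤ C1 * (r ^ n * a) + 8 * C3 * (2 * D) * a * (2 * r) ^ n / (2 * r) *
        (2 * (2 * r)) := by positivity
    calc _ ≤ 2 / (1 + log r) * (C1 * (r ^ n * a) + 8 * C3 * (2 * D) * a * (2 * r) ^ n / (2 * r) *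
        (2 * (2 * r))) := by gcongr
      _ = _ := by rw [mul_pow]; field_simp

theorem exists_rep_large (hn : 2 ≤ n) {φ : Eucl n → ℝ} {A : ℝ} (hφ : KernelBound n φ A) :
    ∃ C : ℝ, 0 < C ∧ ∀ (r : ℝ), 1 ≤ r → ∀ (h : Eucl n → ℝ) (b : ℝ), 0 ≤ b →
      AEStronglyMeasurable h volume → (∀ x, h x ≠ 0 → x ∈ closedBall 0 r) → ∫ x, h x = 0 →
      (∀ᵐ x, |h x| ≤ b) →
      Rep n φ (bsize n) (fun ψ => ∫ x, h x * ψ x)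
        (ENNReal.ofReal (C * (r ^ n * b / (1 + log r)))) := by
  obtain ⟨C, hC, H⟩ := exists_smoothRep_large hn hφ
  have hω := omegaVol_pos (n := n)
  refine ⟨8 * (omegaVol n + 1) * C, by positivity, fun r hr h b hb hm hs h0 hle => ?_⟩
  have hlog0 : 0 ≤ log r := Real.log_nonneg hr
  refine ((H r hr).bounded (by positivity) (by linarith) hm hs h0 hb hle).mono
    (ENNReal.ofReal_le_ofReal (le_of_eq (by ring)))

/-- The tent function. -/
def tent (s : ℝ) : ℝ := max 0 (1 - |s|)

theorem tent_nonneg (s : ℝ) : 0 ≤ tent s := le_max_left _ _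

theorem tent_le_one (s : ℝ) : tent s ≤ 1 := max_le zero_le_one (by linarith [abs_nonneg s])

theorem tent_continuous : Continuous tent := by unfold tent; fun_prop

theorem abs_tent_sub_le (s t : ℝ) : |tent s - tent t| ≤ |s - t| := by
  unfold tent
  rw [max_comm 0, max_comm 0]
  refine ((abs_max_sub_max_le_abs _ _ _).trans_eq ?_).trans
    ((abs_abs_sub_abs_le t s).trans_eq (abs_sub_comm t s))
  rw [show 1 - |s| - (1 - |t|) = |t| - |s| by ring]

theorem tent_eq_zero {s : ℝ} (h : 1 ≤ |s|) : tent s = 0 := max_eq_left (by linarith)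

theorem tent_neg (s : ℝ) : tent (-s) = tent s := by unfold tent; rw [abs_neg]

theorem tent_refine_of_nonneg {s : ℝ} (hs : 0 ≤ s) :
    tent s = 1 / 2 * tent (2 * s + 1) + tent (2 * s) + 1 / 2 * tent (2 * s - 1) := by
  rw [tent_eq_zero (s := 2 * s + 1) (by rw [abs_of_nonneg (by linarith)]; linarith)]
  unfold tent
  rw [abs_of_nonneg hs, abs_of_nonneg (show 0 ≤ 2 * s by linarith)]
  rcases abs_cases (2 * s - 1) with h3 | h3 <;> rw [h3.1] <;>
    rcases max_cases 0 (1 - s) with h4 | h4 <;> rw [h4.1] <;>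
    rcases max_cases 0 (1 - 2 * s) with h6 | h6 <;> rw [h6.1]
  · rw [max_eq_left (by linarith)]; linarith
  · linarith [h3.2, h4.2, h6.2]
  · rw [max_eq_right (by linarith)]; linarith
  · rw [max_eq_right (by linarith)]; linarith
  · linarith [h3.2, h4.2, h6.2]
  · linarith [h3.2, h4.2, h6.2]
  · rw [max_eq_right (by linarith)]; linarith
  · rw [max_eq_right (by linarith)]; linarith

theorem tent_refine (s : ℝ) :
    tent s = 1 / 2 * tent (2 * s + 1) + tent (2 * s) + 1 / 2 * tent (2 * s - 1) := by
  rcases le_total 0 s with hs | hs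
  · exact tent_refine_of_nonneg hs
  · have h := tent_refine_of_nonneg (neg_nonneg.2 hs)
    rw [tent_neg, show 2 * -s + 1 = -(2 * s - 1) by ring, show 2 * -s = -(2 * s) by ring,
      show -(2 * s) - 1 = -(2 * s + 1) by ring, tent_neg, tent_neg, tent_neg] at h
    linarith

/-- A dyadic scale together with a lattice point. -/
abbrev Node (n : ℕ) := ℤ × (Fin n → ℤ)

/-- The size of a node. -/
def Node.rad (σ : Node n) : ℝ := ((2 : ℝ) ^ σ.1)⁻¹

/-- The centre of a node. -/
def Node.ctr (σ : Node n) : Eucl n := WithLp.toLp 2 fun i => σ.rad * σ.2 i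

theorem Node.rad_pos (σ : Node n) : 0 < σ.rad := by unfold Node.rad; positivity

/-- The tensor tent at the origin. -/
def tent0 (n : ℕ) (x : Eucl n) : ℝ := ∏ i, tent (x i)

/-- The hat function of a node. -/
def hatN (σ : Node n) (x : Eucl n) : ℝ := tent0 n (σ.rad⁻¹ • (x - σ.ctr))

theorem hatN_apply (σ : Node n) (x : Eucl n) : hatN σ x = ∏ i, tent (2 ^ σ.1 * x i - σ.2 i) := by
  unfold hatN tent0
  refine Finset.prod_congr rfl fun i _ => ?_
  congr 1
  have : σ.rad ≠ 0 := σ.rad_pos.ne'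
  simp only [PiLp.smul_apply, PiLp.sub_apply, Node.ctr, smul_eq_mul]
  rw [mul_sub, ← mul_assoc, inv_mul_cancel₀ this, Node.rad, inv_inv, one_mul]

theorem tent0_nonneg (x : Eucl n) : 0 ≤ tent0 n x := Finset.prod_nonneg fun _ _ => tent_nonneg _

theorem tent0_le_one (x : Eucl n) : tent0 n x ≤ 1 :=
  Finset.prod_le_one (fun _ _ => tent_nonneg _) fun _ _ => tent_le_one _

theorem tent0_continuous : Continuous (tent0 n) :=
  continuous_finsetProd _ fun i _ => tent_continuous.comp (by fun_prop)

theorem abs_coord_le (x : Eucl n) (i : Fin n) : |x i| ≤ ‖x‖ := by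
  have := PiLp.norm_apply_le x i
  rwa [Real.norm_eq_abs] at this

theorem abs_prod_sub_prod_le {ι : Type*} (s : Finset ι) (a b : ι → ℝ)
    (ha : ∀ i, 0 ≤ a i ∧ a i ≤ 1) (hb : ∀ i, 0 ≤ b i ∧ b i ≤ 1) :
    |∏ i ∈ s, a i - ∏ i ∈ s, b i| ≤ ∑ i ∈ s, |a i - b i| := by
  classical
  induction s using Finset.induction_on with
  | empty => simp
  | insert j s hj ih =>
    rw [Finset.prod_insert hj, Finset.prod_insert hj, Finset.sum_insert hj]
    have e : a j * ∏ i ∈ s, a i - b j * ∏ i ∈ s, b i =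
        (a j - b j) * ∏ i ∈ s, a i + b j * (∏ i ∈ s, a i - ∏ i ∈ s, b i) := by ring
    rw [e]
    refine (abs_add_le _ _).trans (add_le_add ?_ ?_)
    · rw [abs_mul, abs_of_nonneg (Finset.prod_nonneg fun i _ => (ha i).1)]
      exact mul_le_of_le_one_right (abs_nonneg _)
        (Finset.prod_le_one (fun i _ => (ha i).1) fun i _ => (ha i).2)
    · rw [abs_mul, abs_of_nonneg (hb j).1]
      exact (mul_le_of_le_one_left (abs_nonneg _) (hb j).2).trans ih

theorem abs_tent0_sub_le (x y : Eucl n) : |tent0 n x - tent0 n y| ≤ n * ‖x - y‖ := by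
  refine (abs_prod_sub_prod_le _ _ _ (fun i => ⟨tent_nonneg _, tent_le_one _⟩)
    fun i => ⟨tent_nonneg _, tent_le_one _⟩).trans ?_
  refine (Finset.sum_le_sum fun i _ => (abs_tent_sub_le (x i) (y i)).trans
    (abs_coord_le (x - y) i)).trans ?_
  simp

theorem tent0_supp (x : Eucl n) (hx : tent0 n x ≠ 0) : ‖x‖ ≤ n := by
  have := norm_le_of_coord_le (x := x) (ρ := 1) fun i => ?_
  · simpa using this
  · by_contra h
    push Not at h
    exact Finset.prod_ne_zero_iff.1 hx i (Finset.mem_univ i) (tent_eq_zero h.le)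

theorem tent0_hasCompactSupport : HasCompactSupport (tent0 n) :=
  HasCompactSupport.of_support_subset_isCompact (isCompact_closedBall (0 : Eucl n) n)
    fun x hx => by simpa using tent0_supp x hx

/-- The mass of the unit hat. -/
def hatMass (n : ℕ) : ℝ := ∫ x, tent0 n x

theorem hatMass_pos : 0 < hatMass n := by
  refine (tent0_continuous).integral_pos_of_hasCompactSupport_nonneg_nonzero tent0_hasCompactSupport
    tent0_nonneg (x := 0) ?_
  simp [tent0, tent]

theorem hatN_nonneg (σ : Node n) (x : Eucl n) : 0 ≤ hatN σ x := tent0_nonneg _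

theorem hatN_le_one (σ : Node n) (x : Eucl n) : hatN σ x ≤ 1 := tent0_le_one _

theorem hatN_continuous (σ : Node n) : Continuous (hatN σ) :=
  tent0_continuous.comp (by fun_prop)

theorem integral_hatN (σ : Node n) : ∫ x, hatN σ x = σ.rad ^ n * hatMass n :=
  integral_scale σ.ctr σ.rad_pos (tent0 n)

theorem integral_hatN_pos (σ : Node n) : 0 < ∫ x, hatN σ x := by
  rw [integral_hatN]
  have := σ.rad_pos
  have := hatMass_pos (n := n)
  positivity

theorem hatN_supp (σ : Node n) (x : Eucl n) (hx : hatN σ x ≠ 0) :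
    x ∈ closedBall σ.ctr (n * σ.rad) := by
  have h := tent0_supp _ hx
  rw [norm_smul, norm_inv, Real.norm_of_nonneg σ.rad_pos.le, inv_mul_le_iff₀ σ.rad_pos] at h
  rw [mem_closedBall, dist_eq_norm]
  linarith

theorem hatN_hasCompactSupport (σ : Node n) : HasCompactSupport (hatN σ) :=
  HasCompactSupport.of_support_subset_isCompact (isCompact_closedBall σ.ctr (n * σ.rad))
    (hatN_supp σ)

theorem integrable_hatN (σ : Node n) : Integrable (hatN σ) :=
  (hatN_continuous σ).integrable_of_hasCompactSupport (hatN_hasCompactSupport σ)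

theorem integrable_mul_of_hasCompactSupport {f u : Eucl n → ℝ} (hf : LocallyIntegrable f volume)
    (hu : Continuous u) (hc : HasCompactSupport u) : Integrable fun x => f x * u x := by
  simpa [mul_comm] using hf.integrable_smul_left_of_hasCompactSupport hu hc

theorem integrable_mul_hatN {f : Eucl n → ℝ} (hf : LocallyIntegrable f volume) (σ : Node n) :
    Integrable fun x => f x * hatN σ x :=
  integrable_mul_of_hasCompactSupport hf (hatN_continuous σ) (hatN_hasCompactSupport σ)

/-- The weight of a child. -/
def cw (c : Fin n → Fin 3) : ℝ≥0 := ∏ i, if c i = 1 then 1 else 1 / 2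

/-- The children of a node. -/
def Node.child (σ : Node n) (c : Fin n → Fin 3) : Node n :=
  (σ.1 + 1, fun i => 2 * σ.2 i + ((c i : ℕ) - 1))

theorem Node.child_rad (σ : Node n) (c : Fin n → Fin 3) : (σ.child c).rad = σ.rad / 2 := by
  unfold Node.child Node.rad
  rw [zpow_add₀ (by norm_num)]
  simp [div_eq_mul_inv, mul_comm]

theorem hatN_refine (σ : Node n) (x : Eucl n) :
    hatN σ x = ∑ c : Fin n → Fin 3, (cw c : ℝ) * hatN (σ.child c) x := by
  have h1 : ∀ i, tent (2 ^ σ.1 * x i - σ.2 i) = ∑ j : Fin 3,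
      ((if j = 1 then 1 else 1 / 2 : ℝ≥0) : ℝ) *
        tent (2 ^ (σ.1 + 1) * x i - ((2 * σ.2 i + (((j : ℕ) : ℤ) - 1) : ℤ) : ℝ)) := by
    intro i
    rw [tent_refine, Fin.sum_univ_three, zpow_add₀ (by norm_num)]
    simp
    ring_nf
  rw [hatN_apply]
  simp_rw [h1]
  rw [Finset.prod_univ_sum, Fintype.piFinset_univ]
  refine Finset.sum_congr rfl fun c _ => ?_
  rw [hatN_apply, Finset.prod_mul_distrib, cw, NNReal.coe_prod]
  rfl

theorem Node.dist_child_ctr_le (σ : Node n) (c : Fin n → Fin 3) :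
    dist (σ.child c).ctr σ.ctr ≤ n * (σ.rad / 2) := by
  rw [dist_eq_norm]
  have hr := σ.rad_pos
  rw [← abs_of_pos (show 0 < σ.rad / 2 by positivity)]
  refine norm_le_of_coord_le fun i => ?_
  simp only [PiLp.sub_apply, Node.ctr, Node.child_rad]
  have : σ.rad / 2 * (((σ.child c).2 i : ℤ) : ℝ) - σ.rad * σ.2 i =
      σ.rad / 2 * (((c i : ℕ) : ℝ) - 1) := by
    simp only [Node.child]; push_cast; ring
  rw [this, abs_mul, abs_of_pos (by positivity)]
  have hc : ((c i : ℕ) : ℝ) ≤ 2 := by exact_mod_cast Nat.lt_succ_iff.1 (c i).2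
  have hc0 : (0 : ℝ) ≤ ((c i : ℕ) : ℝ) := Nat.cast_nonneg _
  have : |((c i : ℕ) : ℝ) - 1| ≤ 1 := abs_le.2 ⟨by linarith, by linarith⟩
  nlinarith

theorem Node.child_ball_subset (σ : Node n) (c : Fin n → Fin 3) {R : ℝ} (hR : n ≤ R) :
    closedBall (σ.child c).ctr (R * (σ.child c).rad) ⊆ closedBall σ.ctr (R * σ.rad) := by
  refine closedBall_subset_closedBall' ?_
  have := σ.dist_child_ctr_le c
  rw [σ.child_rad c]
  nlinarith [σ.rad_pos]

/-- The index of the cube of side `δ` containing a point. -/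
def cubeIdx (δ : ℝ) (y : Eucl n) : Fin n → ℤ := fun i => ⌊y i / δ⌋

theorem measurable_cubeIdx (δ : ℝ) : Measurable (cubeIdx (n := n) δ) := by
  refine measurable_pi_lambda _ fun i => Int.measurable_floor.comp ?_
  exact Continuous.measurable (by fun_prop)

theorem volume_cubeIdx {δ : ℝ} (hδ : 0 < δ) (z : Fin n → ℤ) :
    volume (cubeIdx (n := n) δ ⁻¹' {z}) = ENNReal.ofReal (δ ^ n) := by
  have h : cubeIdx (n := n) δ ⁻¹' {z} = (WithLp.ofLp : Eucl n → Fin n → ℝ) ⁻¹'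
      (Set.pi Set.univ fun i => Set.Ico (δ * z i) (δ * z i + δ)) := by
    ext y
    simp only [Set.mem_preimage, Set.mem_singleton_iff, funext_iff, cubeIdx, Int.floor_eq_iff,
      Set.mem_pi, Set.mem_univ, true_imp_iff, Set.mem_Ico, le_div_iff₀ hδ, div_lt_iff₀ hδ]
    refine forall_congr' fun i => ?_
    rw [mul_comm δ, add_mul, one_mul]
  rw [h, (PiLp.volume_preserving_ofLp (Fin n)).measure_preimage
    (MeasurableSet.univ_pi fun i => measurableSet_Ico).nullMeasurableSet, Real.volume_pi_Ico]
  simp [ENNReal.ofReal_pow hδ.le]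

theorem norm_sub_le_of_cubeIdx {δ : ℝ} (hδ : 0 < δ) {x y : Eucl n}
    (h : cubeIdx δ x = cubeIdx δ y) : ‖x - y‖ ≤ n * δ := by
  rw [← abs_of_pos hδ]
  refine norm_le_of_coord_le fun i => ?_
  have hi : ⌊x i / δ⌋ = ⌊y i / δ⌋ := congrFun h i
  have := Int.abs_sub_lt_one_of_floor_eq_floor hi
  rw [← sub_div, abs_div, abs_of_pos hδ, div_lt_one hδ] at this
  exact this.le

/-- Sampling a nonnegative function at good points of a grid. -/
theorem exists_sampling {δ : ℝ} (hδ : 0 < δ) {G : Eucl n → ℝ≥0∞} (hG : Measurable G) :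
    ∃ Y : Eucl n → Eucl n, Measurable Y ∧ (∀ y, ‖Y y - y‖ ≤ n * δ) ∧
      ∀ R S : ℝ, R + n * δ ≤ S →
        (∫⁻ y in closedBall 0 R, G (Y y)) ≤ ∫⁻ y in closedBall 0 S, G y ∧
        ∀ y, ‖y‖ ≤ R → G (Y y) ≤ (ENNReal.ofReal (δ ^ n))⁻¹ * ∫⁻ y in closedBall 0 S, G y := by
  set Q : (Fin n → ℤ) → Set (Eucl n) := fun z => cubeIdx δ ⁻¹' {z} with hQ
  have hQm : ∀ z, MeasurableSet (Q z) := fun z => measurable_cubeIdx δ (measurableSet_singleton z)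
  have hv : ∀ z, volume (Q z) = ENNReal.ofReal (δ ^ n) := volume_cubeIdx hδ
  have hv0 : ENNReal.ofReal (δ ^ n) ≠ 0 := by simp; positivity
  have : ∀ z, ∃ x ∈ Q z, G x ≤ ⨍⁻ a in Q z, G a ∂volume := fun z =>
    exists_le_setLAverage (by rw [hv]; exact hv0) (by rw [hv]; simp) hG.aemeasurable
  choose P hP hPle using this
  have hPle' : ∀ z, G (P z) ≤ (ENNReal.ofReal (δ ^ n))⁻¹ * ∫⁻ y in Q z, G y := fun z => by
    have := hPle z
    rwa [setLAverage_eq, hv, ENNReal.div_eq_inv_mul] at this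
  have hQS : ∀ R S : ℝ, R + n * δ ≤ S → ∀ y, ‖y‖ ≤ R → Q (cubeIdx δ y) ⊆ closedBall 0 S := by
    intro R S hRS y hy x hx
    rw [mem_closedBall, dist_zero_right]
    have h1 := norm_sub_le_of_cubeIdx hδ (x := x) (y := y) hx
    have h2 := norm_le_norm_add_norm_sub' x y
    linarith
  refine ⟨fun y => P (cubeIdx δ y), (Measurable.of_discrete (f := P)).comp (measurable_cubeIdx δ),
    fun y => norm_sub_le_of_cubeIdx hδ (hP (cubeIdx δ y)), fun R S hRS => ⟨?_, fun y hy => ?_⟩⟩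
  · have hU : (⋃ z, Q z) = Set.univ := by
      ext y; simp [hQ]
    have hd : Pairwise (Function.onFun Disjoint Q) := by
      intro z z' hz
      refine Set.disjoint_left.2 fun y h1 h2 => hz ?_
      rw [← (h1 : cubeIdx δ y = z), ← (h2 : cubeIdx δ y = z')]
    rw [← setLIntegral_univ, ← setLIntegral_univ (fun y => G y), ← hU,
      lintegral_iUnion hQm hd, lintegral_iUnion hQm hd]
    refine ENNReal.tsum_le_tsum fun z => ?_
    rw [Measure.restrict_restrict (hQm z), Measure.restrict_restrict (hQm z)]
    by_cases hz : ∃ y ∈ Q z, ‖y‖ ≤ R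
    · obtain ⟨y, hy, hyR⟩ := hz
      have hsub := hQS R S hRS y hyR
      rw [(hy : cubeIdx δ y = z)] at hsub
      rw [Set.inter_eq_left.2 hsub]
      calc ∫⁻ y in Q z ∩ closedBall 0 R, G (P (cubeIdx δ y))
          ≤ ∫⁻ y in Q z, G (P (cubeIdx δ y)) := lintegral_mono_set Set.inter_subset_left
        _ = ∫⁻ y in Q z, G (P z) := setLIntegral_congr_fun (hQm z) fun y hy => by
            rw [(hy : cubeIdx δ y = z)]
        _ = G (P z) * volume (Q z) := by rw [setLIntegral_const]
        _ ≤ (ENNReal.ofReal (δ ^ n))⁻¹ * (∫⁻ y in Q z, G y) * ENNReal.ofReal (δ ^ n) := by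
            rw [hv]; gcongr; exact hPle' z
        _ = _ := by
            rw [mul_comm, ← mul_assoc, ENNReal.mul_inv_cancel hv0 ENNReal.ofReal_ne_top, one_mul]
    · have : Q z ∩ closedBall 0 R = ∅ := by
        ext y
        simp only [Set.mem_inter_iff, mem_closedBall, dist_zero_right, Set.mem_empty_iff_false,
          iff_false, not_and]
        exact fun h h' => hz ⟨y, h, h'⟩
      rw [this]; simp
  · refine (hPle' _).trans ?_
    gcongr
    exact hQS R S hRS y hy

theorem abs_integral_le_of_ball {F : Eucl n → ℝ} {c : Eucl n} {ρ M : ℝ} (hρ : 0 ≤ ρ)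
    (hs : ∀ y, F y ≠ 0 → y ∈ closedBall c ρ) (hb : ∀ y, |F y| ≤ M) :
    |∫ y, F y| ≤ M * (ρ ^ n * omegaVol n) := by
  rw [← setIntegral_eq_integral_of_forall_compl_eq_zero (s := closedBall c ρ)
    fun y hy => by_contra fun h => hy (hs y h), ← Real.norm_eq_abs, ← volume_real_closedBall c hρ]
  exact norm_setIntegral_le_of_norm_le_const measure_closedBall_lt_top fun y _ => hb y

theorem integrable_of_ball {F : Eucl n → ℝ} (hm : AEStronglyMeasurable F volume) {c : Eucl n}
    {ρ M : ℝ} (hs : ∀ y, F y ≠ 0 → y ∈ closedBall c ρ) (hb : ∀ y, |F y| ≤ M) :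
    Integrable F := by
  refine Integrable.mono' (g := (closedBall c ρ).indicator fun _ => M)
    ((integrable_indicator_iff measurableSet_closedBall).2
      (integrableOn_const measure_closedBall_lt_top.ne)) hm (ae_of_all _ fun y => ?_)
  by_cases h : y ∈ closedBall c ρ
  · rw [Set.indicator_of_mem h]; exact hb y
  · rw [Set.indicator_of_notMem h, by_contra fun h' => h (hs y h')]; simp

theorem integral_dil_sub {φ : Eucl n → ℝ} {A : ℝ} (hφ : KernelBound n φ A) {t : ℝ} (ht : 0 < t)
    (x : Eucl n) : ∫ y, dil n φ t (y - x) = 1 := by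
  unfold dil
  rw [integral_const_mul, integral_scale x ht φ, hφ.int_eq, mul_one, inv_mul_cancel₀ (by positivity)]

/-- A bounded Lipschitz function supported in a ball. -/
structure LipBump (n : ℕ) (R a l : ℝ) (e : Eucl n → ℝ) : Prop where
  supp : ∀ x, e x ≠ 0 → ‖x‖ ≤ R
  bound : ∀ x, |e x| ≤ a
  lip : ∀ x y, |e x - e y| ≤ l * ‖x - y‖

theorem LipBump.continuous {R a l : ℝ} {e : Eucl n → ℝ} (h : LipBump n R a l e) (hl : 0 ≤ l) :
    Continuous e := by
  refine (LipschitzWith.of_dist_le_mul (K := ⟨l, hl⟩) fun x y => ?_).continuous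
  rw [Real.dist_eq, dist_eq_norm]
  exact h.lip x y

theorem LipBump.mono {R a l R' a' l' : ℝ} {e : Eucl n → ℝ} (h : LipBump n R a l e) (hR : R ≤ R')
    (ha : a ≤ a') (hl : l ≤ l') : LipBump n R' a' l' e :=
  ⟨fun x hx => (h.supp x hx).trans hR, fun x => (h.bound x).trans ha,
    fun x y => (h.lip x y).trans (mul_le_mul_of_nonneg_right hl (norm_nonneg _))⟩

/-- Subtracting a sampled mollification. -/
def sampleStep (φ : Eucl n → ℝ) (t : ℝ) (Y : Eucl n → Eucl n) (e : Eucl n → ℝ) (x : Eucl n) : ℝ :=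
  e x - ∫ y, e y * dil n φ t (Y y - x)

theorem norm_sub_le_of_dil_ne {φ : Eucl n → ℝ} {A : ℝ} (hφ : KernelBound n φ A) {t s : ℝ}
    (ht : 0 < t) {Y : Eucl n → Eucl n} (hYs : ∀ y, ‖Y y - y‖ ≤ s) {x y : Eucl n}
    (h : dil n φ t (Y y - x) ≠ 0) : ‖y - x‖ ≤ t + s := by
  have h1 : ‖Y y - x‖ ≤ t := by
    by_contra h'
    exact h (dil_eq_zero hφ ht (not_le.1 h'))
  have h2 := norm_sub_le (Y y - x) (Y y - y)
  rw [show Y y - x - (Y y - y) = y - x by abel] at h2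
  linarith [hYs y]

theorem LipBump.sampleStep {φ : Eucl n → ℝ} {A : ℝ} (hφ : KernelBound n φ A) {C₀ : ℝ}
    (hC₀ : 2 ^ (n + 1) * (n + 1) * A * omegaVol n ≤ C₀) {R a l t δ : ℝ} (ht : 0 < t) (hδ : 0 < δ)
    (hδt : n * δ ≤ t) (ha : 0 ≤ a) (hl : 0 ≤ l) {Y : Eucl n → Eucl n} (hY : Measurable Y)
    (hYs : ∀ y, ‖Y y - y‖ ≤ n * δ) {e : Eucl n → ℝ} (he : LipBump n R a l e) :
    LipBump n (R + 2 * t) (C₀ * (t * l + δ / t * a)) (l + C₀ * a / t) (HlogFact.sampleStep φ t Y e) := by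
  have hA := hφ.pos
  have hω := omegaVol_pos (n := n)
  have hec := he.continuous hl
  have hdc := dil_continuous hφ t
  have hne : ∀ {x y}, dil n φ t (Y y - x) ≠ 0 → ‖y - x‖ ≤ 2 * t := fun h =>
    (norm_sub_le_of_dil_ne hφ ht hYs h).trans (by linarith)
  have hfac : ∀ k : ℕ, A * (t ^ (n + k))⁻¹ * ((2 * t) ^ n * omegaVol n) =
      2 ^ n * A * omegaVol n * (t ^ k)⁻¹ := by
    intro k; rw [mul_pow, pow_add]; field_simp
  have hb : (1 : ℝ) ≤ 2 ^ n := one_le_pow₀ (by norm_num)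
  have hY' : ∀ x, AEStronglyMeasurable (fun y => dil n φ t (Y y - x)) volume := fun x =>
    (hdc.measurable.comp (hY.sub_const x)).aestronglyMeasurable
  refine ⟨fun x hx => ?_, fun x => ?_, fun x x' => ?_⟩
  · by_contra h
    push Not at h
    refine hx ?_
    unfold HlogFact.sampleStep
    have h0 : e x = 0 := by
      by_contra h'
      have := he.supp x h'
      linarith
    rw [h0, integral_eq_zero_of_ae, sub_zero]
    refine ae_of_all _ fun y => ?_
    by_contra h'
    have h1 := he.supp y (left_ne_zero_of_mul h')
    have h2 := hne (right_ne_zero_of_mul h')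
    have h3 := norm_le_norm_add_norm_sub x y
    rw [norm_sub_rev] at h2
    have h4 := norm_sub_norm_le x y
    linarith
  · have hd0 : ∀ y, dil n φ t (y - x) ≠ 0 → y ∈ closedBall x t := fun y h => by
      rw [mem_closedBall, dist_eq_norm]
      by_contra h'
      exact h (dil_eq_zero hφ ht (not_le.1 h'))
    have i1 : Integrable fun y => dil n φ t (y - x) :=
      integrable_of_ball (hdc.comp (continuous_id.sub continuous_const)).aestronglyMeasurable hd0
        fun y => abs_dil_le hφ ht _
    have i2 : Integrable fun y => e y * dil n φ t (y - x) := by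
      refine integrable_of_ball (hec.mul
        (hdc.comp (continuous_id.sub continuous_const))).aestronglyMeasurable
        (fun y h => hd0 y (right_ne_zero_of_mul h)) (M := a * (A * (t ^ n)⁻¹)) fun y => ?_
      rw [abs_mul]
      exact mul_le_mul (he.bound y) (abs_dil_le hφ ht _) (abs_nonneg _) ha
    have i3 : Integrable fun y => e y * dil n φ t (Y y - x) := by
      refine integrable_of_ball (hec.aestronglyMeasurable.mul (hY' x)) (c := x) (ρ := 2 * t)
        (fun y h => ?_) (M := a * (A * (t ^ n)⁻¹)) fun y => ?_
      · rw [mem_closedBall, dist_eq_norm]; exact hne (right_ne_zero_of_mul h)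
      · rw [abs_mul]
        exact mul_le_mul (he.bound y) (abs_dil_le hφ ht _) (abs_nonneg _) ha
    have key : HlogFact.sampleStep φ t Y e x = (∫ y, (e x - e y) * dil n φ t (y - x)) +
        ∫ y, e y * (dil n φ t (y - x) - dil n φ t (Y y - x)) := by
      unfold HlogFact.sampleStep
      simp_rw [sub_mul, mul_sub]
      rw [integral_sub (i1.const_mul _) i2, integral_sub i2 i3, integral_const_mul,
        integral_dil_sub hφ ht]
      ring
    have b1 : |∫ y, (e x - e y) * dil n φ t (y - x)| ≤
        l * t * (A * (t ^ n)⁻¹) * (t ^ n * omegaVol n) := by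
      refine abs_integral_le_of_ball (c := x) ht.le (fun y h => hd0 y (right_ne_zero_of_mul h))
        fun y => ?_
      by_cases hy : dil n φ t (y - x) = 0
      · rw [hy, mul_zero, abs_zero]; positivity
      · rw [abs_mul]
        have h1 := hd0 y hy
        rw [mem_closedBall, dist_eq_norm, norm_sub_rev] at h1
        exact mul_le_mul ((he.lip x y).trans (by gcongr)) (abs_dil_le hφ ht _) (abs_nonneg _)
          (by positivity)
    have b2 : |∫ y, e y * (dil n φ t (y - x) - dil n φ t (Y y - x))| ≤
        a * (A * (t ^ (n + 1))⁻¹ * (n * δ)) * ((2 * t) ^ n * omegaVol n) := by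
      refine abs_integral_le_of_ball (c := x) (by positivity) (fun y h => ?_) fun y => ?_
      · rw [mem_closedBall, dist_eq_norm]
        by_cases hy : dil n φ t (y - x) = 0
        · rw [hy, zero_sub, mul_neg, neg_ne_zero] at h
          exact hne (right_ne_zero_of_mul h)
        · have := hd0 y hy
          rw [mem_closedBall, dist_eq_norm] at this
          linarith
      · rw [abs_mul]
        refine mul_le_mul (he.bound y) ((abs_dil_sub_le hφ ht _ _).trans ?_) (abs_nonneg _) ha
        gcongr
        rw [show y - x - (Y y - x) = -(Y y - y) by abel, norm_neg]
        exact hYs y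
    rw [key]
    refine (abs_add_le _ _).trans ((add_le_add b1 b2).trans ?_)
    have e2 : a * (A * (t ^ (n + 1))⁻¹ * (n * δ)) * ((2 * t) ^ n * omegaVol n) =
        2 ^ n * n * A * omegaVol n * (δ / t * a) := by
      rw [mul_pow, pow_succ]; field_simp
    have e1 : l * t * (A * (t ^ n)⁻¹) * (t ^ n * omegaVol n) = A * omegaVol n * (t * l) := by
      field_simp
    rw [e1, e2, mul_add]
    have hn0 : (0 : ℝ) ≤ n := Nat.cast_nonneg n
    have hP : 0 ≤ A * omegaVol n := by positivity
    have hN : 1 ≤ (2 : ℝ) ^ (n + 1) * (n + 1) := by rw [pow_succ]; nlinarith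
    have hN' : (2 : ℝ) ^ n * n ≤ 2 ^ (n + 1) * (n + 1) := by rw [pow_succ]; nlinarith
    gcongr
    · refine le_trans ?_ hC₀; nlinarith
    · refine le_trans ?_ hC₀; nlinarith
  · have i3 : ∀ x, Integrable fun y => e y * dil n φ t (Y y - x) := fun x => by
      refine integrable_of_ball (hec.aestronglyMeasurable.mul (hY' x)) (c := x) (ρ := 2 * t)
        (fun y h => ?_) (M := a * (A * (t ^ n)⁻¹)) fun y => ?_
      · rw [mem_closedBall, dist_eq_norm]; exact hne (right_ne_zero_of_mul h)
      · rw [abs_mul]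
        exact mul_le_mul (he.bound y) (abs_dil_le hφ ht _) (abs_nonneg _) ha
    have key : HlogFact.sampleStep φ t Y e x - HlogFact.sampleStep φ t Y e x' = (e x - e x') -
        ∫ y, e y * (dil n φ t (Y y - x) - dil n φ t (Y y - x')) := by
      unfold HlogFact.sampleStep
      simp_rw [mul_sub]
      rw [integral_sub (i3 x) (i3 x')]
      ring
    set M : ℝ := a * (A * (t ^ (n + 1))⁻¹ * ‖x - x'‖) with hM
    have hM0 : 0 ≤ M := by positivity
    have hK : ∀ y, |e y * (dil n φ t (Y y - x) - dil n φ t (Y y - x'))| ≤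
        (closedBall x (2 * t)).indicator (fun _ => M) y +
          (closedBall x' (2 * t)).indicator (fun _ => M) y := by
      intro y
      have hI : ∀ z, 0 ≤ (closedBall z (2 * t)).indicator (fun _ : Eucl n => M) y := fun z =>
        Set.indicator_nonneg (fun _ _ => hM0) y
      have hle : |e y * (dil n φ t (Y y - x) - dil n φ t (Y y - x'))| ≤ M := by
        rw [abs_mul]
        refine mul_le_mul (he.bound y) ((abs_dil_sub_le hφ ht _ _).trans ?_) (abs_nonneg _) ha
        rw [show Y y - x - (Y y - x') = -(x - x') by abel, norm_neg]
      by_cases h1 : y ∈ closedBall x (2 * t)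
      · rw [Set.indicator_of_mem h1]; linarith [hI x']
      by_cases h2 : y ∈ closedBall x' (2 * t)
      · rw [Set.indicator_of_mem h2]; linarith [hI x]
      · have z1 : dil n φ t (Y y - x) = 0 := by
          by_contra h; exact h1 (by rw [mem_closedBall, dist_eq_norm]; exact hne h)
        have z2 : dil n φ t (Y y - x') = 0 := by
          by_contra h; exact h2 (by rw [mem_closedBall, dist_eq_norm]; exact hne h)
        rw [z1, z2]; simpa using add_nonneg (hI x) (hI x')
    have hInt : ∀ z, Integrable ((closedBall z (2 * t)).indicator fun _ : Eucl n => M) := fun z =>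
      (integrable_indicator_iff measurableSet_closedBall).2
        (integrableOn_const measure_closedBall_lt_top.ne)
    have hIv : ∀ z, ∫ y, (closedBall z (2 * t)).indicator (fun _ : Eucl n => M) y =
        (2 * t) ^ n * omegaVol n * M := fun z => by
      rw [integral_indicator measurableSet_closedBall, setIntegral_const, Measure.real,
        volume_real_closedBall _ (by positivity), smul_eq_mul]
    have b : |∫ y, e y * (dil n φ t (Y y - x) - dil n φ t (Y y - x'))| ≤
        2 * ((2 * t) ^ n * omegaVol n * M) := by
      rw [← Real.norm_eq_abs]
      refine (norm_integral_le_of_norm_le ((hInt x).add (hInt x')) (ae_of_all _ hK)).trans ?_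
      simp only [Pi.add_apply]
      rw [integral_add (hInt x) (hInt x'), hIv, hIv]; linarith
    rw [key, add_mul]
    refine (abs_sub _ _).trans (add_le_add (he.lip x x') (b.trans ?_))
    have e2 : 2 * ((2 * t) ^ n * omegaVol n * M) =
        2 ^ (n + 1) * A * omegaVol n * a / t * ‖x - x'‖ := by
      rw [hM, mul_pow, pow_succ]; field_simp
      ring
    rw [e2]
    gcongr
    refine le_trans ?_ hC₀
    have hP : 0 ≤ 2 ^ (n + 1) * (A * omegaVol n) := by positivity
    nlinarith [mul_nonneg hP (Nat.cast_nonneg n)]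

theorem abs_integral_sub_sampleStep {φ : Eucl n → ℝ} {A : ℝ} (hφ : KernelBound n φ A)
    {R a l t s : ℝ} (ht : 0 < t) (hl : 0 ≤ l) {Y : Eucl n → Eucl n}
    (hY : Measurable Y) (hYs : ∀ y, ‖Y y - y‖ ≤ s) {e : Eucl n → ℝ} (he : LipBump n R a l e)
    {f : Eucl n → ℝ} (hf : LocallyIntegrable f volume)
    (hie : Integrable fun x => f x * sampleStep φ t Y e x) :
    ENNReal.ofReal |(∫ x, f x * e x) - ∫ x, f x * sampleStep φ t Y e x| ≤
      ENNReal.ofReal a * ∫⁻ y in closedBall 0 R, maxFun n φ f (Y y) := by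
  have hA := hφ.pos
  have hec := he.continuous hl
  have hdc := dil_continuous hφ t
  have hes : HasCompactSupport e := HasCompactSupport.of_support_subset_isCompact
    (isCompact_closedBall (0 : Eucl n) R) fun x hx => by simpa using he.supp x hx
  have i0 : Integrable fun x => f x * e x := by
    exact integrable_mul_of_hasCompactSupport hf hec hes
  have hF : Integrable ((closedBall (0 : Eucl n) (R + t + s)).indicator f) :=
    (integrable_indicator_iff measurableSet_closedBall).2
      (hf.integrableOn_isCompact (isCompact_closedBall _ _))
  have hei : Integrable e := hec.integrable_of_hasCompactSupport hes
  have hprod : Integrable (Function.uncurry fun x y => f x * (e y * dil n φ t (Y y - x)))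
      ((volume : Measure (Eucl n)).prod volume) := by
    refine ((hF.norm.mul_prod (hei.norm.mul_const (A * (t ^ n)⁻¹)))).mono' ?_
      (ae_of_all _ fun z => ?_)
    · refine hf.aestronglyMeasurable.comp_fst.mul ?_
      refine (hec.comp continuous_snd).aestronglyMeasurable.mul ?_
      exact (hdc.measurable.comp ((hY.comp measurable_snd).sub measurable_fst)).aestronglyMeasurable
    · obtain ⟨x, y⟩ := z
      simp only [Function.uncurry, norm_mul]
      by_cases hd : e y * dil n φ t (Y y - x) = 0
      · rw [← norm_mul, hd, norm_zero, mul_zero]; positivity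
      have h1 := norm_sub_le_of_dil_ne hφ ht hYs (right_ne_zero_of_mul hd)
      have h2 := he.supp y (left_ne_zero_of_mul hd)
      have h3 := norm_sub_norm_le x y
      rw [norm_sub_rev] at h3
      rw [Set.indicator_of_mem (by rw [mem_closedBall, dist_zero_right]; linarith)]
      gcongr
      exact abs_dil_le hφ ht _
  have key : (∫ x, f x * e x) - ∫ x, f x * sampleStep φ t Y e x =
      ∫ y, e y * ∫ x, f x * dil n φ t (Y y - x) := by
    rw [← integral_sub i0 hie]
    have : ∀ x, f x * e x - f x * sampleStep φ t Y e x =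
        ∫ y, f x * (e y * dil n φ t (Y y - x)) := by
      intro x
      rw [integral_const_mul]
      unfold sampleStep
      ring
    simp_rw [this]
    rw [integral_integral_swap hprod]
    congr 1; ext y
    rw [← integral_const_mul]
    congr 1; ext x
    ring
  rw [key, ← Real.enorm_eq_ofReal_abs]
  refine (enorm_integral_le_lintegral_enorm _).trans ?_
  rw [← lintegral_const_mul' _ _ ENNReal.ofReal_ne_top, ← lintegral_indicator measurableSet_closedBall]
  refine lintegral_mono fun y => ?_
  by_cases hy : e y = 0
  · simp [hy]
  rw [Set.indicator_of_mem (by rw [mem_closedBall, dist_zero_right]; exact he.supp y hy), enorm_mul]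
  gcongr
  · rw [Real.enorm_eq_ofReal_abs]; exact ENNReal.ofReal_le_ofReal (he.bound y)
  · rw [Real.enorm_eq_ofReal_abs]; exact le_maxFun φ f ht (Y y)

/-- The iterated sampled mollification scheme. -/
def sampleSeq (φ : Eucl n → ℝ) (ε : ℝ) (Y : ℕ → Eucl n → Eucl n) : ℕ → Eucl n → ℝ
  | 0 => tent0 n
  | k + 1 => sampleStep φ (ε ^ (k + 1)) (Y k) (sampleSeq φ ε Y k)

theorem sampleSeq_bump {φ : Eucl n → ℝ} {A : ℝ} (hφ : KernelBound n φ A) {C₀ : ℝ}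
    (hC₀ : 2 ^ (n + 1) * (n + 1) * A * omegaVol n ≤ C₀) (hn : (n : ℝ) ≤ C₀) (h1 : 1 ≤ C₀)
    {Y : ℕ → Eucl n → Eucl n} (hY : ∀ k, Measurable (Y k))
    (hYs : ∀ k y, ‖Y k y - y‖ ≤ n * ((4 * C₀)⁻¹ * (16 * C₀ ^ 2)⁻¹ ^ (k + 1))) (k : ℕ) :
    LipBump n (n + 1 - (16 * C₀ ^ 2)⁻¹ ^ k) ((2 : ℝ)⁻¹ ^ k)
      (4 * C₀ * (2 : ℝ)⁻¹ ^ k / (16 * C₀ ^ 2)⁻¹ ^ k) (sampleSeq φ (16 * C₀ ^ 2)⁻¹ Y k) := by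
  set ε := (16 * C₀ ^ 2)⁻¹ with hε
  have hε0 : 0 < ε := by positivity
  have hε1 : ε ≤ 1 / 16 := by
    rw [hε, one_div]; exact inv_anti₀ (by norm_num) (by nlinarith)
  induction k with
  | zero =>
    refine ⟨fun x hx => ?_, fun x => ?_, fun x y => ?_⟩
    · simpa using tent0_supp x hx
    · simpa [sampleSeq, abs_of_nonneg (tent0_nonneg x)] using tent0_le_one x
    · refine (abs_tent0_sub_le x y).trans ?_
      gcongr
      simp; linarith
  | succ k ih =>
    have ht : 0 < ε ^ (k + 1) := by positivity
    have hC : 0 < C₀ := by linarith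
    have hC4 : n * ((4 * C₀)⁻¹ * ε ^ (k + 1)) ≤ ε ^ (k + 1) := by
      rw [← mul_assoc]
      refine mul_le_of_le_one_left ht.le ?_
      rw [← div_eq_mul_inv, div_le_one (by positivity)]; linarith
    refine (ih.sampleStep hφ hC₀ ht (δ := (4 * C₀)⁻¹ * ε ^ (k + 1)) (by positivity) hC4
      (by positivity) (by positivity) (hY k) (hYs k)).mono ?_ ?_ ?_
    · have : 0 < ε ^ k := by positivity
      rw [pow_succ]; nlinarith
    · have e1 : ε ^ (k + 1) * (4 * C₀ * (2 : ℝ)⁻¹ ^ k / ε ^ k) = 4 * C₀ * (2 : ℝ)⁻¹ ^ k * ε := by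
        rw [pow_succ]; field_simp
      have e2 : (4 * C₀)⁻¹ * ε ^ (k + 1) / ε ^ (k + 1) = (4 * C₀)⁻¹ := by field_simp
      rw [e1, e2, hε]
      apply le_of_eq
      rw [pow_succ]; field_simp; ring
    · have e1 : 4 * C₀ * (2 : ℝ)⁻¹ ^ (k + 1) / ε ^ (k + 1) - 4 * C₀ * (2 : ℝ)⁻¹ ^ k / ε ^ k -
          C₀ * (2 : ℝ)⁻¹ ^ k / ε ^ (k + 1) = C₀ * (2 : ℝ)⁻¹ ^ k / ε ^ (k + 1) * (1 - 4 * ε) := by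
        rw [pow_succ, pow_succ]; field_simp; ring
      have : 0 ≤ C₀ * (2 : ℝ)⁻¹ ^ k / ε ^ (k + 1) * (1 - 4 * ε) :=
        mul_nonneg (by positivity) (by linarith)
      linarith

theorem exists_integral_tent0_le {φ : Eucl n → ℝ} {A : ℝ} (hφ : KernelBound n φ A) :
    ∃ (q C : ℝ), 0 < q ∧ 0 < C ∧ ∀ f : Eucl n → ℝ, LocallyIntegrable f volume →
      ENNReal.ofReal |∫ x, f x * tent0 n x| ≤ ENNReal.ofReal C *
        (∫⁻ y in closedBall 0 (n + 2), maxFun n φ f y ^ (1 / (1 + q))) ^ (1 + q) := by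
  set C₀ : ℝ := max (2 ^ (n + 1) * (n + 1) * A * omegaVol n) (max n 1) with hC₀
  have hc1 : 2 ^ (n + 1) * (n + 1) * A * omegaVol n ≤ C₀ := le_max_left _ _
  have hc2 : (n : ℝ) ≤ C₀ := (le_max_left _ _).trans (le_max_right _ _)
  have hc3 : 1 ≤ C₀ := (le_max_right _ _).trans (le_max_right _ _)
  set ε := (16 * C₀ ^ 2)⁻¹ with hε
  set η := (4 * C₀)⁻¹ with hη
  have hε0 : 0 < ε := by positivity
  have hη0 : 0 < η := by positivity
  have hε1 : ε ≤ 1 := inv_le_one_of_one_le₀ (by nlinarith)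
  have hη1 : η * n ≤ 1 := by
    rw [hη, inv_mul_eq_div, div_le_one (by positivity)]; linarith
  set D : ℝ := (η ^ n)⁻¹ with hD
  obtain ⟨M, hM⟩ := pow_unbounded_of_one_lt (ε ^ n)⁻¹ (show (1 : ℝ) < 3 / 2 by norm_num)
  obtain ⟨q, hq0, E, hE1, hB⟩ : ∃ q : ℝ, 0 < q ∧ ∃ E : ℝ, 1 ≤ E ∧ ∀ k : ℕ,
      (ENNReal.ofReal ((η * ε ^ (k + 1)) ^ n))⁻¹ ^ q ≤ ENNReal.ofReal (E * (3 / 2) ^ (k + 1)) := by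
    refine ⟨((M + 1 : ℕ) : ℝ)⁻¹, by positivity, max D 1, le_max_right _ _, fun k => ?_⟩
    rw [← ENNReal.ofReal_inv_of_pos (by positivity)]
    have : ((η * ε ^ (k + 1)) ^ n)⁻¹ ≤ (max D 1 * (3 / 2) ^ (k + 1)) ^ (M + 1) := by
      rw [mul_pow, mul_inv, mul_pow, ← pow_mul, ← pow_mul]
      refine mul_le_mul ?_ ?_ (by positivity) (by positivity)
      · exact (le_max_left D 1).trans (le_self_pow₀ (le_max_right _ _) (by simp))
      · rw [mul_comm (k + 1) n, pow_mul, ← inv_pow, mul_comm (k + 1), pow_mul]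
        gcongr
        exact hM.le.trans (pow_le_pow_right₀ (by norm_num) (by simp))
    refine (ENNReal.rpow_le_rpow (ENNReal.ofReal_le_ofReal this) (by positivity)).trans ?_
    rw [ENNReal.ofReal_pow (by positivity), ENNReal.pow_rpow_inv_natCast (by simp)]
  refine ⟨q, 6 * E, hq0, by positivity, fun f hf => ?_⟩
  set g := maxFun n φ f with hg
  have hgm : Measurable g := maxFun_measurable hφ hf
  set p : ℝ := 1 / (1 + q) with hp
  have hp0 : 0 < p := by positivity
  set I := ∫⁻ y in closedBall 0 (n + 2), g y ^ p with hI
  choose Y hYm hYs hYI using fun k : ℕ => exists_sampling (n := n) (δ := η * ε ^ (k + 1))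
    (by positivity) (hgm.pow_const p)
  set e := sampleSeq φ ε Y with he
  have hb : ∀ k, LipBump n _ _ _ (e k) := fun k => sampleSeq_bump hφ hc1 hc2 hc3 hYm hYs k
  have hec : ∀ k, Continuous (e k) := fun k => (hb k).continuous (by positivity)
  have hR : ∀ k : ℕ, (n : ℝ) + 1 - ε ^ k ≤ n + 1 := fun k => by
    have : 0 < ε ^ k := by positivity
    linarith
  have hes : ∀ k, HasCompactSupport (e k) := fun k =>
    HasCompactSupport.of_support_subset_isCompact
    (isCompact_closedBall (0 : Eucl n) (n + 1)) fun x hx => by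
      simpa using ((hb k).supp x hx).trans (hR k)
  have hInt : ∀ k, Integrable fun x => f x * e k x := fun k => by
    simpa [mul_comm] using hf.integrable_smul_left_of_hasCompactSupport (hec k) (hes k)
  have hstep : ∀ k, ENNReal.ofReal |(∫ x, f x * e k x) - ∫ x, f x * e (k + 1) x| ≤
      ENNReal.ofReal (E * (3 / 2) * (3 / 4) ^ k) * I ^ (1 + q) := by
    intro k
    refine (abs_integral_sub_sampleStep hφ (by positivity) (by positivity) (hYm k) (hYs k)
      (hb k) hf (hInt (k + 1))).trans ?_
    have hS : (n : ℝ) + 1 - ε ^ k + n * (η * ε ^ (k + 1)) ≤ n + 2 := by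
      have h2 : ε ^ (k + 1) ≤ 1 := pow_le_one₀ hε0.le hε1
      have h3 : 0 < ε ^ (k + 1) := by positivity
      have := hR k
      nlinarith
    obtain ⟨s1, s2⟩ := hYI k _ _ hS
    have hpt : (∫⁻ y in closedBall 0 (n + 1 - ε ^ k), g (Y k y)) ≤
        (ENNReal.ofReal (E * (3 / 2) ^ (k + 1)) * I ^ q) * I := by
      calc _ ≤ ∫⁻ y in closedBall 0 (n + 1 - ε ^ k),
            (ENNReal.ofReal (E * (3 / 2) ^ (k + 1)) * I ^ q) * g (Y k y) ^ p := by
            refine setLIntegral_mono' measurableSet_closedBall fun y hy => ?_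
            have h4 := s2 y (by simpa using hy)
            have h5 : g (Y k y) = (g (Y k y) ^ p) ^ q * g (Y k y) ^ p := by
              rw [← ENNReal.rpow_mul, ← ENNReal.rpow_add_of_nonneg _ _ (by positivity) hp0.le]
              have : p * q + p = 1 := by rw [hp]; field_simp; ring
              rw [this, ENNReal.rpow_one]
            calc g (Y k y) = _ := h5
              _ ≤ ((ENNReal.ofReal ((η * ε ^ (k + 1)) ^ n))⁻¹ * I) ^ q * g (Y k y) ^ p := by
                gcongr
              _ ≤ _ := by
                rw [ENNReal.mul_rpow_of_nonneg _ _ hq0.le]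
                gcongr
                exact hB k
        _ = _ * ∫⁻ y in closedBall 0 (n + 1 - ε ^ k), g (Y k y) ^ p :=
            lintegral_const_mul _ ((hgm.comp (hYm k)).pow_const p)
        _ ≤ _ := by gcongr
    refine (mul_le_mul_right hpt _).trans (le_of_eq ?_)
    rw [mul_assoc (ENNReal.ofReal _), ← mul_assoc, ← ENNReal.ofReal_mul (by positivity)]
    congr 1
    · congr 1
      rw [show (3 : ℝ) / 4 = 2⁻¹ * (3 / 2) by norm_num, mul_pow, pow_succ]; ring
    · rw [add_comm, ENNReal.rpow_add_of_nonneg _ _ hq0.le zero_le_one, ENNReal.rpow_one]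
  have hsum : ∀ m, ENNReal.ofReal |∫ x, f x * e 0 x| ≤
      (∑ k ∈ Finset.range m, ENNReal.ofReal (E * (3 / 2) * (3 / 4) ^ k) * I ^ (1 + q)) +
        ENNReal.ofReal |∫ x, f x * e m x| := by
    intro m
    induction m with
    | zero => simp
    | succ m ih =>
      refine ih.trans ?_
      rw [Finset.sum_range_succ, add_assoc]
      gcongr
      refine le_trans ?_ (add_le_add_left (hstep m) _)
      rw [← ENNReal.ofReal_add (abs_nonneg _) (abs_nonneg _)]
      refine ENNReal.ofReal_le_ofReal ?_
      have := abs_add_le ((∫ x, f x * e m x) - ∫ x, f x * e (m + 1) x) (∫ x, f x * e (m + 1) x)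
      simpa using this
  set F := ∫ x in closedBall 0 ((n : ℝ) + 1), |f x| with hF
  have hsmall : ∀ m, |∫ x, f x * e m x| ≤ (2 : ℝ)⁻¹ ^ m * F := by
    intro m
    rw [hF, ← integral_const_mul, ← Real.norm_eq_abs,
      ← setIntegral_eq_integral_of_forall_compl_eq_zero (s := closedBall 0 ((n : ℝ) + 1))]
    · refine norm_integral_le_of_norm_le
        ((hf.integrableOn_isCompact (isCompact_closedBall _ _)).abs.const_mul _)
        (ae_of_all _ fun x => ?_)
      rw [norm_mul, mul_comm, Real.norm_eq_abs, Real.norm_eq_abs]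
      exact mul_le_mul_of_nonneg_right ((hb m).bound x) (abs_nonneg _)
    · intro x hx
      by_contra h
      exact hx (by simpa using ((hb m).supp x (right_ne_zero_of_mul h)).trans (hR m))
  have hgeo : ∀ m, (∑ k ∈ Finset.range m, ENNReal.ofReal (E * (3 / 2) * (3 / 4) ^ k) *
      I ^ (1 + q)) ≤ ENNReal.ofReal (6 * E) * I ^ (1 + q) := by
    intro m
    rw [← Finset.sum_mul, ← ENNReal.ofReal_sum_of_nonneg (fun _ _ => by positivity)]
    gcongr
    rw [← Finset.mul_sum]
    have : (∑ i ∈ Finset.range m, ((3 : ℝ) / 4) ^ i) ≤ 4 := by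
      have h := geom_sum_eq (show (3 : ℝ) / 4 ≠ 1 by norm_num) m
      have : (0 : ℝ) < (3 / 4) ^ m := by positivity
      rw [h, div_le_iff_of_neg (by norm_num)]
      linarith
    nlinarith
  have hlim : Tendsto (fun m : ℕ => ENNReal.ofReal (6 * E) * I ^ (1 + q) +
      ENNReal.ofReal ((2 : ℝ)⁻¹ ^ m * F)) atTop
      (𝓝 (ENNReal.ofReal (6 * E) * I ^ (1 + q) + ENNReal.ofReal (0 * F))) := by
    refine tendsto_const_nhds.add (ENNReal.tendsto_ofReal ?_)
    exact (tendsto_pow_atTop_nhds_zero_of_lt_one (by norm_num) (by norm_num)).mul_const _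
  rw [zero_mul, ENNReal.ofReal_zero, add_zero] at hlim
  refine ge_of_tendsto' hlim fun m => ?_
  refine (hsum m).trans (add_le_add (hgeo m) (ENNReal.ofReal_le_ofReal (hsmall m)))

/-- Averages against hats are controlled by means of a power of the maximal function. -/
theorem exists_integral_hatN_le {φ : Eucl n → ℝ} {A : ℝ} (hφ : KernelBound n φ A) :
    ∃ (q C : ℝ), 0 < q ∧ 0 < C ∧ ∀ f : Eucl n → ℝ, LocallyIntegrable f volume → ∀ σ : Node n,
      ENNReal.ofReal |∫ x, f x * hatN σ x| ≤ ENNReal.ofReal (C * σ.rad ^ n) *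
        ((ENNReal.ofReal (σ.rad ^ n))⁻¹ * ∫⁻ y in closedBall σ.ctr ((n + 2) * σ.rad),
          maxFun n φ f y ^ (1 / (1 + q))) ^ (1 + q) := by
  obtain ⟨q, C, hq, hC, h⟩ := exists_integral_tent0_le hφ
  refine ⟨q, C, hq, hC, fun f hf σ => ?_⟩
  have hr := σ.rad_pos
  set r := σ.rad with hrd
  set c := σ.ctr with hc
  set f' : Eucl n → ℝ := fun u => f (r • u + c) with hf'
  have hff : ∀ x, f' (r⁻¹ • (x - c)) = f x := fun x => by
    simp [hf', smul_smul, hr.ne']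
  have hf'i : LocallyIntegrable f' volume := by
    rw [locallyIntegrable_iff]
    intro K hK
    have hK' : IsCompact ((fun u => r • u + c) '' K) := hK.image (by fun_prop)
    have hi := (hf.integrableOn_isCompact hK').integrable_indicator hK'.measurableSet
    have hi2 := (hi.comp_add_right c).comp_smul hr.ne'
    refine (hi2.integrableOn (s := K)).congr_fun (fun u hu => ?_) hK.measurableSet
    simp only []
    rw [Set.indicator_of_mem (Set.mem_image_of_mem _ hu)]
  have h1 : ∫ x, f x * hatN σ x = r ^ n * ∫ x, f' x * tent0 n x := by
    rw [← integral_scale c hr fun x => f' x * tent0 n x]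
    simp_rw [hff]
    rfl
  have h2 : ∀ x, maxFun n φ f x = maxFun n φ f' (r⁻¹ • (x - c)) := fun x => by
    rw [← maxFun_scale φ f' c hr x]; simp_rw [hff]
  have h3 : ∫⁻ y in closedBall c ((n + 2) * r), maxFun n φ f y ^ (1 / (1 + q)) =
      ENNReal.ofReal (r ^ n) * ∫⁻ y in closedBall 0 (n + 2), maxFun n φ f' y ^ (1 / (1 + q)) := by
    rw [← lintegral_indicator measurableSet_closedBall, ← lintegral_indicator measurableSet_closedBall,
      ← lintegral_scale c hr]
    refine lintegral_congr fun y => ?_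
    have : y ∈ closedBall c ((n + 2) * r) ↔ r⁻¹ • (y - c) ∈ closedBall (0 : Eucl n) (n + 2) := by
      rw [mem_closedBall, mem_closedBall, dist_zero_right, dist_eq_norm, norm_smul, norm_inv,
        Real.norm_of_nonneg hr.le, inv_mul_le_iff₀ hr, mul_comm]
    by_cases hy : y ∈ closedBall c ((n + 2) * r)
    · rw [Set.indicator_of_mem hy, Set.indicator_of_mem (this.1 hy), h2]
    · rw [Set.indicator_of_notMem hy, Set.indicator_of_notMem fun h => hy (this.2 h)]
  rw [h1, h3, ← mul_assoc, ENNReal.inv_mul_cancel (by simp; positivity) ENNReal.ofReal_ne_top,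
    one_mul, abs_mul, abs_of_pos (by positivity), mul_comm C, ENNReal.ofReal_mul (by positivity),
    ENNReal.ofReal_mul (by positivity), mul_assoc]
  exact mul_le_mul_right (h f' hf'i) _

section

/-- Weights of the descendants of `σ` reached at generation `d + 1` which are the first ones on
their line whose value exceeds `2t`. -/
def lw (T : Node n → ℝ≥0) (t : ℝ≥0) : ℕ → Node n → Node n →₀ ℝ≥0
  | 0, σ => ∑ c, if 2 * t < T (σ.child c) then Finsupp.single (σ.child c) (cw c) else 0
  | d + 1, σ => ∑ c, if 2 * t < T (σ.child c) then 0 else cw c • lw T t d (σ.child c)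

/-- Weights of the descendants of `σ` at generation `d` reached without exceeding `2t`. -/
def uw (T : Node n → ℝ≥0) (t : ℝ≥0) : ℕ → Node n → Node n →₀ ℝ≥0
  | 0, σ => Finsupp.single σ 1
  | d + 1, σ => ∑ c, if 2 * t < T (σ.child c) then 0 else cw c • uw T t d (σ.child c)

theorem lw_support {T : Node n → ℝ≥0} {t : ℝ≥0} {P : Node n → Prop}
    (hP : ∀ ν c, P ν → P (ν.child c)) (d : ℕ) {σ κ : Node n} (hσ : P σ) (hT : T σ ≤ 2 * t)
    (hκ : lw T t d σ κ ≠ 0) :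
    ∃ ν c, κ = ν.child c ∧ P ν ∧ T ν ≤ 2 * t ∧ 2 * t < T κ := by
  induction d generalizing σ with
  | zero =>
    rw [lw, Finsupp.finsetSum_apply] at hκ
    obtain ⟨c, -, hc⟩ := Finset.exists_ne_zero_of_sum_ne_zero hκ
    split_ifs at hc with h
    · rw [Finsupp.single_apply] at hc
      split_ifs at hc with h'
      · exact ⟨σ, c, h'.symm, hσ, hT, h' ▸ h⟩
      · exact absurd rfl hc
    · exact absurd rfl hc
  | succ d ih =>
    rw [lw, Finsupp.finsetSum_apply] at hκ
    obtain ⟨c, -, hc⟩ := Finset.exists_ne_zero_of_sum_ne_zero hκ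
    split_ifs at hc with h
    · exact absurd rfl hc
    · exact ih (hP _ c hσ) (not_lt.1 h) (right_ne_zero_of_mul hc)

theorem uw_support {T : Node n → ℝ≥0} {t : ℝ≥0} (d : ℕ) {σ κ : Node n} (hT : T σ ≤ 2 * t)
    (hκ : uw T t d σ κ ≠ 0) : T κ ≤ 2 * t ∧ κ.1 = σ.1 + d := by
  induction d generalizing σ with
  | zero =>
    rw [uw, Finsupp.single_apply] at hκ
    split_ifs at hκ with h
    · subst h; exact ⟨hT, by simp⟩
    · exact absurd rfl hκ
  | succ d ih =>
    rw [uw, Finsupp.finsetSum_apply] at hκ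
    obtain ⟨c, -, hc⟩ := Finset.exists_ne_zero_of_sum_ne_zero hκ
    split_ifs at hc with h
    · exact absurd rfl hc
    · obtain ⟨h1, h2⟩ := ih (not_lt.1 h) (right_ne_zero_of_mul hc)
      refine ⟨h1, ?_⟩
      rw [h2]; simp only [Node.child]; push_cast; ring

/-- A node function satisfying the refinement equation of the hats. -/
def Refinable {M : Type*} [AddCommMonoid M] [Module ℝ≥0 M] (u : Node n → M) : Prop :=
  ∀ σ, u σ = ∑ c, cw c • u (σ.child c)

section generic
variable {M : Type*} [AddCommMonoid M] [Module ℝ≥0 M]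

theorem Refinable.uw_succ {u : Node n → M} (hu : Refinable u) (T : Node n → ℝ≥0) (t : ℝ≥0)
    (d : ℕ) (σ : Node n) :
    Finsupp.linearCombination ℝ≥0 u (uw T t d σ) =
      Finsupp.linearCombination ℝ≥0 u (lw T t d σ) +
        Finsupp.linearCombination ℝ≥0 u (uw T t (d + 1) σ) := by
  induction d generalizing σ with
  | zero =>
    simp only [uw, lw, map_sum, Finsupp.linearCombination_single, one_smul]
    rw [hu σ, ← Finset.sum_add_distrib]
    refine Finset.sum_congr rfl fun c _ => ?_
    split_ifs <;> simp
  | succ d ih =>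
    rw [uw, lw, uw]
    simp only [map_sum]
    rw [← Finset.sum_add_distrib]
    refine Finset.sum_congr rfl fun c _ => ?_
    split_ifs
    · simp
    · simp only [map_smul, ih, smul_add]

theorem Refinable.sum_lw {u : Node n → M} (hu : Refinable u) (T : Node n → ℝ≥0) (t : ℝ≥0)
    (D : ℕ) (σ : Node n) :
    u σ = (∑ d ∈ Finset.range D, Finsupp.linearCombination ℝ≥0 u (lw T t d σ)) +
        Finsupp.linearCombination ℝ≥0 u (uw T t D σ) := by
  induction D with
  | zero => simp [uw]
  | succ D ih => rw [Finset.sum_range_succ, add_assoc, ← hu.uw_succ, ← ih]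

end generic

theorem refinable_hatN (x : Eucl n) : Refinable fun σ : Node n => hatN σ x := fun σ => by
  simp only [NNReal.smul_def, smul_eq_mul]; exact hatN_refine σ x

theorem refinable_mul_hatN (a : ℝ≥0∞) (x : Eucl n) :
    Refinable fun σ : Node n => a * ENNReal.ofReal (hatN σ x) := fun σ => by
  simp only [ENNReal.smul_def, smul_eq_mul]
  rw [hatN_refine σ x, ENNReal.ofReal_sum_of_nonneg fun c _ => mul_nonneg (cw c).coe_nonneg
    (hatN_nonneg _ _), Finset.mul_sum]
  refine Finset.sum_congr rfl fun c _ => ?_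
  rw [ENNReal.ofReal_mul (cw c).coe_nonneg, ENNReal.ofReal_coe_nnreal]; ring

/-- Weight of the passage from `σ` to the principal descendant `i.2`. -/
def wt (T : Node n → ℝ≥0) (σ : Node n) (i : ℕ × Node n) : ℝ≥0 := lw T (T σ) i.1 σ i.2

theorem wt_support {T : Node n → ℝ≥0} {P : Node n → Prop}
    (hP : ∀ ν c, P ν → P (ν.child c)) {σ : Node n} (hσ : P σ) {i : ℕ × Node n}
    (h : wt T σ i ≠ 0) :
    ∃ ν c, i.2 = ν.child c ∧ P ν ∧ T ν ≤ 2 * T σ ∧ 2 * T σ < T i.2 :=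
  lw_support hP i.1 hσ (le_mul_of_one_le_left zero_le one_le_two) h

/-- Transition operator to principal descendants, on nonnegative functions. -/
def JE (T : Node n → ℝ≥0) (u : Node n → ℝ≥0∞) (σ : Node n) : ℝ≥0∞ :=
  ∑' i : ℕ × Node n, (wt T σ i : ℝ≥0∞) * u i.2

/-- Transition operator to principal descendants, on real functions. -/
def JR (T : Node n → ℝ≥0) (u : Node n → ℝ) (σ : Node n) : ℝ :=
  ∑' i : ℕ × Node n, (wt T σ i : ℝ) * u i.2

theorem JE_mono {T : Node n → ℝ≥0} {σ : Node n} {u v : Node n → ℝ≥0∞}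
    (h : ∀ i, wt T σ i ≠ 0 → u i.2 ≤ v i.2) : JE T u σ ≤ JE T v σ :=
  ENNReal.tsum_le_tsum fun i => by
    by_cases hi : wt T σ i = 0
    · simp [hi]
    · exact mul_le_mul_right (h i hi) _

theorem JE_const_mul (T : Node n → ℝ≥0) (σ : Node n) (a : ℝ≥0∞) (u : Node n → ℝ≥0∞) :
    JE T (fun κ => a * u κ) σ = a * JE T u σ := by
  unfold JE
  rw [← ENNReal.tsum_mul_left]
  exact tsum_congr fun i => by ring

theorem JE_add (T : Node n → ℝ≥0) (σ : Node n) (u v : Node n → ℝ≥0∞) :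
    JE T (fun κ => u κ + v κ) σ = JE T u σ + JE T v σ := by
  unfold JE
  rw [← ENNReal.tsum_add]
  exact tsum_congr fun i => by ring

theorem JE_lintegral (T : Node n → ℝ≥0) (σ : Node n) {u : Node n → Eucl n → ℝ≥0∞}
    (hu : ∀ κ, AEMeasurable (u κ) volume) :
    JE T (fun κ => ∫⁻ x, u κ x) σ = ∫⁻ x, JE T (fun κ => u κ x) σ := by
  unfold JE
  rw [lintegral_tsum fun i => (hu _).const_mul _]
  exact tsum_congr fun i => (lintegral_const_mul' _ _ ENNReal.coe_ne_top).symm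

theorem JE_aemeasurable (T : Node n → ℝ≥0) (σ : Node n) {u : Node n → Eucl n → ℝ≥0∞}
    (hu : ∀ κ, AEMeasurable (u κ) volume) :
    AEMeasurable (fun x => JE T (fun κ => u κ x) σ) volume :=
  AEMeasurable.tsum fun _ => (hu _).const_mul _

theorem Refinable.JE_le {T : Node n → ℝ≥0} {u : Node n → ℝ≥0∞} (hu : Refinable u) (σ : Node n) :
    JE T u σ ≤ u σ := by
  unfold JE
  refine (ENNReal.tsum_prod (f := fun d κ => (wt T σ (d, κ) : ℝ≥0∞) * u κ)).trans_le ?_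
  have : ∀ d, ∑' κ, (wt T σ (d, κ) : ℝ≥0∞) * u κ =
      Finsupp.linearCombination ℝ≥0 u (lw T (T σ) d σ) := by
    intro d
    rw [Finsupp.linearCombination_apply, Finsupp.sum, tsum_eq_sum]
    · rfl
    · intro κ hκ
      rw [Finsupp.notMem_support_iff] at hκ
      simp [wt, hκ]
  simp_rw [this]
  refine ENNReal.tsum_le_of_sum_range_le fun D => ?_
  exact le_self_add.trans (hu.sum_lw T (T σ) D σ).ge

theorem JR_summable {T : Node n → ℝ≥0} {σ : Node n} {u : Node n → ℝ} {v : Node n → ℝ≥0∞}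
    (huv : ∀ i, wt T σ i ≠ 0 → ‖u i.2‖ₑ ≤ v i.2) (hv : JE T v σ ≠ ⊤) :
    Summable fun i : ℕ × Node n => (wt T σ i : ℝ) * u i.2 := by
  refine summable_of_tsum_enorm (ne_top_of_le_ne_top hv (ENNReal.tsum_le_tsum fun i => ?_))
  by_cases hi : wt T σ i = 0
  · simp [hi]
  rw [enorm_mul]
  gcongr
  · simp
  · exact huv i hi

theorem enorm_JR_le {T : Node n → ℝ≥0} {σ : Node n} {u : Node n → ℝ} {v : Node n → ℝ≥0∞}
    (huv : ∀ i, wt T σ i ≠ 0 → ‖u i.2‖ₑ ≤ v i.2) : ‖JR T u σ‖ₑ ≤ JE T v σ := by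
  refine (enorm_tsum_le_tsum_enorm).trans (ENNReal.tsum_le_tsum fun i => ?_)
  by_cases hi : wt T σ i = 0
  · simp [hi]
  rw [enorm_mul]
  gcongr
  · simp
  · exact huv i hi

theorem JR_sub {T : Node n → ℝ≥0} {σ : Node n} {u u' : Node n → ℝ} {v : Node n → ℝ≥0∞}
    (huv : ∀ i, wt T σ i ≠ 0 → ‖u i.2‖ₑ ≤ v i.2)
    (huv' : ∀ i, wt T σ i ≠ 0 → ‖u' i.2‖ₑ ≤ v i.2) (hv : JE T v σ ≠ ⊤) :
    JR T (fun κ => u κ - u' κ) σ = JR T u σ - JR T u' σ := by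
  unfold JR
  rw [← (JR_summable huv hv).tsum_sub (JR_summable huv' hv)]
  exact tsum_congr fun i => by ring

theorem JR_hasSum {T : Node n → ℝ≥0} {σ : Node n} {u : Node n → ℝ} {v : Node n → ℝ≥0∞}
    (huv : ∀ i, wt T σ i ≠ 0 → ‖u i.2‖ₑ ≤ v i.2) (hv : JE T v σ ≠ ⊤) :
    HasSum (fun d => Finsupp.linearCombination ℝ≥0 u (lw T (T σ) d σ)) (JR T u σ) := by
  refine (JR_summable huv hv).hasSum.prod_fiberwise fun d => ?_
  rw [Finsupp.linearCombination_apply, Finsupp.sum]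
  refine hasSum_sum_of_ne_finset_zero fun κ hκ => ?_
  rw [Finsupp.notMem_support_iff] at hκ
  simp [wt, hκ]

end

section

/-- Average of `f` against a hat. -/
def avgN (f : Eucl n → ℝ) (σ : Node n) : ℝ := (∫ x, f x * hatN σ x) / ∫ x, hatN σ x

/-- The localized oscillation of `f` at a node. -/
def bN (f : Eucl n → ℝ) (σ : Node n) (x : Eucl n) : ℝ := (f x - avgN f σ) * hatN σ x

/-- Localized mass of `f` at a node. -/
def massN (f : Eucl n → ℝ) (σ : Node n) : ℝ≥0∞ := ∫⁻ x, ‖f x‖ₑ * ENNReal.ofReal (hatN σ x)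

/-- The part of `f` between a node and its principal descendants. -/
def hN (f : Eucl n → ℝ) (T : Node n → ℝ≥0) (σ : Node n) (x : Eucl n) : ℝ :=
  bN f σ x - JR T (fun κ => bN f κ x) σ

/-- Size control of `f` along the dyadic tree by the values `T`. -/
structure TreeBound (f : Eucl n → ℝ) (T : Node n → ℝ≥0) (K : ℝ≥0) : Prop where
  loc : LocallyIntegrable f volume
  avg : ∀ σ, |avgN f σ| ≤ K * T σ
  child : ∀ σ c, T (σ.child c) ≤ K * T σ
  leb : ∀ᵐ x, ∀ κ : ℕ → Node n, (∀ j, hatN (κ j) x ≠ 0) → Tendsto (fun j => (κ j).1) atTop atTop →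
    Tendsto (fun j => avgN f (κ j)) atTop (𝓝 (f x))
  bdd : ∀ᵐ x, ∀ κ : ℕ → Node n, (∀ j, hatN (κ j) x ≠ 0) → Tendsto (fun j => (κ j).1) atTop atTop →
    ¬ Tendsto (fun j => T (κ j)) atTop atTop

theorem massN_lt_top {f : Eucl n → ℝ} (hf : LocallyIntegrable f volume) (σ : Node n) :
    massN f σ < ⊤ := by
  have h := integrable_mul_hatN hf σ
  refine lt_of_eq_of_lt (lintegral_congr fun x => ?_) h.2
  rw [enorm_mul, Real.enorm_of_nonneg (hatN_nonneg σ x)]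

theorem massN_refinable {f : Eucl n → ℝ} (hf : LocallyIntegrable f volume) :
    Refinable (massN f) := fun σ => by
  have h : ∀ c, AEMeasurable
      (fun x => ‖f x‖ₑ * ENNReal.ofReal (hatN (Node.child σ c) x)) volume := fun c =>
    hf.aestronglyMeasurable.enorm.mul (hatN_continuous _).measurable.ennreal_ofReal.aemeasurable
  have e : ∀ c, cw c • massN f (Node.child σ c) = ∫⁻ x, cw c •
      (‖f x‖ₑ * ENNReal.ofReal (hatN (Node.child σ c) x)) := fun c => by
    simp only [ENNReal.smul_def, smul_eq_mul, massN]
    rw [lintegral_const_mul' _ _ ENNReal.coe_ne_top]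
  simp_rw [e]
  rw [← lintegral_finsetSum' (f := fun c x => cw c • (‖f x‖ₑ *
    ENNReal.ofReal (hatN (Node.child σ c) x))) _ fun c _ => (h c).const_smul _]
  exact lintegral_congr fun x => refinable_mul_hatN ‖f x‖ₑ x σ

theorem integrable_bN {f : Eucl n → ℝ} (hf : LocallyIntegrable f volume) (σ : Node n) :
    Integrable (bN f σ) := by
  have h := integrable_mul_hatN hf σ
  have h2 := (integrable_hatN σ).const_mul (avgN f σ)
  refine (h.sub h2).congr (ae_of_all _ fun x => ?_)
  simp only [bN, Pi.sub_apply]; ring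

theorem integral_bN {f : Eucl n → ℝ} (hf : LocallyIntegrable f volume) (σ : Node n) :
    ∫ x, bN f σ x = 0 := by
  have h := integrable_mul_hatN hf σ
  have h2 := (integrable_hatN σ).const_mul (avgN f σ)
  simp_rw [bN, sub_mul]
  rw [integral_sub h h2, integral_const_mul, avgN, div_mul_cancel₀ _ (integral_hatN_pos σ).ne',
    sub_self]

theorem enorm_integral_bN_le {f : Eucl n → ℝ} (hf : LocallyIntegrable f volume) {ψ : Eucl n → ℝ}
    {B : ℝ} (hψ : ∀ x, |ψ x| ≤ B) (σ : Node n) :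
    ‖∫ x, bN f σ x * ψ x‖ₑ ≤ ENNReal.ofReal (2 * B) * massN f σ := by
  have hB : 0 ≤ B := (abs_nonneg _).trans (hψ 0)
  have hm : AEMeasurable (fun x => ‖f x‖ₑ * ENNReal.ofReal (hatN σ x)) volume :=
    hf.aestronglyMeasurable.enorm.mul (hatN_continuous _).measurable.ennreal_ofReal.aemeasurable
  have hA : ∫⁻ x, ‖avgN f σ‖ₑ * ENNReal.ofReal (hatN σ x) ≤ massN f σ := by
    rw [lintegral_const_mul' _ _ enorm_ne_top, ← ofReal_integral_eq_lintegral_ofReal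
      (integrable_hatN σ)
      (ae_of_all _ (hatN_nonneg σ)), ← Real.enorm_of_nonneg (integral_hatN_pos σ).le, ← enorm_mul,
      avgN, div_mul_cancel₀ _ (integral_hatN_pos σ).ne']
    refine (enorm_integral_le_lintegral_enorm _).trans (le_of_eq (lintegral_congr fun x => ?_))
    rw [enorm_mul, Real.enorm_of_nonneg (hatN_nonneg σ x)]
  calc _ ≤ ∫⁻ x, ‖bN f σ x * ψ x‖ₑ := enorm_integral_le_lintegral_enorm _
    _ ≤ ∫⁻ x, ENNReal.ofReal B * (‖f x‖ₑ * ENNReal.ofReal (hatN σ x) +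
          ‖avgN f σ‖ₑ * ENNReal.ofReal (hatN σ x)) := by
        refine lintegral_mono fun x => ?_
        rw [enorm_mul, bN, enorm_mul, mul_comm, ← add_mul, Real.enorm_of_nonneg (hatN_nonneg σ x)]
        gcongr
        · rw [Real.enorm_eq_ofReal_abs]; exact ENNReal.ofReal_le_ofReal (hψ x)
        · exact enorm_sub_le
    _ = ENNReal.ofReal B * (massN f σ + ∫⁻ x, ‖avgN f σ‖ₑ * ENNReal.ofReal (hatN σ x)) := by
        rw [lintegral_const_mul' _ _ ENNReal.ofReal_ne_top, lintegral_add_left' hm, massN]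
    _ ≤ ENNReal.ofReal B * (massN f σ + massN f σ) := by gcongr
    _ = _ := by
        rw [← two_mul, ENNReal.ofReal_mul zero_le_two, ENNReal.ofReal_ofNat]; ring

/-- Partial version of `hN`. -/
def hND (f : Eucl n → ℝ) (T : Node n → ℝ≥0) (D : ℕ) (σ : Node n) (x : Eucl n) : ℝ :=
  bN f σ x - ∑ d ∈ Finset.range D,
    Finsupp.linearCombination ℝ≥0 (fun κ => bN f κ x) (lw T (T σ) d σ)

namespace TreeBound
variable {f : Eucl n → ℝ} {T : Node n → ℝ≥0} {K : ℝ≥0}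

theorem avg_stopped (h : TreeBound f T K) {t : ℝ≥0} {d : ℕ} {σ κ : Node n} (ht : T σ ≤ 2 * t)
    (hκ : lw T t d σ κ ≠ 0) : |avgN f κ| ≤ 2 * K ^ 2 * t := by
  obtain ⟨ν, c, rfl, -, h1, -⟩ := lw_support (P := fun _ => True) (fun _ _ _ => trivial) d trivial
    ht hκ
  refine (h.avg _).trans ?_
  have h2 : T (ν.child c) ≤ K * (2 * t) := (h.child ν c).trans (by gcongr)
  calc (K : ℝ) * T (ν.child c) ≤ K * ((K * (2 * t) : ℝ≥0) : ℝ) := by gcongr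
    _ = _ := by push_cast; ring

theorem enorm_bN_le (h : TreeBound f T K) (x : Eucl n) (σ : Node n) (i : ℕ × Node n)
    (hi : wt T σ i ≠ 0) :
    ‖bN f i.2 x‖ₑ ≤ ENNReal.ofReal (|f x| + 2 * K ^ 2 * T σ) * ENNReal.ofReal (hatN i.2 x) := by
  rw [Real.enorm_eq_ofReal_abs, ← ENNReal.ofReal_mul (by positivity), bN, abs_mul,
    abs_of_nonneg (hatN_nonneg _ _)]
  refine ENNReal.ofReal_le_ofReal (mul_le_mul_of_nonneg_right ?_ (hatN_nonneg _ _))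
  exact (abs_sub _ _).trans (add_le_add_right
    (h.avg_stopped (le_mul_of_one_le_left zero_le one_le_two) hi) _)

theorem tendsto_hND (h : TreeBound f T K) (σ : Node n) (x : Eucl n) :
    Tendsto (fun D => hND f T D σ x) atTop (𝓝 (hN f T σ x)) := by
  refine tendsto_const_nhds.sub (JR_hasSum (v := fun κ => ENNReal.ofReal (|f x| +
    2 * K ^ 2 * T σ) * ENNReal.ofReal (hatN κ x)) (h.enorm_bN_le x σ) ?_).tendsto_sum_nat
  exact ne_top_of_le_ne_top (ENNReal.mul_ne_top ENNReal.ofReal_ne_top ENNReal.ofReal_ne_top)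
    ((refinable_mul_hatN _ x).JE_le σ)

theorem lc_hatN_nonneg (x : Eucl n) (w : Node n →₀ ℝ≥0) :
    0 ≤ Finsupp.linearCombination ℝ≥0 (fun κ => hatN κ x) w := by
  rw [Finsupp.linearCombination_apply]
  exact Finset.sum_nonneg fun κ _ => mul_nonneg (w κ).coe_nonneg (hatN_nonneg κ x)

theorem abs_hND_le (h : TreeBound f T K) (D : ℕ) (σ : Node n) (x : Eucl n) :
    |hND f T D σ x| ≤ |f x| * Finsupp.linearCombination ℝ≥0 (fun κ => hatN κ x) (uw T (T σ) D σ) +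
      (K + 2 * K ^ 2) * T σ * hatN σ x := by
  set N : Node n → ℝ := fun κ => hatN κ x with hN
  have e1 : ∀ d, Finsupp.linearCombination ℝ≥0 (fun κ => bN f κ x) (lw T (T σ) d σ) =
      f x * Finsupp.linearCombination ℝ≥0 N (lw T (T σ) d σ) -
        Finsupp.linearCombination ℝ≥0 (fun κ => avgN f κ * N κ) (lw T (T σ) d σ) := by
    intro d
    simp only [Finsupp.linearCombination_apply, Finsupp.sum, Finset.mul_sum]
    rw [← Finset.sum_sub_distrib]
    refine Finset.sum_congr rfl fun κ _ => ?_
    simp only [NNReal.smul_def, smul_eq_mul, bN, hN]; ring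
  have e2 : ∀ d, |Finsupp.linearCombination ℝ≥0 (fun κ => avgN f κ * N κ) (lw T (T σ) d σ)| ≤
      2 * K ^ 2 * T σ * Finsupp.linearCombination ℝ≥0 N (lw T (T σ) d σ) := by
    intro d
    simp only [Finsupp.linearCombination_apply, Finsupp.sum, Finset.mul_sum]
    refine (Finset.abs_sum_le_sum_abs _ _).trans (Finset.sum_le_sum fun κ hκ => ?_)
    have h1 := h.avg_stopped (le_mul_of_one_le_left zero_le one_le_two) (Finsupp.mem_support_iff.1 hκ)
    simp only [NNReal.smul_def, smul_eq_mul, abs_mul, NNReal.abs_eq]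
    rw [abs_of_nonneg (show 0 ≤ N κ from hatN_nonneg κ x), mul_left_comm]
    refine mul_le_mul_of_nonneg_right h1 (mul_nonneg (NNReal.coe_nonneg _) (hatN_nonneg κ x))
  have e3 := (refinable_hatN x).sum_lw T (T σ) D σ
  set S := ∑ d ∈ Finset.range D, Finsupp.linearCombination ℝ≥0 N (lw T (T σ) d σ) with hS
  set U := Finsupp.linearCombination ℝ≥0 N (uw T (T σ) D σ) with hU
  have hU0 : 0 ≤ U := lc_hatN_nonneg x _
  have e4 : hND f T D σ x = f x * U - avgN f σ * hatN σ x + ∑ d ∈ Finset.range D,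
      Finsupp.linearCombination ℝ≥0 (fun κ => avgN f κ * N κ) (lw T (T σ) d σ) := by
    simp only [hND, e1, Finset.sum_sub_distrib, ← Finset.mul_sum]
    have : hatN σ x = S + U := e3
    rw [← hS, bN, sub_mul, this]; ring
  have e5 : |∑ d ∈ Finset.range D, Finsupp.linearCombination ℝ≥0 (fun κ => avgN f κ * N κ)
      (lw T (T σ) d σ)| ≤ 2 * K ^ 2 * T σ * hatN σ x := by
    refine (Finset.abs_sum_le_sum_abs _ _).trans ((Finset.sum_le_sum fun d _ => e2 d).trans ?_)
    rw [← Finset.mul_sum, ← hS]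
    refine mul_le_mul_of_nonneg_left ?_ (by positivity)
    have : hatN σ x = S + U := e3
    linarith
  have e6 : |avgN f σ * hatN σ x| ≤ K * T σ * hatN σ x := by
    rw [abs_mul, abs_of_nonneg (hatN_nonneg σ x)]
    exact mul_le_mul_of_nonneg_right (h.avg σ) (hatN_nonneg σ x)
  rw [e4]
  have e7 : |f x * U| = |f x| * U := by rw [abs_mul, abs_of_nonneg hU0]
  have := abs_add_le (f x * U - avgN f σ * hatN σ x) (∑ d ∈ Finset.range D,
      Finsupp.linearCombination ℝ≥0 (fun κ => avgN f κ * N κ) (lw T (T σ) d σ))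
  have := abs_sub (f x * U) (avgN f σ * hatN σ x)
  linarith

theorem lc_uw_le (T : Node n → ℝ≥0) (D : ℕ) (σ : Node n) (x : Eucl n) :
    Finsupp.linearCombination ℝ≥0 (fun κ => hatN κ x) (uw T (T σ) D σ) ≤ hatN σ x := by
  have e3 := (refinable_hatN x).sum_lw T (T σ) D σ
  have : 0 ≤ ∑ d ∈ Finset.range D, Finsupp.linearCombination ℝ≥0 (fun κ => hatN κ x)
    (lw T (T σ) d σ) := Finset.sum_nonneg fun d _ => lc_hatN_nonneg x _
  linarith

theorem abs_hN_le (h : TreeBound f T K) (σ : Node n) :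
    ∀ᵐ x, |hN f T σ x| ≤ (3 * K + 2 * K ^ 2) * T σ * hatN σ x := by
  filter_upwards [h.leb] with x hx
  set U : ℕ → ℝ := fun D =>
    Finsupp.linearCombination ℝ≥0 (fun κ => hatN κ x) (uw T (T σ) D σ) with hU
  have hU0 : ∀ D, 0 ≤ U D := fun D => lc_hatN_nonneg x _
  have ev : ∀ᶠ D in atTop, |f x| * U D ≤ 2 * K * T σ * hatN σ x := by
    by_cases hz : ∃ D, U D = 0
    · obtain ⟨D, hD⟩ := hz
      have hanti : Antitone U := antitone_nat_of_succ_le fun D => by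
        have := (refinable_hatN x).uw_succ T (T σ) D σ
        have h2 := lc_hatN_nonneg x (lw T (T σ) D σ)
        simp only [hU]
        linarith
      filter_upwards [eventually_ge_atTop D] with D' hD'
      have : U D' = 0 := le_antisymm (hD ▸ hanti hD') (hU0 _)
      rw [this, mul_zero]
      exact mul_nonneg (by positivity) (hatN_nonneg σ x)
    · push Not at hz
      have : ∀ D, ∃ κ, uw T (T σ) D σ κ ≠ 0 ∧ hatN κ x ≠ 0 := by
        intro D
        have hD := hz D
        simp only [hU, Finsupp.linearCombination_apply, Finsupp.sum] at hD
        obtain ⟨κ, hκ, hκ'⟩ := Finset.exists_ne_zero_of_sum_ne_zero hD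
        exact ⟨κ, Finsupp.mem_support_iff.1 hκ, right_ne_zero_of_mul hκ'⟩
      choose κ hκ hκx using this
      have hs := fun D => uw_support D (le_mul_of_one_le_left zero_le one_le_two) (hκ D)
      have hlim := hx κ hκx (by
        simp_rw [(hs _).2]
        exact tendsto_atTop_add_const_left _ _ tendsto_natCast_atTop_atTop)
      have hfx : |f x| ≤ 2 * K * T σ := by
        refine le_of_tendsto hlim.abs (Eventually.of_forall fun D => (h.avg _).trans ?_)
        have : (T (κ D) : ℝ) ≤ 2 * T σ := by exact_mod_cast (hs D).1
        nlinarith [K.coe_nonneg]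
      refine Eventually.of_forall fun D => ?_
      exact mul_le_mul hfx (lc_uw_le T D σ x) (hU0 _) (by positivity)
  refine le_of_tendsto (h.tendsto_hND σ x).abs ?_
  filter_upwards [ev] with D hD
  refine (h.abs_hND_le D σ x).trans ?_
  have : (3 * (K : ℝ) + 2 * K ^ 2) * T σ * hatN σ x = 2 * K * T σ * hatN σ x +
    (K + 2 * K ^ 2) * T σ * hatN σ x := by ring
  rw [this]
  exact add_le_add_left hD _

theorem integrable_lc_bN (h : TreeBound f T K) (w : Node n →₀ ℝ≥0) :
    Integrable fun x => Finsupp.linearCombination ℝ≥0 (fun κ => bN f κ x) w := by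
  simp only [Finsupp.linearCombination_apply, Finsupp.sum, NNReal.smul_def, smul_eq_mul]
  exact integrable_finsetSum _ fun κ _ => (integrable_bN h.loc κ).const_mul _

theorem integrable_hND (h : TreeBound f T K) (D : ℕ) (σ : Node n) : Integrable (hND f T D σ) :=
  (integrable_bN h.loc σ).sub (integrable_finsetSum _ fun _ _ => h.integrable_lc_bN _)

theorem aestronglyMeasurable_hN (h : TreeBound f T K) (σ : Node n) :
    AEStronglyMeasurable (hN f T σ) volume :=
  aestronglyMeasurable_of_tendsto_ae atTop (fun D => (h.integrable_hND D σ).1)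
    (ae_of_all _ (h.tendsto_hND σ))

theorem integral_hN_mul (h : TreeBound f T K) {ψ : Eucl n → ℝ} (hψc : Continuous ψ) {B : ℝ}
    (hψ : ∀ x, |ψ x| ≤ B) (σ : Node n) :
    ∫ x, hN f T σ x * ψ x = (∫ x, bN f σ x * ψ x) - JR T (fun κ => ∫ x, bN f κ x * ψ x) σ := by
  have hB : 0 ≤ B := (abs_nonneg _).trans (hψ 0)
  have i1 : ∀ {u : Eucl n → ℝ}, Integrable u → Integrable fun x => u x * ψ x := fun hu =>
    hu.mul_bdd hψc.aestronglyMeasurable (ae_of_all _ hψ)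
  have hS := (JR_hasSum (T := T) (σ := σ) (u := fun κ => ∫ x, bN f κ x * ψ x)
    (v := fun κ => ENNReal.ofReal (2 * B) * massN f κ)
    (fun i _ => enorm_integral_bN_le h.loc hψ i.2) (by
    rw [JE_const_mul]
    exact ENNReal.mul_ne_top ENNReal.ofReal_ne_top (ne_top_of_le_ne_top (massN_lt_top h.loc σ).ne
      ((massN_refinable h.loc).JE_le σ)))).tendsto_sum_nat
  have e : ∀ D, ∫ x, hND f T D σ x * ψ x = (∫ x, bN f σ x * ψ x) - ∑ d ∈ Finset.range D,
      Finsupp.linearCombination ℝ≥0 (fun κ => ∫ x, bN f κ x * ψ x) (lw T (T σ) d σ) := by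
    intro D
    simp_rw [hND, sub_mul, Finset.sum_mul]
    rw [integral_sub (i1 (integrable_bN h.loc σ))
      (integrable_finsetSum _ fun d _ => i1 (h.integrable_lc_bN _)),
      integral_finsetSum _ fun d _ => i1 (h.integrable_lc_bN _)]
    congr 1
    refine Finset.sum_congr rfl fun d _ => ?_
    simp only [Finsupp.linearCombination_apply, Finsupp.sum, NNReal.smul_def, smul_eq_mul,
      Finset.sum_mul]
    rw [integral_finsetSum _ fun κ _ => i1 ((integrable_bN h.loc κ).const_mul _)]
    refine Finset.sum_congr rfl fun κ _ => ?_
    rw [← integral_const_mul]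
    congr 1; ext x; ring
  refine tendsto_nhds_unique ?_ (hS.const_sub (∫ x, bN f σ x * ψ x))
  simp_rw [← e]
  have hg : Integrable fun x => ((|f x| + (K + 2 * K ^ 2) * T σ) * hatN σ x) * B := by
    have h1 : Integrable fun x => |f x| * hatN σ x := by
      have h0 : Integrable fun x => f x * hatN σ x := by
        simpa [mul_comm] using h.loc.integrable_smul_left_of_hasCompactSupport
          (hatN_continuous σ) (hatN_hasCompactSupport σ)
      refine h0.abs.congr (ae_of_all _ fun x => ?_)
      simp only [abs_mul, abs_of_nonneg (hatN_nonneg σ x)]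
    have h2 := (integrable_hatN σ).const_mul ((K + 2 * K ^ 2) * T σ : ℝ)
    refine ((h1.mul_const B).add (h2.mul_const B)).congr (ae_of_all _ fun x => ?_)
    simp only [Pi.add_apply]; ring
  refine tendsto_integral_of_dominated_convergence _ (fun D => (i1 (h.integrable_hND D σ)).1) hg
    (fun D => ae_of_all _ fun x => ?_) (ae_of_all _ fun x => (h.tendsto_hND σ x).mul_const _)
  rw [norm_mul, Real.norm_eq_abs, Real.norm_eq_abs]
  refine mul_le_mul ((h.abs_hND_le D σ x).trans ?_) (hψ x) (abs_nonneg _)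
    (mul_nonneg (by positivity) (hatN_nonneg σ x))
  rw [add_mul (|f x|)]
  exact add_le_add_left (mul_le_mul_of_nonneg_left (lc_uw_le T D σ x) (abs_nonneg _)) _

theorem integral_hN (h : TreeBound f T K) (σ : Node n) : ∫ x, hN f T σ x = 0 := by
  have := h.integral_hN_mul (ψ := fun _ => 1) continuous_const (B := 1) (by simp) σ
  simpa [integral_bN h.loc, JR] using this

theorem hN_supp (h : TreeBound f T K) (σ : Node n) (x : Eucl n) (hx : hN f T σ x ≠ 0) :
    hatN σ x ≠ 0 := by
  intro hz
  refine hx (tendsto_nhds_unique (h.tendsto_hND σ x) (tendsto_const_nhds.congr fun D => ?_))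
  have h1 := h.abs_hND_le D σ x
  have h2 : Finsupp.linearCombination ℝ≥0 (fun κ => hatN κ x) (uw T (T σ) D σ) = 0 :=
    le_antisymm (hz ▸ lc_uw_le T D σ x) (lc_hatN_nonneg x _)
  rw [h2, hz, mul_zero, mul_zero, add_zero] at h1
  exact (abs_eq_zero.1 (le_antisymm h1 (abs_nonneg _))).symm

end TreeBound

end

section

/-- Iterates of `JE`. -/
def JEit (T : Node n → ℝ≥0) (u : Node n → ℝ≥0∞) : ℕ → Node n → ℝ≥0∞
  | 0 => u
  | G + 1 => JE T (JEit T u G)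

/-- Iterates of `JR`. -/
def JRit (T : Node n → ℝ≥0) (u : Node n → ℝ) : ℕ → Node n → ℝ
  | 0 => u
  | G + 1 => JR T (JRit T u G)

theorem JEit_const_mul (T : Node n → ℝ≥0) (a : ℝ≥0∞) (u : Node n → ℝ≥0∞) (G : ℕ) (σ : Node n) :
    JEit T (fun κ => a * u κ) G σ = a * JEit T u G σ := by
  induction G generalizing σ with
  | zero => rfl
  | succ G ih =>
    rw [JEit, JEit, ← JE_const_mul]
    congr 1; ext κ; exact ih κ

theorem Refinable.JEit_antitone {T : Node n → ℝ≥0} {u : Node n → ℝ≥0∞} (hu : Refinable u)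
    (σ : Node n) : Antitone fun G => JEit T u G σ := by
  refine antitone_nat_of_succ_le fun G => ?_
  induction G generalizing σ with
  | zero => exact hu.JE_le σ
  | succ G ih => exact JE_mono fun i _ => ih i.2

theorem JEit_aemeasurable (T : Node n → ℝ≥0) {u : Node n → Eucl n → ℝ≥0∞}
    (hu : ∀ κ, AEMeasurable (u κ) volume) (G : ℕ) (σ : Node n) :
    AEMeasurable (fun x => JEit T (fun κ => u κ x) G σ) volume := by
  induction G generalizing σ with
  | zero => exact hu σ
  | succ G ih => exact JE_aemeasurable T σ (u := fun κ x => JEit T (fun κ => u κ x) G κ) ih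

theorem JEit_lintegral (T : Node n → ℝ≥0) {u : Node n → Eucl n → ℝ≥0∞}
    (hu : ∀ κ, AEMeasurable (u κ) volume) (G : ℕ) (σ : Node n) :
    JEit T (fun κ => ∫⁻ x, u κ x) G σ = ∫⁻ x, JEit T (fun κ => u κ x) G σ := by
  induction G generalizing σ with
  | zero => rfl
  | succ G ih =>
    simp only [JEit]
    rw [← JE_lintegral T σ (JEit_aemeasurable T hu G)]
    congr 1; ext κ; exact ih κ

theorem JEit_ne_zero {T : Node n → ℝ≥0} {u : Node n → ℝ≥0∞} {G : ℕ} {σ : Node n}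
    (h : JEit T u G σ ≠ 0) : ∃ κ, u κ ≠ 0 ∧ σ.1 + G ≤ κ.1 ∧ 2 ^ G * T σ ≤ T κ := by
  induction G generalizing σ with
  | zero => exact ⟨σ, h, by simp, by simp⟩
  | succ G ih =>
    rw [JEit, JE, Ne, ENNReal.tsum_eq_zero] at h
    push Not at h
    obtain ⟨i, hi⟩ := h
    have hw : wt T σ i ≠ 0 := fun h0 => by simp [h0] at hi
    obtain ⟨ν, c, hν, h1, -, h2⟩ := wt_support (P := fun ν => σ.1 ≤ ν.1)
      (fun ν c hν => hν.trans (by simp [Node.child])) le_rfl hw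
    obtain ⟨κ, a, b, d⟩ := ih (right_ne_zero_of_mul hi)
    refine ⟨κ, a, ?_, ?_⟩
    · have : i.2.1 = ν.1 + 1 := by rw [hν]; rfl
      push_cast; omega
    · calc 2 ^ (G + 1) * T σ = 2 ^ G * (2 * T σ) := by ring
        _ ≤ 2 ^ G * T i.2 := by gcongr
        _ ≤ _ := d

namespace TreeBound
variable {f : Eucl n → ℝ} {T : Node n → ℝ≥0} {K : ℝ≥0}

theorem pos_of_wt_ne_zero (h : TreeBound f T K) {σ : Node n} {i : ℕ × Node n}
    (hi : wt T σ i ≠ 0) : 0 < T σ := by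
  obtain ⟨ν, c, hν, -, h1, h2⟩ := wt_support (P := fun _ => True) (fun _ _ _ => trivial) trivial hi
  by_contra h0
  have h0 : T σ = 0 := by simpa using h0
  rw [h0, mul_zero] at h1 h2
  have h3 := h.child ν c
  rw [le_zero_iff.1 h1, mul_zero, ← hν] at h3
  exact absurd h2 (not_lt.2 h3)

theorem tendsto_JEit_massN (h : TreeBound f T K) (σ : Node n) :
    Tendsto (fun G => JEit T (massN f) G σ) atTop (𝓝 0) := by
  have hm : ∀ κ : Node n, AEMeasurable (fun x => ‖f x‖ₑ * ENNReal.ofReal (hatN κ x)) volume :=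
    fun κ => h.loc.aestronglyMeasurable.enorm.mul
      (hatN_continuous _).measurable.ennreal_ofReal.aemeasurable
  have e : ∀ G, JEit T (massN f) G σ =
      ∫⁻ x, JEit T (fun κ => ‖f x‖ₑ * ENNReal.ofReal (hatN κ x)) G σ := fun G =>
    JEit_lintegral T hm G σ
  simp_rw [e]
  rw [← lintegral_zero (μ := (volume : Measure (Eucl n)))]
  refine tendsto_lintegral_of_dominated_convergence'
    (fun x => ‖f x‖ₑ * ENNReal.ofReal (hatN σ x)) (fun G => JEit_aemeasurable T hm G σ)
    (fun G => ae_of_all _ fun x => (refinable_mul_hatN _ x).JEit_antitone σ (Nat.zero_le G))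
    (massN_lt_top h.loc σ).ne ?_
  filter_upwards [h.bdd] with x hx
  by_cases hz : ∃ G, JEit T (fun κ => ‖f x‖ₑ * ENNReal.ofReal (hatN κ x)) G σ = 0
  · obtain ⟨G, hG⟩ := hz
    refine tendsto_const_nhds.congr' ?_
    filter_upwards [eventually_ge_atTop G] with G' hG'
    exact (le_antisymm (((refinable_mul_hatN _ x).JEit_antitone σ hG').trans hG.le) zero_le).symm
  · exfalso
    push Not at hz
    choose κ hκ h1 h2 using fun G => JEit_ne_zero (hz G)
    have hp : 0 < T σ := by
      have := hz 1
      simp only [JEit, JE, Ne, ENNReal.tsum_eq_zero] at this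
      push Not at this
      obtain ⟨i, hi⟩ := this
      refine h.pos_of_wt_ne_zero (i := i) fun h0 => ?_
      simp [h0] at hi
    refine hx κ (fun G h0 => hκ G (by simp [h0])) ?_ ?_
    · refine tendsto_atTop_mono h1 ?_
      exact tendsto_atTop_add_const_left _ _ tendsto_natCast_atTop_atTop
    · refine tendsto_atTop_mono h2 ?_
      exact (tendsto_pow_atTop_atTop_of_one_lt one_lt_two).atTop_mul_const hp

theorem enorm_JRit_le (h : TreeBound f T K) {ψ : Eucl n → ℝ} {B : ℝ} (hψ : ∀ x, |ψ x| ≤ B)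
    (G : ℕ) (σ : Node n) : ‖JRit T (fun κ => ∫ x, bN f κ x * ψ x) G σ‖ₑ ≤
      ENNReal.ofReal (2 * B) * JEit T (massN f) G σ := by
  induction G generalizing σ with
  | zero => exact enorm_integral_bN_le h.loc hψ σ
  | succ G ih =>
    rw [JEit, ← JE_const_mul]
    exact enorm_JR_le fun i _ => ih i.2

theorem JRit_hN (h : TreeBound f T K) {ψ : Eucl n → ℝ} (hψc : Continuous ψ) {B : ℝ}
    (hψ : ∀ x, |ψ x| ≤ B) (G : ℕ) (σ : Node n) :
    JRit T (fun κ => ∫ x, hN f T κ x * ψ x) G σ =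
      JRit T (fun κ => ∫ x, bN f κ x * ψ x) G σ -
        JRit T (fun κ => ∫ x, bN f κ x * ψ x) (G + 1) σ := by
  induction G generalizing σ with
  | zero => exact h.integral_hN_mul hψc hψ σ
  | succ G ih =>
    rw [JRit, JRit, JRit]
    rw [← JR_sub (v := fun κ => ENNReal.ofReal (2 * B) * massN f κ)]
    · congr 1; ext κ; exact ih κ
    · exact fun i _ => (h.enorm_JRit_le hψ G i.2).trans
        (mul_le_mul_right ((massN_refinable h.loc).JEit_antitone i.2 (Nat.zero_le G)) _)
    · exact fun i _ => (h.enorm_JRit_le hψ (G + 1) i.2).trans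
        (mul_le_mul_right ((massN_refinable h.loc).JEit_antitone i.2 (Nat.zero_le _)) _)
    · rw [JE_const_mul]
      exact ENNReal.mul_ne_top ENNReal.ofReal_ne_top
        (ne_top_of_le_ne_top (massN_lt_top h.loc σ).ne ((massN_refinable h.loc).JE_le σ))

variable {φ : Eucl n → ℝ} {Pd : Node n → Prop} {c0 : Node n → ℝ≥0∞}

theorem rep_JRit (hPd : ∀ ν c, Pd ν → Pd (ν.child c))
    (hrep : ∀ σ, Pd σ → Rep n φ (bsize n) (fun ψ => ∫ x, hN f T σ x * ψ x) (c0 σ)) (G : ℕ)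
    {σ : Node n} (hσ : Pd σ) (hc : JEit T c0 G σ ≠ ⊤) :
    Rep n φ (bsize n) (fun ψ => JRit T (fun κ => ∫ x, hN f T κ x * ψ x) G σ)
      (JEit T c0 G σ) := by
  induction G generalizing σ with
  | zero => exact hrep σ hσ
  | succ G ih =>
    refine rep_sum (ι := ℕ × Node n)
      (c := fun i => (wt T σ i : ℝ≥0∞) * JEit T c0 G i.2) (fun i => ?_) hc
    by_cases hi : wt T σ i = 0
    · simp only [hi, NNReal.coe_zero, zero_mul]
      exact rep_zero _ _ _
    · obtain ⟨ν, c, hν, h1, -⟩ := wt_support hPd hσ hi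
      have hfin : JEit T c0 G i.2 ≠ ⊤ := fun ht => by
        have := ENNReal.ne_top_of_tsum_ne_top hc i
        rw [ht] at this
        exact this (ENNReal.mul_top (by simpa using hi))
      have h2 := (ih (hν ▸ hPd ν c h1) hfin).const_mul (wt T σ i : ℝ)
      rwa [NNReal.abs_eq, ENNReal.ofReal_coe_nnreal] at h2

theorem rep (h : TreeBound f T K) (hPd : ∀ ν c, Pd ν → Pd (ν.child c))
    (hrep : ∀ σ, Pd σ → Rep n φ (bsize n) (fun ψ => ∫ x, hN f T σ x * ψ x) (c0 σ))
    {σ : Node n} (hσ : Pd σ) (hc : ∑' G, JEit T c0 G σ ≠ ⊤) :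
    Rep n φ (bsize n) (fun ψ => ∫ x, bN f σ x * ψ x) (∑' G, JEit T c0 G σ) := by
  have hr := fun G => rep_JRit hPd hrep G hσ (ENNReal.ne_top_of_tsum_ne_top hc G)
  refine (rep_sum hr hc).congr fun ψ hψ => ?_
  have hB := (testSize_spec hψ).1
  have hs := (summable_of_rep hr hc hψ).hasSum.tendsto_sum_nat
  refine tendsto_nhds_unique ?_ hs
  simp_rw [h.JRit_hN hψ.1.continuous hB, Finset.sum_range_sub']
  have h0 : Tendsto (fun G => JRit T (fun κ => ∫ x, bN f κ x * ψ x) G σ) atTop (𝓝 0) := by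
    rw [tendsto_zero_iff_enorm_tendsto_zero]
    have := ENNReal.Tendsto.const_mul (a := ENNReal.ofReal (2 * testSize n ψ))
      (h.tendsto_JEit_massN σ) (Or.inr ENNReal.ofReal_ne_top)
    rw [mul_zero] at this
    exact tendsto_of_tendsto_of_tendsto_of_le_of_le tendsto_const_nhds this (fun _ => zero_le)
      fun G => h.enorm_JRit_le hB G σ
  simpa [JRit] using h0.const_sub (JRit T (fun κ => ∫ x, bN f κ x * ψ x) 0 σ)

end TreeBound

end

/-- The denominator of `θ`. -/
def DD (x : Eucl n) (t : ℝ) : ℝ := log (exp 1 + ‖x‖) + log (exp 1 + t)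

theorem two_le_DD (x : Eucl n) {t : ℝ} (ht : 0 ≤ t) : 2 ≤ DD x t := by
  have := one_le_log_exp_add (norm_nonneg x)
  have := one_le_log_exp_add ht
  unfold DD; linarith

theorem DD_mono (x : Eucl n) {s t : ℝ} (hs : 0 ≤ s) (h : s ≤ t) : DD x s ≤ DD x t := by
  unfold DD
  gcongr

theorem thetaE_ofReal (x : Eucl n) {t : ℝ} (ht : 0 ≤ t) :
    thetaE n x (ENNReal.ofReal t) = ENNReal.ofReal (t / DD x t) := by
  have := two_le_DD x ht
  rw [thetaE, ENNReal.toReal_ofReal ht, ENNReal.ofReal_div_of_pos (by linarith)]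
  rfl

theorem thetaE_top (x : Eucl n) : thetaE n x ⊤ = ⊤ := by
  rw [thetaE, ENNReal.top_div_of_ne_top ENNReal.ofReal_ne_top]

theorem exists_DD_growth {δ c : ℝ} (hδ : 0 < δ) (hc : 0 < c) :
    ∃ C : ℝ, 0 < C ∧ ∀ (x : Eucl n) (a t : ℝ), 0 < a → c * a ≤ t →
      DD x t ≤ C * (t / a) ^ δ * DD x a := by
  refine ⟨(c ^ δ)⁻¹ + (1 + δ⁻¹), by positivity, fun x a t ha hat => ?_⟩
  have ht : 0 < t := lt_of_lt_of_le (by positivity) hat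
  have hu : c ≤ t / a := by rwa [le_div_iff₀ ha]
  have h2 := two_le_DD x ha.le
  rcases le_total t a with h | h
  · have h3 : 1 ≤ (c ^ δ)⁻¹ * (t / a) ^ δ := by
      rw [inv_mul_eq_div, one_le_div (by positivity)]
      exact Real.rpow_le_rpow hc.le hu hδ.le
    have h4 : 0 ≤ (1 + δ⁻¹) * (t / a) ^ δ := by positivity
    calc DD x t ≤ 1 * DD x a := by rw [one_mul]; exact DD_mono x ht.le h
      _ ≤ _ := by gcongr; linarith
  · have hu1 : 1 ≤ t / a := by rwa [one_le_div ha]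
    have h3 : 1 ≤ (t / a) ^ δ := Real.one_le_rpow hu1 hδ.le
    have h4 : log (exp 1 + t) ≤ log (exp 1 + a) + log (t / a) := by
      rw [← Real.log_mul (by positivity) (by positivity)]
      refine Real.log_le_log (by positivity) ?_
      rw [add_mul, mul_div_cancel₀ _ ha.ne']
      gcongr
      exact le_mul_of_one_le_right (by positivity) hu1
    have h5 : log (t / a) ≤ (t / a) ^ δ / δ := Real.log_le_rpow_div (by positivity) hδ
    have h6 : 0 ≤ (c ^ δ)⁻¹ * (t / a) ^ δ * DD x a := by positivity
    have h7 : DD x t ≤ DD x a + (t / a) ^ δ * δ⁻¹ := by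
      rw [← div_eq_mul_inv]; unfold DD; linarith
    have h8 : 0 ≤ (t / a) ^ δ * δ⁻¹ := by positivity
    nlinarith

theorem exists_zpow_sum {δ : ℝ} (hδ : 0 < δ) : ∃ C : ℝ≥0, ∀ t : ℝ, 0 < t →
    ∑' s : ℤ, (if (2 : ℝ) ^ s < t then ENNReal.ofReal (((2 : ℝ) ^ s) ^ δ) else 0) ≤
      C * ENNReal.ofReal (t ^ δ) := by
  set b : ℝ≥0∞ := ENNReal.ofReal ((2 : ℝ) ^ (-δ)) with hb
  have hb1 : b < 1 := by
    rw [hb, ENNReal.ofReal_lt_one]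
    exact Real.rpow_lt_one_of_one_lt_of_neg one_lt_two (by linarith)
  have hC : (1 - b)⁻¹ ≠ ⊤ := by
    rw [Ne, ENNReal.inv_eq_top, tsub_eq_zero_iff_le]; exact not_le.2 hb1
  refine ⟨((1 - b)⁻¹).toNNReal, fun t ht => ?_⟩
  rw [ENNReal.coe_toNNReal hC]
  obtain ⟨s0, hs0, hs1⟩ := exists_mem_Ico_zpow ht (one_lt_two)
  have hinj : Function.Injective fun k : ℕ => s0 - (k : ℤ) := fun a b h => by
    simpa using h
  rw [← hinj.tsum_eq]
  · calc _ ≤ ∑' k : ℕ, ENNReal.ofReal (t ^ δ) * b ^ k := by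
          refine ENNReal.tsum_le_tsum fun k => ?_
          split_ifs with h
          · rw [hb, ← ENNReal.ofReal_pow (by positivity), ← ENNReal.ofReal_mul (by positivity)]
            refine ENNReal.ofReal_le_ofReal ?_
            have e : ((2 : ℝ) ^ (s0 - (k : ℤ))) ^ δ = ((2 : ℝ) ^ s0) ^ δ * (2 ^ (-δ)) ^ k := by
              rw [zpow_sub₀ two_ne_zero, zpow_natCast, Real.div_rpow (by positivity)
                (by positivity), div_eq_mul_inv, Real.rpow_neg zero_le_two, inv_pow,
                ← Real.rpow_natCast, ← Real.rpow_natCast, ← Real.rpow_mul zero_le_two,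
                ← Real.rpow_mul zero_le_two, mul_comm δ]
            rw [e]
            gcongr
          · exact zero_le
      _ = _ := by rw [ENNReal.tsum_mul_left, ENNReal.tsum_geometric, mul_comm]
  · intro s hs
    rw [Function.mem_support] at hs
    have h : (2 : ℝ) ^ s < t := by
      by_contra h; simp [h] at hs
    have : s < s0 + 1 := (zpow_lt_zpow_iff_right₀ one_lt_two).1 (h.trans hs1)
    exact ⟨(s0 - s).toNat, by simp only []; omega⟩

/-- Weight at level `a`. -/
def wL (a : ℝ) (x : Eucl n) : ℝ≥0∞ := ENNReal.ofReal (1 / DD x a)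

/-- The part of `t^p` above the level `a`. -/
def hi (p a : ℝ) (t : ℝ≥0∞) : ℝ≥0∞ := if ENNReal.ofReal a < t then t ^ p else 0

theorem exists_pointwise_sum {p c : ℝ} (hp : 0 < p) (hp1 : p < 1) (hc : 0 < c) :
    ∃ C : ℝ≥0, ∀ (x : Eucl n) (t : ℝ≥0∞), t ≠ ⊤ →
      ∑' s : ℤ, ENNReal.ofReal (2 ^ s) * (ENNReal.ofReal (((2 : ℝ) ^ s) ^ (-p)) *
        (hi p (c * 2 ^ s) t * wL (2 ^ s) x)) ≤ C * thetaE n x t := by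
  have hδ : 0 < (1 - p) / 2 := by linarith
  set δ := (1 - p) / 2 with hδe
  obtain ⟨C1, hC1, H1⟩ := exists_DD_growth (n := n) hδ hc
  obtain ⟨C2, H2⟩ := exists_zpow_sum hδ
  refine ⟨C2 * (C1 * (c ^ δ)⁻¹).toNNReal, fun x t ht => ?_⟩
  rcases eq_zero_or_pos t with h0 | h0
  · subst h0; simp [hi]
  obtain ⟨τ, hτ, et⟩ : ∃ τ : ℝ, 0 < τ ∧ t = ENNReal.ofReal τ :=
    ⟨t.toReal, ENNReal.toReal_pos h0.ne' ht, (ENNReal.ofReal_toReal ht).symm⟩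
  have hD := two_le_DD x hτ.le
  calc _ ≤ ∑' s : ℤ, ENNReal.ofReal (C1 * τ ^ (p + δ) / DD x τ) *
        (if (2 : ℝ) ^ s < τ / c then ENNReal.ofReal (((2 : ℝ) ^ s) ^ δ) else 0) := by
        refine ENNReal.tsum_le_tsum fun s => ?_
        have ha : (0 : ℝ) < 2 ^ s := by positivity
        set a : ℝ := 2 ^ s
        have hDa := two_le_DD x ha.le
        simp only [et, hi, ENNReal.ofReal_lt_ofReal_iff hτ]
        by_cases hlt : c * a < τ
        · have h2 : a < τ / c := by rwa [lt_div_iff₀ hc, mul_comm]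
          rw [if_pos hlt, if_pos h2, ENNReal.ofReal_rpow_of_pos hτ, wL,
            ← ENNReal.ofReal_mul (by positivity), ← ENNReal.ofReal_mul (by positivity),
            ← ENNReal.ofReal_mul (by positivity), ← ENNReal.ofReal_mul (by positivity)]
          refine ENNReal.ofReal_le_ofReal ?_
          have hg := H1 x a τ ha hlt.le
          have e1 : (τ / a) ^ δ = τ ^ δ * (a ^ δ)⁻¹ := by
            rw [Real.div_rpow hτ.le ha.le, div_eq_mul_inv]
          have e2 : a * a ^ (-p) = a ^ δ * a ^ δ := by
            rw [← Real.rpow_add ha, ← Real.rpow_one_add' ha.le (by linarith)]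
            congr 1; rw [hδe]; ring
          rw [Real.rpow_add hτ, ← mul_assoc, e2, mul_one_div, ← mul_div_assoc, div_mul_eq_mul_div,
            div_le_div_iff₀ (by linarith) (by linarith)]
          have hq : 0 < a ^ δ := by positivity
          calc a ^ δ * a ^ δ * τ ^ p * DD x τ
              ≤ a ^ δ * a ^ δ * τ ^ p * (C1 * (τ ^ δ * (a ^ δ)⁻¹) * DD x a) := by
                rw [← e1]; gcongr
            _ = _ := by field_simp
        · rw [if_neg hlt]; simp
    _ ≤ ENNReal.ofReal (C1 * τ ^ (p + δ) / DD x τ) * (C2 * ENNReal.ofReal ((τ / c) ^ δ)) := by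
        rw [ENNReal.tsum_mul_left]
        gcongr
        exact H2 _ (by positivity)
    _ = _ := by
        rw [et, thetaE_ofReal x hτ.le, ENNReal.coe_mul, mul_left_comm, mul_assoc,
          ← ENNReal.ofReal_mul (by positivity)]
        congr 1
        change _ = ENNReal.ofReal _ * _
        rw [← ENNReal.ofReal_mul (by positivity)]
        congr 1
        rw [Real.div_rpow hτ.le hc.le]
        have e3 : τ ^ (p + δ) * τ ^ δ = τ := by
          rw [← Real.rpow_add hτ, show p + δ + δ = 1 by rw [hδe]; ring, Real.rpow_one]
        field_simp
        rw [e3]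

/-- The average of `g^{1/(1+q)}` on a ball, raised to the power `1+q`. -/
def TT (g : Eucl n → ℝ≥0∞) (q : ℝ) (c : Eucl n) (r : ℝ) : ℝ≥0∞ :=
  ((ENNReal.ofReal (r ^ n))⁻¹ * ∫⁻ y in closedBall c r, g y ^ (1 / (1 + q))) ^ (1 + q)

/-- Density controlling the size of level sets. -/
def dens (p c a : ℝ) (g : Eucl n → ℝ≥0∞) (x : Eucl n) : ℝ≥0∞ :=
  ENNReal.ofReal (a ^ (-p)) * (hi p (c * a) (g x) * wL a x)

theorem wL_measurable (a : ℝ) : Measurable (wL a : Eucl n → ℝ≥0∞) := by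
  unfold wL DD; fun_prop

theorem hi_comp_measurable (p a : ℝ) {g : Eucl n → ℝ≥0∞} (hg : Measurable g) :
    Measurable fun x => hi p a (g x) := by
  unfold hi
  exact Measurable.ite (measurableSet_lt measurable_const hg) (hg.pow_const p) measurable_const

theorem dens_measurable (p c a : ℝ) {g : Eucl n → ℝ≥0∞} (hg : Measurable g) :
    Measurable (dens p c a g) :=
  ((hi_comp_measurable p _ hg).mul (wL_measurable a)).const_mul _

theorem thetaE_measurable {g : Eucl n → ℝ≥0∞} (hg : Measurable g) :
    Measurable fun x => thetaE n x (g x) := by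
  unfold thetaE
  refine hg.div (ENNReal.measurable_ofReal.comp ?_)
  have := hg.ennreal_toReal
  fun_prop

theorem ae_lt_top_of_theta {g : Eucl n → ℝ≥0∞} (hg : Measurable g)
    (h : ∫⁻ x, thetaE n x (g x) ≤ 1) : ∀ᵐ x, g x ≠ ⊤ := by
  filter_upwards [ae_lt_top (thetaE_measurable hg) (ne_top_of_le_ne_top ENNReal.one_ne_top h)]
    with x hx hg
  rw [hg, thetaE_top] at hx
  exact lt_irrefl _ hx

theorem exists_level_sum {p c : ℝ} (hp : 0 < p) (hp1 : p < 1) (hc : 0 < c) :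
    ∃ C : ℝ≥0, ∀ g : Eucl n → ℝ≥0∞, Measurable g → ∫⁻ x, thetaE n x (g x) ≤ 1 →
      ∑' s : ℤ, ENNReal.ofReal (2 ^ s) * ∫⁻ x, dens p c (2 ^ s) g x ≤ C := by
  obtain ⟨C, H⟩ := exists_pointwise_sum (n := n) hp hp1 hc
  refine ⟨C, fun g hg hθ => ?_⟩
  simp_rw [← lintegral_const_mul' _ _ ENNReal.ofReal_ne_top]
  rw [← lintegral_tsum fun s => ((dens_measurable p c _ hg).const_mul _).aemeasurable]
  calc _ ≤ ∫⁻ x, C * thetaE n x (g x) := by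
        refine lintegral_mono_ae ?_
        filter_upwards [ae_lt_top_of_theta hg hθ] with x hx
        exact H x _ hx
    _ ≤ C * 1 := by
        rw [lintegral_const_mul' _ _ ENNReal.coe_ne_top]; gcongr
    _ = C := mul_one _

theorem exists_rpow_le_theta {p : ℝ} (hp : 0 < p) (hp1 : p < 1) :
    ∃ C : ℝ, 0 < C ∧ ∀ (x : Eucl n) (t : ℝ≥0∞), t ≠ ⊤ →
      t ^ p ≤ 1 + ENNReal.ofReal (C * (1 + ‖x‖)) * thetaE n x t := by
  obtain ⟨C, hC, H⟩ := exists_DD_growth (n := n) (show 0 < 1 - p by linarith) one_pos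
  refine ⟨6 * C, by positivity, fun x t ht => ?_⟩
  obtain ⟨τ, hτ, rfl⟩ : ∃ τ : ℝ, 0 ≤ τ ∧ t = ENNReal.ofReal τ :=
    ⟨t.toReal, ENNReal.toReal_nonneg, (ENNReal.ofReal_toReal ht).symm⟩
  rcases le_total τ 1 with h | h
  · refine le_add_right (ENNReal.rpow_le_one ?_ hp.le)
    rwa [ENNReal.ofReal_le_one]
  · refine le_add_left ?_
    have hτ0 : 0 < τ := by linarith
    have hD := two_le_DD x hτ
    have h1 := H x 1 τ one_pos (by linarith)
    have h2 : DD x 1 ≤ 6 * (1 + ‖x‖) := by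
      have := log_exp_add_le (norm_nonneg x)
      have := log_exp_add_le zero_le_one
      have := norm_nonneg x
      unfold DD; linarith
    rw [thetaE_ofReal x hτ, ENNReal.ofReal_rpow_of_nonneg hτ hp.le,
      ← ENNReal.ofReal_mul (by positivity)]
    refine ENNReal.ofReal_le_ofReal ?_
    rw [← mul_div_assoc, le_div_iff₀ (by linarith)]
    rw [div_one] at h1
    calc τ ^ p * DD x τ ≤ τ ^ p * (C * τ ^ (1 - p) * (6 * (1 + ‖x‖))) := by
          gcongr; exact h1.trans (by gcongr)
      _ = (τ ^ p * τ ^ (1 - p)) * (C * (6 * (1 + ‖x‖))) := by ring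
      _ = _ := by
          rw [← Real.rpow_add hτ0, show p + (1 - p) = 1 by ring, Real.rpow_one]; ring

theorem exists_TT_log_le {q : ℝ} (hq : 0 < q) :
    ∃ M : ℝ, 0 < M ∧ ∀ g : Eucl n → ℝ≥0∞, Measurable g → ∫⁻ x, thetaE n x (g x) ≤ 1 →
      ∀ (c : Eucl n) (r : ℝ), 0 < r → (∫⁻ y in closedBall c r, g y ^ (1 / (1 + q))) ≠ ⊤ ∧
        TT g q c r ≠ ⊤ ∧ log (exp 1 + (TT g q c r).toReal) ≤
          M * (log (exp 1 + r⁻¹) + log (exp 1 + (‖c‖ + r))) := by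
  have hp : 0 < 1 / (1 + q) := by positivity
  have hp1 : 1 / (1 + q) < 1 := by rw [div_lt_one (by linarith)]; linarith
  obtain ⟨C, hC, H⟩ := exists_rpow_le_theta (n := n) hp hp1
  set p := 1 / (1 + q)
  have hω := omegaVol_pos (n := n)
  set A : ℝ := omegaVol n + C with hA
  have hA0 : 0 < A := by positivity
  have hl : 0 ≤ log (exp 1 + A ^ (1 + q)) :=
    zero_le_one.trans (one_le_log_exp_add (by positivity))
  refine ⟨log (exp 1 + A ^ (1 + q)) + (1 + q) * (n + 1), by positivity, fun g hg hθ c r hr => ?_⟩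
  have hi : ∫⁻ y in closedBall c r, g y ^ p ≤
      ENNReal.ofReal (r ^ n * omegaVol n + C * (1 + (‖c‖ + r))) := by
    calc _ ≤ ∫⁻ y in closedBall c r,
          (1 + ENNReal.ofReal (C * (1 + (‖c‖ + r))) * thetaE n y (g y)) := by
          refine lintegral_mono_ae ?_
          filter_upwards [ae_restrict_of_ae (ae_lt_top_of_theta hg hθ),
            ae_restrict_mem measurableSet_closedBall] with y hy hyc
          refine (H y _ hy).trans ?_
          gcongr
          have := norm_le_norm_add_norm_sub' y c
          rw [mem_closedBall, dist_eq_norm] at hyc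
          linarith
      _ ≤ volume (closedBall c r) + ENNReal.ofReal (C * (1 + (‖c‖ + r))) * 1 := by
          rw [lintegral_add_left measurable_const, setLIntegral_one,
            lintegral_const_mul' _ _ ENNReal.ofReal_ne_top]
          gcongr
          exact (setLIntegral_le_lintegral _ _).trans hθ
      _ = _ := by
          rw [volume_closedBall_eq c hr.le, mul_one, ENNReal.ofReal_add (by positivity)
            (by positivity)]
  have hX1 := one_le_log_exp_add (inv_nonneg.2 hr.le)
  have hZ1 := one_le_log_exp_add (show 0 ≤ ‖c‖ + r by positivity)
  have hX : 1 ≤ exp 1 + r⁻¹ := by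
    have := Real.add_one_le_exp 1
    have : 0 < r⁻¹ := by positivity
    linarith
  have hZ : 1 ≤ exp 1 + (‖c‖ + r) := by
    have := Real.add_one_le_exp 1
    have : 0 ≤ ‖c‖ + r := by positivity
    linarith
  set X := exp 1 + r⁻¹ with hXe
  set Z := exp 1 + (‖c‖ + r) with hZe
  have hav : (ENNReal.ofReal (r ^ n))⁻¹ * ∫⁻ y in closedBall c r, g y ^ p ≤
      ENNReal.ofReal (A * (X ^ n * Z)) := by
    rw [← ENNReal.ofReal_inv_of_pos (by positivity)]
    refine (mul_le_mul_right hi _).trans ?_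
    rw [← ENNReal.ofReal_mul (by positivity)]
    refine ENNReal.ofReal_le_ofReal ?_
    have h1 : (r ^ n)⁻¹ ≤ X ^ n := by
      rw [← inv_pow]
      have : r⁻¹ ≤ X := by rw [hXe]; linarith [Real.exp_pos 1]
      gcongr
    have h2 : 1 ≤ X ^ n := one_le_pow₀ hX
    have h3 : 1 + (‖c‖ + r) ≤ Z := by
      have := Real.add_one_le_exp 1
      rw [hZe]; linarith
    calc (r ^ n)⁻¹ * (r ^ n * omegaVol n + C * (1 + (‖c‖ + r)))
        = omegaVol n * (1 * 1) + C * ((r ^ n)⁻¹ * (1 + (‖c‖ + r))) := by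
          field_simp
      _ ≤ omegaVol n * (X ^ n * Z) + C * (X ^ n * Z) := by gcongr
      _ = _ := by rw [hA]; ring
  have hTT : TT g q c r ≤ ENNReal.ofReal ((A * (X ^ n * Z)) ^ (1 + q)) := by
    rw [← ENNReal.ofReal_rpow_of_pos (by positivity)]
    exact ENNReal.rpow_le_rpow hav (by linarith)
  refine ⟨ne_top_of_le_ne_top ENNReal.ofReal_ne_top hi,
    ne_top_of_le_ne_top ENNReal.ofReal_ne_top hTT, ?_⟩
  have h1 : (TT g q c r).toReal ≤ (A * (X ^ n * Z)) ^ (1 + q) := by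
    refine (ENNReal.toReal_mono ENNReal.ofReal_ne_top hTT).trans_eq ?_
    rw [ENNReal.toReal_ofReal (by positivity)]
  have h2 : 1 ≤ (X ^ n * Z) ^ (1 + q) :=
    Real.one_le_rpow (one_le_mul_of_one_le_of_one_le (one_le_pow₀ hX) hZ) (by linarith)
  have h3 : exp 1 + (TT g q c r).toReal ≤ (exp 1 + A ^ (1 + q)) * (X ^ n * Z) ^ (1 + q) := by
    rw [Real.mul_rpow hA0.le (by positivity)] at h1
    rw [add_mul]
    have : exp 1 * 1 ≤ exp 1 * (X ^ n * Z) ^ (1 + q) := by gcongr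
    linarith
  have hTT0 : 0 ≤ (TT g q c r).toReal := ENNReal.toReal_nonneg
  have h4 := Real.log_le_log (by positivity) h3
  rw [Real.log_mul (by positivity) (by positivity), Real.log_rpow (by positivity),
    Real.log_mul (by positivity) (by positivity), Real.log_pow] at h4
  have hn0 : (0 : ℝ) ≤ n := Nat.cast_nonneg n
  have h5 : 0 ≤ n * log Z := mul_nonneg hn0 (by linarith)
  calc _ ≤ _ := h4
    _ ≤ log (exp 1 + A ^ (1 + q)) * (log X + log Z) +
        (1 + q) * ((n + 1) * (log X + log Z)) := by
        gcongr
        · exact le_mul_of_one_le_right hl (by linarith)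
        · nlinarith
    _ = _ := by ring

/-- On a ball where the average is at least `a`, the values above `c a` carry the mass. -/
theorem exists_ball_hi {q : ℝ} (hq : 0 < q) :
    ∃ c : ℝ, 0 < c ∧ ∀ g : Eucl n → ℝ≥0∞, Measurable g → ∀ (z : Eucl n) (r a : ℝ), 0 < r → 0 < a →
      ENNReal.ofReal a ≤ TT g q z r →
      ENNReal.ofReal (a ^ (1 / (1 + q)) * r ^ n / 2) ≤
        ∫⁻ y in closedBall z r, hi (1 / (1 + q)) (c * a) (g y) := by
  have hω := omegaVol_pos (n := n)
  have hp : 0 < 1 / (1 + q) := by positivity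
  set p := 1 / (1 + q) with hpe
  refine ⟨((2 * omegaVol n)⁻¹) ^ (1 + q), by positivity, fun g hg z r a hr ha h => ?_⟩
  set c := ((2 * omegaVol n)⁻¹) ^ (1 + q) with hc
  have hcp : c ^ p = (2 * omegaVol n)⁻¹ := by
    rw [hc, ← Real.rpow_mul (by positivity), hpe, mul_one_div_cancel (by linarith), Real.rpow_one]
  have h1 : ENNReal.ofReal (a ^ p * r ^ n) ≤ ∫⁻ y in closedBall z r, g y ^ p := by
    have h2 := ENNReal.rpow_le_rpow h hp.le
    rw [TT, ← ENNReal.rpow_mul, mul_one_div_cancel (by linarith), ENNReal.rpow_one,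
      ENNReal.ofReal_rpow_of_pos ha, mul_comm, ← div_eq_mul_inv,
      ENNReal.le_div_iff_mul_le (Or.inl (by simpa using by positivity))
        (Or.inl ENNReal.ofReal_ne_top), ← ENNReal.ofReal_mul (by positivity)] at h2
    exact h2
  have h3 : ∫⁻ y in closedBall z r, g y ^ p ≤
      (∫⁻ y in closedBall z r, hi p (c * a) (g y)) + ENNReal.ofReal (a ^ p * r ^ n / 2) := by
    calc _ ≤ ∫⁻ y in closedBall z r, (hi p (c * a) (g y) + ENNReal.ofReal ((c * a) ^ p)) := by
          refine lintegral_mono fun y => ?_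
          rw [hi]
          split_ifs with h
          · exact le_self_add
          · rw [zero_add, ← ENNReal.ofReal_rpow_of_pos (by positivity)]
            exact ENNReal.rpow_le_rpow (not_lt.1 h) hp.le
      _ = _ := by
          rw [lintegral_add_right _ measurable_const, setLIntegral_const,
            volume_closedBall_eq z hr.le, ← ENNReal.ofReal_mul (by positivity),
            Real.mul_rpow (by positivity) ha.le, hcp]
          congr 2
          field_simp
  have h4 := h1.trans h3
  have e : ENNReal.ofReal (a ^ p * r ^ n) =
      ENNReal.ofReal (a ^ p * r ^ n / 2) + ENNReal.ofReal (a ^ p * r ^ n / 2) := by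
    rw [← ENNReal.ofReal_add (by positivity) (by positivity)]; congr 1; ring
  rw [e] at h4
  exact (ENNReal.add_le_add_iff_right ENNReal.ofReal_ne_top).1 h4

/-- The value attached to a node. -/
def Tn (g : Eucl n → ℝ≥0∞) (q : ℝ) (σ : Node n) : ℝ≥0 :=
  (TT g q σ.ctr ((n + 2) * σ.rad)).toNNReal

theorem TT_le_of_subset (g : Eucl n → ℝ≥0∞) {q : ℝ} (hq : 0 < q) {c c' : Eucl n} {r r' : ℝ}
    (hr : 0 < r) (hr' : 0 < r') (h : closedBall c r ⊆ closedBall c' r') :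
    TT g q c r ≤ ENNReal.ofReal (((r' / r) ^ n) ^ (1 + q)) * TT g q c' r' := by
  rw [TT, TT, ← ENNReal.ofReal_rpow_of_pos (by positivity),
    ← ENNReal.mul_rpow_of_nonneg _ _ (by linarith)]
  refine ENNReal.rpow_le_rpow ?_ (by linarith)
  rw [← mul_assoc, ← ENNReal.ofReal_inv_of_pos (by positivity),
    ← ENNReal.ofReal_inv_of_pos (by positivity), ← ENNReal.ofReal_mul (by positivity)]
  have e : (r' / r) ^ n * (r' ^ n)⁻¹ = (r ^ n)⁻¹ := by
    rw [div_pow]; field_simp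
  rw [e]
  gcongr

theorem tendsto_node_rad {κ : ℕ → Node n} (h : Tendsto (fun j => (κ j).1) atTop atTop) {R : ℝ}
    (hR : 0 < R) : Tendsto (fun j => R * (κ j).rad) atTop (𝓝[>] 0) := by
  rw [tendsto_nhdsWithin_iff]
  refine ⟨?_, Eventually.of_forall fun j => mul_pos hR (κ j).rad_pos⟩
  have h1 : Tendsto (fun j => (κ j).rad) atTop (𝓝 0) := by
    have := (tendsto_rpow_atTop_of_base_gt_one (2 : ℝ) one_lt_two).comp
      (tendsto_intCast_atTop_atTop.comp h)
    simp only [Function.comp_def, Real.rpow_intCast] at this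
    exact tendsto_inv_atTop_zero.comp this
  simpa using h1.const_mul R

theorem hatN_supp' (σ : Node n) (x : Eucl n) (hx : hatN σ x ≠ 0) :
    x ∈ closedBall σ.ctr ((n + 2) * σ.rad) :=
  closedBall_subset_closedBall (by nlinarith [σ.rad_pos]) (hatN_supp σ x hx)

theorem abs_avgN_sub_le {f : Eucl n → ℝ} (hf : LocallyIntegrable f volume) (σ : Node n) (a : ℝ) :
    |avgN f σ - a| ≤ ((n + 2) ^ n * omegaVol n / hatMass n) *
      ⨍ y in closedBall σ.ctr ((n + 2) * σ.rad), ‖f y - a‖ := by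
  have hr := σ.rad_pos
  have hω := omegaVol_pos (n := n)
  have hM := hatMass_pos (n := n)
  have h1 : Integrable fun x => f x * hatN σ x := by
    simpa [mul_comm] using hf.integrable_smul_left_of_hasCompactSupport (hatN_continuous σ)
      (hatN_hasCompactSupport σ)
  have h2 := (integrable_hatN σ).const_mul a
  have e : avgN f σ - a = (∫ x, (f x - a) * hatN σ x) / ∫ x, hatN σ x := by
    simp_rw [sub_mul]
    rw [integral_sub h1 h2, integral_const_mul, avgN, sub_div,
      mul_div_cancel_right₀ _ (integral_hatN_pos σ).ne']
  have hfin : IntegrableOn (fun y => ‖f y - a‖) (closedBall σ.ctr ((n + 2) * σ.rad)) :=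
    ((hf.sub (locallyIntegrable_const a)).integrableOn_isCompact
      (isCompact_closedBall _ _)).norm
  have h3 : |∫ x, (f x - a) * hatN σ x| ≤
      ∫ y in closedBall σ.ctr ((n + 2) * σ.rad), ‖f y - a‖ := by
    rw [← setIntegral_eq_integral_of_forall_compl_eq_zero
      (s := closedBall σ.ctr ((n + 2) * σ.rad)) (fun x hx => by
        rw [not_not.1 (mt (hatN_supp' σ x) hx), mul_zero]), ← Real.norm_eq_abs]
    refine norm_integral_le_of_norm_le hfin (ae_of_all _ fun x => ?_)
    rw [norm_mul, Real.norm_of_nonneg (hatN_nonneg σ x)]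
    exact mul_le_of_le_one_right (norm_nonneg _) (hatN_le_one σ x)
  rw [e, abs_div, abs_of_pos (integral_hatN_pos σ), integral_hatN, setAverage_eq, smul_eq_mul,
    Measure.real, volume_real_closedBall _ (by positivity)]
  refine (div_le_div_of_nonneg_right h3 (by positivity)).trans_eq ?_
  rw [mul_pow]
  field_simp

theorem tendsto_avgN {f : Eucl n → ℝ} (hf : LocallyIntegrable f volume) :
    ∀ᵐ x, ∀ κ : ℕ → Node n, (∀ j, hatN (κ j) x ≠ 0) → Tendsto (fun j => (κ j).1) atTop atTop →
      Tendsto (fun j => avgN f (κ j)) atTop (𝓝 (f x)) := by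
  filter_upwards [IsUnifLocDoublingMeasure.ae_tendsto_average_norm_sub volume hf 1] with x hx κ h1 h2
  have h3 := hx (l := atTop) (fun j => (κ j).ctr) (fun j => (n + 2) * (κ j).rad)
    (tendsto_node_rad h2 (by positivity)) (Eventually.of_forall fun j => by
      rw [one_mul]; exact hatN_supp' _ _ (h1 j))
  have h4 := h3.const_mul ((n + 2) ^ n * omegaVol n / hatMass n)
  rw [mul_zero] at h4
  rw [tendsto_iff_norm_sub_tendsto_zero]
  exact squeeze_zero (fun _ => norm_nonneg _) (fun j => abs_avgN_sub_le hf _ _) h4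

theorem not_tendsto_Tn {g : Eucl n → ℝ≥0∞} (hg : Measurable g) {q : ℝ} (hq : 0 < q)
    (hfin : ∀ᵐ x, g x ≠ ⊤)
    (hloc : ∀ (c : Eucl n) (r : ℝ), 0 < r → ∫⁻ y in closedBall c r, g y ^ (1 / (1 + q)) ≠ ⊤) :
    ∀ᵐ x, ∀ κ : ℕ → Node n, (∀ j, hatN (κ j) x ≠ 0) → Tendsto (fun j => (κ j).1) atTop atTop →
      ¬ Tendsto (fun j => Tn g q (κ j)) atTop atTop := by
  have hp : 0 < 1 / (1 + q) := by positivity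
  have hmeas : Measurable fun y => (g y ^ (1 / (1 + q))) := hg.pow_const _
  have hlt : ∀ᵐ y, g y ^ (1 / (1 + q)) < ⊤ := by
    filter_upwards [hfin] with y hy
    exact (ENNReal.rpow_ne_top_of_nonneg hp.le hy).lt_top
  have hInt : LocallyIntegrable (fun y => (g y ^ (1 / (1 + q))).toReal) volume := by
    intro z
    refine ⟨closedBall z 1, closedBall_mem_nhds z one_pos, ?_⟩
    exact integrable_toReal_of_lintegral_ne_top hmeas.aemeasurable (hloc z 1 one_pos)
  have hω := omegaVol_pos (n := n)
  filter_upwards [IsUnifLocDoublingMeasure.ae_tendsto_average volume hInt 1] with x hx κ h1 h2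
  have h3 := hx (l := atTop) (fun j => (κ j).ctr) (fun j => (n + 2) * (κ j).rad)
    (tendsto_node_rad h2 (by positivity)) (Eventually.of_forall fun j => by
      rw [one_mul]; exact hatN_supp' _ _ (h1 j))
  have h4 := (h3.const_mul (omegaVol n)).rpow_const (p := 1 + q) (Or.inr (by linarith))
  have e : ∀ j, (Tn g q (κ j) : ℝ) = (omegaVol n *
      ⨍ y in closedBall (κ j).ctr ((n + 2) * (κ j).rad), (g y ^ (1 / (1 + q))).toReal) ^ (1 + q) := by
    intro j
    have hr := (κ j).rad_pos
    rw [Tn, ENNReal.coe_toNNReal_eq_toReal, TT, ← ENNReal.toReal_rpow, ENNReal.toReal_mul,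
      ENNReal.toReal_inv, ENNReal.toReal_ofReal (by positivity), setAverage_eq, smul_eq_mul,
      Measure.real, volume_real_closedBall _ (by positivity),
      integral_toReal hmeas.aemeasurable.restrict (ae_restrict_of_ae hlt)]
    congr 1
    field_simp
  intro h5
  rw [← NNReal.tendsto_coe_atTop] at h5
  simp_rw [e] at h5
  exact not_tendsto_atTop_of_tendsto_nhds h4 h5

theorem exists_treeBound {φ : Eucl n → ℝ} {A : ℝ} (hφ : KernelBound n φ A) :
    ∃ (q : ℝ) (K : ℝ≥0), 0 < q ∧ ∀ f : Eucl n → ℝ, LocallyIntegrable f volume →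
      ∫⁻ x, thetaE n x (maxFun n φ f x) ≤ 1 →
      TreeBound f (Tn (maxFun n φ f) q) K := by
  obtain ⟨q, C, hq, hC, H⟩ := exists_integral_hatN_le hφ
  obtain ⟨M, -, HM⟩ := exists_TT_log_le (n := n) hq
  have hM := hatMass_pos (n := n)
  set R : ℝ := n + 2 with hR
  have hR0 : 0 < R := by positivity
  set K1 : ℝ := C / hatMass n * (R ^ n) ^ (1 + q) with hK1
  set K2 : ℝ := ((2 : ℝ) ^ n) ^ (1 + q) with hK2
  refine ⟨q, (K1 + K2).toNNReal, hq, fun f hf hθ => ?_⟩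
  have hg := maxFun_measurable hφ hf
  have hT : ∀ σ : Node n, TT (maxFun n φ f) q σ.ctr (R * σ.rad) ≠ ⊤ := fun σ =>
    (HM _ hg hθ σ.ctr (R * σ.rad) (mul_pos hR0 σ.rad_pos)).2.1
  have hK : ((K1 + K2).toNNReal : ℝ) = K1 + K2 := Real.coe_toNNReal _ (by positivity)
  refine ⟨hf, fun σ => ?_, fun σ c => ?_, tendsto_avgN hf, not_tendsto_Tn hg hq
    (ae_lt_top_of_theta hg hθ) fun c r hr => (HM _ hg hθ c r hr).1⟩
  · have hr := σ.rad_pos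
    have h1 : |avgN f σ| ≤ K1 * Tn (maxFun n φ f) q σ := by
      rw [← ENNReal.ofReal_le_ofReal_iff (by positivity), ENNReal.ofReal_mul (by positivity),
        ENNReal.ofReal_coe_nnreal, Tn, ENNReal.coe_toNNReal (hT σ), avgN, abs_div,
        abs_of_pos (integral_hatN_pos σ), integral_hatN, div_eq_mul_inv,
        ENNReal.ofReal_mul (by positivity)]
      refine (mul_le_mul_left (H f hf σ) _).trans_eq ?_
      have e : (ENNReal.ofReal (σ.rad ^ n))⁻¹ =
          ENNReal.ofReal (R ^ n) * (ENNReal.ofReal ((R * σ.rad) ^ n))⁻¹ := by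
        rw [← ENNReal.ofReal_inv_of_pos (by positivity), ← ENNReal.ofReal_inv_of_pos (by positivity),
          ← ENNReal.ofReal_mul (by positivity)]
        congr 1
        rw [mul_pow]; field_simp
      rw [e, mul_assoc (ENNReal.ofReal (R ^ n)), ENNReal.mul_rpow_of_nonneg _ _ (by linarith),
        ← TT, ENNReal.ofReal_rpow_of_pos (by positivity), mul_right_comm, ← mul_assoc,
        ← ENNReal.ofReal_mul (by positivity), ← ENNReal.ofReal_mul (by positivity)]
      congr 2
      rw [hK1]
      field_simp
    refine h1.trans ?_
    rw [hK]
    gcongr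
    have : 0 ≤ K2 := by positivity
    linarith
  · have hr := σ.rad_pos
    have hr' := (σ.child c).rad_pos
    have h1 := TT_le_of_subset (maxFun n φ f) hq (mul_pos hR0 hr') (mul_pos hR0 hr)
      (σ.child_ball_subset c (R := R) (by rw [hR]; linarith))
    have e : R * σ.rad / (R * (σ.child c).rad) = 2 := by
      rw [σ.child_rad]; field_simp
    rw [e, ← hK2] at h1
    rw [← ENNReal.coe_le_coe, ENNReal.coe_mul, Tn, Tn, ENNReal.coe_toNNReal (hT _),
      ENNReal.coe_toNNReal (hT _)]
    refine h1.trans ?_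
    gcongr
    refine ENNReal.ofReal_le_ofReal ?_
    have : 0 ≤ K1 := by positivity
    linarith

/-- The index bound beyond which nodes of large radius are admissible. -/
def fineIdx (n : ℕ) : ℕ := 8 * n ^ 2 + 10 * (n + 2)

/-- The nodes which are small, or far from the origin relative to their size. -/
def Fine (σ : Node n) : Prop := 0 ≤ σ.1 ∨ ∃ i, (fineIdx n : ℤ) ≤ |σ.2 i|

theorem Fine.child {σ : Node n} (h : Fine σ) (c : Fin n → Fin 3) : Fine (σ.child c) := by
  rcases h with h | ⟨i, hi⟩
  · left; simp only [Node.child]; omega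
  · right
    refine ⟨i, ?_⟩
    have h1 : (1 : ℤ) ≤ fineIdx n := by unfold fineIdx; push_cast; nlinarith [sq_nonneg (n : ℤ)]
    have h2 := (c i).isLt
    simp only [Node.child]
    rcases abs_cases (σ.2 i) with h3 | h3 <;>
      rcases abs_cases (2 * σ.2 i + (((c i : ℕ) : ℤ) - 1)) with h4 | h4 <;> omega

theorem Fine.rad_le {σ : Node n} (h : Fine σ) : σ.rad ≤ 1 ∨ fineIdx n * σ.rad ≤ ‖σ.ctr‖ := by
  rcases h with h | ⟨i, hi⟩
  · left
    exact inv_le_one_of_one_le₀ (one_le_zpow₀ one_le_two h)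
  · right
    have h1 := abs_coord_le σ.ctr i
    have h2 : σ.ctr i = σ.rad * σ.2 i := rfl
    rw [h2, abs_mul, abs_of_pos σ.rad_pos] at h1
    have h3 : (fineIdx n : ℝ) ≤ |(σ.2 i : ℝ)| := by exact_mod_cast hi
    nlinarith [σ.rad_pos]

theorem Fine.adm {σ : Node n} (h : Fine σ) : Adm σ.ctr (n * σ.rad) := by
  have hr := σ.rad_pos
  have hn : (0 : ℝ) ≤ n := Nat.cast_nonneg n
  rcases h.rad_le with h | h
  · exact Or.inr (by nlinarith)
  · refine Or.inl (le_trans ?_ h)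
    unfold fineIdx; push_cast
    nlinarith [mul_nonneg hn hr.le]

/-- The comparability constant of the logarithmic weight on admissible balls. -/
def cmpC (n : ℕ) : ℝ := 1 + log (1 + 10 * (n + 2))

theorem one_le_cmpC (n : ℕ) : 1 ≤ cmpC n := by
  have : 0 ≤ log (1 + 10 * ((n : ℝ) + 2)) := log_nonneg (by linarith [(Nat.cast_nonneg n : (0 : ℝ) ≤ n)])
  unfold cmpC; linarith

theorem log_le_cmpC {s t : ℝ} (hs : 0 ≤ s) (ht : 0 ≤ t)
    (h : exp 1 + t ≤ (1 + 10 * (n + 2)) * (exp 1 + s)) :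
    log (exp 1 + t) ≤ cmpC n * log (exp 1 + s) := by
  have he := exp_pos 1
  have hn : (0 : ℝ) ≤ n := Nat.cast_nonneg n
  have h1 := one_le_log_exp_add hs
  have h2 := log_le_log (by positivity) h
  rw [log_mul (by positivity) (by positivity)] at h2
  have : 0 ≤ log (1 + 10 * ((n : ℝ) + 2)) := log_nonneg (by linarith)
  unfold cmpC; nlinarith

theorem Fine.norm_le {σ : Node n} (h : Fine σ) {x y : Eucl n}
    (hx : x ∈ closedBall σ.ctr (5 * ((n + 2) * σ.rad)))
    (hy : y ∈ closedBall σ.ctr (5 * ((n + 2) * σ.rad))) :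
    exp 1 + ‖y‖ ≤ (1 + 10 * (n + 2)) * (exp 1 + ‖x‖) := by
  have he := add_one_le_exp (1 : ℝ)
  have hn : (0 : ℝ) ≤ n := Nat.cast_nonneg n
  have hr := σ.rad_pos
  rw [mem_closedBall, dist_eq_norm] at hx hy
  have h1 : ‖y‖ ≤ ‖σ.ctr‖ + ‖y - σ.ctr‖ := by simpa using norm_add_le σ.ctr (y - σ.ctr)
  have h2 : ‖σ.ctr‖ ≤ ‖x‖ + ‖x - σ.ctr‖ := by
    simpa using norm_sub_le x (x - σ.ctr)
  have hx0 := norm_nonneg x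
  rcases h.rad_le with h | h
  · nlinarith
  · unfold fineIdx at h; push_cast at h
    have h3 : 10 * ((n + 2) * σ.rad) ≤ ‖σ.ctr‖ := by nlinarith [mul_nonneg (sq_nonneg (n : ℝ)) hr.le]
    nlinarith

theorem Fine.DD_le {σ : Node n} (h : Fine σ) {x y : Eucl n}
    (hx : x ∈ closedBall σ.ctr (5 * ((n + 2) * σ.rad)))
    (hy : y ∈ closedBall σ.ctr (5 * ((n + 2) * σ.rad))) {a : ℝ} (ha : 0 ≤ a) :
    DD y a ≤ cmpC n * DD x a := by
  have h1 := log_le_cmpC (norm_nonneg x) (norm_nonneg y) (h.norm_le hx hy)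
  have h2 := one_le_log_exp_add ha
  have h3 := one_le_cmpC n
  unfold DD
  nlinarith

theorem DD_pos (x : Eucl n) {a : ℝ} (ha : 0 ≤ a) : 0 < DD x a :=
  lt_of_lt_of_le two_pos (two_le_DD x ha)

theorem Fine.ctr_mem (σ : Node n) (k : ℝ) (hk : 0 ≤ k) :
    σ.ctr ∈ closedBall σ.ctr (k * ((n + 2) * σ.rad)) :=
  mem_closedBall_self (mul_nonneg hk (by have := σ.rad_pos; positivity))

/-- The union of the balls of the nodes whose value is at least `2 ^ s`. -/
def OO (T : Node n → ℝ≥0) (s : ℤ) : Set (Eucl n) :=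
  ⋃ κ ∈ {κ : Node n | Fine κ ∧ (2 : ℝ) ^ s ≤ T κ}, closedBall κ.ctr ((n + 2) * κ.rad)

theorem OO_measurable (T : Node n → ℝ≥0) (s : ℤ) : MeasurableSet (OO T s) :=
  MeasurableSet.biUnion (Set.to_countable _) fun _ _ => isClosed_closedBall.measurableSet

/-- The contribution of the level `s`. -/
def lev (T : Node n → ℝ≥0) (s : ℤ) (x : Eucl n) : ℝ≥0∞ :=
  ENNReal.ofReal (2 ^ (s + 1)) * (OO T s).indicator (wL (2 ^ s)) x

/-- The contribution of the levels above `t`. -/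
def YY (T : Node n → ℝ≥0) (t : ℝ≥0) (x : Eucl n) : ℝ≥0∞ :=
  ∑' s : ℤ, if (t : ℝ) < 2 ^ (s + 1) then lev T s x else 0

theorem YY_anti (T : Node n → ℝ≥0) {t t' : ℝ≥0} (h : t ≤ t') (x : Eucl n) :
    YY T t' x ≤ YY T t x := by
  refine ENNReal.tsum_le_tsum fun s => ?_
  split_ifs with h1 h2
  · exact le_rfl
  · exact absurd (lt_of_le_of_lt (NNReal.coe_le_coe.2 h) h1) h2
  · exact zero_le
  · exact le_rfl

/-- The pointwise contribution of a node. -/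
def uN (T : Node n → ℝ≥0) (κ : Node n) (x : Eucl n) : ℝ≥0∞ :=
  ENNReal.ofReal (T κ / DD x (T κ)) * ENNReal.ofReal (hatN κ x)

theorem add_YY_le {T : Node n → ℝ≥0} {σ : Node n} (hσ : Fine σ) {x : Eucl n}
    (hx : hatN σ x ≠ 0) :
    ENNReal.ofReal (T σ / DD x (T σ)) + YY T (2 * T σ) x ≤ YY T (T σ) x := by
  rcases eq_or_ne (T σ) 0 with h0 | h0
  · simp [h0]
  have hT : 0 < (T σ : ℝ) := by exact_mod_cast pos_iff_ne_zero.2 h0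
  obtain ⟨s, hs1, hs2⟩ := exists_mem_Ico_zpow hT (one_lt_two (α := ℝ))
  have h1 : ENNReal.ofReal (T σ / DD x (T σ)) ≤ ∑' s' : ℤ, if s' = s then lev T s' x else 0 := by
    rw [tsum_ite_eq, lev, Set.indicator_of_mem, wL, ← ENNReal.ofReal_mul (by positivity)]
    · refine ENNReal.ofReal_le_ofReal ?_
      rw [mul_one_div]
      exact div_le_div₀ (by positivity) hs2.le (DD_pos x (by positivity))
        (DD_mono x (by positivity) hs1)
    · exact Set.mem_biUnion (show σ ∈ {κ : Node n | Fine κ ∧ (2 : ℝ) ^ s ≤ T κ} from ⟨hσ, hs1⟩)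
        (hatN_supp' σ x hx)
  refine (add_le_add_left h1 _).trans ?_
  rw [YY, ← ENNReal.tsum_add]
  refine ENNReal.tsum_le_tsum fun s' => ?_
  have hc : ((2 * T σ : ℝ≥0) : ℝ) = 2 * T σ := by push_cast; rfl
  by_cases hs : s' = s
  · subst hs
    have h2 : ¬ (((2 * T σ : ℝ≥0) : ℝ) < 2 ^ (s' + 1)) := by
      rw [hc, zpow_add_one₀ two_ne_zero]; linarith
    rw [if_pos rfl, if_neg h2, if_pos hs2, add_zero]
  · rw [if_neg hs, zero_add]
    by_cases h2 : ((2 * T σ : ℝ≥0) : ℝ) < 2 ^ (s' + 1)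
    · rw [if_pos h2, if_pos (by linarith)]
    · rw [if_neg h2]
      exact zero_le

theorem JE_sum_range (T : Node n → ℝ≥0) (σ : Node n) (v : ℕ → Node n → ℝ≥0∞) (m : ℕ) :
    JE T (fun κ => ∑ G ∈ Finset.range m, v G κ) σ = ∑ G ∈ Finset.range m, JE T (v G) σ := by
  induction m with
  | zero => simp [JE]
  | succ m ih =>
    simp only [Finset.sum_range_succ]
    rw [← ih, ← JE_add]

theorem sum_JEit_le (T : Node n → ℝ≥0) (x : Eucl n) (m : ℕ) {σ : Node n} (hσ : Fine σ) :
    ∑ G ∈ Finset.range m, JEit T (fun κ => uN T κ x) G σ ≤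
      YY T (T σ) x * ENNReal.ofReal (hatN σ x) := by
  induction m generalizing σ with
  | zero => simp
  | succ m ih =>
    rw [Finset.sum_range_succ']
    simp only [JEit]
    rw [← JE_sum_range]
    have h1 : JE T (fun κ => ∑ G ∈ Finset.range m, JEit T (fun κ => uN T κ x) G κ) σ ≤
        YY T (2 * T σ) x * ENNReal.ofReal (hatN σ x) := by
      refine le_trans (JE_mono (v := fun κ => YY T (2 * T σ) x * ENNReal.ofReal (hatN κ x))
        fun i hi => ?_) ((refinable_mul_hatN _ x).JE_le σ)
      obtain ⟨ν, c, hν, hf, -, h2⟩ := wt_support (fun ν c (h : Fine ν) => h.child c) hσ hi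
      exact (ih (hν ▸ hf.child c)).trans (mul_le_mul_left (YY_anti T h2.le x) _)
    by_cases hx : hatN σ x = 0
    · simpa [uN, hx] using h1
    · refine (add_le_add_left h1 _).trans ?_
      rw [uN, ← add_mul, add_comm]
      exact mul_le_mul_left (add_YY_le hσ hx) _

theorem tsum_JEit_le (T : Node n → ℝ≥0) (x : Eucl n) {σ : Node n} (hσ : Fine σ) :
    ∑' G, JEit T (fun κ => uN T κ x) G σ ≤ YY T 0 x * ENNReal.ofReal (hatN σ x) := by
  rw [ENNReal.tsum_eq_iSup_nat]
  exact iSup_le fun m => (sum_JEit_le T x m hσ).trans (mul_le_mul_left (YY_anti T zero_le x) _)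

theorem uN_measurable (T : Node n → ℝ≥0) (κ : Node n) : Measurable (uN T κ) := by
  unfold uN
  refine Measurable.mul ?_ (hatN_continuous κ).measurable.ennreal_ofReal
  unfold DD
  fun_prop

theorem lev_measurable (T : Node n → ℝ≥0) (s : ℤ) : Measurable (lev T s) :=
  ((wL_measurable _).indicator (OO_measurable T s)).const_mul _

theorem YY_measurable (T : Node n → ℝ≥0) (t : ℝ≥0) : Measurable (YY T t) := by
  refine Measurable.tsum fun s => ?_
  split_ifs
  · exact lev_measurable T s
  · exact measurable_const

theorem Fine.lintegral_wL_le {σ : Node n} (h : Fine σ) {q c a : ℝ} (ha : 0 < a)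
    {g : Eucl n → ℝ≥0∞}
    (H : ENNReal.ofReal (a ^ (1 / (1 + q)) * ((n + 2) * σ.rad) ^ n / 2) ≤
      ∫⁻ y in closedBall σ.ctr ((n + 2) * σ.rad), hi (1 / (1 + q)) (c * a) (g y)) :
    ∫⁻ x in closedBall σ.ctr (5 * ((n + 2) * σ.rad)), wL a x ≤
      ∫⁻ x in closedBall σ.ctr ((n + 2) * σ.rad),
        ENNReal.ofReal (2 * 5 ^ n * omegaVol n * cmpC n ^ 2) * dens (1 / (1 + q)) c a g x := by
  have hr := σ.rad_pos
  have hω := omegaVol_pos (n := n)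
  have hC := one_le_cmpC n
  have hC0 : 0 < cmpC n := by linarith
  set p := 1 / (1 + q)
  set ρ := (n + 2) * σ.rad with hρ
  have hρ0 : 0 < ρ := by positivity
  have hD := DD_pos σ.ctr ha.le
  have hctr := Fine.ctr_mem σ 5 (by norm_num)
  have h1 : ∫⁻ x in closedBall σ.ctr (5 * ρ), wL a x ≤
      ENNReal.ofReal (cmpC n / DD σ.ctr a * ((5 * ρ) ^ n * omegaVol n)) := by
    rw [ENNReal.ofReal_mul (by positivity), ← volume_closedBall_eq σ.ctr (by positivity),
      ← setLIntegral_const]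
    refine setLIntegral_mono measurable_const fun x hx => ENNReal.ofReal_le_ofReal ?_
    have := h.DD_le hx hctr ha.le
    rw [div_le_div_iff₀ (DD_pos x ha.le) hD]
    linarith
  have h2 : ENNReal.ofReal (2 * 5 ^ n * omegaVol n * cmpC n ^ 2) *
      (ENNReal.ofReal (a ^ (-p)) * ENNReal.ofReal (1 / (cmpC n * DD σ.ctr a))) *
        ENNReal.ofReal (a ^ p * ρ ^ n / 2) ≤ ∫⁻ x in closedBall σ.ctr ρ,
        ENNReal.ofReal (2 * 5 ^ n * omegaVol n * cmpC n ^ 2) * dens p c a g x := by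
    refine (mul_le_mul_right H _).trans ?_
    rw [← lintegral_const_mul' _ _ (ENNReal.mul_ne_top ENNReal.ofReal_ne_top
      (ENNReal.mul_ne_top ENNReal.ofReal_ne_top ENNReal.ofReal_ne_top))]
    refine setLIntegral_mono' isClosed_closedBall.measurableSet fun x hx => ?_
    rw [dens, mul_assoc (ENNReal.ofReal _), mul_assoc (ENNReal.ofReal (a ^ (-p))),
      mul_comm (hi _ _ _)]
    refine mul_le_mul_right (mul_le_mul_right (mul_le_mul_left ?_ (hi _ _ _)) _) _
    refine ENNReal.ofReal_le_ofReal (one_div_le_one_div_of_le (DD_pos x ha.le) ?_)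
    exact h.DD_le hctr (closedBall_subset_closedBall (by linarith) hx) ha.le
  refine h1.trans (le_trans (le_of_eq ?_) h2)
  rw [← ENNReal.ofReal_mul (by positivity), ← ENNReal.ofReal_mul (by positivity),
    ← ENNReal.ofReal_mul (by positivity)]
  congr 1
  rw [rpow_neg ha.le, mul_pow]
  have := rpow_pos_of_pos ha p
  field_simp

theorem exists_lintegral_YY_le {q : ℝ} (hq : 0 < q) :
    ∃ C : ℝ≥0, ∀ g : Eucl n → ℝ≥0∞, Measurable g → ∫⁻ x, thetaE n x (g x) ≤ 1 →
      ∫⁻ x, YY (Tn g q) 0 x ≤ C := by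
  obtain ⟨c, hc, H⟩ := exists_ball_hi (n := n) hq
  obtain ⟨C1, HC⟩ := exists_level_sum (n := n) (p := 1 / (1 + q)) (by positivity)
    (by rw [div_lt_one (by linarith)]; linarith) hc
  set C2 : ℝ := 2 * 5 ^ n * omegaVol n * cmpC n ^ 2 with hC2
  refine ⟨2 * C2.toNNReal * C1, fun g hg hθ => ?_⟩
  have h1 : ∀ s : ℤ, ∫⁻ x in OO (Tn g q) s, wL (2 ^ s) x ≤
      ENNReal.ofReal C2 * ∫⁻ x, dens (1 / (1 + q)) c (2 ^ s) g x := by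
    intro s
    have hs : (0 : ℝ) < 2 ^ s := by positivity
    rw [← lintegral_const_mul' _ _ ENNReal.ofReal_ne_top]
    refine vitali_lintegral _ _ _ (fun κ _ => by have := κ.rad_pos; positivity) _ _ fun κ hκ => ?_
    refine hκ.1.lintegral_wL_le hs (H g hg _ _ _ (by have := κ.rad_pos; positivity) hs ?_)
    refine (ENNReal.ofReal_le_ofReal hκ.2).trans ?_
    rw [ENNReal.ofReal_coe_nnreal, Tn]
    exact ENNReal.coe_toNNReal_le_self
  calc ∫⁻ x, YY (Tn g q) 0 x
      = ∑' s : ℤ, ENNReal.ofReal (2 ^ (s + 1)) * ∫⁻ x in OO (Tn g q) s, wL (2 ^ s) x := by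
        simp only [YY]
        rw [lintegral_tsum fun s => ?_]
        · refine tsum_congr fun s => ?_
          have : ((0 : ℝ≥0) : ℝ) < 2 ^ (s + 1) := by rw [NNReal.coe_zero]; positivity
          simp only [this, if_true, lev]
          rw [lintegral_const_mul' _ _ ENNReal.ofReal_ne_top,
            lintegral_indicator (OO_measurable _ s)]
        · split_ifs
          · exact (lev_measurable _ s).aemeasurable
          · exact aemeasurable_const
    _ ≤ ∑' s : ℤ, 2 * ENNReal.ofReal C2 *
          (ENNReal.ofReal (2 ^ s) * ∫⁻ x, dens (1 / (1 + q)) c (2 ^ s) g x) := by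
        refine ENNReal.tsum_le_tsum fun s => (mul_le_mul_right (h1 s) _).trans_eq ?_
        rw [zpow_add_one₀ two_ne_zero, ENNReal.ofReal_mul (by positivity), ENNReal.ofReal_ofNat]
        ring
    _ ≤ _ := by
        rw [ENNReal.tsum_mul_left]
        push_cast
        change _ ≤ 2 * ENNReal.ofReal C2 * _
        gcongr
        exact HC g hg hθ

/-- On fine nodes, the denominator of `θ` is dominated by the logarithmic gain. -/
theorem Fine.DD_le_LL {σ : Node n} (h : Fine σ) (hn : 0 < n) {M : ℝ} (hM : 0 ≤ M) {t : ℝ}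
    (ht : log (exp 1 + t) ≤ M * (log (exp 1 + ((n + 2) * σ.rad)⁻¹) +
      log (exp 1 + (‖σ.ctr‖ + (n + 2) * σ.rad)))) {x : Eucl n} (hx : hatN σ x ≠ 0) :
    DD x t ≤ cmpC n * (1 + M) * LL σ.ctr (n * σ.rad) := by
  have hr := σ.rad_pos
  have hn' : (0 : ℝ) < n := Nat.cast_pos.2 hn
  have hC := one_le_cmpC n
  have he := exp_pos 1
  have hρ : 0 < (n + 2) * σ.rad := by positivity
  have hx1 := closedBall_subset_closedBall (by linarith) (hatN_supp' σ x hx) (ε₂ := 5 * ((n + 2) * σ.rad))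
  have h1 := log_le_cmpC (norm_nonneg σ.ctr) (norm_nonneg x)
    (h.norm_le (Fine.ctr_mem σ 5 (by norm_num)) hx1)
  have h2 : log (exp 1 + (‖σ.ctr‖ + (n + 2) * σ.rad)) ≤ cmpC n * log (exp 1 + ‖σ.ctr‖) := by
    refine log_le_cmpC (norm_nonneg _) (by positivity) ?_
    have h0 := norm_nonneg σ.ctr
    have he1 := add_one_le_exp (1 : ℝ)
    rcases h.rad_le with h | h
    · nlinarith
    · unfold fineIdx at h; push_cast at h
      have h3 : 10 * ((n + 2) * σ.rad) ≤ ‖σ.ctr‖ := by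
        nlinarith [mul_nonneg (sq_nonneg (n : ℝ)) hr.le]
      nlinarith
  have h3 : log (exp 1 + ((n + 2) * σ.rad)⁻¹) ≤ log (exp 1 + (n * σ.rad)⁻¹) := by
    gcongr; linarith
  have h4 := one_le_log_exp_add (norm_nonneg σ.ctr)
  have h5 := one_le_log_exp_add (t := (n * σ.rad)⁻¹) (by positivity)
  unfold DD LL
  set l1 := log (exp 1 + ‖σ.ctr‖)
  set l2 := log (exp 1 + (n * σ.rad)⁻¹)
  calc _ ≤ cmpC n * l1 + M * (l2 + cmpC n * l1) := by
        refine add_le_add h1 (ht.trans ?_)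
        gcongr
    _ ≤ _ := by nlinarith [mul_nonneg hM (mul_nonneg (sub_nonneg.2 hC) (by linarith : 0 ≤ l2)),
        mul_nonneg (by linarith : 0 ≤ cmpC n) (by linarith : 0 ≤ l2)]

theorem lintegral_hatN (σ : Node n) :
    ∫⁻ x, ENNReal.ofReal (hatN σ x) = ENNReal.ofReal (σ.rad ^ n * hatMass n) := by
  rw [← integral_hatN, ofReal_integral_eq_lintegral_ofReal
    (integrable_hatN σ) (ae_of_all _ (hatN_nonneg σ))]

theorem exists_rep_hN (hn : 2 ≤ n) {φ : Eucl n → ℝ} {A : ℝ} (hφ : KernelBound n φ A)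
    {q : ℝ} (hq : 0 < q) (K : ℝ≥0) :
    ∃ C : ℝ≥0, ∀ (f : Eucl n → ℝ) (g : Eucl n → ℝ≥0∞), Measurable g →
      ∫⁻ x, thetaE n x (g x) ≤ 1 → TreeBound f (Tn g q) K → ∀ σ : Node n, Fine σ →
      Rep n φ (bsize n) (fun ψ => ∫ x, hN f (Tn g q) σ x * ψ x)
        (C * ∫⁻ x, uN (Tn g q) σ x) := by
  obtain ⟨C, hC, H⟩ := exists_rep_adm hn hφ
  obtain ⟨M, hM, HM⟩ := exists_TT_log_le (n := n) hq
  have hn0 : 0 < n := by omega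
  have hn' : (0 : ℝ) < n := Nat.cast_pos.2 hn0
  have hm := hatMass_pos (n := n)
  have hc := one_le_cmpC n
  set C1 : ℝ := cmpC n * (1 + M) with hC1
  have hC1' : 0 < C1 := by positivity
  set C2 : ℝ := C * n ^ n * (3 * K + 2 * K ^ 2) * C1 / hatMass n with hC2
  refine ⟨C2.toNNReal, fun f g hg hθ hT σ hσ => ?_⟩
  have hr := σ.rad_pos
  have hρ : 0 < (n + 2) * σ.rad := by positivity
  have hK := K.coe_nonneg
  have ht := (Tn g q σ).coe_nonneg
  have hL : 0 < LL σ.ctr (n * σ.rad) := by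
    have h4 := one_le_log_exp_add (norm_nonneg σ.ctr)
    have h5 := one_le_log_exp_add (t := (n * σ.rad)⁻¹) (by positivity)
    unfold LL; linarith
  refine (H σ.ctr (n * σ.rad) (by positivity) hσ.adm (hN f (Tn g q) σ)
    ((3 * K + 2 * K ^ 2) * Tn g q σ) (by positivity) (hT.aestronglyMeasurable_hN σ)
    (fun x hx => hatN_supp σ x (hT.hN_supp σ x hx)) (hT.integral_hN σ) ?_).mono ?_
  · filter_upwards [hT.abs_hN_le σ] with x hx
    exact hx.trans (mul_le_of_le_one_right (by positivity) (hatN_le_one σ x))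
  · have h1 : ENNReal.ofReal (Tn g q σ / (C1 * LL σ.ctr (n * σ.rad)) *
        (σ.rad ^ n * hatMass n)) ≤ ∫⁻ x, uN (Tn g q) σ x := by
      rw [ENNReal.ofReal_mul (by positivity), ← lintegral_hatN,
        ← lintegral_const_mul' _ _ ENNReal.ofReal_ne_top]
      refine lintegral_mono fun x => ?_
      by_cases hx : hatN σ x = 0
      · simp [hx]
      · refine mul_le_mul_left (ENNReal.ofReal_le_ofReal ?_) _
        have h2 := (HM g hg hθ σ.ctr _ hρ).2.2
        exact div_le_div_of_nonneg_left ht (DD_pos x ht) (hσ.DD_le_LL hn0 hM.le h2 hx)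
    change _ ≤ ENNReal.ofReal C2 * _
    refine le_trans (le_of_eq ?_) (mul_le_mul_right h1 _)
    rw [← ENNReal.ofReal_mul (by positivity)]
    congr 1
    rw [hC2, mul_pow]
    field_simp

/-- The oscillations on the admissible nodes are factorized with summable costs. -/
theorem exists_fine_cost (hn : 2 ≤ n) {φ : Eucl n → ℝ} {A : ℝ} (hφ : KernelBound n φ A) :
    ∃ (q : ℝ) (K C : ℝ≥0), 0 < q ∧ ∀ f : Eucl n → ℝ, LocallyIntegrable f volume →
      ∫⁻ x, thetaE n x (maxFun n φ f x) ≤ 1 → TreeBound f (Tn (maxFun n φ f) q) K ∧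
      ∃ cost : Node n → ℝ≥0∞, (∀ σ, Fine σ → cost σ ≠ ⊤ →
        Rep n φ (bsize n) (fun ψ => ∫ x, bN f σ x * ψ x) (cost σ)) ∧
        ∀ (ι : Type) [Countable ι] (ρ : ι → Node n) (α : ι → ℝ≥0),
          (∀ x, ∑' i, (α i : ℝ≥0∞) * ENNReal.ofReal (hatN (ρ i) x) ≤ 1) →
          (∀ i, α i ≠ 0 → Fine (ρ i)) → ∑' i, (α i : ℝ≥0∞) * cost (ρ i) ≤ C := by
  obtain ⟨q, K, hq, HT⟩ := exists_treeBound hφ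
  obtain ⟨C1, H1⟩ := exists_rep_hN hn hφ hq K
  obtain ⟨C2, H2⟩ := exists_lintegral_YY_le (n := n) hq
  refine ⟨q, K, C1 * C2, hq, fun f hf hθ => ?_⟩
  have hT := HT f hf hθ
  have hg := maxFun_measurable hφ hf
  refine ⟨hT, ?_⟩
  set T := Tn (maxFun n φ f) q
  refine ⟨fun σ => ∑' G, JEit T (fun κ => C1 * ∫⁻ x, uN T κ x) G σ, fun σ hσ hc =>
    hT.rep (fun ν c h => Fine.child h c) (H1 f _ hg hθ hT) hσ hc, fun ι _ ρ α h1 h2 => ?_⟩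
  have e : ∀ σ, ∑' G, JEit T (fun κ => C1 * ∫⁻ x, uN T κ x) G σ =
      C1 * ∫⁻ x, ∑' G, JEit T (fun κ => uN T κ x) G σ := by
    intro σ
    rw [lintegral_tsum fun G => JEit_aemeasurable T (fun κ => (uN_measurable T κ).aemeasurable) G σ,
      ← ENNReal.tsum_mul_left]
    refine tsum_congr fun G => ?_
    rw [JEit_const_mul, JEit_lintegral T fun κ => (uN_measurable T κ).aemeasurable]
  calc ∑' i, (α i : ℝ≥0∞) * ∑' G, JEit T (fun κ => C1 * ∫⁻ x, uN T κ x) G (ρ i)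
      ≤ ∑' i, C1 * ∫⁻ x, YY T 0 x * ((α i : ℝ≥0∞) * ENNReal.ofReal (hatN (ρ i) x)) := by
        refine ENNReal.tsum_le_tsum fun i => ?_
        by_cases hα : α i = 0
        · simp [hα]
        rw [e, mul_left_comm]
        refine mul_le_mul_right ?_ _
        rw [← lintegral_const_mul' _ _ ENNReal.coe_ne_top]
        refine lintegral_mono fun x => ?_
        refine (mul_le_mul_right (tsum_JEit_le T x (h2 i hα)) _).trans_eq ?_
        ring
    _ = C1 * ∫⁻ x, YY T 0 x * ∑' i, ((α i : ℝ≥0∞) * ENNReal.ofReal (hatN (ρ i) x)) := by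
        have hm : ∀ i, AEMeasurable
            (fun x => YY T 0 x * ((α i : ℝ≥0∞) * ENNReal.ofReal (hatN (ρ i) x))) volume := fun i =>
          ((YY_measurable T 0).mul
            ((hatN_continuous (ρ i)).measurable.ennreal_ofReal.const_mul _)).aemeasurable
        rw [ENNReal.tsum_mul_left, ← lintegral_tsum hm]
        simp_rw [ENNReal.tsum_mul_left]
    _ ≤ C1 * ∫⁻ x, YY T 0 x := by
        gcongr with x
        exact mul_le_of_le_one_right' (h1 x)
    _ ≤ _ := by
        push_cast
        gcongr
        exact H2 _ hg hθ

theorem sum_tent_floor (s : ℝ) : tent (s - ⌊s⌋) + tent (s - (⌊s⌋ + 1 : ℤ)) = 1 := by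
  have h1 := Int.floor_le s
  have h2 := Int.lt_floor_add_one s
  push_cast
  unfold tent
  rw [abs_of_nonneg (by linarith), abs_of_nonpos (by linarith), max_eq_right (by linarith),
    max_eq_right (by linarith)]
  ring

theorem sum_tent_pair (s : ℝ) (S : Finset ℤ) :
    ∑ k ∈ S ∪ {⌊s⌋, ⌊s⌋ + 1}, tent (s - k) = 1 := by
  rw [← sum_tent_floor s, ← Finset.sum_pair (f := fun k : ℤ => tent (s - k)) (by omega)]
  refine (Finset.sum_subset Finset.subset_union_right fun k _ hk => tent_eq_zero ?_).symm
  simp only [Finset.mem_insert, Finset.mem_singleton, not_or] at hk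
  have h1 := Int.floor_le s
  have h2 := Int.lt_floor_add_one s
  rcases lt_or_gt_of_ne hk.1 with h | h
  · have : (k : ℝ) + 1 ≤ ⌊s⌋ := by exact_mod_cast h
    rw [abs_of_nonneg (by linarith)]; linarith
  · have : (⌊s⌋ : ℝ) + 2 ≤ k := by
      have : ⌊s⌋ + 2 ≤ k := by omega
      exact_mod_cast this
    rw [abs_of_nonpos (by linarith)]; linarith

theorem sum_tent_le_one (s : ℝ) (S : Finset ℤ) : ∑ k ∈ S, tent (s - k) ≤ 1 := by
  rw [← sum_tent_pair s S]
  exact Finset.sum_le_sum_of_subset_of_nonneg Finset.subset_union_left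
    fun k _ _ => tent_nonneg _

theorem sum_tent_eq_one {s : ℝ} {N : ℕ} (hs : |s| ≤ N) :
    ∑ k ∈ Finset.Icc (-N : ℤ) N, tent (s - k) = 1 := by
  rw [← sum_tent_pair s (Finset.Icc (-N : ℤ) N)]
  refine Finset.sum_subset Finset.subset_union_left fun k _ hk => tent_eq_zero ?_
  rw [Finset.mem_Icc] at hk
  obtain ⟨h1, h2⟩ := abs_le.1 hs
  by_cases h : (-N : ℤ) ≤ k
  · have : (N : ℝ) + 1 ≤ k := by
      have : (N : ℤ) + 1 ≤ k := by omega
      exact_mod_cast this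
    rw [abs_of_nonpos (by linarith)]; linarith
  · have : (k : ℝ) + 1 ≤ -N := by
      have : k + 1 ≤ -(N : ℤ) := by omega
      exact_mod_cast this
    rw [abs_of_nonneg (by linarith)]; linarith

/-- The node of radius `2 ^ j` with index `l`. -/
def nd (j : ℕ) (l : Fin n → ℤ) : Node n := (-(j : ℤ), l)

theorem nd_rad (j : ℕ) (l : Fin n → ℤ) : (nd j l).rad = 2 ^ j := by
  simp [nd, Node.rad]

/-- The cube of indices of size `N`. -/
def cube (n N : ℕ) : Finset (Fin n → ℤ) := Fintype.piFinset fun _ => Finset.Icc (-N : ℤ) N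

theorem mem_cube {N : ℕ} {l : Fin n → ℤ} : l ∈ cube n N ↔ ∀ i, |l i| ≤ N := by
  simp [cube, abs_le]

/-- The partial sums of the partition of unity at scale `2 ^ j`. -/
def Phi (n j : ℕ) (x : Eucl n) : ℝ := ∑ l ∈ cube n (fineIdx n), hatN (nd j l) x

theorem Phi_eq (j : ℕ) (x : Eucl n) :
    Phi n j x = ∏ i, ∑ k ∈ Finset.Icc (-fineIdx n : ℤ) (fineIdx n), tent ((2 ^ j)⁻¹ * x i - k) := by
  rw [Finset.prod_univ_sum]
  refine Finset.sum_congr rfl fun l _ => ?_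
  rw [hatN_apply]
  simp [nd]

theorem Phi_nonneg (j : ℕ) (x : Eucl n) : 0 ≤ Phi n j x :=
  Finset.sum_nonneg fun _ _ => hatN_nonneg _ _

theorem Phi_le_one (j : ℕ) (x : Eucl n) : Phi n j x ≤ 1 := by
  rw [Phi_eq]
  exact Finset.prod_le_one (fun _ _ => Finset.sum_nonneg fun _ _ => tent_nonneg _)
    fun _ _ => sum_tent_le_one _ _

theorem Phi_eq_one {j : ℕ} {x : Eucl n} (hx : ∀ i, |x i| ≤ fineIdx n * 2 ^ j) :
    Phi n j x = 1 := by
  rw [Phi_eq]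
  refine Finset.prod_eq_one fun i _ => sum_tent_eq_one ?_
  rw [abs_mul, abs_of_pos (by positivity), inv_mul_le_iff₀ (by positivity)]
  linarith [hx i]

/-- The coefficients of `Phi n (j + 1)` in terms of the hats of scale `2 ^ j`. -/
def qC (l : Fin n → ℤ) : ℝ≥0 :=
  ∑ k ∈ cube n (fineIdx n), ∑ c : Fin n → Fin 3,
    if (fun i => 2 * k i + ((c i : ℕ) - 1) : Fin n → ℤ) = l then cw c else 0

/-- The larger cube of indices. -/
abbrev bigIdx (n : ℕ) : ℕ := 2 * fineIdx n + 1

theorem child_nd (j : ℕ) (k : Fin n → ℤ) (c : Fin n → Fin 3) :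
    (nd (j + 1) k).child c = nd j fun i => 2 * k i + ((c i : ℕ) - 1) := by
  simp only [nd, Node.child]
  congr 1
  push_cast; ring

theorem Phi_succ (j : ℕ) (x : Eucl n) :
    Phi n (j + 1) x = ∑ l ∈ cube n (bigIdx n), qC l * hatN (nd j l) x := by
  simp only [qC, NNReal.coe_sum, Finset.sum_mul]
  rw [Finset.sum_comm, Phi]
  refine Finset.sum_congr rfl fun k hk => ?_
  rw [Finset.sum_comm, hatN_refine]
  refine Finset.sum_congr rfl fun c _ => ?_
  rw [Finset.sum_eq_single (fun i => 2 * k i + ((c i : ℕ) - 1))]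
  · rw [if_pos rfl, child_nd]
  · intro l _ hl
    rw [if_neg (Ne.symm hl)]; simp
  · intro h
    refine absurd (mem_cube.2 fun i => ?_) h
    have h1 := mem_cube.1 hk i
    have h2 := (c i).isLt
    rw [abs_le] at h1 ⊢
    unfold bigIdx
    push_cast
    omega

theorem nd_zero_ctr (l : Fin n → ℤ) (i : Fin n) : (nd 0 l).ctr i = l i := by
  change (nd 0 l).rad * (nd 0 l).2 i = _
  rw [nd_rad]; simp [nd]

theorem hatN_nd_zero_ctr (l l' : Fin n → ℤ) :
    hatN (nd 0 l') (nd 0 l).ctr = if l' = l then 1 else 0 := by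
  rw [hatN_apply]
  simp only [nd_zero_ctr]
  simp only [nd]
  split_ifs with h
  · subst h; simp [tent]
  · obtain ⟨i, hi⟩ := Function.ne_iff.1 h
    refine Finset.prod_eq_zero (Finset.mem_univ i) (tent_eq_zero ?_)
    simp only [Nat.cast_zero, neg_zero, zpow_zero, one_mul]
    have : 1 ≤ |l i - l' i| := Int.one_le_abs (sub_ne_zero.2 (Ne.symm hi))
    exact_mod_cast this

theorem qC_eq_one {l : Fin n → ℤ} (hl : l ∈ cube n (fineIdx n)) : qC l = 1 := by
  have hl' : l ∈ cube n (bigIdx n) := mem_cube.2 fun i =>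
    (mem_cube.1 hl i).trans (by unfold bigIdx; push_cast; omega)
  have h := Phi_succ 0 (nd 0 l).ctr
  simp_rw [hatN_nd_zero_ctr] at h
  rw [Phi_eq_one] at h
  · simpa [hl', eq_comm] using h
  · intro i
    have h1 : |(l i : ℝ)| ≤ fineIdx n := by exact_mod_cast mem_cube.1 hl i
    rw [nd_zero_ctr]
    have : (0 : ℝ) ≤ fineIdx n := Nat.cast_nonneg _
    norm_num
    linarith

/-- The coefficients of the root nodes. -/
def rootC (j : ℕ) (l : Fin n → ℤ) : ℝ≥0 :=
  if l ∈ cube n (bigIdx n) then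
    if j = 0 then qC l else if l ∈ cube n (fineIdx n) then 0 else qC l
  else 0

/-- `Phi`, started at zero. -/
def Psi (n j : ℕ) (x : Eucl n) : ℝ := if j = 0 then 0 else Phi n j x

theorem sum_rootC (j : ℕ) (x : Eucl n) :
    ∑ l ∈ cube n (bigIdx n), rootC j l * hatN (nd j l) x = Psi n (j + 1) x - Psi n j x := by
  rw [Psi, if_neg (Nat.succ_ne_zero j), Phi_succ]
  rcases eq_or_ne j 0 with rfl | hj
  · rw [Psi, if_pos rfl, sub_zero]
    refine Finset.sum_congr rfl fun l hl => ?_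
    rw [rootC, if_pos hl, if_pos rfl]
  · rw [Psi, if_neg hj, eq_sub_iff_add_eq, Phi]
    have hs : cube n (fineIdx n) ⊆ cube n (bigIdx n) := fun l hl => mem_cube.2 fun i =>
      (mem_cube.1 hl i).trans (by unfold bigIdx; push_cast; omega)
    rw [← Finset.inter_eq_right.2 hs, ← Finset.sum_ite_mem, ← Finset.sum_add_distrib]
    refine Finset.sum_congr rfl fun l hl => ?_
    rw [rootC, if_pos hl, if_neg hj]
    split_ifs with h
    · simp [qC_eq_one h]
    · simp

theorem Psi_le_one (j : ℕ) (x : Eucl n) : Psi n j x ≤ 1 := by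
  unfold Psi; split_ifs
  · exact zero_le_one
  · exact Phi_le_one j x

theorem fine_of_rootC_ne_zero {j : ℕ} {l : Fin n → ℤ} (h : rootC j l ≠ 0) : Fine (nd j l) := by
  unfold rootC at h
  split_ifs at h with h1 h2 h3
  · left; simp [nd, h2]
  · exact absurd rfl h
  · right
    rw [mem_cube] at h3
    push Not at h3
    obtain ⟨i, hi⟩ := h3
    exact ⟨i, hi.le⟩
  · exact absurd rfl h

theorem rootC_eq_zero {j : ℕ} {l : Fin n → ℤ} (h : l ∉ cube n (bigIdx n)) : rootC j l = 0 :=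
  if_neg h

theorem tsum_rootC_le (x : Eucl n) : ∑' i : ℕ × (Fin n → ℤ),
    (rootC i.1 i.2 : ℝ≥0∞) * ENNReal.ofReal (hatN (nd i.1 i.2) x) ≤ 1 := by
  refine (ENNReal.tsum_prod (f := fun j l => (rootC j l : ℝ≥0∞) *
    ENNReal.ofReal (hatN (nd j l) x))).trans_le ?_
  have h1 : ∀ j, ∑' l, (rootC j l : ℝ≥0∞) * ENNReal.ofReal (hatN (nd j l) x) =
      ENNReal.ofReal (Psi n (j + 1) x - Psi n j x) := by
    intro j
    rw [tsum_eq_sum (s := cube n (bigIdx n)) fun l hl => by rw [rootC_eq_zero hl]; simp,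
      ← sum_rootC, ENNReal.ofReal_sum_of_nonneg fun l _ =>
        mul_nonneg (NNReal.coe_nonneg _) (hatN_nonneg _ _)]
    refine Finset.sum_congr rfl fun l _ => ?_
    rw [ENNReal.ofReal_mul (NNReal.coe_nonneg _), ENNReal.ofReal_coe_nnreal]
  simp_rw [h1]
  rw [ENNReal.tsum_eq_iSup_nat]
  refine iSup_le fun J => ?_
  rw [← ENNReal.ofReal_sum_of_nonneg, Finset.sum_range_sub (fun j => Psi n j x), ← ENNReal.ofReal_one]
  · refine ENNReal.ofReal_le_ofReal ?_
    simpa [Psi] using Psi_le_one J x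
  · intro j _
    rw [← sum_rootC]
    exact Finset.sum_nonneg fun l _ => mul_nonneg (NNReal.coe_nonneg _) (hatN_nonneg _ _)

/-- The weight of the coarse pieces. -/
def wC (n j : ℕ) : ℝ := (2 ^ j) ^ n / (1 + j)

theorem wC_pos (n j : ℕ) : 0 < wC n j := by unfold wC; positivity

theorem two_mul_wC_le (hn : 2 ≤ n) (j : ℕ) : 2 * wC n j ≤ wC n (j + 1) := by
  unfold wC
  have h1 : (4 : ℝ) ≤ 2 ^ n := by
    calc (4 : ℝ) = 2 ^ 2 := by norm_num
      _ ≤ 2 ^ n := pow_le_pow_right₀ one_le_two hn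
  have h2 : (0 : ℝ) < (2 ^ j) ^ n := by positivity
  rw [← mul_div_assoc, div_le_div_iff₀ (by positivity) (by positivity), pow_succ, mul_pow]
  push_cast
  have h3 : 2 * (1 + ((j : ℝ) + 1)) ≤ 2 ^ n * (1 + j) := by nlinarith [(Nat.cast_nonneg j : (0 : ℝ) ≤ j)]
  nlinarith

theorem sum_wC_le (hn : 2 ≤ n) (J : ℕ) : ∑ j ∈ Finset.range (J + 1), wC n j ≤ 2 * wC n J := by
  induction J with
  | zero => simp [(wC_pos n 0).le, two_mul]
  | succ J ih =>
    rw [Finset.sum_range_succ]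
    linarith [two_mul_wC_le hn J]

/-- The values attached to the large balls around the origin. -/
def Tc (g : Eucl n → ℝ≥0∞) (q R : ℝ) (j : ℕ) : ℝ := (TT g q 0 (R * 2 ^ j)).toReal

theorem exists_wC_le {q R : ℝ} (hq : 0 < q) (hR : 1 ≤ R) :
    ∃ c C : ℝ, 0 < c ∧ 0 < C ∧ ∀ g : Eucl n → ℝ≥0∞, Measurable g → ∫⁻ x, thetaE n x (g x) ≤ 1 →
      ∀ (j : ℕ) (s : ℤ), 2 ^ s ≤ Tc g q R j →
        ENNReal.ofReal (wC n j) ≤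
          ENNReal.ofReal C * ∫⁻ x, dens (1 / (1 + q)) c (2 ^ s) g x := by
  obtain ⟨c, hc, H⟩ := exists_ball_hi (n := n) hq
  obtain ⟨M, hM, HM⟩ := exists_TT_log_le (n := n) hq
  have hl : 0 ≤ log R := log_nonneg hR
  set C5 : ℝ := (3 + log R) + M * (3 + (3 + log R)) with hC5
  have hC5' : 0 < C5 := by positivity
  refine ⟨c, 2 * C5 / R ^ n, hc, by positivity, fun g hg hθ j s hs => ?_⟩
  set p := 1 / (1 + q)
  set a : ℝ := 2 ^ s with ha'
  have ha : 0 < a := by positivity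
  set ρ : ℝ := R * 2 ^ j with hρ
  have h2j : (1 : ℝ) ≤ 2 ^ j := one_le_pow₀ one_le_two
  have hρ1 : 1 ≤ ρ := by nlinarith
  obtain ⟨-, hfin, hlog⟩ := HM g hg hθ 0 ρ (by linarith)
  have h1 := H g hg 0 ρ a (by linarith) ha (by
    rw [← ENNReal.ofReal_toReal hfin]; exact ENNReal.ofReal_le_ofReal hs)
  have hj : (0 : ℝ) ≤ j := Nat.cast_nonneg j
  have h2 : log (exp 1 + ρ) ≤ (3 + log R) * (1 + j) := by
    have h3 := log_exp_add_le_log hρ1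
    have h4 : log ρ = log R + j * log 2 := by
      rw [hρ, log_mul (by positivity) (by positivity), log_pow]
    have h5 : log 2 ≤ 1 := by linarith [log_two_lt_d9]
    nlinarith
  have h3 : log (exp 1 + ρ⁻¹) ≤ 3 * (1 + j) := by
    have h4 := log_exp_add_le (t := ρ⁻¹) (by positivity)
    have h5 := inv_le_one_of_one_le₀ hρ1
    nlinarith
  have hD : ∀ x ∈ closedBall (0 : Eucl n) ρ, DD x a ≤ C5 * (1 + j) := by
    intro x hx
    have hx' : ‖x‖ ≤ ρ := by simpa using hx
    have e1 : log (exp 1 + ‖x‖) ≤ log (exp 1 + ρ) := by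
      have := exp_pos 1
      gcongr
    have e2 : log (exp 1 + a) ≤ log (exp 1 + (TT g q 0 ρ).toReal) := by
      have := exp_pos 1
      have := hs
      unfold Tc at this
      gcongr
    rw [norm_zero, zero_add] at hlog
    have e3 : M * (log (exp 1 + ρ⁻¹) + log (exp 1 + ρ)) ≤
        M * (3 * (1 + j) + (3 + log R) * (1 + j)) := by gcongr
    unfold DD
    rw [hC5]
    linarith
  have h4 : ENNReal.ofReal (a ^ (-p)) * ENNReal.ofReal (1 / (C5 * (1 + j))) *
      ENNReal.ofReal (a ^ p * ρ ^ n / 2) ≤ ∫⁻ x, dens p c a g x := by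
    refine (mul_le_mul_right h1 _).trans (le_trans ?_
      (setLIntegral_le_lintegral (closedBall (0 : Eucl n) ρ) _))
    rw [← lintegral_const_mul' _ _ (ENNReal.mul_ne_top ENNReal.ofReal_ne_top ENNReal.ofReal_ne_top)]
    refine setLIntegral_mono' isClosed_closedBall.measurableSet fun x hx => ?_
    rw [dens, mul_assoc, mul_comm (hi _ _ _)]
    refine mul_le_mul_right (mul_le_mul_left ?_ (hi _ _ _)) _
    exact ENNReal.ofReal_le_ofReal (one_div_le_one_div_of_le (DD_pos x ha.le) (hD x hx))
  refine le_trans (le_of_eq ?_) (mul_le_mul_right h4 _)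
  rw [← ENNReal.ofReal_mul (by positivity), ← ENNReal.ofReal_mul (by positivity),
    ← ENNReal.ofReal_mul (by positivity)]
  congr 1
  rw [rpow_neg ha.le, hρ, mul_pow, wC]
  have := rpow_pos_of_pos ha p
  field_simp

theorem exists_coarse_sum (hn : 2 ≤ n) {q R : ℝ} (hq : 0 < q) (hR : 1 ≤ R) :
    ∃ C : ℝ≥0, ∀ g : Eucl n → ℝ≥0∞, Measurable g → ∫⁻ x, thetaE n x (g x) ≤ 1 →
      ∑' j : ℕ, ENNReal.ofReal (wC n j * Tc g q R j) ≤ C := by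
  obtain ⟨c, C6, hc, hC6, H⟩ := exists_wC_le (n := n) hq hR
  obtain ⟨C1, HC⟩ := exists_level_sum (n := n) (p := 1 / (1 + q)) (by positivity)
    (by rw [div_lt_one (by linarith)]; linarith) hc
  refine ⟨4 * C6.toNNReal * C1, fun g hg hθ => ?_⟩
  set P : ℕ → ℤ → Prop := fun j s => (2 : ℝ) ^ s ≤ Tc g q R j ∧ Tc g q R j < 2 ^ (s + 1)
  classical
  have h1 : ∀ j, ENNReal.ofReal (wC n j * Tc g q R j) ≤
      ∑' s : ℤ, ENNReal.ofReal (2 ^ (s + 1)) * if P j s then ENNReal.ofReal (wC n j) else 0 := by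
    intro j
    have h0' : 0 ≤ Tc g q R j := ENNReal.toReal_nonneg
    rcases h0'.eq_or_lt with h0 | h0
    · rw [show wC n j * Tc g q R j = 0 by rw [← h0, mul_zero]]; simp
    · obtain ⟨s, hs1, hs2⟩ := exists_mem_Ico_zpow h0 (one_lt_two (α := ℝ))
      refine le_trans ?_ (ENNReal.le_tsum s)
      rw [if_pos ⟨hs1, hs2⟩, ← ENNReal.ofReal_mul (by positivity)]
      refine ENNReal.ofReal_le_ofReal ?_
      nlinarith [wC_pos n j]
  have h2 : ∀ s : ℤ, ∑' j, (if P j s then ENNReal.ofReal (wC n j) else 0) ≤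
      ENNReal.ofReal (2 * C6) * ∫⁻ x, dens (1 / (1 + q)) c (2 ^ s) g x := by
    intro s
    rw [ENNReal.tsum_eq_iSup_sum]
    refine iSup_le fun F => ?_
    rw [← Finset.sum_filter]
    rcases (F.filter fun j => P j s).eq_empty_or_nonempty with hF | hF
    · simp [hF]
    · obtain ⟨J, hJ, hmax⟩ := (F.filter fun j => P j s).exists_max_image id hF
      have hP := (Finset.mem_filter.1 hJ).2
      rw [← ENNReal.ofReal_sum_of_nonneg fun j _ => (wC_pos n j).le]
      have h3 : ∑ j ∈ F.filter (fun j => P j s), wC n j ≤ 2 * wC n J := by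
        refine (Finset.sum_le_sum_of_subset_of_nonneg (fun j hj => ?_)
          fun j _ _ => (wC_pos n j).le).trans (sum_wC_le hn J)
        exact Finset.mem_range.2 (Nat.lt_succ_of_le (hmax j hj))
      refine (ENNReal.ofReal_le_ofReal h3).trans ?_
      rw [ENNReal.ofReal_mul zero_le_two, ENNReal.ofReal_mul zero_le_two, mul_assoc]
      exact mul_le_mul_right (H g hg hθ J s hP.1) _
  calc ∑' j : ℕ, ENNReal.ofReal (wC n j * Tc g q R j)
      ≤ ∑' (j : ℕ) (s : ℤ), ENNReal.ofReal (2 ^ (s + 1)) *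
          if P j s then ENNReal.ofReal (wC n j) else 0 := ENNReal.tsum_le_tsum h1
    _ = ∑' s : ℤ, ENNReal.ofReal (2 ^ (s + 1)) *
          ∑' j, if P j s then ENNReal.ofReal (wC n j) else 0 := by
        rw [ENNReal.tsum_comm]
        simp_rw [ENNReal.tsum_mul_left]
    _ ≤ ∑' s : ℤ, 4 * ENNReal.ofReal C6 *
          (ENNReal.ofReal (2 ^ s) * ∫⁻ x, dens (1 / (1 + q)) c (2 ^ s) g x) := by
        refine ENNReal.tsum_le_tsum fun s => (mul_le_mul_right (h2 s) _).trans_eq ?_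
        rw [← mul_assoc, ← mul_assoc, ← ENNReal.ofReal_mul (by positivity)]
        congr 1
        rw [← ENNReal.ofReal_ofNat 4, ← ENNReal.ofReal_mul (by norm_num),
          ← ENNReal.ofReal_mul (by positivity), zpow_add_one₀ two_ne_zero]
        congr 1
        ring
    _ ≤ _ := by
        rw [ENNReal.tsum_mul_left]
        push_cast
        change _ ≤ 4 * ENNReal.ofReal C6 * _
        gcongr
        exact HC g hg hθ

theorem tendsto_Tc (hn : 2 ≤ n) {q R : ℝ} (hq : 0 < q) (hR : 1 ≤ R) {g : Eucl n → ℝ≥0∞}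
    (hg : Measurable g) (hθ : ∫⁻ x, thetaE n x (g x) ≤ 1) :
    Tendsto (fun j => Tc g q R j) atTop (𝓝 0) := by
  obtain ⟨C, H⟩ := exists_coarse_sum hn hq hR
  have h1 := ENNReal.tendsto_atTop_zero_of_tsum_ne_top
    (ne_top_of_le_ne_top ENNReal.coe_ne_top (H g hg hθ))
  have h0 : ∀ j, 0 ≤ Tc g q R j := fun j => ENNReal.toReal_nonneg
  have h2 := (ENNReal.tendsto_toReal ENNReal.zero_ne_top).comp h1
  refine squeeze_zero h0 (fun j => ?_) h2
  simp only [Function.comp]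
  rw [ENNReal.toReal_ofReal (mul_nonneg (wC_pos n j).le (h0 j))]
  refine le_mul_of_one_le_left (h0 j) ?_
  have : ∀ j, 1 ≤ wC n j := by
    intro j
    induction j with
    | zero => simp [wC]
    | succ j ih => linarith [two_mul_wC_le hn j]
  exact this j

section

/-- The normalized radius of a ball containing all the nodes of a coarse scale. -/
def bigRad (n : ℕ) : ℝ := 2 * (n * bigIdx n + (n + 2))

theorem one_le_bigRad (n : ℕ) : 1 ≤ bigRad n := by
  unfold bigRad
  have : (0 : ℝ) ≤ n * bigIdx n := by positivity
  have : (0 : ℝ) ≤ n := Nat.cast_nonneg n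
  linarith

theorem cube_fineIdx_subset : cube n (fineIdx n) ⊆ cube n (bigIdx n) := fun _ hl =>
  mem_cube.2 fun i => (mem_cube.1 hl i).trans (by unfold bigIdx; push_cast; omega)

theorem closedBall_nd_subset {i j : ℕ} (hij : i ≤ j + 1) {l : Fin n → ℤ}
    (hl : l ∈ cube n (bigIdx n)) :
    closedBall (nd i l).ctr ((n + 2) * (nd i l).rad) ⊆ closedBall 0 (bigRad n * 2 ^ j) := by
  refine closedBall_subset_closedBall' ?_
  have h1 : ‖(nd i l).ctr‖ ≤ n * |2 ^ i * (bigIdx n : ℝ)| := by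
    refine norm_le_of_coord_le fun k => ?_
    change |(nd i l).rad * (l k : ℝ)| ≤ _
    rw [nd_rad, abs_mul, abs_of_pos (by positivity)]
    have : |(l k : ℝ)| ≤ bigIdx n := by exact_mod_cast mem_cube.1 hl k
    gcongr
  rw [abs_of_nonneg (by positivity)] at h1
  have h2 : (2 : ℝ) ^ i ≤ 2 * 2 ^ j := by
    rw [← pow_succ']; exact pow_le_pow_right₀ one_le_two hij
  rw [dist_zero_right, nd_rad, bigRad]
  have h3 : ((n : ℝ) * bigIdx n + (n + 2)) * 2 ^ i ≤ (n * bigIdx n + (n + 2)) * (2 * 2 ^ j) := by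
    gcongr
  linarith

theorem hatN_nd_supp {i j : ℕ} (hij : i ≤ j + 1) {l : Fin n → ℤ} (hl : l ∈ cube n (bigIdx n))
    {x : Eucl n} (hx : hatN (nd i l) x ≠ 0) : x ∈ closedBall 0 (bigRad n * 2 ^ j) := by
  refine closedBall_nd_subset hij hl (closedBall_subset_closedBall ?_ (hatN_supp _ x hx))
  have := (nd i l).rad_pos
  gcongr
  linarith

theorem Phi_continuous (j : ℕ) : Continuous (Phi n j) :=
  continuous_finsetSum _ fun _ _ => hatN_continuous _

theorem Psi_continuous (j : ℕ) : Continuous (Psi n j) := by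
  unfold Psi
  split_ifs
  · exact continuous_const
  · exact Phi_continuous j

theorem Psi_nonneg (j : ℕ) (x : Eucl n) : 0 ≤ Psi n j x := by
  unfold Psi; split_ifs
  · exact le_rfl
  · exact Phi_nonneg j x

theorem Psi_supp {i j : ℕ} (hij : i ≤ j + 1) {x : Eucl n} (hx : Psi n i x ≠ 0) :
    x ∈ closedBall 0 (bigRad n * 2 ^ j) := by
  unfold Psi at hx
  split_ifs at hx
  · exact absurd rfl hx
  · obtain ⟨l, hl, h⟩ := Finset.exists_ne_zero_of_sum_ne_zero hx
    exact hatN_nd_supp hij (cube_fineIdx_subset hl) h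

theorem Psi_hasCompactSupport (j : ℕ) : HasCompactSupport (Psi n j) :=
  HasCompactSupport.of_support_subset_isCompact (isCompact_closedBall 0 (bigRad n * 2 ^ j))
    fun _ hx => Psi_supp (Nat.le_succ j) hx

/-- The multiple of `Psi n j` with the same integral as `f * Psi n j`. -/
def coarseAvg (f : Eucl n → ℝ) (j : ℕ) (x : Eucl n) : ℝ :=
  (∫ y, f y * Psi n j y) / (∫ y, Psi n j y) * Psi n j x

/-- The contribution of the averages of `f` on the root nodes of scale `2 ^ j`. -/
def rootAvg (f : Eucl n → ℝ) (j : ℕ) (x : Eucl n) : ℝ :=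
  ∑ l ∈ cube n (bigIdx n), rootC j l * avgN f (nd j l) * hatN (nd j l) x

/-- The coarse piece of scale `2 ^ j`. -/
def coarse (f : Eucl n → ℝ) (j : ℕ) (x : Eucl n) : ℝ :=
  rootAvg f j x + coarseAvg f j x - coarseAvg f (j + 1) x

theorem rootAvg_continuous (f : Eucl n → ℝ) (j : ℕ) : Continuous (rootAvg f j) :=
  continuous_finsetSum _ fun _ _ => continuous_const.mul (hatN_continuous _)

theorem coarseAvg_continuous (f : Eucl n → ℝ) (j : ℕ) : Continuous (coarseAvg f j) :=
  continuous_const.mul (Psi_continuous j)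

theorem coarse_continuous (f : Eucl n → ℝ) (j : ℕ) : Continuous (coarse f j) :=
  ((rootAvg_continuous f j).add (coarseAvg_continuous f j)).sub (coarseAvg_continuous f (j + 1))

theorem coarse_supp (f : Eucl n → ℝ) (j : ℕ) (x : Eucl n) (hx : coarse f j x ≠ 0) :
    x ∈ closedBall 0 (bigRad n * 2 ^ j) := by
  by_contra h
  have h1 : ∀ i, i ≤ j + 1 → Psi n i x = 0 := fun i hi => by
    by_contra h'; exact h (Psi_supp hi h')
  refine hx ?_
  rw [coarse, rootAvg, coarseAvg, coarseAvg, h1 j (Nat.le_succ j), h1 _ le_rfl,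
    Finset.sum_eq_zero fun l hl => ?_]
  · simp
  · have : hatN (nd j l) x = 0 := by
      by_contra h'; exact h (hatN_nd_supp (Nat.le_succ j) hl h')
    rw [this, mul_zero]

variable {f : Eucl n → ℝ}

theorem integral_mul_Psi (hf : LocallyIntegrable f volume) {j : ℕ} (hj : j ≠ 0) :
    ∫ x, f x * Psi n j x = ∑ l ∈ cube n (fineIdx n), avgN f (nd j l) * ∫ x, hatN (nd j l) x := by
  simp only [Psi, if_neg hj, Phi, Finset.mul_sum]
  rw [integral_finsetSum _ fun l _ => integrable_mul_hatN hf _]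
  refine Finset.sum_congr rfl fun l _ => ?_
  rw [avgN, div_mul_cancel₀ _ (integral_hatN_pos _).ne']

theorem integral_Psi {j : ℕ} (hj : j ≠ 0) :
    ∫ x, Psi n j x = ∑ l ∈ cube n (fineIdx n), ∫ x, hatN (nd j l) x := by
  simp only [Psi, if_neg hj, Phi]
  exact integral_finsetSum _ fun l _ => integrable_hatN _

theorem integral_Psi_pos {j : ℕ} (hj : j ≠ 0) : 0 < ∫ x, Psi n j x := by
  rw [integral_Psi hj]
  exact Finset.sum_pos (fun l _ => integral_hatN_pos _) ⟨0, mem_cube.2 fun i => by simp⟩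

theorem integral_coarseAvg (f : Eucl n → ℝ) (j : ℕ) :
    ∫ x, coarseAvg f j x = ∫ x, f x * Psi n j x := by
  unfold coarseAvg
  rw [integral_const_mul]
  rcases eq_or_ne j 0 with rfl | hj
  · simp [Psi]
  · rw [div_mul_cancel₀ _ (integral_Psi_pos hj).ne']

theorem abs_coarseAvg_le (hf : LocallyIntegrable f volume) {j : ℕ} {b : ℝ} (hb : 0 ≤ b)
    (h : ∀ l ∈ cube n (bigIdx n), |avgN f (nd j l)| ≤ b) (x : Eucl n) : |coarseAvg f j x| ≤ b := by
  rcases eq_or_ne j 0 with rfl | hj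
  · simpa [coarseAvg, Psi] using hb
  · have hP := integral_Psi_pos (n := n) hj
    have h1 : |∫ y, f y * Psi n j y| ≤ b * ∫ y, Psi n j y := by
      rw [integral_mul_Psi hf hj, integral_Psi hj, Finset.mul_sum]
      refine (Finset.abs_sum_le_sum_abs _ _).trans (Finset.sum_le_sum fun l hl => ?_)
      have h0 := integral_hatN_pos (nd j l)
      rw [abs_mul, abs_of_pos h0]
      exact mul_le_mul_of_nonneg_right (h l (cube_fineIdx_subset hl)) h0.le
    rw [coarseAvg, abs_mul, abs_div, abs_of_pos hP, abs_of_nonneg (Psi_nonneg j x)]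
    calc _ ≤ b * 1 := mul_le_mul ((div_le_iff₀ hP).2 h1) (Psi_le_one j x) (Psi_nonneg j x) hb
      _ = b := mul_one b

theorem abs_rootAvg_le {j : ℕ} {b : ℝ} (hb : 0 ≤ b)
    (h : ∀ l ∈ cube n (bigIdx n), |avgN f (nd j l)| ≤ b) (x : Eucl n) : |rootAvg f j x| ≤ b := by
  have h1 : |rootAvg f j x| ≤ b * ∑ l ∈ cube n (bigIdx n), rootC j l * hatN (nd j l) x := by
    rw [Finset.mul_sum]
    refine (Finset.abs_sum_le_sum_abs _ _).trans (Finset.sum_le_sum fun l hl => ?_)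
    have h0 : 0 ≤ (rootC j l : ℝ) * hatN (nd j l) x :=
      mul_nonneg (NNReal.coe_nonneg _) (hatN_nonneg _ _)
    rw [mul_right_comm, abs_mul, abs_of_nonneg h0, mul_comm]
    exact mul_le_mul_of_nonneg_right (h l hl) h0
  rw [sum_rootC] at h1
  nlinarith [Psi_le_one (j + 1) x, Psi_nonneg j x]

theorem integral_rootAvg (hf : LocallyIntegrable f volume) (j : ℕ) :
    ∫ x, rootAvg f j x = (∫ x, f x * Psi n (j + 1) x) - ∫ x, f x * Psi n j x := by
  rw [← integral_sub
    (integrable_mul_of_hasCompactSupport hf (Psi_continuous _) (Psi_hasCompactSupport _))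
    (integrable_mul_of_hasCompactSupport hf (Psi_continuous _) (Psi_hasCompactSupport _))]
  simp_rw [← mul_sub, ← sum_rootC, Finset.mul_sum, rootAvg]
  have h1 : ∀ l : Fin n → ℤ, Integrable fun x => f x * hatN (nd j l) x := fun l =>
    integrable_mul_hatN hf _
  rw [integral_finsetSum _ fun l _ => (integrable_hatN _).const_mul _]
  simp_rw [mul_left_comm (f _)]
  rw [integral_finsetSum _ fun l _ => (h1 l).const_mul _]
  refine Finset.sum_congr rfl fun l _ => ?_
  rw [integral_const_mul, integral_const_mul, mul_assoc, avgN,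
    div_mul_cancel₀ _ (integral_hatN_pos _).ne']

theorem integrable_rootAvg (f : Eucl n → ℝ) (j : ℕ) : Integrable (rootAvg f j) :=
  integrable_finsetSum _ fun _ _ => (integrable_hatN _).const_mul _

theorem integrable_coarseAvg (f : Eucl n → ℝ) (j : ℕ) : Integrable (coarseAvg f j) :=
  ((Psi_continuous j).integrable_of_hasCompactSupport (Psi_hasCompactSupport j)).const_mul _

theorem integral_coarse (hf : LocallyIntegrable f volume) (j : ℕ) : ∫ x, coarse f j x = 0 := by
  have h1 := integrable_rootAvg f j
  have h2 := integrable_coarseAvg f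
  have h3 : Integrable (fun x => rootAvg f j x + coarseAvg f j x) := h1.add (h2 j)
  change ∫ x, (rootAvg f j x + coarseAvg f j x) - coarseAvg f (j + 1) x = 0
  rw [integral_sub h3 (h2 _), integral_add h1 (h2 j), integral_rootAvg hf,
    integral_coarseAvg, integral_coarseAvg]
  ring

theorem integral_mul_Psi_mul (hf : LocallyIntegrable f volume) {ψ : Eucl n → ℝ}
    (hψ : IsTest n ψ) (J : ℕ) :
    ∫ x, f x * (Psi n J x * ψ x) =
      ∑ j ∈ Finset.range J, ((∑ l ∈ cube n (bigIdx n), rootC j l * ∫ x, bN f (nd j l) x * ψ x) +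
        ∫ x, coarse f j x * ψ x) + ∫ x, coarseAvg f J x * ψ x := by
  have hc := hψ.1.continuous
  have hInt : ∀ u : Eucl n → ℝ, Continuous u → Integrable fun x => u x * ψ x := fun u hu =>
    (hu.mul hc).integrable_of_hasCompactSupport hψ.2.mul_left
  have hfu : ∀ u : Eucl n → ℝ, Continuous u → Integrable fun x => f x * (u x * ψ x) :=
    fun u hu => integrable_mul_of_hasCompactSupport hf (hu.mul hc) hψ.2.mul_left
  induction J with
  | zero => simp [Psi, coarseAvg]
  | succ J ih =>
    have h1 : ∀ l, ∫ x, bN f (nd J l) x * ψ x = (∫ x, f x * (hatN (nd J l) x * ψ x)) -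
        avgN f (nd J l) * ∫ x, hatN (nd J l) x * ψ x := by
      intro l
      rw [← integral_const_mul, ← integral_sub (hfu _ (hatN_continuous _))
        ((hInt _ (hatN_continuous _)).const_mul _)]
      refine integral_congr_ae (ae_of_all _ fun x => ?_)
      simp only [bN]; ring
    have h2 : ∫ x, coarse f J x * ψ x = (∫ x, rootAvg f J x * ψ x) +
        (∫ x, coarseAvg f J x * ψ x) - ∫ x, coarseAvg f (J + 1) x * ψ x := by
      have h3 : Integrable fun x => rootAvg f J x * ψ x + coarseAvg f J x * ψ x :=
        (hInt _ (rootAvg_continuous f J)).add (hInt _ (coarseAvg_continuous f J))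
      rw [← integral_add (hInt _ (rootAvg_continuous f J)) (hInt _ (coarseAvg_continuous f J)),
        ← integral_sub h3 (hInt _ (coarseAvg_continuous f _))]
      refine integral_congr_ae (ae_of_all _ fun x => ?_)
      simp only [coarse]; ring
    have h3 : ∫ x, rootAvg f J x * ψ x = ∑ l ∈ cube n (bigIdx n),
        rootC J l * (avgN f (nd J l) * ∫ x, hatN (nd J l) x * ψ x) := by
      simp_rw [rootAvg, Finset.sum_mul, mul_assoc]
      rw [integral_finsetSum _ fun l _ => ((hInt _ (hatN_continuous _)).const_mul _).const_mul _]
      refine Finset.sum_congr rfl fun l _ => ?_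
      rw [integral_const_mul, integral_const_mul]
    have h4 : (∫ x, f x * (Psi n (J + 1) x * ψ x)) - ∫ x, f x * (Psi n J x * ψ x) =
        ∑ l ∈ cube n (bigIdx n), rootC J l * ∫ x, f x * (hatN (nd J l) x * ψ x) := by
      rw [← integral_sub (hfu _ (Psi_continuous _)) (hfu _ (Psi_continuous _))]
      simp_rw [← mul_sub, ← sub_mul, ← sum_rootC, Finset.sum_mul, Finset.mul_sum, mul_assoc,
        mul_left_comm (f _)]
      rw [integral_finsetSum]
      · refine Finset.sum_congr rfl fun l _ => ?_
        rw [integral_const_mul]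
      · intro l _
        refine Integrable.const_mul ?_ _
        simpa [mul_left_comm] using hfu _ (hatN_continuous (nd J l))
    rw [Finset.sum_range_succ, h2, h3]
    simp_rw [h1, mul_sub]
    rw [Finset.sum_sub_distrib, ← h4]
    linarith

end

theorem abs_avgN_nd_le {f : Eucl n → ℝ} {g : Eucl n → ℝ≥0∞} {q : ℝ} (hq : 0 < q) {K : ℝ≥0}
    (h : TreeBound f (Tn g q) K) (hfin : ∀ r, 0 < r → TT g q 0 r ≠ ⊤) {i j : ℕ} (hji : j ≤ i)
    (hij : i ≤ j + 1) {l : Fin n → ℤ} (hl : l ∈ cube n (bigIdx n)) :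
    |avgN f (nd i l)| ≤ K * (bigRad n ^ n) ^ (1 + q) * Tc g q (bigRad n) j := by
  have hR := one_le_bigRad n
  have hr : 0 < bigRad n * 2 ^ j := by positivity
  have hr' : 0 < ((n : ℝ) + 2) * (nd i l).rad := mul_pos (by positivity) (nd i l).rad_pos
  have h1 := TT_le_of_subset g hq hr' hr (closedBall_nd_subset hij hl)
  refine (h.avg _).trans ?_
  rw [mul_assoc]
  refine mul_le_mul_of_nonneg_left ?_ K.coe_nonneg
  change (TT g q (nd i l).ctr ((n + 2) * (nd i l).rad)).toReal ≤ _
  refine (ENNReal.toReal_mono (ENNReal.mul_ne_top ENNReal.ofReal_ne_top (hfin _ hr)) h1).trans ?_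
  rw [ENNReal.toReal_mul, ENNReal.toReal_ofReal (by positivity), Tc]
  gcongr
  rw [div_le_iff₀ hr', nd_rad]
  have h2 : (2 : ℝ) ^ j ≤ 2 ^ i := pow_le_pow_right₀ one_le_two hji
  have h3 : (0 : ℝ) ≤ n * 2 ^ i := by positivity
  have h4 : (0 : ℝ) < 2 ^ j := by positivity
  refine mul_le_mul_of_nonneg_left ?_ (by linarith)
  linarith

theorem one_add_le_log {R : ℝ} (hR : 1 ≤ R) (j : ℕ) : 1 + (j : ℝ) ≤ 2 * (1 + log (R * 2 ^ j)) := by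
  rw [log_mul (by positivity) (by positivity), log_pow]
  have h1 := log_nonneg hR
  have h2 := log_two_gt_d9
  have h3 : (0 : ℝ) ≤ j := Nat.cast_nonneg j
  nlinarith

theorem eventually_Psi_mul {ψ : Eucl n → ℝ} (hψ : HasCompactSupport ψ) :
    ∀ᶠ J in atTop, ∀ x, Psi n J x * ψ x = ψ x := by
  obtain ⟨ρ, hρ⟩ := hψ.isCompact.isBounded.subset_closedBall (0 : Eucl n)
  have h1 := (tendsto_pow_atTop_atTop_of_one_lt (one_lt_two (α := ℝ))).eventually_ge_atTop ρ
  filter_upwards [h1, eventually_ne_atTop 0] with J hJ hJ0 x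
  by_cases hx : ψ x = 0
  · rw [hx, mul_zero]
  · have hx' : ‖x‖ ≤ ρ := by simpa using hρ (subset_tsupport ψ hx)
    rw [Psi, if_neg hJ0, Phi_eq_one fun i => ?_, one_mul]
    refine ((abs_coord_le x i).trans (hx'.trans hJ)).trans (le_mul_of_one_le_left (by positivity) ?_)
    have : 1 ≤ fineIdx n := by unfold fineIdx; nlinarith
    exact Nat.one_le_cast.2 this

set_option maxHeartbeats 1000000 in
/-- Functions in the unit ball of `H^{log}` are sums of div-curl products. -/
theorem exists_rep_unit (hn : 2 ≤ n) {φ : Eucl n → ℝ} {A : ℝ} (hφ : KernelBound n φ A) :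
    ∃ C : ℝ≥0, ∀ f : Eucl n → ℝ, LocallyIntegrable f volume →
      ∫⁻ x, thetaE n x (maxFun n φ f x) ≤ 1 →
      Measurable (maxFun n φ f) → Rep n φ (bsize n) (fun ψ => ∫ x, f x * ψ x) C := by
  obtain ⟨q, K, C1, hq, H⟩ := exists_fine_cost hn hφ
  obtain ⟨C2, hC2, HL⟩ := exists_rep_large hn hφ
  obtain ⟨C3, HS⟩ := exists_coarse_sum hn hq (one_le_bigRad n)
  obtain ⟨M, hM, HM⟩ := exists_TT_log_le (n := n) hq
  have hR := one_le_bigRad n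
  set A' : ℝ := K * (bigRad n ^ n) ^ (1 + q) with hA'
  have hA0 : 0 ≤ A' := by positivity
  set D : ℝ := C2 * (bigRad n ^ n * (3 * A') * 2) with hD
  refine ⟨C1 + D.toNNReal * C3, fun f hf hθ hg => ?_⟩
  obtain ⟨htree, cost, hcost, hsum⟩ := H f hf hθ
  set g := maxFun n φ f
  set T : ℕ → ℝ := Tc g q (bigRad n) with hT
  have hT0 : ∀ j, 0 ≤ T j := fun j => ENNReal.toReal_nonneg
  have hfin : ∀ r, 0 < r → TT g q 0 r ≠ ⊤ := fun r hr => (HM g hg hθ 0 r hr).2.1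
  have hb0 : ∀ j, 0 ≤ A' * T j := fun j => mul_nonneg hA0 (hT0 j)
  have havg : ∀ j, ∀ l ∈ cube n (bigIdx n), |avgN f (nd j l)| ≤ A' * T j := fun j l hl =>
    abs_avgN_nd_le hq htree hfin le_rfl (Nat.le_succ j) hl
  have havg' : ∀ j, ∀ l ∈ cube n (bigIdx n), |avgN f (nd (j + 1) l)| ≤ A' * T j := fun j l hl =>
    abs_avgN_nd_le hq htree hfin (Nat.le_succ j) le_rfl hl
  -- the fine pieces
  have hs1 : ∑' i : ℕ × (Fin n → ℤ), (rootC i.1 i.2 : ℝ≥0∞) * cost (nd i.1 i.2) ≤ C1 :=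
    hsum (ℕ × (Fin n → ℤ)) (fun i => nd i.1 i.2) (fun i => rootC i.1 i.2) tsum_rootC_le
      fun i => fine_of_rootC_ne_zero
  have hs1' := ne_top_of_le_ne_top ENNReal.coe_ne_top hs1
  have hr1 : ∀ i : ℕ × (Fin n → ℤ), Rep n φ (bsize n)
      (fun ψ => rootC i.1 i.2 * ∫ x, bN f (nd i.1 i.2) x * ψ x)
      ((rootC i.1 i.2 : ℝ≥0∞) * cost (nd i.1 i.2)) := by
    intro i
    by_cases h0 : rootC i.1 i.2 = 0
    · refine (rep_zero φ (bsize n) _).congr fun ψ _ => ?_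
      rw [h0]; simp
    · have h1 := ENNReal.ne_top_of_tsum_ne_top hs1' i
      have h2 : cost (nd i.1 i.2) ≠ ⊤ := fun h => h1 <| by
        rw [h, ENNReal.mul_top (by exact_mod_cast h0)]
      have h3 := (hcost _ (fine_of_rootC_ne_zero h0) h2).const_mul (rootC i.1 i.2)
      rwa [abs_of_nonneg (NNReal.coe_nonneg _), ENNReal.ofReal_coe_nnreal] at h3
  -- the coarse pieces
  have hr2 : ∀ j, Rep n φ (bsize n) (fun ψ => ∫ x, coarse f j x * ψ x)
      (ENNReal.ofReal D * ENNReal.ofReal (wC n j * T j)) := by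
    intro j
    have hr : 1 ≤ bigRad n * 2 ^ j := one_le_mul_of_one_le_of_one_le hR (one_le_pow₀ one_le_two)
    refine (HL _ hr (coarse f j) (3 * (A' * T j)) (by linarith [hb0 j])
      (coarse_continuous f j).aestronglyMeasurable (coarse_supp f j) (integral_coarse hf j)
      (ae_of_all _ fun x => ?_)).mono ?_
    · have h1 := abs_rootAvg_le (hb0 j) (havg j) x
      have h2 := abs_coarseAvg_le hf (hb0 j) (havg j) x
      have h3 := abs_coarseAvg_le hf (hb0 j) (havg' j) x
      rw [abs_le] at h1 h2 h3 ⊢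
      unfold coarse
      constructor <;> linarith
    · rw [← ENNReal.ofReal_mul (by positivity)]
      refine ENNReal.ofReal_le_ofReal ?_
      have h1 := one_add_le_log hR j
      have h2 : 0 < 1 + (j : ℝ) := by positivity
      have h3 : 0 < 1 + log (bigRad n * 2 ^ j) := by linarith
      rw [hD, wC, mul_assoc C2]
      refine mul_le_mul_of_nonneg_left ?_ hC2.le
      calc (bigRad n * 2 ^ j) ^ n * (3 * (A' * T j)) / (1 + log (bigRad n * 2 ^ j))
          ≤ (bigRad n * 2 ^ j) ^ n * (3 * (A' * T j)) / ((1 + j) / 2) := by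
            refine div_le_div_of_nonneg_left ?_ (by positivity) (by linarith)
            have := hb0 j
            positivity
        _ = _ := by rw [mul_pow]; field_simp
  have hs2 : ∑' j, ENNReal.ofReal D * ENNReal.ofReal (wC n j * T j) ≤ D.toNNReal * C3 := by
    rw [ENNReal.tsum_mul_left]
    exact mul_le_mul_right (HS g hg hθ) _
  have hs2' := ne_top_of_le_ne_top (ENNReal.mul_ne_top ENNReal.coe_ne_top ENNReal.coe_ne_top) hs2
  refine (((rep_sum hr1 hs1').add (rep_sum hr2 hs2') hs1' hs2').mono (c' := ↑(C1 + D.toNNReal * C3))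
    ?_).congr fun ψ hψ => ?_
  · push_cast
    exact add_le_add hs1 hs2
  have hc := hψ.1.continuous
  have hlim1 : Tendsto (fun J => ∑ j ∈ Finset.range J, ((∑ l ∈ cube n (bigIdx n),
      rootC j l * ∫ x, bN f (nd j l) x * ψ x) + ∫ x, coarse f j x * ψ x)) atTop
      (𝓝 ((∑' i : ℕ × (Fin n → ℤ), rootC i.1 i.2 * ∫ x, bN f (nd i.1 i.2) x * ψ x) +
        ∑' j, ∫ x, coarse f j x * ψ x)) := by
    simp_rw [Finset.sum_add_distrib]
    refine Tendsto.add ?_ (summable_of_rep hr2 hs2' hψ).hasSum.tendsto_sum_nat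
    refine HasSum.tendsto_sum_nat ((summable_of_rep hr1 hs1' hψ).hasSum.prod_fiberwise fun j => ?_)
    refine hasSum_sum_of_ne_finset_zero fun l hl => ?_
    rw [rootC_eq_zero hl]; simp
  have hlim2 : Tendsto (fun J => ∫ x, coarseAvg f J x * ψ x) atTop (𝓝 0) := by
    have hi : Integrable fun x => |ψ x| := (hc.integrable_of_hasCompactSupport hψ.2).abs
    have h1 : Tendsto (fun J => A' * T J * ∫ x, |ψ x|) atTop (𝓝 0) := by
      simpa using ((tendsto_Tc hn hq hR hg hθ).const_mul A').mul_const (∫ x, |ψ x|)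
    refine squeeze_zero_norm (fun J => ?_) h1
    rw [← integral_const_mul]
    refine norm_integral_le_of_norm_le (hi.const_mul _) (ae_of_all _ fun x => ?_)
    rw [norm_mul, Real.norm_eq_abs, Real.norm_eq_abs]
    exact mul_le_mul_of_nonneg_right (abs_coarseAvg_le hf (hb0 J) (havg J) x) (abs_nonneg _)
  have hlim := hlim1.add hlim2
  rw [add_zero] at hlim
  refine tendsto_nhds_unique (tendsto_const_nhds.congr' ?_) hlim
  filter_upwards [eventually_Psi_mul hψ.2] with J hJ
  rw [← integral_mul_Psi_mul hf hψ J]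
  simp_rw [hJ]

theorem exists_rep_luxNorm (hn : 2 ≤ n) {φ : Eucl n → ℝ} {A : ℝ} (hφ : KernelBound n φ A) :
    ∃ C : ℝ≥0, ∀ f : Eucl n → ℝ, LocallyIntegrable f volume → HlogNorm n φ f < ⊤ →
      Rep n φ (bsize n) (fun ψ => ∫ x, f x * ψ x) (C * HlogNorm n φ f) := by
  obtain ⟨C, H⟩ := exists_rep_unit hn hφ
  refine ⟨C * 2, fun f hf hfin => ?_⟩
  have key : ∀ lam : ℝ≥0∞, lam ≠ 0 → lam ≠ ⊤ →
      ∫⁻ x, thetaE n x (maxFun n φ f x / lam) ≤ 1 →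
        Rep n φ (bsize n) (fun ψ => ∫ x, f x * ψ x) (C * lam) := by
    intro lam h0 h1 h2
    have hpos : 0 < lam.toReal := ENNReal.toReal_pos h0 h1
    have hm : ∀ x, maxFun n φ (fun y => lam.toReal⁻¹ * f y) x = maxFun n φ f x / lam := by
      intro x
      rw [maxFun_smul, abs_of_pos (inv_pos.2 hpos), ENNReal.ofReal_inv_of_pos hpos,
        ENNReal.ofReal_toReal h1, mul_comm, div_eq_mul_inv]
    have hf' : LocallyIntegrable (fun y => lam.toReal⁻¹ * f y) volume := hf.smul lam.toReal⁻¹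
    have h3 := (H _ hf' (by simpa only [hm] using h2) (maxFun_measurable hφ hf')).const_mul
      lam.toReal
    rw [abs_of_pos hpos, ENNReal.ofReal_toReal h1, mul_comm] at h3
    refine h3.congr fun ψ _ => ?_
    simp_rw [mul_assoc]
    rw [integral_const_mul, mul_inv_cancel_left₀ hpos.ne']
  have hex : ∀ b : ℝ≥0∞, HlogNorm n φ f < b → ∃ lam < b, lam ≠ 0 ∧
      ∫⁻ x, thetaE n x (maxFun n φ f x / lam) ≤ 1 := by
    intro b hb
    obtain ⟨lam, h1, h2⟩ := sInf_lt_iff.1 hb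
    exact ⟨lam, h2, h1⟩
  rcases eq_or_ne (HlogNorm n φ f) 0 with h0 | h0
  · refine (rep_zero φ (bsize n) _).congr fun ψ hψ => ?_
    rw [← enorm_eq_zero, ← nonpos_iff_eq_zero]
    have hle : ∀ ε : ℝ≥0, 0 < ε →
        ‖∫ x, f x * ψ x‖ₑ ≤ bsize n ψ * C * ε := by
      intro ε hε
      obtain ⟨lam, h1, h2, h3⟩ := hex ε (by rw [h0]; exact_mod_cast hε)
      refine ((key lam h2 (h1.trans ENNReal.coe_lt_top).ne h3).enorm_le hψ).trans ?_
      rw [mul_assoc]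
      gcongr
    have hlim : Tendsto (fun ε : ℝ≥0 => ((bsize n ψ * C * ε : ℝ≥0) : ℝ≥0∞)) (𝓝[>] 0) (𝓝 0) := by
      rw [← ENNReal.coe_zero, ENNReal.tendsto_coe]
      refine tendsto_nhdsWithin_of_tendsto_nhds ?_
      have : Continuous fun ε : ℝ≥0 => bsize n ψ * C * ε := by fun_prop
      simpa using this.tendsto 0
    refine ge_of_tendsto hlim ?_
    filter_upwards [self_mem_nhdsWithin] with ε hε
    push_cast
    exact hle ε hε
  · obtain ⟨lam, h1, h2, h3⟩ := hex (2 * HlogNorm n φ f) (by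
      rw [two_mul]; exact ENNReal.lt_add_right hfin.ne h0)
    refine (key lam h2 (h1.trans (ENNReal.mul_lt_top (by simp) hfin)).ne h3).mono ?_
    push_cast
    rw [mul_assoc]
    gcongr

end HlogFact

/-- **Weak factorization of `H^{log}(ℝⁿ)` by div-free and curl-free vector fields**
(Corollary of Theorem 5.1): any `f ∈ H^{log}` is a distributional sum `Σ_k F_k · G_k`
of scalar products of vector fields, one of each pair being divergence-free and the
other curl-free, with `Σ_k ‖F_k‖_{H¹} ‖G_k‖_{BMO⁺} ≲ ‖f‖_{H^{log}}`. -/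
theorem weak_factorization_Hlog_div_curl
    (n : ℕ) (hn : 2 ≤ n) (φ₀ : Eucl n → ℝ)
    (hφ_smooth : ContDiff ℝ (⊤ : ℕ∞) φ₀)
    (hφ_supp : Function.support φ₀ ⊆ Metric.closedBall 0 1)
    (hφ_int : ∫ x, φ₀ x = 1) :
    ∃ C : ℝ, 0 < C ∧
      ∀ f : Eucl n → ℝ, LocallyIntegrable f volume → HlogNorm n φ₀ f < ⊤ →
        ∃ F G : ℕ → Eucl n → Eucl n,
          (∀ k i, LocallyIntegrable (fun x => F k x i) volume) ∧
          (∀ k i, LocallyIntegrable (fun x => G k x i) volume) ∧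
          (∀ k i, H1Norm n φ₀ (fun x => F k x i) < ⊤) ∧
          (∀ k, (⨆ i, BMOplus n (fun x => G k x i)) < ⊤) ∧
          (∀ k, (DivFree n (F k) ∧ CurlFree n (G k)) ∨ (CurlFree n (F k) ∧ DivFree n (G k))) ∧
          (∀ k, Integrable (fun x => ∑ i, F k x i * G k x i) volume) ∧
          (∀ ψ : Eucl n → ℝ, ContDiff ℝ (⊤ : ℕ∞) ψ → HasCompactSupport ψ →
            Tendsto (fun N => ∑ k ∈ Finset.range (N + 1), ∫ x, (∑ i, F k x i * G k x i) * ψ x)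
              atTop (𝓝 (∫ x, f x * ψ x))) ∧
          ∑' k, (⨆ i, H1Norm n φ₀ (fun x => F k x i)) * (⨆ i, BMOplus n (fun x => G k x i))
            ≤ ENNReal.ofReal C * HlogNorm n φ₀ f := by
  obtain ⟨A, hφ⟩ := HlogFact.exists_kernelBound n φ₀ hφ_smooth hφ_supp hφ_int
  obtain ⟨C, H⟩ := HlogFact.exists_rep_luxNorm hn hφ
  refine ⟨C + 1, by positivity, fun f hf hfin => ?_⟩
  obtain ⟨F, G, hgood, hcost, hsum⟩ := (H f hf hfin).exists_seq
  refine ⟨F, G, fun k => (hgood k).locF, fun k => (hgood k).locG, fun k => (hgood k).h1,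
    fun k => (hgood k).bmo, fun k => (hgood k).divcurl, fun k => (hgood k).integrable,
    fun ψ h1 h2 => ?_, hcost.trans ?_⟩
  · exact (hsum ψ ⟨h1, h2⟩).tendsto_sum_nat.comp (tendsto_add_atTop_nat 1)
  · refine mul_le_mul_left ?_ _
    rw [← ENNReal.ofReal_coe_nnreal]
    exact ENNReal.ofReal_le_ofReal (by linarith)
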